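/- For any ε > 0 there exists N(ε) ∈ ℕ such that every even integer n > N(ε) admits a decomposition n = q₁ + q₂ + q₃ + q₄, where q₁, q₂, q₃, q₄ are prime numbers and (1 − ε)·n/4 ≤ q_j ≤ (1 + ε)·n/4 for each j ∈ {1, 2, 3, 4}. -/

import Mathlib

namespace FP
open Finset

/-- additive character -/
noncomputable def ee (x : ℝ) : ℂ := Complex.exp (((2 * Real.pi * x : ℝ) : ℂ) * Complex.I)

lemma ee_zero : ee 0 = 1 := by simp [ee]

lemma ee_add (x y : ℝ) : ee (x + y) = ee x * ee y := by
  unfold ee; rw [← Complex.exp_add]; congr 1; push_cast; ring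

lemma norm_ee (x : ℝ) : ‖ee x‖ = 1 := by
  unfold ee; exact Complex.norm_exp_ofReal_mul_I _

lemma ee_int (n : ℤ) : ee n = 1 := by
  unfold ee; rw [Complex.exp_eq_one_iff]; exact ⟨n, by push_cast; ring⟩

lemma ee_nat (n : ℕ) : ee n = 1 := by
  simpa using ee_int (n : ℤ)

lemma ee_add_int (x : ℝ) (n : ℤ) : ee (x + n) = ee x := by rw [ee_add, ee_int, mul_one]

lemma ee_sub_int (x : ℝ) (n : ℤ) : ee (x - n) = ee x := by
  rw [← ee_add_int (x - n) n]; congr 1; ring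

lemma ee_ne_zero (x : ℝ) : ee x ≠ 0 := by unfold ee; exact Complex.exp_ne_zero _

lemma ee_neg (x : ℝ) : ee (-x) = (ee x)⁻¹ := by
  apply eq_inv_of_mul_eq_one_left; rw [← ee_add]; simp [ee_zero]

lemma ee_neg_conj (x : ℝ) : ee (-x) = (starRingEnd ℂ) (ee x) := by
  unfold ee
  rw [← Complex.exp_conj, map_mul, Complex.conj_I, Complex.conj_ofReal]; congr 1; push_cast; ring

lemma ee_nat_mul (n : ℕ) (x : ℝ) : ee (n * x) = ee x ^ n := by
  unfold ee; rw [← Complex.exp_nat_mul]; congr 1; push_cast; ring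

lemma norm_ee_sub_one (x : ℝ) : ‖ee x - 1‖ = 2 * |Real.sin (Real.pi * x)| := by
  unfold ee
  have := Complex.norm_exp_I_mul_ofReal_sub_one (2 * Real.pi * x)
  rw [mul_comm Complex.I] at this
  rw [this]
  rw [show 2 * Real.pi * x / 2 = Real.pi * x by ring]
  simp

lemma norm_ee_sub_one_le (x : ℝ) : ‖ee x - 1‖ ≤ 2 * Real.pi * |x| := by
  rw [norm_ee_sub_one]
  have : |Real.sin (Real.pi * x)| ≤ |Real.pi * x| := Real.abs_sin_le_abs
  rw [abs_mul, abs_of_pos Real.pi_pos] at this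
  linarith

lemma norm_ee_sub_ee_le (x y : ℝ) : ‖ee x - ee y‖ ≤ 2 * Real.pi * |x - y| := by
  have : ee x - ee y = ee y * (ee (x - y) - 1) := by
    rw [mul_sub, ← ee_add]; simp
  rw [this, norm_mul, norm_ee, one_mul]; exact norm_ee_sub_one_le _

/-- distance to nearest integer -/
noncomputable def nn (x : ℝ) : ℝ := |x - round x|

lemma nn_nonneg (x : ℝ) : 0 ≤ nn x := abs_nonneg _

lemma nn_le_half (x : ℝ) : nn x ≤ 1 / 2 := abs_sub_round x

lemma nn_le (x : ℝ) (n : ℤ) : nn x ≤ |x - n| := round_le x n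

lemma nn_add_int (x : ℝ) (n : ℤ) : nn (x + n) = nn x := by
  unfold nn; rw [round_add_intCast]; push_cast; congr 1; ring

lemma nn_sub_le (x y : ℝ) : nn x - |y| ≤ nn (x + y) := by
  have h := nn_le x (round (x + y))
  unfold nn at *
  have : x - round (x+y) = (x + y - round (x+y)) + (-y) := by ring
  have h2 := abs_add_le (x + y - round (x+y)) (-y)
  rw [← this, abs_neg] at h2
  linarith

lemma nn_neg (x : ℝ) : nn (-x) = nn x := by
  have key : ∀ z : ℝ, nn (-z) ≤ nn z := by
    intro z
    have := nn_le (-z) (-(round z))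
    refine this.trans (le_of_eq ?_)
    unfold nn; push_cast; rw [← abs_neg]; congr 1; ring
  refine le_antisymm (key x) ?_
  simpa using key (-x)

/-- a fraction away from integers -/
lemma nn_frac_ge {q : ℕ} (hq : 0 < q) (b : ℤ) (hb : ¬ (q : ℤ) ∣ b) : 1 / (q : ℝ) ≤ nn ((b : ℝ) / q) := by
  unfold nn
  have hq' : (0 : ℝ) < q := by exact_mod_cast hq
  set r := round ((b : ℝ) / q)
  have : ((b : ℝ) / q - r) = ((b - r * q : ℤ) : ℝ) / q := by push_cast; field_simp
  rw [this, abs_div, abs_of_pos hq']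
  have h1 : (b - r * q : ℤ) ≠ 0 := by
    intro h; exact hb ⟨r, by linarith⟩
  have h2 : (1 : ℝ) ≤ |((b - r * q : ℤ) : ℝ)| := by
    rw [← Int.cast_abs]; exact_mod_cast Int.one_le_abs h1
  gcongr

lemma sin_ge_nn (x : ℝ) : 2 * nn x ≤ |Real.sin (Real.pi * x)| := by
  have h0 : |Real.sin (Real.pi * x)| = |Real.sin (Real.pi * (x - round x))| := by
    rw [mul_sub, mul_comm Real.pi (round x : ℝ), Real.sin_sub_int_mul_pi]
    rw [abs_mul]; simp
  rw [h0]
  have h1 : |Real.sin (Real.pi * (x - round x))| = Real.sin (Real.pi * nn x) := by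
    unfold nn
    rcases le_total 0 (x - round x) with h | h
    · rw [abs_of_nonneg h, abs_of_nonneg]
      apply Real.sin_nonneg_of_nonneg_of_le_pi (by positivity)
      have := abs_sub_round x
      rw [abs_of_nonneg h] at this
      nlinarith [Real.pi_pos]
    · rw [abs_of_nonpos h, mul_neg, Real.sin_neg, abs_of_nonpos]
      have := abs_sub_round x
      rw [abs_of_nonpos h] at this
      apply Real.sin_nonpos_of_nonpos_of_neg_pi_le
      · nlinarith [Real.pi_pos]
      · nlinarith [Real.pi_pos]
  rw [h1]
  have := Real.mul_le_sin (x := Real.pi * nn x) (by have := nn_nonneg x; positivity)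
    (by nlinarith [Real.pi_pos, nn_le_half x])
  refine le_trans (le_of_eq ?_) this
  field_simp

lemma geom_ee (θ : ℝ) (A B : ℕ) (hAB : A ≤ B) :
    (∑ m ∈ Ioc A B, ee (m * θ)) * (ee θ - 1) = ee ((B + 1 : ℕ) * θ) - ee ((A + 1 : ℕ) * θ) := by
  induction B, hAB using Nat.le_induction with
  | base => simp
  | succ n hn ih =>
    rw [← Finset.insert_Ioc_right_eq_Ioc_add_one (by omega), Finset.sum_insert (by simp), add_mul, ih]
    have : ee ((n + 1 + 1 : ℕ) * θ) = ee ((n + 1 : ℕ) * θ) * ee θ := by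
      rw [← ee_add]; congr 1; push_cast; ring
    rw [this]; ring

lemma geom_le (θ δ : ℝ) (hδ : 0 < δ) (h : δ ≤ nn θ) (A B : ℕ) :
    ‖∑ m ∈ Ioc A B, ee (m * θ)‖ ≤ 1 / (2 * δ) := by
  rcases le_total A B with hAB | hAB
  · have h1 := congrArg norm (geom_ee θ A B hAB)
    rw [norm_mul, norm_ee_sub_one] at h1
    have h2 : ‖ee ((B + 1 : ℕ) * θ) - ee ((A + 1 : ℕ) * θ)‖ ≤ 2 := by
      refine (norm_sub_le _ _).trans ?_
      rw [norm_ee, norm_ee]; norm_num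
    have h3 := sin_ge_nn θ
    rw [le_div_iff₀ (by positivity)]
    have h4 := norm_nonneg (∑ m ∈ Ioc A B, ee (m * θ))
    nlinarith
  · rw [Finset.Ioc_eq_empty (by omega)]; simp; positivity

lemma geom_le_card (θ : ℝ) (A B : ℕ) :
    ‖∑ m ∈ Ioc A B, ee (m * θ)‖ ≤ ((B - A : ℕ) : ℝ) := by
  refine (norm_sum_le _ _).trans ?_
  simp [norm_ee]

end FP


namespace FP
open Finset

/-- reduced residues -/
def cop (r : ℕ) : Finset ℕ := (range r).filter (fun c => r.Coprime c)

lemma card_cop (r : ℕ) : (cop r).card = r.totient := rfl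

lemma mem_cop {r c : ℕ} : c ∈ cop r ↔ c < r ∧ r.Coprime c := by simp [cop]

lemma sum_cop_divisors (g : ℝ → ℂ) (r : ℕ) (hr : 0 < r) :
    ∑ d ∈ r.divisors, ∑ c ∈ cop d, g ((c : ℝ) / d) = ∑ c ∈ range r, g ((c : ℝ) / r) := by
  rw [← Finset.sum_fiberwise_of_maps_to (s := range r) (t := r.divisors) (g := fun c => r / r.gcd c)]
  · apply Finset.sum_congr rfl
    intro d hd
    obtain ⟨k, hk⟩ := (Nat.mem_divisors.1 hd).1
    have hd0 : 0 < d := Nat.pos_of_mem_divisors hd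
    have hk0 : 0 < k := by
      rcases Nat.eq_zero_or_pos k with h | h
      · subst h; simp at hk; omega
      · exact h
    have e1 : ∀ c', Nat.Coprime d c' → r / r.gcd (c' * k) = d := by
      intro c' h2
      have h2' : d.gcd c' = 1 := h2
      rw [hk, Nat.gcd_mul_right, h2', one_mul, Nat.mul_div_cancel _ hk0]
    refine Finset.sum_bij' (fun c _ => c * k) (fun c _ => c / k) ?_ ?_ ?_ ?_ ?_
    · intro c hc
      obtain ⟨h1, h2⟩ := mem_cop.1 hc
      rw [mem_filter, mem_range]
      refine ⟨?_, e1 c h2⟩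
      rw [hk]; exact Nat.mul_lt_mul_of_pos_right h1 hk0
    · intro c hc
      rw [mem_filter, mem_range] at hc
      obtain ⟨h1, h2⟩ := hc
      have hg : r.gcd c = k := by
        have h3 : r.gcd c * d = r := by rw [← h2]; exact Nat.mul_div_cancel' (Nat.gcd_dvd_left r c)
        have : r.gcd c * d = k * d := by rw [h3, hk]; ring
        exact Nat.eq_of_mul_eq_mul_right hd0 this
      rw [mem_cop]
      constructor
      · apply Nat.div_lt_of_lt_mul; rw [mul_comm, ← hk]; exact h1
      · have h4 : r / k = d := by rw [hk]; exact Nat.mul_div_cancel _ hk0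
        have := Nat.coprime_div_gcd_div_gcd (m := r) (n := c) (by rw [hg]; exact hk0)
        rw [hg, h4] at this; exact this
    · intro c hc; exact Nat.mul_div_cancel _ hk0
    · intro c hc
      rw [mem_filter, mem_range] at hc
      obtain ⟨h1, h2⟩ := hc
      have hg : r.gcd c = k := by
        have h3 : r.gcd c * d = r := by rw [← h2]; exact Nat.mul_div_cancel' (Nat.gcd_dvd_left r c)
        have : r.gcd c * d = k * d := by rw [h3, hk]; ring
        exact Nat.eq_of_mul_eq_mul_right hd0 this
      exact Nat.div_mul_cancel (hg ▸ Nat.gcd_dvd_right r c)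
    · intro c hc
      congr 1
      rw [hk]; push_cast
      have : (k : ℝ) ≠ 0 := by positivity
      have : (d : ℝ) ≠ 0 := by positivity
      field_simp
  · intro c hc
    rw [Nat.mem_divisors]
    exact ⟨Nat.div_dvd_of_dvd (Nat.gcd_dvd_left _ _), hr.ne'⟩

lemma sum_range_ee (r : ℕ) (hr : 0 < r) (n : ℤ) :
    ∑ c ∈ range r, ee (((c : ℝ) / r) * n) = if (r : ℤ) ∣ n then (r : ℂ) else 0 := by
  have hr' : (r : ℝ) ≠ 0 := by positivity
  have h : ∀ c : ℕ, ee (((c : ℝ) / r) * n) = ee ((n : ℝ) / r) ^ c := by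
    intro c; rw [← ee_nat_mul]; congr 1; ring
  simp_rw [h]
  split_ifs with hd
  · obtain ⟨k, hk⟩ := hd
    have : ee ((n : ℝ) / r) = 1 := by
      rw [hk]; push_cast; rw [mul_div_cancel_left₀ _ hr']; exact ee_int k
    simp [this]
  · have hne : ee ((n : ℝ) / r) ≠ 1 := by
      intro h1
      apply hd
      unfold ee at h1
      rw [Complex.exp_eq_one_iff] at h1
      obtain ⟨m, hm⟩ := h1
      have hpi : ((2 * Real.pi : ℝ) : ℂ) * Complex.I ≠ 0 := by
        apply mul_ne_zero _ Complex.I_ne_zero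
        exact_mod_cast (by positivity : (2 * Real.pi : ℝ) ≠ 0)
      have h2 : (((n : ℝ) / r : ℝ) : ℂ) = ((m : ℝ) : ℂ) := by
        apply mul_left_cancel₀ hpi
        push_cast at hm ⊢
        linear_combination hm
      have h3 : (n : ℝ) / r = m := by exact_mod_cast h2
      rw [div_eq_iff hr'] at h3
      refine ⟨m, ?_⟩
      have : (n : ℤ) = m * r := by exact_mod_cast h3
      rw [this]; ring
    rw [geom_sum_eq hne, ← ee_nat_mul, mul_div_cancel₀ _ hr', ee_int]
    simp

/-- Ramanujan sums at coprime arguments -/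
lemma ramanujan (n : ℤ) : ∀ r : ℕ, 0 < r → IsCoprime (r : ℤ) n →
    ∑ c ∈ cop r, ee (((c : ℝ) / r) * n) = ((ArithmeticFunction.moebius r : ℤ) : ℂ) := by
  intro r
  induction r using Nat.strong_induction_on with
  | _ r ih =>
  intro hr hc
  have h1 := sum_cop_divisors (fun t => ee (t * n)) r hr
  rw [sum_range_ee r hr n] at h1
  have h2 : ∑ d ∈ r.divisors, ((ArithmeticFunction.moebius d : ℤ) : ℂ) = if r = 1 then 1 else 0 := by
    have := congrArg (fun f : ArithmeticFunction ℤ => f r) ArithmeticFunction.moebius_mul_coe_zeta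
    simp only [ArithmeticFunction.coe_mul_zeta_apply, ArithmeticFunction.one_apply] at this
    exact_mod_cast this
  have h3 : (if (r : ℤ) ∣ n then (r : ℂ) else 0) = if r = 1 then 1 else 0 := by
    by_cases h : r = 1
    · subst h; simp
    · rw [if_neg h, if_neg]
      intro hd
      have := hc.isUnit_of_dvd' dvd_rfl hd
      rw [Int.isUnit_iff] at this
      omega
  rw [h3, ← h2, ← Nat.cons_self_properDivisors hr.ne', Finset.sum_cons, Finset.sum_cons] at h1
  rw [Finset.sum_congr (s₁ := r.properDivisors) rfl
    (g := fun d => ((ArithmeticFunction.moebius d : ℤ) : ℂ))] at h1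
  · exact add_right_cancel h1
  · intro d hd
    have hd' := Nat.mem_properDivisors.1 hd
    exact ih d hd'.2 (Nat.pos_of_mem_properDivisors hd)
      (hc.of_isCoprime_of_dvd_left (by exact_mod_cast hd'.1))

lemma continuous_ee : Continuous ee := by unfold ee; fun_prop

/-- finite trigonometric sums -/
noncomputable def SS (a : ℕ → ℂ) (s : Finset ℕ) (α : ℝ) : ℂ := ∑ n ∈ s, a n * ee (n * α)

lemma continuous_SS (a : ℕ → ℂ) (s : Finset ℕ) : Continuous (SS a s) := by
  unfold SS
  have := continuous_ee
  fun_prop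

lemma SS_add_int (a : ℕ → ℂ) (s : Finset ℕ) (α : ℝ) (m : ℤ) : SS a s (α + m) = SS a s α := by
  unfold SS
  apply Finset.sum_congr rfl
  intro n _
  rw [mul_add]
  have : (n : ℝ) * (m : ℝ) = ((n * m : ℤ) : ℝ) := by push_cast; ring
  rw [this, ee_add_int]

lemma SS_periodic (a : ℕ → ℂ) (s : Finset ℕ) : Function.Periodic (SS a s) 1 := by
  intro x; simpa using SS_add_int a s x 1

lemma integral_ee (m : ℤ) : ∫ α in (0 : ℝ)..1, ee (m * α) = if m = 0 then 1 else 0 := by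
  split_ifs with h
  · subst h; simp [ee_zero]
  · have hc : (((2 * Real.pi * m : ℝ) : ℂ) * Complex.I) ≠ 0 := by
      apply mul_ne_zero _ Complex.I_ne_zero
      have : (2 * Real.pi * m : ℝ) ≠ 0 := by
        have : (m : ℝ) ≠ 0 := by exact_mod_cast h
        positivity
      exact_mod_cast this
    have h1 : ∀ α : ℝ, ee (m * α) = Complex.exp ((((2 * Real.pi * m : ℝ) : ℂ) * Complex.I) * α) := by
      intro α; unfold ee; congr 1; push_cast; ring
    simp_rw [h1]
    rw [integral_exp_mul_complex hc]
    have h2 : Complex.exp ((((2 * Real.pi * m : ℝ) : ℂ) * Complex.I) * (1 : ℝ)) = 1 := by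
      rw [← h1]; simpa using ee_int m
    rw [h2]; simp

lemma normSq_SS (a : ℕ → ℂ) (s : Finset ℕ) (α : ℝ) :
    ((‖SS a s α‖ ^ 2 : ℝ) : ℂ) =
      ∑ n ∈ s, ∑ m ∈ s, a n * (starRingEnd ℂ) (a m) * ee (((n : ℤ) - (m : ℤ) : ℤ) * α) := by
  have : ((‖SS a s α‖ ^ 2 : ℝ) : ℂ) = SS a s α * (starRingEnd ℂ) (SS a s α) := by
    rw [Complex.mul_conj, Complex.normSq_eq_norm_sq]
  rw [this]
  unfold SS
  rw [map_sum, Finset.sum_mul_sum]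
  refine Finset.sum_congr rfl fun n _ => Finset.sum_congr rfl fun m _ => ?_
  rw [map_mul, ← ee_neg_conj]
  have : ee (((n : ℤ) - (m : ℤ) : ℤ) * α) = ee (n * α) * ee (-(m * α)) := by
    rw [← ee_add]; congr 1; push_cast; ring
  rw [this]; ring

lemma parseval (a : ℕ → ℂ) (s : Finset ℕ) :
    ∫ α in (0 : ℝ)..1, ‖SS a s α‖ ^ 2 = ∑ n ∈ s, ‖a n‖ ^ 2 := by
  have hc := continuous_ee
  have h : ((∫ α in (0 : ℝ)..1, ‖SS a s α‖ ^ 2 : ℝ) : ℂ) = ((∑ n ∈ s, ‖a n‖ ^ 2 : ℝ) : ℂ) := by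
    rw [← intervalIntegral.integral_ofReal]
    simp_rw [normSq_SS]
    rw [intervalIntegral.integral_finsetSum]
    · rw [Complex.ofReal_sum]
      apply Finset.sum_congr rfl
      intro n hn
      rw [intervalIntegral.integral_finsetSum]
      · rw [Finset.sum_eq_single n]
        · rw [intervalIntegral.integral_const_mul, integral_ee, if_pos (by ring), mul_one,
            Complex.mul_conj, Complex.normSq_eq_norm_sq]
        · intro m _ hm
          rw [intervalIntegral.integral_const_mul, integral_ee, if_neg, mul_zero]
          intro h0; apply hm; omega
        · intro h0; exact absurd hn h0
      · intro m _; apply Continuous.intervalIntegrable; fun_prop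
    · intro m _; apply Continuous.intervalIntegrable; fun_prop
  exact_mod_cast h

lemma SS_shift_sum (a : ℕ → ℂ) (s : Finset ℕ) (r : ℕ) (hr : 0 < r)
    (hcop : ∀ n ∈ s, a n ≠ 0 → Nat.Coprime r n) (α : ℝ) :
    ∑ c ∈ cop r, SS a s (α + (c : ℝ) / r) = ((ArithmeticFunction.moebius r : ℤ) : ℂ) * SS a s α := by
  unfold SS
  rw [Finset.sum_comm, Finset.mul_sum]
  apply Finset.sum_congr rfl
  intro n hn
  by_cases h0 : a n = 0
  · simp [h0]
  · have h1 := ramanujan (n : ℤ) r hr (by exact_mod_cast Nat.Coprime.isCoprime (hcop n hn h0))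
    rw [← h1, Finset.sum_mul]
    apply Finset.sum_congr rfl
    intro c _
    rw [mul_add, ee_add]
    have : (n : ℝ) * ((c : ℝ) / r) = ((c : ℝ) / r) * ((n : ℤ) : ℝ) := by push_cast; ring
    rw [this]; ring

lemma norm_sum_sq_le {ι : Type*} (s : Finset ι) (f : ι → ℂ) :
    ‖∑ i ∈ s, f i‖ ^ 2 ≤ s.card * ∑ i ∈ s, ‖f i‖ ^ 2 := by
  calc ‖∑ i ∈ s, f i‖ ^ 2 ≤ (∑ i ∈ s, ‖f i‖) ^ 2 := by
        gcongr; exact norm_sum_le _ _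
    _ ≤ _ := sq_sum_le_card_mul_sum_sq

lemma ii_sum {ι : Type*} (s : Finset ι) (f : ι → ℝ → ℝ) (a b : ℝ)
    (h : ∀ i ∈ s, IntervalIntegrable (f i) MeasureTheory.volume a b) :
    IntervalIntegrable (fun x => ∑ i ∈ s, f i x) MeasureTheory.volume a b := by
  have := IntervalIntegrable.sum s h
  have e : (∑ i ∈ s, f i) = fun x => ∑ i ∈ s, f i x := by ext x; simp
  rwa [e] at this

lemma star_general (a : ℕ → ℂ) (s : Finset ℕ) (R : Finset ℕ) (hR : ∀ r ∈ R, Squarefree r)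
    (hcop : ∀ n ∈ s, a n ≠ 0 → ∀ r ∈ R, Nat.Coprime r n) (g : ℝ → ℝ) (hg0 : ∀ x, 0 ≤ g x)
    (hgm : Measurable g) (hg1 : ∀ x, g x ≤ 1) (hgp : Function.Periodic g 1)
    (hd : ∀ α, ∑ r ∈ R, ∑ c ∈ cop r, g (α - (c : ℝ) / r) ≤ 1) :
    (∑ r ∈ R, 1 / (r.totient : ℝ)) * ∫ α in (0 : ℝ)..1, g α * ‖SS a s α‖ ^ 2 ≤ ∑ n ∈ s, ‖a n‖ ^ 2 := by
  have hS := continuous_SS a s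
  have hintgr : ∀ t u : ℝ, IntervalIntegrable (fun α => g (α - t) * ‖SS a s (α + u)‖ ^ 2)
      MeasureTheory.volume 0 1 := by
    intro t u
    have h1 : IntervalIntegrable (fun α => ‖SS a s (α + u)‖ ^ 2) MeasureTheory.volume 0 1 := by
      apply Continuous.intervalIntegrable; fun_prop
    refine h1.mono_fun' ?_ ?_
    · apply Measurable.aestronglyMeasurable
      apply Measurable.mul
      · exact hgm.comp (measurable_id.sub_const t)
      · exact Continuous.measurable (by fun_prop)
    · apply Filter.Eventually.of_forall
      intro x
      simp only [norm_mul, norm_pow, norm_norm]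
      rw [Real.norm_of_nonneg (hg0 _)]
      exact mul_le_of_le_one_left (by positivity) (hg1 _)
  have hint0 : ∀ t : ℝ, IntervalIntegrable (fun α => g (α - t) * ‖SS a s α‖ ^ 2)
      MeasureTheory.volume 0 1 := by intro t; simpa using hintgr t 0
  have key : ∀ r ∈ R, 1 / (r.totient : ℝ) * ∫ α in (0 : ℝ)..1, g α * ‖SS a s α‖ ^ 2 ≤
      ∑ c ∈ cop r, ∫ α in (0 : ℝ)..1, g (α - (c : ℝ) / r) * ‖SS a s α‖ ^ 2 := by
    intro r hr
    have hr0 : 0 < r := Nat.pos_of_ne_zero (hR r hr).ne_zero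
    have hφ : (0 : ℝ) < r.totient := by exact_mod_cast Nat.totient_pos.2 hr0
    have hpt : ∀ α, ‖SS a s α‖ ^ 2 ≤ r.totient * ∑ c ∈ cop r, ‖SS a s (α + (c : ℝ) / r)‖ ^ 2 := by
      intro α
      have h1 := norm_sum_sq_le (cop r) (fun c => SS a s (α + (c : ℝ) / r))
      rw [SS_shift_sum a s r hr0 (fun n hn h => hcop n hn h r hr) α, card_cop, norm_mul, mul_pow] at h1
      have h2 : ‖((ArithmeticFunction.moebius r : ℤ) : ℂ)‖ ^ 2 = 1 := by
        have := ArithmeticFunction.moebius_sq_eq_one_of_squarefree (hR r hr)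
        rw [← norm_pow]
        have : (((ArithmeticFunction.moebius r : ℤ) : ℂ)) ^ 2 = 1 := by exact_mod_cast this
        rw [this]; simp
      rwa [h2, one_mul] at h1
    have hshift : ∀ c ∈ cop r, ∫ α in (0 : ℝ)..1, g (α - (c : ℝ) / r) * ‖SS a s α‖ ^ 2 =
        ∫ α in (0 : ℝ)..1, g α * ‖SS a s (α + (c : ℝ) / r)‖ ^ 2 := by
      intro c _
      set t : ℝ := (c : ℝ) / r
      have hper : Function.Periodic (fun α => g α * ‖SS a s (α + t)‖ ^ 2) 1 := by
        intro x
        have h1 := SS_periodic a s (x + t)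
        simp only [hgp x]
        rw [add_right_comm, h1]
      have h3 := intervalIntegral.integral_comp_sub_right (a := 0) (b := 1)
        (fun α => g α * ‖SS a s (α + t)‖ ^ 2) t
      simp only [sub_add_cancel] at h3
      rw [h3, show (1 : ℝ) - t = (0 - t) + 1 by ring, hper.intervalIntegral_add_eq (0 - t) 0, zero_add]
    rw [Finset.sum_congr rfl hshift, ← intervalIntegral.integral_finsetSum]
    · rw [← intervalIntegral.integral_const_mul]
      apply intervalIntegral.integral_mono_on zero_le_one
      · exact (by simpa using hintgr 0 0 : IntervalIntegrable (fun α => g α * ‖SS a s α‖ ^ 2)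
          MeasureTheory.volume 0 1).const_mul _
      · exact ii_sum _ _ _ _ (fun c _ => by simpa using hintgr 0 ((c : ℝ) / r))
      · intro α _
        rw [← Finset.mul_sum]
        have := hpt α
        calc 1 / (r.totient : ℝ) * (g α * ‖SS a s α‖ ^ 2)
            ≤ 1 / (r.totient : ℝ) * (g α * (r.totient * ∑ c ∈ cop r, ‖SS a s (α + (c : ℝ) / r)‖ ^ 2)) := by
              gcongr; exact hg0 _
          _ = _ := by field_simp
    · intro c _; simpa using hintgr 0 ((c : ℝ) / r)
  calc _ = ∑ r ∈ R, 1 / (r.totient : ℝ) * ∫ α in (0 : ℝ)..1, g α * ‖SS a s α‖ ^ 2 := by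
        rw [Finset.sum_mul]
    _ ≤ ∑ r ∈ R, ∑ c ∈ cop r, ∫ α in (0 : ℝ)..1, g (α - (c : ℝ) / r) * ‖SS a s α‖ ^ 2 :=
        Finset.sum_le_sum key
    _ = ∫ α in (0 : ℝ)..1, ∑ r ∈ R, ∑ c ∈ cop r, g (α - (c : ℝ) / r) * ‖SS a s α‖ ^ 2 := by
        rw [intervalIntegral.integral_finsetSum]
        · apply Finset.sum_congr rfl
          intro r _
          rw [intervalIntegral.integral_finsetSum]
          intro c _; exact hint0 _
        · intro r _; exact ii_sum _ _ _ _ (fun c _ => hint0 _)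
    _ ≤ ∫ α in (0 : ℝ)..1, ‖SS a s α‖ ^ 2 := by
        apply intervalIntegral.integral_mono_on zero_le_one
        · exact ii_sum _ _ _ _ (fun r _ => ii_sum _ _ _ _ (fun c _ => hint0 _))
        · apply Continuous.intervalIntegrable; fun_prop
        · intro α _
          simp_rw [← Finset.sum_mul]
          exact mul_le_of_le_one_left (by positivity) (hd α)
    _ = _ := parseval a s

/-- union of closed arcs of radius `η` around all fractions with denominators in `Q` -/
def arcs (Q : Finset ℕ) (η : ℝ) : Set ℝ := {α | ∃ q ∈ Q, ∃ k : ℤ, |α - k / q| ≤ η}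

lemma measurableSet_arcs (Q : Finset ℕ) (η : ℝ) : MeasurableSet (arcs Q η) := by
  have : arcs Q η = ⋃ q ∈ Q, ⋃ k : ℤ, {α : ℝ | |α - k / q| ≤ η} := by ext; simp [arcs]
  rw [this]
  refine Finset.measurableSet_biUnion _ fun q _ => MeasurableSet.iUnion fun k => ?_
  exact (isClosed_le (by fun_prop) continuous_const).measurableSet

lemma arcs_add_one (Q : Finset ℕ) (η : ℝ) (hQ : ∀ q ∈ Q, 0 < q) (x : ℝ) : x + 1 ∈ arcs Q η ↔ x ∈ arcs Q η := by
  constructor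
  · rintro ⟨q, hq, k, hk⟩
    refine ⟨q, hq, k - q, ?_⟩
    have : (q : ℝ) ≠ 0 := by have := hQ q hq; positivity
    convert hk using 2
    push_cast; field_simp; ring
  · rintro ⟨q, hq, k, hk⟩
    refine ⟨q, hq, k + q, ?_⟩
    have : (q : ℝ) ≠ 0 := by have := hQ q hq; positivity
    convert hk using 2
    push_cast; field_simp; ring

lemma star (a : ℕ → ℂ) (s : Finset ℕ) (R : Finset ℕ) (hR : ∀ r ∈ R, Squarefree r)
    (hcop : ∀ n ∈ s, a n ≠ 0 → ∀ r ∈ R, Nat.Coprime r n) (Q : Finset ℕ) (η : ℝ)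
    (hQ : ∀ q ∈ Q, 0 < q) (hQR : ∀ q ∈ Q, ∀ r ∈ R, Nat.Coprime r q) (X Y : ℝ)
    (hX : ∀ q ∈ Q, (q : ℝ) ≤ X) (hY : ∀ r ∈ R, (r : ℝ) ≤ Y) (hη : 2 * η * X ^ 2 * Y ^ 2 < 1) :
    (∑ r ∈ R, 1 / (r.totient : ℝ)) *
      ∫ α in (0 : ℝ)..1, (arcs Q η).indicator (fun _ => (1 : ℝ)) α * ‖SS a s α‖ ^ 2 ≤ ∑ n ∈ s, ‖a n‖ ^ 2 := by
  classical
  apply star_general a s R hR hcop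
  · intro x; apply Set.indicator_nonneg; intros; norm_num
  · exact measurable_const.indicator (measurableSet_arcs Q η)
  · intro x; apply Set.indicator_le' <;> intros <;> norm_num
  · intro x
    by_cases h : x ∈ arcs Q η
    · rw [Set.indicator_of_mem h, Set.indicator_of_mem ((arcs_add_one Q η hQ x).2 h)]
    · rw [Set.indicator_of_notMem h, Set.indicator_of_notMem (fun h' => h ((arcs_add_one Q η hQ x).1 h'))]
  · intro α
    rw [Finset.sum_sigma']
    have hr0 : ∀ r ∈ R, 0 < r := fun r hr => Nat.pos_of_ne_zero (hR r hr).ne_zero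
    have huniq : ∀ i ∈ R.sigma cop, ∀ j ∈ R.sigma cop, α - (i.2 : ℝ) / i.1 ∈ arcs Q η →
        α - (j.2 : ℝ) / j.1 ∈ arcs Q η → i = j := by
      rintro ⟨r, c⟩ hi ⟨r', c'⟩ hj ⟨q, hq, k, hk⟩ ⟨q', hq', k', hk'⟩
      simp only [Finset.mem_sigma, mem_cop] at hi hj hk hk'
      have r0 := hr0 r hi.1
      have r0' := hr0 r' hj.1
      have q0 := hQ q hq
      have q0' := hQ q' hq'
      have hrR : (0 : ℝ) < r := by exact_mod_cast r0
      have hrR' : (0 : ℝ) < r' := by exact_mod_cast r0'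
      have hqR : (0 : ℝ) < q := by exact_mod_cast q0
      have hqR' : (0 : ℝ) < q' := by exact_mod_cast q0'
      -- the integer numerator
      set m : ℤ := (k * q' - k' * q) * (r * r') + (c * r' - c' * r) * (q * q') with hm
      have hmR : (m : ℝ) = ((k : ℝ) / q + (c : ℝ) / r - (k' / q' + c' / r')) * (q * q' * (r * r')) := by
        rw [hm]; push_cast; field_simp; ring
      have hsmall : |(k : ℝ) / q + (c : ℝ) / r - (k' / q' + c' / r')| ≤ 2 * η := by
        have e : (k : ℝ) / q + (c : ℝ) / r - (k' / q' + c' / r') =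
          (α - (c' : ℝ) / r' - k' / q') - (α - (c : ℝ) / r - k / q) := by ring
        rw [e]
        have := abs_sub (α - (c' : ℝ) / r' - k' / q') (α - (c : ℝ) / r - k / q)
        linarith
      have hη0 : 0 ≤ η := le_trans (abs_nonneg _) hk
      have hX0 : 0 < X := lt_of_lt_of_le hqR (hX q hq)
      have hY0 : 0 < Y := lt_of_lt_of_le hrR (hY r hi.1)
      have hm0 : m = 0 := by
        have h1 : |(m : ℝ)| < 1 := by
          rw [hmR, abs_mul, abs_of_pos (a := (q : ℝ) * q' * (r * r')) (by positivity)]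
          calc _ ≤ 2 * η * (X * X * (Y * Y)) := by
                have := hX q hq; have := hX q' hq'; have := hY r hi.1; have := hY r' hj.1
                gcongr
            _ = 2 * η * X ^ 2 * Y ^ 2 := by ring
            _ < 1 := hη
        have h2 : |m| < 1 := by exact_mod_cast h1
        exact Int.abs_lt_one_iff.1 h2
      -- divisibility
      have hcop1 : IsCoprime ((r * r' : ℕ) : ℤ) ((q * q' : ℕ) : ℤ) := by
        apply Nat.Coprime.isCoprime
        exact Nat.Coprime.mul_left
          (Nat.Coprime.mul_right (hQR q hq r hi.1) (hQR q' hq' r hi.1))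
          (Nat.Coprime.mul_right (hQR q hq r' hj.1) (hQR q' hq' r' hj.1))
      have hdvd : ((r * r' : ℕ) : ℤ) ∣ ((c : ℤ) * r' - c' * r) := by
        apply hcop1.dvd_of_dvd_mul_right
        refine ⟨-(k * q' - k' * q), ?_⟩
        push_cast
        linear_combination hm0 - hm
      have hlt : |((c : ℤ) * r' - c' * r)| < ((r * r' : ℕ) : ℤ) := by
        have h1 : (c : ℤ) < r := by exact_mod_cast hi.2.1
        have h2 : (c' : ℤ) < r' := by exact_mod_cast hj.2.1
        have h3 : (0 : ℤ) ≤ c := by positivity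
        have h4 : (0 : ℤ) ≤ c' := by positivity
        push_cast
        rw [abs_lt]; constructor <;> nlinarith
      have hz := Int.eq_zero_of_abs_lt_dvd hdvd hlt
      have heq : c * r' = c' * r := by
        have : (c : ℤ) * r' = c' * r := by linarith
        exact_mod_cast this
      have hrr : r = r' := by
        apply Nat.dvd_antisymm
        · exact hi.2.2.dvd_of_dvd_mul_left (heq ▸ Dvd.intro_left _ rfl)
        · exact hj.2.2.dvd_of_dvd_mul_left (heq ▸ Dvd.intro_left _ rfl)
      subst hrr
      have := Nat.eq_of_mul_eq_mul_right r0 heq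
      subst this; rfl
    by_cases hex : ∃ i ∈ R.sigma cop, α - (i.2 : ℝ) / i.1 ∈ arcs Q η
    · obtain ⟨i, hi, hia⟩ := hex
      rw [Finset.sum_eq_single i]
      · rw [Set.indicator_of_mem hia]
      · intro j hj hji
        apply Set.indicator_of_notMem
        intro hja
        exact hji (huniq j hj i hi hja hia)
      · intro h; exact absurd hi h
    · push Not at hex
      rw [Finset.sum_eq_zero]
      · norm_num
      · intro i hi; exact Set.indicator_of_notMem (hex i hi) _

end FP


namespace FP
open Finset

/-- primes up to `Q` -/
def pr (Q : ℕ) : Finset ℕ := (Ioc 0 Q).filter Nat.Prime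

lemma mem_pr {Q p : ℕ} : p ∈ pr Q ↔ p ≤ Q ∧ p.Prime := by
  simp only [pr, mem_filter, mem_Ioc]
  constructor
  · rintro ⟨⟨_, h⟩, h2⟩; exact ⟨h, h2⟩
  · rintro ⟨h, h2⟩; exact ⟨⟨h2.pos, h⟩, h2⟩

lemma theta_pr (Q : ℕ) : Chebyshev.theta Q = ∑ p ∈ pr Q, Real.log p := by
  unfold Chebyshev.theta pr; simp

lemma theta_pr_le (Q : ℕ) : ∑ p ∈ pr Q, Real.log p ≤ 2 * Q := by
  rw [← theta_pr]
  have h := Chebyshev.theta_le_log4_mul_x (x := (Q : ℝ)) (by positivity)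
  have h4 : Real.log 4 ≤ 2 := by
    have : Real.log 4 = 2 * Real.log 2 := by
      rw [show (4 : ℝ) = 2 ^ 2 by norm_num, Real.log_pow]; norm_num
    have := Real.log_two_lt_d9
    linarith
  have : (0 : ℝ) ≤ Q := by positivity
  nlinarith

lemma hs_step (Q : ℕ) (hQ : 64 ≤ Real.log ((Q : ℝ) / 2) * Real.log 2) :
    ∑ p ∈ pr Q, 1 / (p : ℝ) ≤ ∑ p ∈ pr (Q / 2), 1 / (p : ℝ) + Real.log 2 / 16 := by
  have hl2 : 0 < Real.log 2 := Real.log_pos one_lt_two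
  have hlq : 0 < Real.log ((Q : ℝ) / 2) := by
    by_contra h; push Not at h; nlinarith
  have hQ0 : (0 : ℝ) < Q := by
    rcases Nat.eq_zero_or_pos Q with h | h
    · subst h; simp at hlq
    · exact_mod_cast h
  have hsub : pr (Q / 2) ⊆ pr Q := by
    intro p hp; rw [mem_pr] at hp ⊢; exact ⟨hp.1.trans (Nat.div_le_self _ _), hp.2⟩
  rw [← Finset.sum_sdiff hsub, add_comm]
  gcongr
  have h1 : ∀ p ∈ pr Q \ pr (Q / 2), 1 / (p : ℝ) ≤ Real.log p * (2 / (Q * Real.log ((Q : ℝ) / 2))) := by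
    intro p hp
    rw [mem_sdiff, mem_pr, mem_pr] at hp
    have hpQ : (Q : ℝ) / 2 < p := by
      have : Q / 2 < p := by
        by_contra h; push Not at h; exact hp.2 ⟨h, hp.1.2⟩
      have : Q < 2 * p := by omega
      have : (Q : ℝ) < 2 * p := by exact_mod_cast this
      linarith
    have hp0 : (0 : ℝ) < p := by linarith
    have hlog : Real.log ((Q : ℝ) / 2) ≤ Real.log p := Real.log_le_log (by positivity) hpQ.le
    rw [div_le_iff₀ hp0]
    have : Real.log p * (2 / (Q * Real.log ((Q : ℝ) / 2))) * p =
      (Real.log p / Real.log ((Q : ℝ) / 2)) * (p / (Q / 2)) := by field_simp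
    rw [this]
    apply one_le_mul_of_one_le_of_one_le
    · rwa [one_le_div hlq]
    · rw [one_le_div (by positivity)]; exact hpQ.le
  calc _ ≤ ∑ p ∈ pr Q \ pr (Q / 2), Real.log p * (2 / (Q * Real.log ((Q : ℝ) / 2))) := Finset.sum_le_sum h1
    _ ≤ ∑ p ∈ pr Q, Real.log p * (2 / (Q * Real.log ((Q : ℝ) / 2))) := by
        apply Finset.sum_le_sum_of_subset_of_nonneg Finset.sdiff_subset
        intro p hp _
        have := Real.log_natCast_nonneg p
        positivity
    _ = (∑ p ∈ pr Q, Real.log p) * (2 / (Q * Real.log ((Q : ℝ) / 2))) := by rw [Finset.sum_mul]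
    _ ≤ (2 * Q) * (2 / (Q * Real.log ((Q : ℝ) / 2))) := by
        gcongr; exact theta_pr_le Q
    _ = 4 / Real.log ((Q : ℝ) / 2) := by field_simp; norm_num
    _ ≤ _ := by
        rw [div_le_div_iff₀ hlq (by norm_num)]; linarith

lemma hs_bound : ∃ C : ℝ, 0 ≤ C ∧ ∀ Q : ℕ, 1 ≤ Q → ∑ p ∈ pr Q, 1 / (p : ℝ) ≤ C + Real.log Q / 16 := by
  have hl2 : 0 < Real.log 2 := Real.log_pos one_lt_two
  obtain ⟨Q0, hQ0⟩ : ∃ Q0 : ℕ, 2 ≤ Q0 ∧ ∀ Q ≥ Q0, 64 ≤ Real.log ((Q : ℝ) / 2) * Real.log 2 := by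
    have h1 : Filter.Tendsto (fun Q : ℕ => Real.log ((Q : ℝ) / 2) * Real.log 2) Filter.atTop Filter.atTop := by
      apply Filter.Tendsto.atTop_mul_const hl2
      apply Real.tendsto_log_atTop.comp
      apply Filter.Tendsto.atTop_div_const (by norm_num)
      exact tendsto_natCast_atTop_atTop
    obtain ⟨Q0, h⟩ := Filter.eventually_atTop.1 (h1.eventually_ge_atTop 64)
    exact ⟨max Q0 2, le_max_right _ _, fun Q hQ => h Q (le_trans (le_max_left _ _) hQ)⟩
  refine ⟨∑ p ∈ pr Q0, 1 / (p : ℝ), by positivity, ?_⟩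
  intro Q
  induction Q using Nat.strong_induction_on with
  | _ Q ih =>
  intro hQ1
  by_cases hQ : Q < Q0
  · have hsub : pr Q ⊆ pr Q0 := by
      intro p hp; rw [mem_pr] at hp ⊢; exact ⟨hp.1.trans hQ.le, hp.2⟩
    have := Finset.sum_le_sum_of_subset_of_nonneg (f := fun p : ℕ => 1 / (p : ℝ)) hsub
      (fun _ _ _ => by positivity)
    have := Real.log_natCast_nonneg Q
    linarith
  · push Not at hQ
    have h1 := hs_step Q (hQ0.2 Q hQ)
    have h2 := ih (Q / 2) (by omega) (by omega)
    have h3 : Real.log ((Q / 2 : ℕ) : ℝ) ≤ Real.log Q - Real.log 2 := by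
      rw [← Real.log_div (by positivity) (by norm_num)]
      apply Real.log_le_log
      · have : 0 < Q / 2 := by omega
        exact_mod_cast this
      · exact Nat.cast_div_le
    linarith

lemma exp_bound {x : ℝ} (h0 : 0 ≤ x) (h1 : x ≤ 1 / 2) : (1 - x)⁻¹ ≤ Real.exp (2 * x) := by
  have h2 : 0 < 1 - x := by linarith
  rw [inv_le_iff_one_le_mul₀ h2]
  have := Real.add_one_le_exp (2 * x)
  nlinarith

/-- the sieve product -/
noncomputable def VV (P : Finset ℕ) : ℝ := ∏ p ∈ P, (1 - (p : ℝ)⁻¹)⁻¹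

lemma prime_inv_le {p : ℕ} (hp : p.Prime) : (p : ℝ)⁻¹ ≤ 1 / 2 := by
  rw [inv_eq_one_div]
  have : (2 : ℝ) ≤ p := by exact_mod_cast hp.two_le
  apply one_div_le_one_div_of_le <;> linarith

lemma VV_pos (P : Finset ℕ) (hP : ∀ p ∈ P, p.Prime) : 0 < VV P := by
  apply Finset.prod_pos; intro p hp
  have := prime_inv_le (hP p hp)
  rw [inv_pos]; linarith

lemma VV_bound : ∃ C : ℝ, 0 < C ∧ ∀ (Q : ℕ) (P : Finset ℕ), 1 ≤ Q → P ⊆ pr Q →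
    VV P ≤ C * (Q : ℝ) ^ (1 / 8 : ℝ) := by
  obtain ⟨C, hC0, hC⟩ := hs_bound
  refine ⟨Real.exp (2 * C), Real.exp_pos _, ?_⟩
  intro Q P hQ hP
  have hQ' : (0 : ℝ) < Q := by exact_mod_cast hQ
  calc VV P ≤ ∏ p ∈ P, Real.exp (2 * (p : ℝ)⁻¹) := by
        apply Finset.prod_le_prod
        · intro p hp
          have := prime_inv_le (mem_pr.1 (hP hp)).2
          rw [inv_nonneg]; linarith
        · intro p hp
          exact exp_bound (by positivity) (prime_inv_le (mem_pr.1 (hP hp)).2)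
    _ = Real.exp (2 * ∑ p ∈ P, 1 / (p : ℝ)) := by
        rw [← Real.exp_sum, Finset.mul_sum]; simp
    _ ≤ Real.exp (2 * (C + Real.log Q / 16)) := by
        apply Real.exp_le_exp.2
        have := Finset.sum_le_sum_of_subset_of_nonneg (f := fun p : ℕ => 1 / (p : ℝ)) hP
          (fun _ _ _ => by positivity)
        have := hC Q hQ
        linarith
    _ = _ := by
        rw [Real.rpow_def_of_pos hQ', ← Real.exp_add]; congr 1; ring

lemma totient_VV {q : ℕ} (hq : 0 < q) : (q : ℝ) = q.totient * VV q.primeFactors := by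
  have h := Nat.totient_eq_mul_prod_factors q
  have h' : (q.totient : ℝ) = q * ∏ p ∈ q.primeFactors, (1 - (p : ℝ)⁻¹) := by
    have := congrArg (fun x : ℚ => (x : ℝ)) h
    push_cast at this; exact this
  rw [h', VV, mul_assoc, ← Finset.prod_mul_distrib, Finset.prod_eq_one, mul_one]
  intro p hp
  have := prime_inv_le (Nat.prime_of_mem_primeFactors hp)
  exact mul_inv_cancel₀ (by linarith)

lemma phi_lower : ∃ C : ℝ, 0 < C ∧ ∀ q : ℕ, 0 < q → (q : ℝ) ^ (7 / 8 : ℝ) ≤ C * q.totient := by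
  obtain ⟨C, hC0, hC⟩ := VV_bound
  refine ⟨C, hC0, ?_⟩
  intro q hq
  have hq' : (0 : ℝ) < q := by exact_mod_cast hq
  have h1 := hC q q.primeFactors hq (by
    intro p hp; rw [mem_pr]
    exact ⟨Nat.le_of_mem_primeFactors hp, Nat.prime_of_mem_primeFactors hp⟩)
  have h2 : (q : ℝ) ≤ q.totient * (C * (q : ℝ) ^ (1 / 8 : ℝ)) := by
    nth_rw 1 [totient_VV hq]; gcongr
  have h3 : (q : ℝ) = (q : ℝ) ^ (7 / 8 : ℝ) * (q : ℝ) ^ (1 / 8 : ℝ) := by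
    rw [← Real.rpow_add hq']; norm_num
  have h4 : 0 < (q : ℝ) ^ (1 / 8 : ℝ) := Real.rpow_pos_of_pos hq' _
  by_contra hcon
  push Not at hcon
  nlinarith [mul_lt_mul_of_pos_right hcon h4]

/-- squarefree numbers up to `R` free of primes in `P` -/
def sqf (P : Finset ℕ) (R : ℕ) : Finset ℕ := (Ioc 0 R).filter (fun r => Squarefree r ∧ ∀ p ∈ P, ¬ p ∣ r)

lemma mem_sqf {P : Finset ℕ} {R r : ℕ} : r ∈ sqf P R ↔ (0 < r ∧ r ≤ R) ∧ Squarefree r ∧ ∀ p ∈ P, ¬ p ∣ r := by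
  simp [sqf]

noncomputable def GG (P : Finset ℕ) (R : ℕ) : ℝ := ∑ r ∈ sqf P R, 1 / (r.totient : ℝ)

lemma GG_nonneg (P : Finset ℕ) (R : ℕ) : 0 ≤ GG P R := by unfold GG; positivity

lemma GG_insert (P : Finset ℕ) (R p : ℕ) (hp : p.Prime) :
    GG P R ≤ (1 - (p : ℝ)⁻¹)⁻¹ * GG (insert p P) R := by
  have hp2 : (2 : ℝ) ≤ p := by exact_mod_cast hp.two_le
  unfold GG
  rw [← Finset.sum_filter_add_sum_filter_not (sqf P R) (fun r => p ∣ r)]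
  have h1 : (sqf P R).filter (fun r => ¬ p ∣ r) = sqf (insert p P) R := by
    ext r; simp only [mem_filter, mem_sqf, mem_insert, forall_eq_or_imp]; tauto
  rw [h1]
  have h2 : ∑ r ∈ (sqf P R).filter (fun r => p ∣ r), 1 / (r.totient : ℝ) ≤
      1 / ((p : ℝ) - 1) * ∑ r ∈ sqf (insert p P) R, 1 / (r.totient : ℝ) := by
    rw [Finset.mul_sum]
    have hkey : ∀ r ∈ (sqf P R).filter (fun r => p ∣ r), r / p ∈ sqf (insert p P) R ∧
        1 / (r.totient : ℝ) = 1 / ((p : ℝ) - 1) * (1 / ((r / p).totient : ℝ)) := by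
      intro r hr
      rw [mem_filter, mem_sqf] at hr
      obtain ⟨⟨⟨h0, hR⟩, hs, hP⟩, s, rfl⟩ := hr
      have hs0 : 0 < s := Nat.pos_of_mul_pos_left h0
      rw [Nat.mul_div_cancel_left _ hp.pos]
      have hcop := Nat.coprime_of_squarefree_mul hs
      constructor
      · rw [mem_sqf]
        refine ⟨⟨hs0, le_trans (Nat.le_mul_of_pos_left _ hp.pos) hR⟩, hs.of_mul_right, ?_⟩
        intro p' hp'
        rw [mem_insert] at hp'
        rcases hp' with rfl | hp'
        · exact (Nat.Prime.coprime_iff_not_dvd hp).1 hcop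
        · intro hd; exact hP p' hp' (Dvd.dvd.mul_left hd p)
      · rw [Nat.totient_mul hcop, Nat.totient_prime hp]
        push_cast [hp.one_le]
        rw [one_div_mul_one_div]
    rw [Finset.sum_congr rfl (fun r hr => (hkey r hr).2)]
    have hinj : Set.InjOn (fun r => r / p) ((sqf P R).filter (fun r => p ∣ r) : Set ℕ) := by
      intro r hr r' hr' h
      simp only [coe_filter, Set.mem_ofPred_eq] at hr hr' h
      rw [← Nat.div_mul_cancel hr.2, ← Nat.div_mul_cancel hr'.2, h]
    rw [← Finset.sum_image (f := fun s => 1 / ((p : ℝ) - 1) * (1 / (s.totient : ℝ))) hinj]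
    apply Finset.sum_le_sum_of_subset_of_nonneg
    · intro s hs
      rw [mem_image] at hs
      obtain ⟨r, hr, rfl⟩ := hs
      exact (hkey r hr).1
    · intro s _ _
      have : (0 : ℝ) < p - 1 := by linarith
      positivity
  have h3 : (1 - (p : ℝ)⁻¹)⁻¹ = 1 + 1 / ((p : ℝ) - 1) := by
    have : (p : ℝ) - 1 ≠ 0 := by linarith
    have : (p : ℝ) ≠ 0 := by linarith
    field_simp; ring
  rw [h3]; linarith

lemma GG_le (P : Finset ℕ) (hP : ∀ p ∈ P, p.Prime) (R : ℕ) : GG ∅ R ≤ VV P * GG P R := by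
  classical
  induction P using Finset.induction_on with
  | empty => simp [VV]
  | insert p P hp ih =>
    have h1 := ih (fun p' hp' => hP p' (mem_insert_of_mem hp'))
    have h2 := GG_insert P R p (hP p (mem_insert_self _ _))
    have h3 := VV_pos P (fun p' hp' => hP p' (mem_insert_of_mem hp'))
    unfold VV at *
    rw [Finset.prod_insert hp]
    calc _ ≤ _ := h1
      _ ≤ _ := mul_le_mul_of_nonneg_left h2 h3.le
      _ = _ := by ring

lemma sum_inv_sq_le (M : ℕ) : ∑ m ∈ Ioc 0 M, 1 / ((m : ℝ) ^ 2) ≤ 2 := by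
  have : ∀ M : ℕ, 1 ≤ M → ∑ m ∈ Ioc 0 M, 1 / ((m : ℝ) ^ 2) ≤ 2 - 1 / (M : ℝ) := by
    intro M hM
    induction M, hM using Nat.le_induction with
    | base => simp; norm_num
    | succ n hn ih =>
      rw [← Finset.insert_Ioc_right_eq_Ioc_add_one (Nat.zero_le n), Finset.sum_insert (by simp)]
      have hn' : (0 : ℝ) < n := by exact_mod_cast hn
      have : 1 / (((n + 1 : ℕ) : ℝ) ^ 2) ≤ 1 / (n : ℝ) - 1 / ((n + 1 : ℕ) : ℝ) := by
        push_cast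
        rw [div_sub_div _ _ (by positivity) (by positivity), div_le_div_iff₀ (by positivity) (by positivity)]
        nlinarith
      linarith
  rcases Nat.eq_zero_or_pos M with h | h
  · subst h; simp
  · have := this M h
    have : 0 ≤ 1 / (M : ℝ) := by positivity
    linarith

lemma GG_base (R : ℕ) (hR : 1 ≤ R) : Real.log R / 2 ≤ GG ∅ R := by
  have h1 : Real.log R ≤ ∑ n ∈ Ioc 0 R, 1 / (n : ℝ) := by
    have := log_add_one_le_harmonic R
    have h2 : ((harmonic R : ℚ) : ℝ) = ∑ n ∈ Ioc 0 R, 1 / (n : ℝ) := by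
      rw [harmonic_eq_sum_Icc]; push_cast
      apply Finset.sum_congr
      · ext; simp; omega
      · intros; simp
    have h3 : Real.log R ≤ Real.log ((R + 1 : ℕ) : ℝ) := by
      apply Real.log_le_log (by exact_mod_cast hR); push_cast; linarith
    linarith
  have h2 : ∑ n ∈ Ioc 0 R, 1 / (n : ℝ) ≤ ∑ x ∈ sqf ∅ R ×ˢ Ioc 0 R, 1 / ((x.1 : ℝ) * (x.2 : ℝ) ^ 2) := by
    have hch : ∀ n : ℕ, ∃ x : ℕ × ℕ, 0 < n → (0 < x.1 ∧ 0 < x.2 ∧ x.2 ^ 2 * x.1 = n ∧ Squarefree x.1) := by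
      intro n
      rcases Nat.eq_zero_or_pos n with h | h
      · exact ⟨(0, 0), fun h' => by omega⟩
      · obtain ⟨a, b, h⟩ := Nat.sq_mul_squarefree_of_pos h
        exact ⟨(a, b), fun _ => h⟩
    choose F hF using hch
    have e : ∀ n ∈ Ioc 0 R, 1 / (n : ℝ) = 1 / (((F n).1 : ℝ) * ((F n).2 : ℝ) ^ 2) := by
      intro n hn
      have := (hF n (mem_Ioc.1 hn).1).2.2.1
      congr 1
      rw [mul_comm]; exact_mod_cast this.symm
    rw [Finset.sum_congr rfl e]
    have hinj : Set.InjOn F (Ioc 0 R : Set ℕ) := by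
      intro n hn m hm h
      rw [← (hF n (by simp at hn; exact hn.1)).2.2.1, ← (hF m (by simp at hm; exact hm.1)).2.2.1, h]
    rw [← Finset.sum_image (f := fun x : ℕ × ℕ => 1 / ((x.1 : ℝ) * (x.2 : ℝ) ^ 2)) (s := Ioc 0 R) (g := F)
      (by simpa using hinj)]
    apply Finset.sum_le_sum_of_subset_of_nonneg
    · intro x hx
      rw [mem_image] at hx
      obtain ⟨n, hn, rfl⟩ := hx
      rw [mem_Ioc] at hn
      obtain ⟨h1, h2, h3, h4⟩ := hF n hn.1
      rw [mem_product, mem_sqf, mem_Ioc]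
      refine ⟨⟨⟨h1, ?_⟩, h4, by simp⟩, h2, ?_⟩
      · refine le_trans ?_ hn.2
        calc (F n).1 ≤ (F n).2 ^ 2 * (F n).1 := Nat.le_mul_of_pos_left _ (by positivity)
          _ = n := h3
      · refine le_trans ?_ hn.2
        calc (F n).2 ≤ (F n).2 ^ 2 := Nat.le_self_pow (by norm_num) _
          _ ≤ (F n).2 ^ 2 * (F n).1 := Nat.le_mul_of_pos_right _ h1
          _ = n := h3
    · intro x _ _; positivity
  have h3 : ∑ x ∈ sqf ∅ R ×ˢ Ioc 0 R, 1 / ((x.1 : ℝ) * (x.2 : ℝ) ^ 2) =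
      (∑ r ∈ sqf ∅ R, 1 / (r : ℝ)) * ∑ m ∈ Ioc 0 R, 1 / ((m : ℝ) ^ 2) := by
    rw [Finset.sum_mul_sum, Finset.sum_product]
    simp only [one_div_mul_one_div]
  have h4 : ∑ r ∈ sqf ∅ R, 1 / (r : ℝ) ≤ GG ∅ R := by
    unfold GG
    apply Finset.sum_le_sum
    intro r hr
    have hr0 := (mem_sqf.1 hr).1.1
    apply one_div_le_one_div_of_le
    · exact_mod_cast Nat.totient_pos.2 hr0
    · exact_mod_cast Nat.totient_le r
  have h5 : 0 ≤ ∑ r ∈ sqf ∅ R, 1 / (r : ℝ) := by positivity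
  have h6 := sum_inv_sq_le R
  rw [h3] at h2
  nlinarith

lemma GG_lower (P : Finset ℕ) (hP : ∀ p ∈ P, p.Prime) (R : ℕ) (hR : 1 ≤ R) :
    Real.log R / 2 ≤ VV P * GG P R := (GG_base R hR).trans (GG_le P hP R)

end FP


namespace FP
open Finset

/-- primes in `(A,B]` congruent to `c` mod `q` -/
def prap (A B q c : ℕ) : Finset ℕ := (Ioc A B).filter (fun p => p.Prime ∧ p ≡ c [MOD q])

lemma ee_congr {n c q : ℕ} (hq : 0 < q) (h : n ≡ c [MOD q]) (k : ℤ) :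
    ee (n * ((k : ℝ) / q)) = ee (c * ((k : ℝ) / q)) := by
  have hq' : (q : ℝ) ≠ 0 := by positivity
  obtain ⟨m, hm⟩ := (Nat.modEq_iff_dvd.1 h.symm)
  have : (n : ℝ) = c + q * m := by
    have : (n : ℤ) = c + q * m := by linarith
    exact_mod_cast this
  rw [this, ← ee_add_int (c * ((k : ℝ) / q)) (m * k)]
  congr 1; push_cast; field_simp

lemma bt_card (q R A B c : ℕ) (hq : 0 < q) (hAB : A < B) (hR2 : 2 ≤ R) (hw : q ^ 2 * R ^ 2 ≤ B - A)
    (s : Finset ℕ) (hs : s ⊆ prap A B q c) (hsR : ∀ p ∈ s, R < p) :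
    (s.card : ℝ) * Real.log R ≤ 128 * ((B : ℝ) - A) / q.totient := by
  set w : ℝ := (B : ℝ) - A with hwdef
  have hwR : ((q : ℝ) ^ 2 * R ^ 2) ≤ w := by
    have : ((q ^ 2 * R ^ 2 : ℕ) : ℝ) ≤ ((B - A : ℕ) : ℝ) := by exact_mod_cast hw
    rw [Nat.cast_sub hAB.le] at this; push_cast at this; exact this
  have hqR : (1 : ℝ) ≤ q := by exact_mod_cast hq
  have hRR : (2 : ℝ) ≤ R := by exact_mod_cast hR2
  have hw1 : (q : ℝ) ≤ w := by
    have h1 : (q : ℝ) ≤ (q : ℝ) ^ 2 := by nlinarith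
    have h2 : (1 : ℝ) ≤ (R : ℝ) ^ 2 := by nlinarith
    exact (h1.trans (le_mul_of_one_le_right (by positivity) h2)).trans hwR
  have hw0 : 0 < w := by linarith
  set η : ℝ := 1 / (16 * w) with hη
  have hη0 : 0 < η := by positivity
  set P := q.primeFactors
  have hPp : ∀ p ∈ P, p.Prime := fun p hp => Nat.prime_of_mem_primeFactors hp
  have hmem : ∀ p ∈ s, (A < p ∧ p ≤ B) ∧ p.Prime ∧ p ≡ c [MOD q] := by
    intro p hp; have := hs hp; simpa [prap] using this
  have hst := star (fun _ => 1) s (sqf P R) (fun r hr => (mem_sqf.1 hr).2.1)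
    (by
      intro n hn _ r hr
      have hrm := mem_sqf.1 hr
      rw [Nat.coprime_comm]
      refine ((hmem n hn).2.1.coprime_iff_not_dvd).2 fun hd => ?_
      have := Nat.le_of_dvd hrm.1.1 hd
      have := hsR n hn
      omega) {q} η (by simpa using hq)
    (by
      intro q' hq' r hr
      rw [mem_singleton] at hq'
      rw [hq']
      have hrm := mem_sqf.1 hr
      exact Nat.coprime_of_dvd (fun p hp h1 h2 =>
        hrm.2.2 p (Nat.mem_primeFactors.2 ⟨hp, h2, hq.ne'⟩) h1)) q R (by simp) (fun r hr => by exact_mod_cast (mem_sqf.1 hr).1.2)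
    (by
      have : 2 * η * (q : ℝ) ^ 2 * R ^ 2 = ((q : ℝ) ^ 2 * R ^ 2 / w) / 8 := by rw [hη]; field_simp; norm_num
      rw [this]
      have : (q : ℝ) ^ 2 * R ^ 2 / w ≤ 1 := by rw [div_le_one hw0]; exact hwR
      linarith)
  have hcard : ∑ n ∈ s, ‖((fun _ => 1 : ℕ → ℂ)) n‖ ^ 2 = s.card := by simp
  rw [hcard] at hst
  -- pointwise lower bound
  have hpt : ∀ (k : ℤ) (β : ℝ), 0 ≤ β → β ≤ η →
      (s.card : ℝ) ^ 2 / 4 ≤ ‖SS (fun _ => 1) s (k / q + β)‖ ^ 2 := by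
    intro k β h0 h1
    have e1 : SS (fun _ => 1) s (k / q + β) =
        ee (c * ((k : ℝ) / q)) * ee (A * β) * ∑ n ∈ s, ee ((n - A : ℝ) * β) := by
      unfold SS
      rw [Finset.mul_sum]
      apply Finset.sum_congr rfl
      intro n hn
      have hsp : ee (n * β) = ee (A * β) * ee ((n - A : ℝ) * β) := by
        rw [← ee_add]; congr 1; ring
      rw [one_mul, mul_add, ee_add, ee_congr hq (hmem n hn).2.2 k, hsp, mul_assoc]
    have e2 : ‖(s.card : ℂ) - ∑ n ∈ s, ee ((n - A : ℝ) * β)‖ ≤ s.card * (1 / 2) := by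
      have : (s.card : ℂ) - ∑ n ∈ s, ee ((n - A : ℝ) * β) = ∑ n ∈ s, (1 - ee ((n - A : ℝ) * β)) := by
        rw [Finset.sum_sub_distrib]; simp
      rw [this]
      refine (norm_sum_le _ _).trans ?_
      rw [← nsmul_eq_mul]
      apply Finset.sum_le_card_nsmul
      intro n hn
      rw [norm_sub_rev]
      refine (norm_ee_sub_one_le _).trans ?_
      have hn1 : (0 : ℝ) ≤ n - A := by
        have := (hmem n hn).1.1
        have : (A : ℝ) ≤ n := by exact_mod_cast this.le
        linarith
      have hn2 : (n : ℝ) - A ≤ w := by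
        have := (hmem n hn).1.2
        have : (n : ℝ) ≤ B := by exact_mod_cast this
        linarith
      rw [abs_of_nonneg (by positivity)]
      have h3 : (n - A : ℝ) * β ≤ w * η := by gcongr
      have h4 : w * η = 1 / 16 := by rw [hη]; field_simp
      have := Real.pi_lt_four
      have hpi := Real.pi_pos
      nlinarith
    have e3 : (s.card : ℝ) / 2 ≤ ‖SS (fun _ => 1) s (k / q + β)‖ := by
      rw [e1, norm_mul, norm_mul, norm_ee, norm_ee, one_mul, one_mul]
      have := norm_sub_norm_le (s.card : ℂ) ((s.card : ℂ) - ∑ n ∈ s, ee ((n - A : ℝ) * β))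
      rw [sub_sub_cancel, Complex.norm_natCast] at this
      linarith
    calc (s.card : ℝ) ^ 2 / 4 = (s.card / 2 : ℝ) ^ 2 := by ring
      _ ≤ _ := by gcongr
  -- integral lower bound
  set f : ℝ → ℝ := fun α => (arcs {q} η).indicator (fun _ => (1 : ℝ)) α * ‖SS (fun _ => 1) s α‖ ^ 2 with hf
  have hf0 : ∀ α, 0 ≤ f α := by
    intro α; apply mul_nonneg _ (by positivity)
    apply Set.indicator_nonneg; intros; norm_num
  have hfi : ∀ a b : ℝ, IntervalIntegrable f MeasureTheory.volume a b := by
    intro a b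
    have hS := continuous_SS (fun _ => 1) s
    have h1 : IntervalIntegrable (fun α => ‖SS (fun _ => 1) s α‖ ^ 2) MeasureTheory.volume a b := by
      apply Continuous.intervalIntegrable; fun_prop
    refine h1.mono_fun' ?_ ?_
    · apply Measurable.aestronglyMeasurable
      apply Measurable.mul
      · exact measurable_const.indicator (measurableSet_arcs _ η)
      · exact Continuous.measurable (by fun_prop)
    · apply Filter.Eventually.of_forall
      intro x
      show ‖f x‖ ≤ ‖SS (fun _ => 1) s x‖ ^ 2
      rw [Real.norm_of_nonneg (hf0 x)]
      apply mul_le_of_le_one_left (by positivity)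
      apply Set.indicator_le' <;> intros <;> norm_num
  have hηq : η ≤ 1 / q := by
    rw [hη]; apply one_div_le_one_div_of_le <;> linarith
  have hlow : ∀ k : ℕ, η * ((s.card : ℝ) ^ 2 / 4) ≤ ∫ α in ((k : ℝ) / q)..(((k + 1 : ℕ) : ℝ) / q), f α := by
    intro k
    have e : (((k + 1 : ℕ) : ℝ) / q) = k / q + 1 / q := by push_cast; ring
    rw [e, ← intervalIntegral.integral_add_adjacent_intervals (hfi _ (k / q + η)) (hfi _ _)]
    have h1 : 0 ≤ ∫ α in (k / q + η : ℝ)..(k / q + 1 / q : ℝ), f α :=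
      intervalIntegral.integral_nonneg (by linarith) (fun u _ => hf0 u)
    have h2 : ∫ α in ((k : ℝ) / q)..(k / q + η : ℝ), ((s.card : ℝ) ^ 2 / 4) ≤
        ∫ α in ((k : ℝ) / q)..(k / q + η : ℝ), f α := by
      apply intervalIntegral.integral_mono_on (by linarith) (by simp) (hfi _ _)
      intro α hα
      have hin : α ∈ arcs {q} η := by
        refine ⟨q, by simp, k, ?_⟩
        rw [abs_le]; push_cast; constructor <;> linarith [hα.1, hα.2]
      simp only [hf]
      rw [Set.indicator_of_mem hin, one_mul]
      have := hpt k (α - k / q) (by linarith [hα.1]) (by linarith [hα.2])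
      push_cast at this
      rwa [add_sub_cancel] at this
    rw [intervalIntegral.integral_const, smul_eq_mul] at h2
    have : ((k : ℝ) / q + η - k / q) = η := by ring
    rw [this] at h2
    linarith
  have hlow2 : q * (η * ((s.card : ℝ) ^ 2 / 4)) ≤ ∫ α in (0 : ℝ)..1, f α := by
    have h1 := intervalIntegral.sum_integral_adjacent_intervals (f := f) (μ := MeasureTheory.volume)
      (a := fun k : ℕ => (k : ℝ) / q) (n := q) (fun k _ => hfi _ _)
    have h2 : ((q : ℕ) : ℝ) / q = 1 := div_self (by linarith)
    simp only [h2, Nat.cast_zero, zero_div] at h1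
    rw [← h1]
    calc _ = ∑ k ∈ range q, η * ((s.card : ℝ) ^ 2 / 4) := by simp
      _ ≤ _ := Finset.sum_le_sum (fun k _ => hlow k)
  rcases Nat.eq_zero_or_pos s.card with h0 | h0
  · rw [h0]; simp; positivity
  have hZ : (0 : ℝ) < s.card := by exact_mod_cast h0
  have hG : GG P R * (q * (η * ((s.card : ℝ) ^ 2 / 4))) ≤ s.card :=
    (mul_le_mul_of_nonneg_left hlow2 (GG_nonneg P R)).trans hst
  have hG2 := GG_lower P hPp R (by omega)
  have hV := VV_pos P hPp
  have htot := totient_VV (q := q)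
  have hφ : (0 : ℝ) < q.totient := by exact_mod_cast Nat.totient_pos.2 hq
  have hG3 : GG P R * q * s.card ≤ 64 * w := by
    have : GG P R * (q * (η * ((s.card : ℝ) ^ 2 / 4))) = (GG P R * q * s.card) / (64 * w) * s.card := by
      rw [hη]; field_simp; ring
    rw [this] at hG
    have := le_of_mul_le_mul_right (hG.trans_eq (one_mul _).symm) hZ
    rwa [div_le_one (by positivity)] at this
  rw [le_div_iff₀ hφ]
  have h5 : (s.card : ℝ) * Real.log R * q.totient ≤ s.card * (2 * (VV P * GG P R)) * q.totient := by
    gcongr; linarith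
  have h6 : (s.card : ℝ) * (2 * (VV P * GG P R)) * q.totient = 2 * (GG P R * (q.totient * VV P) * s.card) := by ring
  rw [h6, ← htot hq] at h5
  linarith

/-- Brun--Titchmarsh, logarithmically weighted -/
lemma bt (q R A B c : ℕ) (hq : 0 < q) (hAB : A < B) (hw : q ^ 2 * R ^ 2 ≤ B - A) (hB : B ≤ R ^ 8) :
    ∑ p ∈ prap A B q c, Real.log p ≤ 1026 * ((B : ℝ) - A) / q.totient := by
  have hφ : (0 : ℝ) < q.totient := by exact_mod_cast Nat.totient_pos.2 hq
  have hABR : (A : ℝ) < B := by exact_mod_cast hAB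
  by_cases hR : R < 2
  · have hB1 : B ≤ 1 := hB.trans (by interval_cases R <;> norm_num)
    rw [Finset.sum_eq_zero]
    · have : 0 < (B : ℝ) - A := by linarith
      positivity
    · intro p hp
      simp only [prap, mem_filter, mem_Ioc] at hp
      have := hp.2.1.two_le
      omega
  push Not at hR
  rw [← Finset.sum_filter_add_sum_filter_not (prap A B q c) (fun p => R < p)]
  have h1 := bt_card q R A B c hq hAB hR hw ((prap A B q c).filter (fun p => R < p))
    (Finset.filter_subset _ _) (fun p hp => (mem_filter.1 hp).2)
  have h2 : ∑ p ∈ (prap A B q c).filter (fun p => R < p), Real.log p ≤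
      ((prap A B q c).filter (fun p => R < p)).card * (8 * Real.log R) := by
    rw [← nsmul_eq_mul]
    apply Finset.sum_le_card_nsmul
    intro p hp
    simp only [prap, mem_filter, mem_Ioc] at hp
    have : Real.log ((R ^ 8 : ℕ) : ℝ) = 8 * Real.log R := by push_cast; rw [Real.log_pow]; norm_num
    rw [← this]
    apply Real.log_le_log
    · exact_mod_cast hp.1.2.1.pos
    · exact_mod_cast hp.1.1.2.trans hB
  have h3 : ∑ p ∈ (prap A B q c).filter (fun p => ¬ R < p), Real.log p ≤ 2 * R := by
    refine le_trans ?_ (theta_pr_le R)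
    apply Finset.sum_le_sum_of_subset_of_nonneg
    · intro p hp
      simp only [prap, mem_filter, mem_Ioc] at hp
      rw [mem_pr]; exact ⟨by omega, hp.1.2.1⟩
    · intro p _ _; exact Real.log_natCast_nonneg p
  have h4 : (2 : ℝ) * R ≤ 2 * ((B : ℝ) - A) / q.totient := by
    rw [le_div_iff₀ hφ]
    have hwR : ((q : ℝ) ^ 2 * R ^ 2) ≤ (B : ℝ) - A := by
      have : ((q ^ 2 * R ^ 2 : ℕ) : ℝ) ≤ ((B - A : ℕ) : ℝ) := by exact_mod_cast hw
      rw [Nat.cast_sub hAB.le] at this; push_cast at this; exact this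
    have ht : (q.totient : ℝ) ≤ q := by exact_mod_cast Nat.totient_le q
    have hq1 : (1 : ℝ) ≤ q := by exact_mod_cast hq
    have hR1 : (2 : ℝ) ≤ R := by exact_mod_cast hR
    have : (R : ℝ) * q.totient ≤ R * q := by gcongr
    have : (R : ℝ) * q ≤ (R * q) ^ 2 := by
      have : (1 : ℝ) ≤ R * q := by nlinarith
      nlinarith
    nlinarith
  have h5 : 1026 * ((B : ℝ) - A) / q.totient = 8 * (128 * ((B : ℝ) - A) / q.totient) + 2 * ((B : ℝ) - A) / q.totient := by
    ring
  rw [h5]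
  nlinarith
end FP


namespace FP
open Finset MeasureTheory Filter Topology

/-- one-sided Fejer kernel -/
noncomputable def kk (l w : ℝ) : ℝ := ∫ t in (0 : ℝ)..l, (1 - t / l) * Real.cos (t * w)

lemma kk_eq {l w : ℝ} (hl : 0 < l) (hw : w ≠ 0) : kk l w = (1 - Real.cos (l * w)) / (l * w ^ 2) := by
  unfold kk
  have h : ∀ t ∈ Set.uIcc 0 l, HasDerivAt (fun t => (1 - t / l) * (Real.sin (t * w) / w) - Real.cos (t * w) / (l * w ^ 2))
      ((1 - t / l) * Real.cos (t * w)) t := by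
    intro t _
    have h1 : HasDerivAt (fun t : ℝ => t * w) w t := by simpa using (hasDerivAt_id t).mul_const w
    have h2 : HasDerivAt (fun t : ℝ => 1 - t / l) (-(1 / l)) t := by
      simpa using ((hasDerivAt_id t).div_const l).const_sub 1
    have h3 := (h2.mul (h1.sin.div_const w)).sub (h1.cos.div_const (l * w ^ 2))
    refine h3.congr_deriv ?_
    have := hl.ne'
    field_simp
    ring
  rw [intervalIntegral.integral_eq_sub_of_hasDerivAt h (by apply Continuous.intervalIntegrable; fun_prop)]
  have : (1 : ℝ) - l / l = 0 := by rw [div_self hl.ne']; ring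
  rw [this]; simp; ring

lemma kk_nonneg {l : ℝ} (hl : 0 < l) (w : ℝ) : 0 ≤ kk l w := by
  by_cases hw : w = 0
  · subst hw
    unfold kk
    apply intervalIntegral.integral_nonneg hl.le
    intro t ht
    simp only [mul_zero, Real.cos_zero, mul_one]
    rw [sub_nonneg, div_le_one hl]; exact ht.2
  · rw [kk_eq hl hw]
    have := Real.cos_le_one (l * w)
    apply div_nonneg (by linarith) (by positivity)

lemma kk_le_tail {l w : ℝ} (hl : 0 < l) (hw : w ≠ 0) : kk l w ≤ 2 / (l * w ^ 2) := by
  rw [kk_eq hl hw]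
  have := Real.neg_one_le_cos (l * w)
  gcongr
  linarith

lemma kk_le {l : ℝ} (hl : 0 < l) (w : ℝ) : kk l w ≤ l := by
  have h := intervalIntegral.integral_mono_on (f := fun t => (1 - t / l) * Real.cos (t * w)) (g := fun _ => (1 : ℝ))
    (μ := volume) hl.le (by apply Continuous.intervalIntegrable; fun_prop) (by simp) (by
      intro t ht
      have h1 : 0 ≤ 1 - t / l := by rw [sub_nonneg, div_le_one hl]; exact ht.2
      have h2 : 0 ≤ t / l := div_nonneg ht.1 hl.le
      have := Real.cos_le_one (t * w)
      nlinarith)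
  simpa [kk] using h

lemma kk_lower {l w : ℝ} (hl : 0 < l) (hw : |w| ≤ 1 / l) : l / 4 ≤ kk l w := by
  have h := intervalIntegral.integral_mono_on (g := fun t => (1 - t / l) * Real.cos (t * w)) (f := fun t : ℝ => (1 - t / l) * (1 / 2))
    (μ := volume) hl.le (by apply Continuous.intervalIntegrable; fun_prop)
     (by apply Continuous.intervalIntegrable; fun_prop) (by
      intro t ht
      have h1 : 0 ≤ 1 - t / l := by rw [sub_nonneg, div_le_one hl]; exact ht.2
      have h3 : |t * w| ≤ 1 := by
        rw [abs_mul, abs_of_nonneg ht.1]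
        calc t * |w| ≤ l * (1 / l) := by gcongr; exact ht.2
          _ = 1 := by field_simp
      have := Real.one_sub_sq_div_two_le_cos (x := t * w)
      have h4 : (t * w) ^ 2 ≤ 1 := by rw [← sq_abs]; nlinarith [abs_nonneg (t * w)]
      gcongr
      linarith)
  have e : ∫ t in (0 : ℝ)..l, (1 - t / l) * (1 / 2) = l / 4 := by
    rw [intervalIntegral.integral_mul_const, intervalIntegral.integral_sub (by simp) (by apply Continuous.intervalIntegrable; fun_prop),
      intervalIntegral.integral_div, integral_id]
    simp; field_simp; norm_num
  rw [e] at h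
  exact h

lemma kk_neg (l w : ℝ) : kk l (-w) = kk l w := by simp [kk]

lemma continuous_kk (l : ℝ) : Continuous (kk l) := by
  unfold kk
  exact intervalIntegral.continuous_parametric_intervalIntegral_of_continuous' (by fun_prop) 0 l

lemma integrable_inv_sq (X : ℝ) : Integrable (fun u : ℝ => (1 + (X - u) ^ 2)⁻¹) :=
  integrable_inv_one_add_sq.comp_sub_left X

lemma kk_le_inv {l : ℝ} (hl : 0 < l) (w : ℝ) : kk l w ≤ (l + 2 / l) * (1 + w ^ 2)⁻¹ := by
  rw [← div_eq_mul_inv, le_div_iff₀ (by positivity)]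
  by_cases hw : w = 0
  · subst hw; have := kk_le hl 0; have : 0 < 2 / l := by positivity
    simp; linarith
  · have h1 := kk_le_tail hl hw
    have h2 := kk_le hl w
    have : 2 / (l * w ^ 2) * w ^ 2 = 2 / l := by field_simp
    have h3 : kk l w * w ^ 2 ≤ 2 / (l * w ^ 2) * w ^ 2 := by gcongr
    linarith

lemma integrable_kk {l : ℝ} (hl : 0 < l) (X : ℝ) : Integrable (fun u => kk l (X - u)) := by
  refine ((integrable_inv_sq X).const_mul (l + 2 / l)).mono' ?_ ?_
  · exact ((continuous_kk l).comp (by fun_prop : Continuous fun u : ℝ => X - u)).aestronglyMeasurable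
  · exact Eventually.of_forall fun u => by
      rw [Real.norm_of_nonneg (kk_nonneg hl _)]; exact kk_le_inv hl _

lemma wi_core (r : ℝ → ℝ) (hr : Measurable r) (M : ℝ) (hM : ∀ u, |r u| ≤ M) (H : ℂ → ℂ)
    (hc : ContinuousOn H {s | 1 ≤ s.re})
    (hH : ∀ σ t : ℝ, 1 < σ → H (σ + t * Complex.I) =
      ∫ u in Set.Ioi (0 : ℝ), (r u : ℂ) * Complex.exp (-((σ - 1 : ℝ) + t * Complex.I) * u))
    (l : ℝ) (hl : 0 < l) :
    Tendsto (fun X => ∫ u in Set.Ioi (0 : ℝ), r u * kk l (X - u)) atTop (𝓝 0) := by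
  have hM0 : 0 ≤ M := (abs_nonneg _).trans (hM 0)
  -- integrability
  have hexp : ∀ σ : ℝ, 1 < σ → IntegrableOn (fun u : ℝ => Real.exp (-(σ - 1) * u)) (Set.Ioi 0) := by
    intro σ hσ
    have := exp_neg_integrableOn_Ioi 0 (b := σ - 1) (by linarith)
    simpa using this
  -- step 1
  have h1 : ∀ σ X : ℝ, 1 < σ → ∫ t in (0 : ℝ)..l, (1 - t / l) * (Complex.exp (t * X * Complex.I) * H (σ + t * Complex.I)).re
      = ∫ u in Set.Ioi (0 : ℝ), r u * Real.exp (-(σ - 1) * u) * kk l (X - u) := by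
    intro σ X hσ
    have e1 : ∀ t : ℝ, (Complex.exp (t * X * Complex.I) * H (σ + t * Complex.I)).re =
        ∫ u in Set.Ioi (0 : ℝ), r u * Real.exp (-(σ - 1) * u) * Real.cos (t * (X - u)) := by
      intro t
      rw [hH σ t hσ, ← integral_const_mul]
      have hintgr : Integrable (fun u : ℝ => Complex.exp (t * X * Complex.I) * ((r u : ℂ) * Complex.exp (-((σ - 1 : ℝ) + t * Complex.I) * u)))
          (volume.restrict (Set.Ioi 0)) := by
        refine ((hexp σ hσ).const_mul M).mono' ?_ ?_
        · apply Measurable.aestronglyMeasurable; fun_prop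
        · refine Eventually.of_forall fun u => ?_
          rw [norm_mul, norm_mul, Complex.norm_exp, Complex.norm_exp, Complex.norm_real]
          have a1 : (t * X * Complex.I : ℂ).re = 0 := by simp
          have a2 : (-((σ - 1 : ℝ) + t * Complex.I : ℂ) * u).re = -(σ - 1) * u := by simp
          rw [a1, a2, Real.exp_zero, one_mul, Real.norm_eq_abs]
          gcongr; exact hM u
      have := Complex.reCLM.integral_comp_comm hintgr
      simp only [Complex.reCLM_apply] at this
      rw [← this]
      congr 1
      funext u
      have : Complex.exp (t * X * Complex.I) * ((r u : ℂ) * Complex.exp (-((σ - 1 : ℝ) + t * Complex.I) * u))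
          = ((r u * Real.exp (-(σ - 1) * u) : ℝ) : ℂ) * Complex.exp ((t * (X - u) : ℝ) * Complex.I) := by
        push_cast
        rw [mul_left_comm, ← Complex.exp_add, mul_assoc (r u : ℂ), ← Complex.exp_add]
        congr 2; ring
      rw [this, Complex.re_ofReal_mul, Complex.exp_ofReal_mul_I_re]
    simp_rw [e1]
    have e2 : ∀ t : ℝ, (1 - t / l) * ∫ u in Set.Ioi (0 : ℝ), r u * Real.exp (-(σ - 1) * u) * Real.cos (t * (X - u))
       = ∫ u in Set.Ioi (0 : ℝ), (r u * Real.exp (-(σ - 1) * u)) * ((1 - t / l) * Real.cos (t * (X - u))) := by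
      intro t; rw [← integral_const_mul]; congr 1; funext u; ring
    simp_rw [e2]
    rw [intervalIntegral.integral_of_le hl.le, integral_integral_swap]
    · congr 1; funext u
      rw [integral_const_mul, ← intervalIntegral.integral_of_le hl.le]
      rfl
    · have hp : Integrable (fun z : ℝ × ℝ => (1 : ℝ) * (M * Real.exp (-(σ - 1) * z.2)))
          ((volume.restrict (Set.Ioc 0 l)).prod (volume.restrict (Set.Ioi 0))) :=
        Integrable.mul_prod (f := fun _ : ℝ => (1 : ℝ)) (g := fun u : ℝ => M * Real.exp (-(σ - 1) * u)) (by simp) ((hexp σ hσ).const_mul M)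
      refine hp.mono' ?_ ?_
      · apply Measurable.aestronglyMeasurable; unfold Function.uncurry; fun_prop
      · rw [Measure.prod_restrict]
        refine (ae_restrict_iff' (measurableSet_Ioc.prod measurableSet_Ioi)).2 (Eventually.of_forall ?_)
        rintro ⟨t, u⟩ ⟨ht, _⟩
        simp only [Function.uncurry, norm_mul, Real.norm_eq_abs, Real.abs_exp]
        have a1 : |1 - t / l| ≤ 1 := by
          have : t / l ≤ 1 := by rw [div_le_one hl]; exact ht.2
          have : 0 ≤ t / l := div_nonneg ht.1.le hl.le
          rw [abs_le]; constructor <;> linarith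
        have a2 := Real.abs_cos_le_one (t * (X - u))
        have a3 : |1 - t / l| * |Real.cos (t * (X - u))| ≤ 1 := mul_le_one₀ a1 (abs_nonneg _) a2
        calc |r u| * Real.exp (-(σ - 1) * u) * (|1 - t / l| * |Real.cos (t * (X - u))|)
            ≤ M * Real.exp (-(σ - 1) * u) * 1 := by gcongr; exact hM u
          _ = _ := by ring
  -- step 2 : limit σ → 1
  have h2 : ∀ X : ℝ, ∫ t in (0 : ℝ)..l, (1 - t / l) * (Complex.exp (t * X * Complex.I) * H (1 + t * Complex.I)).re
      = ∫ u in Set.Ioi (0 : ℝ), r u * kk l (X - u) := by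
    intro X
    have hR : Tendsto (fun σ : ℝ => ∫ u in Set.Ioi (0 : ℝ), r u * Real.exp (-(σ - 1) * u) * kk l (X - u)) (𝓝[>] 1)
        (𝓝 (∫ u in Set.Ioi (0 : ℝ), r u * kk l (X - u))) := by
      apply tendsto_integral_filter_of_dominated_convergence (fun u => M * kk l (X - u))
      · refine Eventually.of_forall fun σ => ?_
        have := (continuous_kk l).measurable
        apply Measurable.aestronglyMeasurable; fun_prop
      · filter_upwards [self_mem_nhdsWithin] with σ hσ
        refine (ae_restrict_iff' measurableSet_Ioi).2 (Eventually.of_forall fun u hu => ?_)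
        rw [norm_mul, norm_mul, Real.norm_eq_abs, Real.norm_eq_abs, Real.norm_of_nonneg (kk_nonneg hl _), Real.abs_exp]
        have : Real.exp (-(σ - 1) * u) ≤ 1 := by
          rw [Real.exp_le_one_iff]
          have h1 : 0 < σ - 1 := by simpa using hσ
          have h2 : (0 : ℝ) < u := hu
          nlinarith
        calc |r u| * Real.exp (-(σ - 1) * u) * kk l (X - u) ≤ M * 1 * kk l (X - u) := by
              gcongr
              · exact kk_nonneg hl _
              · exact hM u
          _ = _ := by ring
      · exact ((integrable_kk hl X).const_mul M).integrableOn
      · refine Eventually.of_forall fun u => ?_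
        have : Continuous fun σ : ℝ => r u * Real.exp (-(σ - 1) * u) * kk l (X - u) := by fun_prop
        have h := this.tendsto 1
        simp only [sub_self, neg_zero, zero_mul, Real.exp_zero, mul_one] at h
        exact h.mono_left nhdsWithin_le_nhds
    have hcomp : IsCompact ((Set.Icc (1 : ℝ) 2) ×ˢ (Set.Icc (0 : ℝ) l)) := isCompact_Icc.prod isCompact_Icc
    have hcont : ContinuousOn (fun z : ℝ × ℝ => H (z.1 + z.2 * Complex.I)) ((Set.Icc (1 : ℝ) 2) ×ˢ (Set.Icc (0 : ℝ) l)) := by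
      apply hc.comp (by fun_prop)
      rintro ⟨a, b⟩ ⟨ha, _⟩
      simpa using ha.1
    obtain ⟨C, hC⟩ := hcomp.exists_bound_of_continuousOn hcont
    have hL : Tendsto (fun σ : ℝ => ∫ t in (0 : ℝ)..l, (1 - t / l) * (Complex.exp (t * X * Complex.I) * H (σ + t * Complex.I)).re) (𝓝[>] 1)
        (𝓝 (∫ t in (0 : ℝ)..l, (1 - t / l) * (Complex.exp (t * X * Complex.I) * H (1 + t * Complex.I)).re)) := by
      have hnear : ∀ᶠ σ : ℝ in 𝓝[>] 1, σ ∈ Set.Ioc (1 : ℝ) 2 := Ioc_mem_nhdsGT (by norm_num)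
      apply intervalIntegral.tendsto_integral_filter_of_dominated_convergence (fun _ => C)
      · filter_upwards [hnear] with σ hσ
        apply ContinuousOn.aestronglyMeasurable _ measurableSet_uIoc
        rw [Set.uIoc_of_le hl.le]
        have : ContinuousOn (fun t : ℝ => H (σ + t * Complex.I)) (Set.Ioc 0 l) := by
          apply hc.comp (by fun_prop)
          intro t _; simpa using hσ.1.le
        apply ContinuousOn.mul (by fun_prop)
        apply Complex.continuous_re.comp_continuousOn
        exact ContinuousOn.mul (by fun_prop) this
      · filter_upwards [hnear] with σ hσ
        refine Eventually.of_forall fun t ht => ?_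
        rw [Set.uIoc_of_le hl.le] at ht
        rw [norm_mul, Real.norm_eq_abs, Real.norm_eq_abs]
        have a1 : |1 - t / l| ≤ 1 := by
          have : t / l ≤ 1 := by rw [div_le_one hl]; exact ht.2
          have : 0 ≤ t / l := div_nonneg ht.1.le hl.le
          rw [abs_le]; constructor <;> linarith
        have a2 : |(Complex.exp (t * X * Complex.I) * H (σ + t * Complex.I)).re| ≤ C := by
          refine (Complex.abs_re_le_norm _).trans ?_
          rw [norm_mul, Complex.norm_exp]
          have : (t * X * Complex.I : ℂ).re = 0 := by simp
          rw [this, Real.exp_zero, one_mul]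
          exact hC (σ, t) ⟨⟨hσ.1.le, hσ.2⟩, ⟨ht.1.le, ht.2⟩⟩
        calc _ ≤ 1 * C := by gcongr
          _ = C := one_mul _
      · simp
      · refine Eventually.of_forall fun t ht => ?_
        rw [Set.uIoc_of_le hl.le] at ht
        have hcw : ContinuousWithinAt (fun σ : ℝ => H (σ + t * Complex.I)) (Set.Ici 1) 1 := by
          apply ContinuousOn.continuousWithinAt (s := Set.Ici 1) _ (by simp)
          apply hc.comp (by fun_prop)
          intro σ hσ; simpa using hσ
        have h := (hcw.mono Set.Ioi_subset_Ici_self).tendsto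
        simp only [Complex.ofReal_one] at h
        exact ((Complex.continuous_re.tendsto _).comp (h.const_mul _)).const_mul _
    refine tendsto_nhds_unique hL (hR.congr' ?_)
    filter_upwards [self_mem_nhdsWithin] with σ hσ
    exact (h1 σ X hσ).symm
  -- step 3 : Riemann-Lebesgue
  simp_rw [← h2]
  set g : ℝ → ℂ := (Set.Ioc 0 l).indicator (fun t => ((1 - t / l : ℝ) : ℂ) * H (1 + t * Complex.I)) with hg
  have hRL := Real.tendsto_integral_exp_smul_cocompact g
  have hto : Tendsto (fun X : ℝ => -X / (2 * Real.pi)) atTop (cocompact ℝ) := by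
    rw [cocompact_eq_atBot_atTop]
    refine Tendsto.mono_right ?_ le_sup_left
    exact (tendsto_neg_atTop_atBot).atBot_div_const (by positivity)
  have h3 := (Complex.continuous_re.tendsto _).comp (hRL.comp hto)
  simp only [Complex.zero_re] at h3
  refine h3.congr fun X => ?_
  simp only [Function.comp]
  have hgi : IntegrableOn (fun t : ℝ => Complex.exp (t * X * Complex.I) * (((1 - t / l : ℝ) : ℂ) * H (1 + t * Complex.I))) (Set.Ioc 0 l) := by
    apply IntegrableOn.mono_set _ (Set.Ioc_subset_Icc_self)
    apply ContinuousOn.integrableOn_Icc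
    have : ContinuousOn (fun t : ℝ => H (1 + t * Complex.I)) (Set.Icc 0 l) := by
      apply hc.comp (by fun_prop)
      intro t _; simp
    apply ContinuousOn.mul (by fun_prop)
    exact ContinuousOn.mul (by fun_prop) this
  have e1 : ∫ v : ℝ, Real.fourierChar (-(v * (-X / (2 * Real.pi)))) • g v =
      ∫ t in Set.Ioc (0 : ℝ) l, Complex.exp (t * X * Complex.I) * (((1 - t / l : ℝ) : ℂ) * H (1 + t * Complex.I)) := by
    rw [← integral_indicator measurableSet_Ioc]
    congr 1; funext v
    rw [hg]
    by_cases hv : v ∈ Set.Ioc 0 l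
    · rw [Set.indicator_of_mem hv, Set.indicator_of_mem hv, Circle.smul_def, Real.fourierChar_apply, smul_eq_mul]
      congr 2
      have := Real.pi_ne_zero
      have : (2 * Real.pi * -(v * (-X / (2 * Real.pi)))) = v * X := by field_simp
      rw [this]; push_cast; ring
    · rw [Set.indicator_of_notMem hv, Set.indicator_of_notMem hv, smul_zero]
  rw [e1, intervalIntegral.integral_of_le hl.le]
  have := Complex.reCLM.integral_comp_comm hgi
  simp only [Complex.reCLM_apply] at this
  rw [← this]
  congr 1; funext t
  rw [mul_left_comm, Complex.re_ofReal_mul]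
end FP


namespace FP
open Finset MeasureTheory Filter Topology

lemma taub_aux (r : ℝ → ℝ) (hr : Measurable r) (M : ℝ) (hM : ∀ u, |r u| ≤ M) (l : ℝ) (hl : 0 < l)
    (δ : ℝ) (hδ : 0 < δ) (hlδ : 1 / l ≤ δ) (Y : ℝ) (hY : δ ≤ Y) (c : ℝ) (hc0 : 0 ≤ c)
    (hc : ∀ u, Y - δ ≤ u → u ≤ Y + δ → c ≤ r u) :
    c / 2 ≤ (∫ u in Set.Ioi (0 : ℝ), r u * kk l (Y - u)) + M * (2 / l * (1 + 1 / δ ^ 2) * Real.pi) := by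
  have hM0 : 0 ≤ M := (abs_nonneg _).trans (hM 0)
  have hki := integrable_kk hl Y
  have hfi : Integrable (fun u => r u * kk l (Y - u)) := by
    refine (hki.const_mul M).mono' ?_ ?_
    · have := (continuous_kk l).measurable
      apply Measurable.aestronglyMeasurable; fun_prop
    · refine Eventually.of_forall fun u => ?_
      rw [norm_mul, Real.norm_eq_abs, Real.norm_of_nonneg (kk_nonneg hl _)]
      exact mul_le_mul_of_nonneg_right (hM u) (kk_nonneg hl _)
  set S := Set.Ioc (Y - δ) (Y + δ)
  have hS : S ⊆ Set.Ioi 0 := fun u hu => by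
    have := hu.1; simp only [Set.mem_Ioi]; linarith
  rw [← integral_inter_add_sdiff (measurableSet_Ioc : MeasurableSet S) hfi.integrableOn, Set.inter_eq_right.2 hS]
  have h1 : c * (1 / 2) ≤ ∫ u in S, r u * kk l (Y - u) := by
    have h2 : ∫ u in S, c * kk l (Y - u) ≤ ∫ u in S, r u * kk l (Y - u) := by
      apply setIntegral_mono_on (hki.const_mul c).integrableOn hfi.integrableOn measurableSet_Ioc
      intro u hu
      exact mul_le_mul_of_nonneg_right (hc u hu.1.le hu.2) (kk_nonneg hl _)
    have h3 : (1 : ℝ) / 2 ≤ ∫ u in S, kk l (Y - u) := by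
      have h4 : ∫ u in Set.Ioc (Y - 1 / l) (Y + 1 / l), kk l (Y - u) ≤ ∫ u in S, kk l (Y - u) := by
        apply setIntegral_mono_set hki.integrableOn (Eventually.of_forall fun u => kk_nonneg hl _)
        apply LE.le.eventuallyLE
        apply Set.Ioc_subset_Ioc <;> linarith
      have h5 : ∫ u in Set.Ioc (Y - 1 / l) (Y + 1 / l), (l / 4) ≤ ∫ u in Set.Ioc (Y - 1 / l) (Y + 1 / l), kk l (Y - u) := by
        apply setIntegral_mono_on (by simp) hki.integrableOn measurableSet_Ioc
        intro u hu
        apply kk_lower hl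
        rw [abs_le]; constructor <;> linarith [hu.1, hu.2]
      have h6 : ∫ u in Set.Ioc (Y - 1 / l) (Y + 1 / l), (l / 4) = 1 / 2 := by
        have : 0 < 1 / l := by positivity
        rw [← intervalIntegral.integral_of_le (by linarith), intervalIntegral.integral_const, smul_eq_mul]
        field_simp; norm_num
      linarith
    rw [integral_const_mul] at h2
    exact (mul_le_mul_of_nonneg_left h3 hc0).trans h2
  have h2 : -(M * (2 / l * (1 + 1 / δ ^ 2) * Real.pi)) ≤ ∫ u in Set.Ioi 0 \ S, r u * kk l (Y - u) := by
    have hi2 : Integrable (fun u : ℝ => M * (2 / l * (1 + 1 / δ ^ 2) * (1 + (Y - u) ^ 2)⁻¹)) :=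
      ((integrable_inv_sq Y).const_mul _).const_mul M
    have h3 : ∫ u in Set.Ioi 0 \ S, -(M * (2 / l * (1 + 1 / δ ^ 2) * (1 + (Y - u) ^ 2)⁻¹)) ≤
        ∫ u in Set.Ioi 0 \ S, r u * kk l (Y - u) := by
      apply setIntegral_mono_on hi2.neg.integrableOn hfi.integrableOn (measurableSet_Ioi.diff measurableSet_Ioc)
      intro u hu
      have hd : δ ≤ |Y - u| := by
        by_contra hcon
        push Not at hcon
        rw [abs_lt] at hcon
        exact hu.2 ⟨by linarith, by linarith⟩
      have hne : Y - u ≠ 0 := by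
        intro h0; rw [h0, abs_zero] at hd; linarith
      have hd2 : δ ^ 2 ≤ (Y - u) ^ 2 := by rw [← sq_abs (Y - u)]; gcongr
      have h4 : kk l (Y - u) ≤ 2 / l * (1 + 1 / δ ^ 2) * (1 + (Y - u) ^ 2)⁻¹ := by
        refine (kk_le_tail hl hne).trans ?_
        have hsq : 0 < (Y - u) ^ 2 := by positivity
        rw [← div_eq_mul_inv, div_le_div_iff₀ (by positivity) (by positivity)]
        have h7 : 1 ≤ (Y - u) ^ 2 / δ ^ 2 := by rw [le_div_iff₀ (by positivity)]; linarith
        have : 2 / l * (1 + 1 / δ ^ 2) * (l * (Y - u) ^ 2) = 2 * ((Y - u) ^ 2 + (Y - u) ^ 2 / δ ^ 2) := by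
          field_simp
        rw [this]; linarith
      have h5 := (abs_le.1 (hM u)).1
      have h6 := kk_nonneg hl (Y - u)
      have : M * kk l (Y - u) ≤ M * (2 / l * (1 + 1 / δ ^ 2) * (1 + (Y - u) ^ 2)⁻¹) := by gcongr
      show -(M * (2 / l * (1 + 1 / δ ^ 2) * (1 + (Y - u) ^ 2)⁻¹)) ≤ r u * kk l (Y - u)
      nlinarith
    refine le_trans ?_ h3
    rw [integral_neg, neg_le_neg_iff]
    refine (setIntegral_le_integral hi2 (Eventually.of_forall fun u => by positivity)).trans ?_
    rw [integral_const_mul, integral_const_mul, integral_sub_left_eq_self (fun u : ℝ => (1 + u ^ 2)⁻¹), integral_univ_inv_one_add_sq]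
  linarith

lemma wi_taub (B : ℝ → ℝ) (hB : Measurable B) (A M : ℝ) (hA : 0 ≤ A) (hB0 : ∀ u, 0 ≤ B u)
    (hM : ∀ u, |B u - A| ≤ M) (hmono : ∀ u v, u ≤ v → B u ≤ B v * Real.exp (v - u))
    (hT : ∀ l, 0 < l → Tendsto (fun X => ∫ u in Set.Ioi (0 : ℝ), (B u - A) * kk l (X - u)) atTop (𝓝 0)) :
    Tendsto B atTop (𝓝 A) := by
  have hM0 : 0 ≤ M := (abs_nonneg _).trans (hM 0)
  rw [Metric.tendsto_atTop]
  intro ε hε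
  obtain ⟨δ, hδ, hδ2⟩ : ∃ δ : ℝ, 0 < δ ∧ (A + ε) * Real.exp (2 * δ) ≤ A + ε + ε / 4 := by
    have hcont : Continuous fun δ : ℝ => (A + ε) * Real.exp (2 * δ) := by fun_prop
    have h := hcont.tendsto 0
    simp only [mul_zero, Real.exp_zero, mul_one] at h
    have h2 := (h.mono_left (nhdsWithin_le_nhds (s := Set.Ioi 0))).eventually (gt_mem_nhds (show A + ε < A + ε + ε / 4 by linarith))
    obtain ⟨δ, h3, h4⟩ := (h2.and self_mem_nhdsWithin).exists
    exact ⟨δ, h4, h3.le⟩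
  have hE1 : 1 ≤ Real.exp (2 * δ) := Real.one_le_exp (by linarith)
  set K := M * ((1 + 1 / δ ^ 2) * Real.pi) with hK
  have hK0 : 0 ≤ K := by positivity
  set l := max (1 / δ) ((32 * K + 1) / ε) with hl
  have hl0 : 0 < l := lt_max_of_lt_left (by positivity)
  have hlδ : 1 / l ≤ δ := by
    rw [div_le_iff₀ hl0]
    have : 1 / δ ≤ l := le_max_left _ _
    rw [div_le_iff₀ hδ] at this; linarith
  have hlK : M * (2 / l * (1 + 1 / δ ^ 2) * Real.pi) ≤ ε / 16 := by
    have h1 : M * (2 / l * (1 + 1 / δ ^ 2) * Real.pi) = 2 * K / l := by rw [hK]; field_simp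
    rw [h1, div_le_iff₀ hl0]
    have : (32 * K + 1) / ε ≤ l := le_max_right _ _
    rw [div_le_iff₀ hε] at this; linarith
  obtain ⟨X0, hX0⟩ := (Metric.tendsto_atTop.1 (hT l hl0)) (ε / 16) (by positivity)
  refine ⟨max X0 0 + 2 * δ, fun X hX => ?_⟩
  have hX1 : X0 + 2 * δ ≤ X := by have := le_max_left X0 0; linarith
  have hX2 : 2 * δ ≤ X := by have := le_max_right X0 0; linarith
  rw [Real.dist_eq]
  by_contra hcon
  push Not at hcon
  rcases le_total A (B X) with h | h
  · rw [abs_of_nonneg (by linarith)] at hcon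
    have hm := taub_aux (fun u => B u - A) (hB.sub_const A) M hM l hl0 δ hδ hlδ (X + δ) (by linarith) (ε / 2) (by positivity) (by
      intro u h1 h2
      have h3 := hmono X u (by linarith)
      have h4 : Real.exp (u - X) ≤ Real.exp (2 * δ) := Real.exp_le_exp.2 (by linarith)
      have h5 : A + ε ≤ B u * Real.exp (2 * δ) := by
        have : B u * Real.exp (u - X) ≤ B u * Real.exp (2 * δ) := mul_le_mul_of_nonneg_left h4 (hB0 u)
        linarith
      by_contra h6
      push Not at h6
      have h7 : B u * Real.exp (2 * δ) ≤ (A + ε / 2) * Real.exp (2 * δ) := by gcongr; linarith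
      have : (A + ε) * Real.exp (2 * δ) - (ε / 2) * Real.exp (2 * δ) = (A + ε / 2) * Real.exp (2 * δ) := by ring
      nlinarith)
    have h8 := hX0 (X + δ) (by linarith)
    rw [Real.dist_eq, sub_zero] at h8
    have := (abs_lt.1 h8).2
    linarith
  · rw [abs_of_nonpos (by linarith)] at hcon
    have hm := taub_aux (fun u => -(B u - A)) (hB.sub_const A).neg M (fun u => by rw [abs_neg]; exact hM u) l hl0 δ hδ hlδ (X - δ) (by linarith) (ε / 2) (by positivity) (by
      intro u h1 h2
      have h3 := hmono u X (by linarith)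
      have h4 : Real.exp (X - u) ≤ Real.exp (2 * δ) := Real.exp_le_exp.2 (by linarith)
      have h5 : B u ≤ B X * Real.exp (2 * δ) := h3.trans (mul_le_mul_of_nonneg_left h4 (hB0 X))
      have h6 : B X * Real.exp (2 * δ) ≤ (A - ε) * Real.exp (2 * δ) := by gcongr; linarith
      have : (A + ε) * Real.exp (2 * δ) - (2 * ε) * Real.exp (2 * δ) = (A - ε) * Real.exp (2 * δ) := by ring
      nlinarith)
    have h8 := hX0 (X - δ) (by linarith)
    rw [Real.dist_eq, sub_zero] at h8
    have h9 := (abs_lt.1 h8).1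
    simp only [neg_mul, integral_neg] at hm
    linarith

theorem wiener_ikehara (f : ℕ → ℝ) (hf : ∀ n, 0 ≤ f n) (K : ℝ)
    (hK : ∀ x : ℝ, 0 ≤ x → ∑ k ∈ Icc 1 ⌊x⌋₊, f k ≤ K * x) (A : ℝ) (hA : 0 ≤ A)
    (G : ℂ → ℂ) (hG : ContinuousOn G {s | 1 ≤ s.re})
    (hGL : ∀ s : ℂ, 1 < s.re → LSeries (fun n => (f n : ℂ)) s = G s + A / (s - 1)) :
    Tendsto (fun x : ℝ => (∑ k ∈ Icc 1 ⌊x⌋₊, f k) / x) atTop (𝓝 A) := by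
  set P : ℝ → ℝ := fun x => ∑ k ∈ Icc 1 ⌊x⌋₊, f k with hP
  have hPmono : Monotone P := by
    intro x y hxy
    apply Finset.sum_le_sum_of_subset_of_nonneg
    · exact Icc_subset_Icc le_rfl (Nat.floor_le_floor hxy)
    · intros; exact hf _
  have hP0 : ∀ x, 0 ≤ P x := fun x => Finset.sum_nonneg fun _ _ => hf _
  set B : ℝ → ℝ := fun u => P (Real.exp u) / Real.exp u with hB
  have hBm : Measurable B := (hPmono.measurable.comp Real.measurable_exp).div Real.measurable_exp
  have hB0 : ∀ u, 0 ≤ B u := fun u => div_nonneg (hP0 _) (Real.exp_pos u).le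
  have hBK : ∀ u, B u ≤ K := fun u => by
    rw [hB]; simp only
    rw [div_le_iff₀ (Real.exp_pos u)]; exact hK _ (Real.exp_pos u).le
  have hK0 : 0 ≤ K := (hB0 0).trans (hBK 0)
  have hM : ∀ u, |B u - A| ≤ K + A := fun u => by
    have := hB0 u; have := hBK u
    rw [abs_le]; constructor <;> linarith
  have hO : (fun n : ℕ => ∑ k ∈ Icc 1 n, f k) =O[atTop] fun n : ℕ => (n : ℝ) ^ (1 : ℝ) := by
    apply Asymptotics.IsBigO.of_bound K
    refine Eventually.of_forall fun n => ?_
    have := hK n (by positivity)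
    rw [Nat.floor_natCast] at this
    rw [Real.rpow_one, Real.norm_of_nonneg (Finset.sum_nonneg fun _ _ => hf _), Real.norm_of_nonneg (by positivity)]
    exact this
  have hexpi : ∀ s : ℂ, 1 < s.re → IntegrableOn (fun u : ℝ => Complex.exp (-(s - 1) * u)) (Set.Ioi 0) := by
    intro s hs
    exact integrableOn_exp_mul_complex_Ioi (by simpa using hs) 0
  have hBi : ∀ s : ℂ, 1 < s.re → IntegrableOn (fun u : ℝ => (B u : ℂ) * Complex.exp (-(s - 1) * u)) (Set.Ioi 0) := by
    intro s hs
    refine ((hexpi s hs).norm.const_mul K).mono' ?_ ?_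
    · apply Measurable.aestronglyMeasurable; fun_prop
    · refine Eventually.of_forall fun u => ?_
      rw [norm_mul, Complex.norm_real, Real.norm_of_nonneg (hB0 u)]
      gcongr; exact hBK u
  have hL : ∀ s : ℂ, 1 < s.re → LSeries (fun n => (f n : ℂ)) s =
      s * ∫ u in Set.Ioi (0 : ℝ), (B u : ℂ) * Complex.exp (-(s - 1) * u) := by
    intro s hs
    rw [LSeries_eq_mul_integral_of_nonneg f zero_le_one hs hO hf]
    congr 1
    have him : Real.exp '' Set.Ioi 0 = Set.Ioi 1 := by
      ext y; constructor
      · rintro ⟨u, hu, rfl⟩; exact Real.one_lt_exp_iff.2 hu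
      · intro hy
        have hy1 : (1 : ℝ) < y := hy
        exact ⟨Real.log y, Real.log_pos hy1, Real.exp_log (by linarith)⟩
    rw [← him, integral_image_eq_integral_abs_deriv_smul measurableSet_Ioi
      (fun x _ => (Real.hasDerivAt_exp x).hasDerivWithinAt) Real.exp_injective.injOn]
    congr 1; funext u
    have hne : (Real.exp u : ℂ) ≠ 0 := by exact_mod_cast (Real.exp_pos u).ne'
    rw [abs_of_pos (Real.exp_pos u), Complex.real_smul, Complex.cpow_def_of_ne_zero hne, ← Complex.ofReal_log (Real.exp_pos u).le, Real.log_exp]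
    have e1 : ((B u : ℝ) : ℂ) = (∑ k ∈ Icc 1 ⌊Real.exp u⌋₊, (f k : ℂ)) * Complex.exp (-u) := by
      simp only [hB, hP]
      push_cast
      rw [Complex.exp_neg]; rfl
    rw [e1]
    push_cast
    have e2 : Complex.exp (u * -(s + 1)) * Complex.exp u = Complex.exp (-u) * Complex.exp (-(s - 1) * u) := by
      rw [← Complex.exp_add, ← Complex.exp_add]; congr 1; ring
    linear_combination (∑ k ∈ Icc 1 ⌊Real.exp u⌋₊, (f k : ℂ)) * e2
  have key : ∀ l, 0 < l → Tendsto (fun X => ∫ u in Set.Ioi (0 : ℝ), (B u - A) * kk l (X - u)) atTop (𝓝 0) := by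
    intro l hl
    refine wi_core (fun u => B u - A) (hBm.sub_const A) (K + A) hM (fun s => (G s - A) / s) ?_ ?_ l hl
    · apply ContinuousOn.div (hG.sub continuousOn_const) continuousOn_id
      intro s hs h0
      simp only [id] at h0
      rw [h0] at hs
      have : (1 : ℝ) ≤ (0 : ℂ).re := hs
      simp at this; linarith
    · intro σ t hσ
      set s : ℂ := σ + t * Complex.I with hs
      have hsre : s.re = σ := by simp [hs]
      have hs1 : 1 < s.re := by rw [hsre]; exact hσ
      have hs0 : s ≠ 0 := by intro h; rw [h] at hs1; simp at hs1; linarith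
      have hs10 : s - 1 ≠ 0 := by intro h; rw [sub_eq_zero] at h; rw [h] at hs1; simp at hs1
      have e0 : (((σ - 1 : ℝ) : ℂ) + t * Complex.I) = s - 1 := by rw [hs]; push_cast; ring
      rw [e0]
      have e1 : ∫ u in Set.Ioi (0 : ℝ), ((B u - A : ℝ) : ℂ) * Complex.exp (-(s - 1) * u) =
          (∫ u in Set.Ioi (0 : ℝ), (B u : ℂ) * Complex.exp (-(s - 1) * u)) - ∫ u in Set.Ioi (0 : ℝ), (A : ℂ) * Complex.exp (-(s - 1) * u) := by
        rw [← integral_sub (hBi s hs1) ((hexpi s hs1).const_mul _)]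
        congr 1; funext u; push_cast; ring
      have e2 : ∫ u in Set.Ioi (0 : ℝ), Complex.exp (-(s - 1) * u) = 1 / (s - 1) := by
        rw [integral_exp_mul_complex_Ioi (by simpa using hs1) 0]
        simp only [Complex.ofReal_zero, mul_zero, Complex.exp_zero]
        rw [neg_div_neg_eq]
      have e3 := hL s hs1
      rw [hGL s hs1] at e3
      rw [e1, integral_const_mul, e2]
      have e4 : ∫ u in Set.Ioi (0 : ℝ), (B u : ℂ) * Complex.exp (-(s - 1) * u) = (G s + A / (s - 1)) / s := by
        rw [e3]; field_simp
      rw [e4]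
      field_simp
      ring
  have hBt := wi_taub B hBm A (K + A) hA hB0 hM (by
    intro u v huv
    simp only [hB]
    rw [div_mul_eq_mul_div, div_le_div_iff₀ (Real.exp_pos _) (Real.exp_pos _), mul_assoc, ← Real.exp_add, sub_add_cancel]
    exact mul_le_mul_of_nonneg_right (hPmono (Real.exp_le_exp.2 huv)) (Real.exp_pos _).le) key
  have := hBt.comp Real.tendsto_log_atTop
  refine this.congr' ?_
  filter_upwards [eventually_gt_atTop 0] with x hx
  simp only [Function.comp, hB, Real.exp_log hx, hP]

open ArithmeticFunction in
theorem pnt_ap (q : ℕ) [NeZero q] (a : ZMod q) (ha : IsUnit a) :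
    Tendsto (fun x : ℝ => (∑ k ∈ Icc 1 ⌊x⌋₊, vonMangoldt.residueClass a k) / x) atTop (𝓝 ((q.totient : ℝ)⁻¹)) := by
  refine wiener_ikehara _ (vonMangoldt.residueClass_nonneg a) (Real.log 4 + 4) ?_ _ (by positivity)
    (vonMangoldt.LFunctionResidueClassAux a) (vonMangoldt.continuousOn_LFunctionResidueClassAux a) ?_
  · intro x hx
    refine le_trans ?_ (Chebyshev.psi_le_const_mul_self hx)
    unfold Chebyshev.psi
    rw [← Icc_add_one_left_eq_Ioc]
    exact Finset.sum_le_sum fun n _ => vonMangoldt.residueClass_le a n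
  · intro s hs
    have := vonMangoldt.eqOn_LFunctionResidueClassAux ha hs
    rw [this]; push_cast; ring
end FP


namespace FP
open Finset
open scoped ArithmeticFunction.Moebius ArithmeticFunction.vonMangoldt ArithmeticFunction.zeta

lemma sum_anti {β : Type*} [AddCommMonoid β] (F : ℕ → ℕ → β) (N : ℕ) :
    ∑ n ∈ Ioc 0 N, ∑ x ∈ n.divisorsAntidiagonal, F x.1 x.2 = ∑ d ∈ Ioc 0 N, ∑ m ∈ Ioc 0 (N / d), F d m := by
  rw [Finset.sum_sigma', Finset.sum_sigma']
  refine Finset.sum_bij' (fun z _ => ⟨z.2.1, z.2.2⟩) (fun z _ => ⟨z.1 * z.2, (z.1, z.2)⟩) ?_ ?_ ?_ ?_ ?_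
  · rintro ⟨n, d, m⟩ h
    simp only [mem_sigma, mem_Ioc, Nat.mem_divisorsAntidiagonal] at h ⊢
    obtain ⟨⟨h1, h2⟩, rfl, h3⟩ := h
    have hd : 0 < d := Nat.pos_of_ne_zero fun h => by simp [h] at h3
    have hm : 0 < m := Nat.pos_of_ne_zero fun h => by simp [h] at h3
    refine ⟨⟨hd, (Nat.le_mul_of_pos_right d hm).trans h2⟩, hm, ?_⟩
    rw [Nat.le_div_iff_mul_le hd, mul_comm]; exact h2
  · rintro ⟨d, m⟩ h
    simp only [mem_sigma, mem_Ioc, Nat.mem_divisorsAntidiagonal] at h ⊢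
    obtain ⟨⟨h1, h2⟩, h3, h4⟩ := h
    rw [Nat.le_div_iff_mul_le h1, mul_comm] at h4
    exact ⟨⟨Nat.mul_pos h1 h3, h4⟩, trivial, (Nat.mul_pos h1 h3).ne'⟩
  · rintro ⟨n, d, m⟩ h
    simp only [mem_sigma, mem_Ioc, Nat.mem_divisorsAntidiagonal] at h
    obtain ⟨_, rfl, _⟩ := h
    rfl
  · rintro ⟨d, m⟩ h; rfl
  · rintro ⟨n, d, m⟩ h; rfl

lemma psi_nat_le (N : ℕ) : ∑ n ∈ Ioc 0 N, Λ n ≤ 6 * N := by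
  have h := Chebyshev.psi_le_const_mul_self (x := (N : ℝ)) (by positivity)
  unfold Chebyshev.psi at h
  rw [Nat.floor_natCast] at h
  have h4 : Real.log 4 ≤ 2 := by
    have : (4 : ℝ) = 2 ^ 2 := by norm_num
    rw [this, Real.log_pow]; have := Real.log_two_lt_d9; push_cast; linarith
  have : (Real.log 4 + 4) * N ≤ 6 * N := by gcongr; linarith
  linarith

/-- Mertens upper bound -/
lemma mertens (N : ℕ) (hN : 1 ≤ N) : ∑ n ∈ Ioc 0 N, Λ n / n ≤ Real.log N + 6 := by
  have hNR : (0 : ℝ) < N := by exact_mod_cast hN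
  have h1 : ∑ n ∈ Ioc 0 N, Real.log n = ∑ d ∈ Ioc 0 N, Λ d * ((N / d : ℕ) : ℝ) := by
    have : ∀ n ∈ Ioc 0 N, Real.log n = ∑ x ∈ n.divisorsAntidiagonal, Λ x.1 := by
      intro n _
      rw [← ArithmeticFunction.vonMangoldt_sum, Nat.sum_divisorsAntidiagonal (fun d _ => Λ d)]
    rw [Finset.sum_congr rfl this, sum_anti (fun d _ => Λ d)]
    apply Finset.sum_congr rfl
    intro d _
    simp [mul_comm]
  have h2 : ∑ n ∈ Ioc 0 N, Real.log n ≤ N * Real.log N := by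
    have : ∑ n ∈ Ioc 0 N, Real.log n ≤ (Ioc 0 N).card • Real.log N := by
      apply Finset.sum_le_card_nsmul
      intro n hn
      rw [mem_Ioc] at hn
      apply Real.log_le_log (by exact_mod_cast hn.1) (by exact_mod_cast hn.2)
    simpa using this
  have h3 : N * ∑ n ∈ Ioc 0 N, Λ n / n ≤ ∑ d ∈ Ioc 0 N, (Λ d * ((N / d : ℕ) : ℝ) + Λ d) := by
    rw [Finset.mul_sum]
    apply Finset.sum_le_sum
    intro d hd
    rw [mem_Ioc] at hd
    have hd0 : (0 : ℝ) < d := by exact_mod_cast hd.1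
    have : (N : ℝ) / d ≤ ((N / d : ℕ) : ℝ) + 1 := by
      rw [div_le_iff₀ hd0]
      have := Nat.lt_div_mul_add (a := N) hd.1
      have h : (N : ℝ) ≤ ((N / d : ℕ) : ℝ) * d + d := by exact_mod_cast this.le
      linarith
    have hL : 0 ≤ Λ d := ArithmeticFunction.vonMangoldt_nonneg
    calc (N : ℝ) * (Λ d / d) = Λ d * (N / d) := by ring
      _ ≤ Λ d * (((N / d : ℕ) : ℝ) + 1) := by gcongr
      _ = _ := by ring
  rw [Finset.sum_add_distrib, ← h1] at h3
  have h4 := psi_nat_le N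
  have : N * ∑ n ∈ Ioc 0 N, Λ n / n ≤ N * (Real.log N + 6) := by linarith
  exact le_of_mul_le_mul_left this hNR

lemma log_sq_eq (n : ℕ) (hn : 0 < n) :
    ∑ d ∈ n.divisors, (Λ d * Real.log d + (Λ * Λ) d) = Real.log n ^ 2 := by
  rw [Finset.sum_add_distrib]
  have h1 : ∑ d ∈ n.divisors, (Λ * Λ) d = ∑ x ∈ n.divisorsAntidiagonal, Λ x.1 * Real.log x.2 := by
    rw [← ArithmeticFunction.coe_mul_zeta_apply, mul_assoc, ArithmeticFunction.vonMangoldt_mul_zeta, ArithmeticFunction.mul_apply]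
    rfl
  rw [h1, ← Nat.sum_divisorsAntidiagonal (fun d _ => Λ d * Real.log d), ← Finset.sum_add_distrib]
  have h2 : ∀ x ∈ n.divisorsAntidiagonal, Λ x.1 * Real.log x.1 + Λ x.1 * Real.log x.2 = Λ x.1 * Real.log n := by
    rintro ⟨a, b⟩ hx
    rw [Nat.mem_divisorsAntidiagonal] at hx
    obtain ⟨rfl, h0⟩ := hx
    have ha : (a : ℝ) ≠ 0 := by
      intro h; apply h0; simp [Nat.cast_eq_zero.1 h]
    have hb : (b : ℝ) ≠ 0 := by
      intro h; apply h0; simp [Nat.cast_eq_zero.1 h]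
    push_cast
    rw [Real.log_mul ha hb]; ring
  rw [Finset.sum_congr rfl h2, ← Finset.sum_mul, Nat.sum_divisorsAntidiagonal (fun d _ => Λ d), ArithmeticFunction.vonMangoldt_sum]
  ring

/-- the Selberg function at `n` with parameter `y` -/
noncomputable def sg (y : ℝ) (n : ℕ) : ℝ :=
  (if n = 1 then Real.log y ^ 2 else 0) + 2 * Real.log (y / n) * Λ n + Λ n * Real.log n + (Λ * Λ) n

lemma selberg_pt (y : ℝ) (hy : 0 < y) (n : ℕ) (hn : 0 < n) :
    ∑ x ∈ n.divisorsAntidiagonal, (μ x.1 : ℝ) * Real.log (y / x.1) ^ 2 = sg y n := by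
  have hn0 : (n : ℝ) ≠ 0 := by positivity
  have h2 : ∑ x ∈ n.divisorsAntidiagonal, (μ x.1 : ℝ) * (Real.log x.2 ^ 2) = Λ n * Real.log n + (Λ * Λ) n :=
    (ArithmeticFunction.sum_eq_iff_sum_mul_moebius_eq (f := fun d => Λ d * Real.log d + (Λ * Λ) d)
      (g := fun n => Real.log n ^ 2)).1 (fun n hn => log_sq_eq n hn) n hn
  have h1 : ∑ x ∈ n.divisorsAntidiagonal, (μ x.1 : ℝ) * (Real.log x.2) = Λ n := by
    rw [← ArithmeticFunction.moebius_mul_log_eq_vonMangoldt, ArithmeticFunction.mul_apply]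
    rfl
  have h0 : ∑ x ∈ n.divisorsAntidiagonal, (μ x.1 : ℝ) = if n = 1 then 1 else 0 := by
    rw [Nat.sum_divisorsAntidiagonal (fun d _ => (μ d : ℝ))]
    have := congrArg (fun f => f n) ArithmeticFunction.moebius_mul_coe_zeta
    simp only [ArithmeticFunction.coe_mul_zeta_apply, ArithmeticFunction.one_apply] at this
    exact_mod_cast this
  have h3 : ∀ x ∈ n.divisorsAntidiagonal, (μ x.1 : ℝ) * Real.log (y / x.1) ^ 2 =
      Real.log (y / n) ^ 2 * (μ x.1 : ℝ) + 2 * Real.log (y / n) * ((μ x.1 : ℝ) * (Real.log x.2)) + (μ x.1 : ℝ) * (Real.log x.2 ^ 2) := by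
    rintro ⟨a, b⟩ hx
    rw [Nat.mem_divisorsAntidiagonal] at hx
    obtain ⟨rfl, h0⟩ := hx
    have ha : (a : ℝ) ≠ 0 := by
      intro h; apply h0; simp [Nat.cast_eq_zero.1 h]
    have hb : (b : ℝ) ≠ 0 := by
      intro h; apply h0; simp [Nat.cast_eq_zero.1 h]
    have : Real.log (y / a) = Real.log (y / (a * b : ℕ)) + Real.log b := by
      rw [← Real.log_mul (by positivity) hb]; congr 1; push_cast; field_simp
    simp only
    rw [this]; ring
  rw [Finset.sum_congr rfl h3, Finset.sum_add_distrib, Finset.sum_add_distrib, ← Finset.mul_sum, ← Finset.mul_sum, h0, h1, h2]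
  unfold sg
  split_ifs with h
  · subst h; simp
  · ring

/-- Selberg identity with additive twist -/
lemma selberg_sum (y : ℝ) (hy : 0 < y) (N : ℕ) (e : ℕ → ℂ) :
    ∑ d ∈ Ioc 0 N, ((μ d : ℝ) * Real.log (y / d) ^ 2 : ℝ) * ∑ m ∈ Ioc 0 (N / d), e (d * m) = ∑ n ∈ Ioc 0 N, (sg y n : ℂ) * e n := by
  have h := sum_anti (fun d m => (((μ d : ℝ) * Real.log (y / d) ^ 2 : ℝ) : ℂ) * e (d * m)) N
  simp_rw [Finset.mul_sum]
  rw [← h]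
  apply Finset.sum_congr rfl
  intro n hn
  rw [← selberg_pt y hy n (mem_Ioc.1 hn).1]
  push_cast
  rw [Finset.sum_mul]
  apply Finset.sum_congr rfl
  rintro ⟨a, b⟩ hx
  rw [Nat.mem_divisorsAntidiagonal] at hx
  simp [hx.1]

lemma sum_LL_le (N : ℕ) (hN : 1 ≤ N) : ∑ n ∈ Ioc 0 N, (Λ * Λ) n ≤ 6 * N * (Real.log N + 6) := by
  simp_rw [ArithmeticFunction.mul_apply]
  rw [sum_anti (fun a b => Λ a * Λ b)]
  calc ∑ d ∈ Ioc 0 N, ∑ m ∈ Ioc 0 (N / d), Λ d * Λ m ≤ ∑ d ∈ Ioc 0 N, 6 * N * (Λ d / d) := by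
        apply Finset.sum_le_sum
        intro d hd
        rw [← Finset.mul_sum]
        have h1 := psi_nat_le (N / d)
        have h2 : ((N / d : ℕ) : ℝ) ≤ N / d := Nat.cast_div_le
        have hL : 0 ≤ Λ d := ArithmeticFunction.vonMangoldt_nonneg
        calc Λ d * ∑ m ∈ Ioc 0 (N / d), Λ m ≤ Λ d * (6 * (N / d)) := by gcongr; linarith
          _ = _ := by ring
    _ = 6 * N * ∑ d ∈ Ioc 0 N, Λ d / d := by rw [Finset.mul_sum]
    _ ≤ _ := by gcongr; exact mertens N hN

/-- `∑_{d ≤ N} log²(y/d) ≤ C y` for `N = ⌊y⌋` -/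
lemma sum_log_sq_le (y : ℝ) (hy : 1 ≤ y) : ∑ d ∈ Ioc 0 ⌊y⌋₊, Real.log (y / d) ^ 2 ≤ 32 * y := by
  -- log t ≤ 4 t^(1/4), so log² ≤ 16 t^(1/2); ∑ √(y/d) ≤ 2 y
  have h1 : ∀ d ∈ Ioc 0 ⌊y⌋₊, Real.log (y / d) ^ 2 ≤ 16 * Real.sqrt y * (2 * (Real.sqrt d - Real.sqrt (d - 1 : ℕ))) := by
    intro d hd
    rw [mem_Ioc] at hd
    have hd0 : (0 : ℝ) < d := by exact_mod_cast hd.1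
    have hdy : (d : ℝ) ≤ y := (Nat.le_floor_iff (by linarith)).1 hd.2
    have ht : 1 ≤ y / d := by rw [le_div_iff₀ hd0]; linarith
    have hlog : Real.log (y / d) ≤ 4 * (y / d) ^ (1 / 4 : ℝ) := by
      have := Real.log_le_rpow_div (x := y / d) (by positivity) (show (0 : ℝ) < 1 / 4 by norm_num)
      linarith
    have h0 : 0 ≤ Real.log (y / d) := Real.log_nonneg ht
    have h2 : Real.log (y / d) ^ 2 ≤ 16 * Real.sqrt (y / d) := by
      calc Real.log (y / d) ^ 2 ≤ (4 * (y / d) ^ (1 / 4 : ℝ)) ^ 2 := by gcongr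
        _ = 16 * Real.sqrt (y / d) := by
          rw [mul_pow, ← Real.rpow_natCast, ← Real.rpow_natCast, ← Real.rpow_mul (by positivity), Real.sqrt_eq_rpow]; norm_num
    refine h2.trans ?_
    rw [Real.sqrt_div (by linarith), mul_assoc]
    have h3 : 1 / Real.sqrt d ≤ 2 * (Real.sqrt d - Real.sqrt (d - 1 : ℕ)) := by
      have hs : 0 < Real.sqrt d := Real.sqrt_pos.2 hd0
      rw [div_le_iff₀ hs]
      have e1 : Real.sqrt d ^ 2 = d := Real.sq_sqrt hd0.le
      have e2 : Real.sqrt (d - 1 : ℕ) ^ 2 = d - 1 := by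
        rw [Real.sq_sqrt (by positivity), Nat.cast_sub hd.1]; simp
      nlinarith [sq_nonneg (Real.sqrt d - Real.sqrt (d - 1 : ℕ))]
    calc 16 * (Real.sqrt y / Real.sqrt d) = 16 * (Real.sqrt y * (1 / Real.sqrt d)) := by ring
      _ ≤ _ := by gcongr
  refine (Finset.sum_le_sum h1).trans ?_
  rw [← Finset.mul_sum, ← Finset.mul_sum]
  have h2 : ∀ n : ℕ, ∑ d ∈ Ioc 0 n, (Real.sqrt d - Real.sqrt (d - 1 : ℕ)) = Real.sqrt n := by
    intro n
    induction n with
    | zero => simp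
    | succ k ih =>
      rw [← Finset.insert_Ioc_right_eq_Ioc_add_one (by omega), Finset.sum_insert (by simp), ih]
      simp
  rw [h2]
  have : Real.sqrt ⌊y⌋₊ ≤ Real.sqrt y := Real.sqrt_le_sqrt (Nat.floor_le (by linarith))
  have h3 : Real.sqrt y * Real.sqrt y = y := Real.mul_self_sqrt (by linarith)
  have h4 := Real.sqrt_nonneg y
  nlinarith
end FP


namespace FP
open Finset
open scoped ArithmeticFunction.Moebius ArithmeticFunction.vonMangoldt ArithmeticFunction.zeta

/-- the sum of `μ(k)/k log²(Y/k)` over `k ≤ Y` free of primes of `S` -/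
noncomputable def FF (S : Finset ℕ) (Y : ℝ) : ℝ :=
  ∑ k ∈ (Ioc 0 ⌊Y⌋₊).filter (fun k => ∀ p ∈ S, ¬ p ∣ k), (μ k : ℝ) / k * Real.log (Y / k) ^ 2

lemma FF_lt_one (S : Finset ℕ) {Y : ℝ} (hY : Y < 1) : FF S Y = 0 := by
  unfold FF
  rw [Nat.floor_eq_zero.2 hY]; simp

lemma sum_sg_nonneg_le (Y : ℝ) (hY : 1 ≤ Y) :
    0 ≤ ∑ n ∈ Ioc 0 ⌊Y⌋₊, sg Y n ∧ ∑ n ∈ Ioc 0 ⌊Y⌋₊, sg Y n ≤ Y * (25 * Real.log Y + 36) := by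
  have hN1 : 1 ≤ ⌊Y⌋₊ := Nat.le_floor (by exact_mod_cast hY)
  have hNY : (⌊Y⌋₊ : ℝ) ≤ Y := Nat.floor_le (by linarith)
  have hlY : 0 ≤ Real.log Y := Real.log_nonneg hY
  have hLL : ∀ n, 0 ≤ (Λ * Λ) n := by
    intro n
    rw [ArithmeticFunction.mul_apply]
    exact Finset.sum_nonneg fun x _ => mul_nonneg ArithmeticFunction.vonMangoldt_nonneg ArithmeticFunction.vonMangoldt_nonneg
  have hpt : ∀ n ∈ Ioc 0 ⌊Y⌋₊, 0 ≤ sg Y n ∧ sg Y n ≤ (if n = 1 then Real.log Y ^ 2 else 0) + 3 * Real.log Y * Λ n + (Λ * Λ) n := by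
    intro n hn
    rw [mem_Ioc] at hn
    have hn0 : (1 : ℝ) ≤ n := by exact_mod_cast hn.1
    have hnY : (n : ℝ) ≤ Y := (Nat.le_floor_iff (by linarith)).1 hn.2
    have h1 : Real.log (Y / n) = Real.log Y - Real.log n := Real.log_div (by linarith) (by linarith)
    have h2 : 0 ≤ Real.log n := Real.log_nonneg hn0
    have h3 : Real.log n ≤ Real.log Y := Real.log_le_log (by linarith) hnY
    have hL : 0 ≤ Λ n := ArithmeticFunction.vonMangoldt_nonneg
    have h4 := hLL n
    unfold sg
    rw [h1]
    constructor
    · have : 0 ≤ if n = 1 then Real.log Y ^ 2 else 0 := by split_ifs <;> positivity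
      have h5 : 0 ≤ 2 * (Real.log Y - Real.log n) * Λ n := by
        apply mul_nonneg _ hL; linarith
      positivity
    · nlinarith [mul_nonneg h2 hL, mul_nonneg hlY hL]
  refine ⟨Finset.sum_nonneg fun n hn => (hpt n hn).1, (Finset.sum_le_sum fun n hn => (hpt n hn).2).trans ?_⟩
  rw [Finset.sum_add_distrib, Finset.sum_add_distrib, ← Finset.mul_sum]
  have e1 : ∑ n ∈ Ioc 0 ⌊Y⌋₊, (if n = 1 then Real.log Y ^ 2 else 0) = Real.log Y ^ 2 := by
    rw [Finset.sum_ite_eq' (Ioc 0 ⌊Y⌋₊) 1, if_pos (by rw [mem_Ioc]; omega)]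
  rw [e1]
  have e2 := psi_nat_le ⌊Y⌋₊
  have e3 := sum_LL_le ⌊Y⌋₊ hN1
  have e4 : Real.log ⌊Y⌋₊ ≤ Real.log Y := Real.log_le_log (by exact_mod_cast hN1) hNY
  have e5 : Real.log Y ≤ Y := (Real.log_le_sub_one_of_pos (by linarith)).trans (by linarith)
  have e6 : 6 * (⌊Y⌋₊ : ℝ) * (Real.log ⌊Y⌋₊ + 6) ≤ 6 * Y * (Real.log Y + 6) := by
    gcongr
  have e7 : 3 * Real.log Y * ∑ n ∈ Ioc 0 ⌊Y⌋₊, Λ n ≤ 3 * Real.log Y * (6 * Y) := by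
    gcongr; linarith
  have e8 : Real.log Y ^ 2 ≤ Y * Real.log Y := by rw [sq]; gcongr
  nlinarith

lemma FF_empty (Y : ℝ) (hY : 1 ≤ Y) : |FF ∅ Y| ≤ 68 * (1 + Real.log Y) := by
  have h1 := selberg_sum Y (by linarith) ⌊Y⌋₊ (fun _ => 1)
  simp only [sum_const, Nat.card_Ioc, nsmul_eq_mul, mul_one, tsub_zero] at h1
  have h2 : ∑ d ∈ Ioc 0 ⌊Y⌋₊, ((μ d : ℝ) * Real.log (Y / d) ^ 2) * ((⌊Y⌋₊ / d : ℕ) : ℝ) = ∑ n ∈ Ioc 0 ⌊Y⌋₊, sg Y n := by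
    exact_mod_cast h1
  obtain ⟨h3, h4⟩ := sum_sg_nonneg_le Y hY
  rw [← h2] at h3 h4
  have h5 : |Y * FF ∅ Y - ∑ d ∈ Ioc 0 ⌊Y⌋₊, ((μ d : ℝ) * Real.log (Y / d) ^ 2) * ((⌊Y⌋₊ / d : ℕ) : ℝ)| ≤ 32 * Y := by
    unfold FF
    rw [Finset.filter_true_of_mem (by simp), Finset.mul_sum, ← Finset.sum_sub_distrib]
    refine (Finset.abs_sum_le_sum_abs _ _).trans ((Finset.sum_le_sum ?_).trans (sum_log_sq_le Y hY))
    intro d hd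
    rw [mem_Ioc] at hd
    have hd0 : (0 : ℝ) < d := by exact_mod_cast hd.1
    have e : Y * ((μ d : ℝ) / d * Real.log (Y / d) ^ 2) - (μ d : ℝ) * Real.log (Y / d) ^ 2 * ((⌊Y⌋₊ / d : ℕ) : ℝ) =
        (μ d : ℝ) * (Real.log (Y / d) ^ 2 * (Y / d - ((⌊Y⌋₊ / d : ℕ) : ℝ))) := by ring
    rw [e, abs_mul, abs_mul]
    have hm : |(μ d : ℝ)| ≤ 1 := by
      exact_mod_cast ArithmeticFunction.abs_moebius_le_one
    have hf : |Y / d - ((⌊Y⌋₊ / d : ℕ) : ℝ)| ≤ 1 := by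
      rw [← Nat.floor_div_natCast, abs_le]
      have a1 := Nat.floor_le (show 0 ≤ Y / d by positivity)
      have a2 := Nat.lt_floor_add_one (Y / d)
      constructor <;> linarith
    calc |(μ d : ℝ)| * (|Real.log (Y / d) ^ 2| * |Y / d - ((⌊Y⌋₊ / d : ℕ) : ℝ)|) ≤ 1 * (|Real.log (Y / d) ^ 2| * 1) := by gcongr
      _ = Real.log (Y / d) ^ 2 := by rw [abs_of_nonneg (sq_nonneg _)]; ring
  have hlY : 0 ≤ Real.log Y := Real.log_nonneg hY
  have h6 : |Y * FF ∅ Y| ≤ Y * (68 * (1 + Real.log Y)) := by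
    rw [abs_le] at h5 ⊢
    constructor <;> nlinarith
  rw [abs_mul, abs_of_pos (by linarith : 0 < Y)] at h6
  exact le_of_mul_le_mul_left h6 (by linarith)

lemma FF_insert (S : Finset ℕ) (p : ℕ) (hp : p.Prime) (hS : ∀ r ∈ S, r.Prime) (hpS : p ∉ S) (Y : ℝ) (hY : 0 ≤ Y) :
    FF (insert p S) Y = FF S Y + 1 / p * FF (insert p S) (Y / p) := by
  have hp0 : (0 : ℝ) < p := by exact_mod_cast hp.pos
  unfold FF
  rw [← Finset.sum_filter_add_sum_filter_not ((Ioc 0 ⌊Y⌋₊).filter (fun k => ∀ r ∈ S, ¬ r ∣ k)) (fun k => p ∣ k)]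
  have e1 : ((Ioc 0 ⌊Y⌋₊).filter (fun k => ∀ r ∈ S, ¬ r ∣ k)).filter (fun k => ¬ p ∣ k) = (Ioc 0 ⌊Y⌋₊).filter (fun k => ∀ r ∈ insert p S, ¬ r ∣ k) := by
    ext k; simp only [mem_filter, mem_insert, forall_eq_or_imp]; tauto
  rw [e1]
  suffices h : ∑ k ∈ ((Ioc 0 ⌊Y⌋₊).filter (fun k => ∀ r ∈ S, ¬ r ∣ k)).filter (fun k => p ∣ k), (μ k : ℝ) / k * Real.log (Y / k) ^ 2
      = - (1 / p * ∑ k ∈ (Ioc 0 ⌊Y / p⌋₊).filter (fun k => ∀ r ∈ insert p S, ¬ r ∣ k), (μ k : ℝ) / k * Real.log (Y / p / k) ^ 2) by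
    rw [h]; ring
  rw [Finset.mul_sum, ← Finset.sum_neg_distrib]
  symm
  apply Finset.sum_of_injOn (fun m => p * m)
  · intro a _ b _ h
    exact Nat.eq_of_mul_eq_mul_left hp.pos h
  · intro m hm
    simp only [Finset.coe_filter, Set.mem_setOf_eq, mem_Ioc, mem_insert, forall_eq_or_imp, mem_filter] at hm ⊢
    obtain ⟨⟨h1, h2⟩, h3, h4⟩ := hm
    rw [Nat.floor_div_natCast, Nat.le_div_iff_mul_le hp.pos, mul_comm] at h2
    refine ⟨⟨⟨Nat.mul_pos hp.pos h1, h2⟩, ?_⟩, dvd_mul_right _ _⟩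
    intro r hr hd
    rcases (hS r hr).dvd_mul.1 hd with h | h
    · rw [Nat.prime_dvd_prime_iff_eq (hS r hr) hp] at h
      exact hpS (h ▸ hr)
    · exact h4 r hr h
  · intro k hk hnk
    simp only [mem_filter, mem_Ioc] at hk
    obtain ⟨⟨⟨h1, h2⟩, h3⟩, m, rfl⟩ := hk
    have hpm : p ∣ m := by
      by_contra hpm
      apply hnk
      refine ⟨m, ?_, rfl⟩
      simp only [Finset.coe_filter, Set.mem_setOf_eq, mem_Ioc, mem_insert, forall_eq_or_imp]
      refine ⟨⟨Nat.pos_of_mul_pos_left h1, ?_⟩, hpm, fun r hr hd => h3 r hr (hd.mul_left _)⟩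
      rw [Nat.floor_div_natCast, Nat.le_div_iff_mul_le hp.pos, mul_comm]; exact h2
    have : μ (p * m) = 0 := by
      apply ArithmeticFunction.moebius_eq_zero_of_not_squarefree
      intro hsq
      obtain ⟨c, rfl⟩ := hpm
      have := hsq p ⟨c, by ring⟩
      exact hp.one_lt.ne' (Nat.isUnit_iff.1 this)
    simp [this]
  · intro m hm
    simp only [mem_filter, mem_Ioc, mem_insert, forall_eq_or_imp] at hm
    obtain ⟨⟨h1, h2⟩, h3, h4⟩ := hm
    have hc : Nat.Coprime p m := (Nat.Prime.coprime_iff_not_dvd hp).2 h3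
    have hm0 : (0 : ℝ) < m := by exact_mod_cast h1
    have e : μ (p * m) = - μ m := by
      rw [ArithmeticFunction.isMultiplicative_moebius.map_mul_of_coprime hc, ArithmeticFunction.moebius_apply_prime hp]; ring
    simp only [e]
    push_cast
    rw [div_div]
    field_simp

lemma FF_bound (S : Finset ℕ) (hS : ∀ r ∈ S, r.Prime) : ∀ Y : ℝ, 1 ≤ Y → |FF S Y| ≤ 68 * VV S * (1 + Real.log Y) := by
  induction S using Finset.induction_on with
  | empty => intro Y hY; simpa [VV] using FF_empty Y hY
  | insert p S hpS ih =>
    have hp : p.Prime := hS p (mem_insert_self _ _)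
    have hS' : ∀ r ∈ S, r.Prime := fun r hr => hS r (mem_insert_of_mem hr)
    have ih' := ih hS'
    have hVS := VV_pos S hS'
    have hp0 : (0 : ℝ) < p := by exact_mod_cast hp.pos
    have hp2 : (2 : ℝ) ≤ p := by exact_mod_cast hp.two_le
    have hpi := prime_inv_le hp
    have hpi0 : (0 : ℝ) < (p : ℝ)⁻¹ := by positivity
    have hV : VV (insert p S) = (1 - (p : ℝ)⁻¹)⁻¹ * VV S := by unfold VV; rw [Finset.prod_insert hpS]
    have hV0 : 0 < VV (insert p S) := VV_pos _ hS
    have hV2 : VV S = (1 - (p : ℝ)⁻¹) * VV (insert p S) := by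
      rw [hV, mul_inv_cancel_left₀]; linarith
    suffices h : ∀ n : ℕ, ∀ Y : ℝ, 1 ≤ Y → ⌊Y⌋₊ = n → |FF (insert p S) Y| ≤ 68 * VV (insert p S) * (1 + Real.log Y) from
      fun Y hY => h _ Y hY rfl
    intro n
    induction n using Nat.strong_induction_on with
    | _ n ihn =>
      intro Y hY hn
      have hlY : 0 ≤ Real.log Y := Real.log_nonneg hY
      rw [FF_insert S p hp hS' hpS Y (by linarith)]
      have b2 : |FF (insert p S) (Y / p)| ≤ 68 * VV (insert p S) * (1 + Real.log Y) := by
        rcases lt_or_ge (Y / p) 1 with h | h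
        · rw [FF_lt_one _ h, abs_zero]; positivity
        · have hlt : ⌊Y / p⌋₊ < n := by
            rw [Nat.floor_div_natCast, hn]
            apply Nat.div_lt_self _ hp.one_lt
            rw [← hn]; exact Nat.floor_pos.2 hY
          refine (ihn _ hlt (Y / p) h rfl).trans ?_
          have : Real.log (Y / p) ≤ Real.log Y := by
            apply Real.log_le_log (by positivity)
            rw [div_le_iff₀ hp0]; nlinarith
          gcongr
      have b1 := ih' Y hY
      rw [hV2] at b1
      calc |FF S Y + 1 / p * FF (insert p S) (Y / p)| ≤ |FF S Y| + |1 / p * FF (insert p S) (Y / p)| := abs_add_le _ _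
        _ = |FF S Y| + (p : ℝ)⁻¹ * |FF (insert p S) (Y / p)| := by rw [abs_mul, abs_of_pos (by positivity : (0 : ℝ) < 1 / p), one_div]
        _ ≤ 68 * ((1 - (p : ℝ)⁻¹) * VV (insert p S)) * (1 + Real.log Y) + (p : ℝ)⁻¹ * (68 * VV (insert p S) * (1 + Real.log Y)) := by gcongr
        _ = _ := by ring
end FP


namespace FP
open Finset
open scoped ArithmeticFunction.Moebius ArithmeticFunction.vonMangoldt ArithmeticFunction.zeta

/-- a permutation of residues -/
lemma perm_sum (q : ℕ) (hq : 0 < q) (a c : ℤ) (ha : IsCoprime a q) (f : ℕ → ℝ) :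
    ∑ j ∈ range q, f (((c + a * j) % q).toNat) = ∑ r ∈ range q, f r := by
  have hq' : (0 : ℤ) < q := by exact_mod_cast hq
  have hinj : Set.InjOn (fun j : ℕ => ((c + a * j) % q).toNat) (range q : Set ℕ) := by
    intro i hi j hj h
    simp only [coe_range, Set.mem_Iio] at hi hj
    simp only at h
    have h1 := Int.emod_nonneg (c + a * i) hq'.ne'
    have h2 := Int.emod_nonneg (c + a * j) hq'.ne'
    have h3 : (c + a * i) % q = (c + a * j) % q := by omega
    have h4 : (q : ℤ) ∣ (c + a * j) - (c + a * i) := (Int.ModEq.dvd h3)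
    have h5 : (q : ℤ) ∣ a * (j - i) := by convert h4 using 1; ring
    have h6 : (q : ℤ) ∣ (j - i : ℤ) := (ha.symm).dvd_of_dvd_mul_left h5
    have h7 := Int.eq_zero_of_abs_lt_dvd h6 (by rw [abs_lt]; omega)
    omega
  have himg : (range q).image (fun j : ℕ => ((c + a * j) % q).toNat) = range q := by
    apply Finset.eq_of_subset_of_card_le
    · intro x hx
      simp only [mem_image, mem_range] at hx ⊢
      obtain ⟨j, _, rfl⟩ := hx
      have h1 := Int.emod_nonneg (c + a * j) hq'.ne'
      have h2 := Int.emod_lt_of_pos (c + a * j) hq'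
      omega
    · rw [Finset.card_image_of_injOn hinj]
  conv_rhs => rw [← himg]
  rw [Finset.sum_image hinj]

/-- weight for residues -/
noncomputable def ww (q r : ℕ) : ℝ := if r = 0 then 0 else (q : ℝ) / r + q / (q - r)

lemma ww_nonneg (q r : ℕ) (h : r < q) : 0 ≤ ww q r := by
  unfold ww
  have : (r : ℝ) < q := by exact_mod_cast h
  split_ifs
  · rfl
  · have : (0 : ℝ) < q - r := by linarith
    positivity

lemma harm_le (n : ℕ) : ∑ i ∈ range n, 1 / ((i : ℝ) + 1) ≤ 1 + Real.log n := by
  have := harmonic_le_one_add_log n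
  rw [harmonic] at this
  push_cast at this
  simpa [one_div] using this

lemma harm_ge (n : ℕ) : Real.log (n + 1) ≤ ∑ i ∈ range n, 1 / ((i : ℝ) + 1) := by
  have := log_add_one_le_harmonic n
  rw [harmonic] at this
  push_cast at this
  simpa [one_div] using this

lemma sum_Ioc_inv (n : ℕ) : ∑ i ∈ Ioc 0 n, 1 / (i : ℝ) = ∑ i ∈ range n, 1 / ((i : ℝ) + 1) := by
  induction n with
  | zero => simp
  | succ k ih =>
    rw [← Finset.insert_Ioc_right_eq_Ioc_add_one (by omega), Finset.sum_insert (by simp), ih, Finset.sum_range_succ]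
    push_cast; ring

lemma sum_Ioc_inv_le (A B : ℕ) (hAB : A ≤ B) : ∑ i ∈ Ioc A B, 1 / (i : ℝ) ≤ 1 + Real.log B - Real.log (A + 1) := by
  have h := Finset.sum_Ioc_consecutive (fun i : ℕ => 1 / (i : ℝ)) (Nat.zero_le A) hAB
  rw [sum_Ioc_inv, sum_Ioc_inv B] at h
  have h1 := harm_le B
  have h2 := harm_ge A
  linarith

lemma sum_ww (q : ℕ) (hq : 0 < q) : ∑ r ∈ range q, ww q r ≤ 2 * q * (1 + Real.log q) := by
  have hqR : (0 : ℝ) < q := by exact_mod_cast hq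
  obtain ⟨p, rfl⟩ : ∃ p, q = p + 1 := ⟨q - 1, by omega⟩
  rw [Finset.sum_range_succ']
  have h1 : ∀ i ∈ range p, ww (p + 1) (i + 1) = ((p + 1 : ℕ) : ℝ) * (1 / ((i : ℝ) + 1)) + ((p + 1 : ℕ) : ℝ) * (1 / ((p - 1 - i : ℕ) + 1 : ℝ)) := by
    intro i hi
    rw [mem_range] at hi
    have : ((p - 1 - i : ℕ) : ℝ) = p - 1 - i := by
      rw [Nat.cast_sub (by omega), Nat.cast_sub (by omega)]; simp
    unfold ww
    rw [if_neg (by omega), this]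
    push_cast
    ring_nf
  rw [Finset.sum_congr rfl h1, Finset.sum_add_distrib, ← Finset.mul_sum, ← Finset.mul_sum,
    Finset.sum_range_reflect (fun i => 1 / ((i : ℝ) + 1)) p]
  have h2 := harm_le p
  have h3 : Real.log p ≤ Real.log (p + 1 : ℕ) := by
    rcases Nat.eq_zero_or_pos p with rfl | h
    · simp
    · apply Real.log_le_log (by exact_mod_cast h); push_cast; linarith
  have h4 : ww (p + 1) 0 = 0 := by simp [ww]
  rw [h4]
  have : ((p + 1 : ℕ) : ℝ) * ∑ i ∈ range p, 1 / ((i : ℝ) + 1) ≤ ((p + 1 : ℕ) : ℝ) * (1 + Real.log (p + 1 : ℕ)) := by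
    gcongr; linarith
  linarith

/-- distance of `m/q` to integers from residue -/
lemma nn_res (q : ℕ) (hq : 0 < q) (m : ℤ) (r : ℕ) (hr : ((m % q).toNat) = r) :
    min ((r : ℝ) / q) (((q : ℝ) - r) / q) ≤ nn ((m : ℝ) / q) := by
  have hq' : (0 : ℤ) < q := by exact_mod_cast hq
  have hqR : (0 : ℝ) < q := by exact_mod_cast hq
  have h1 := Int.emod_nonneg m hq'.ne'
  have h2 := Int.emod_lt_of_pos m hq'
  have h3 := Int.emod_add_mul_ediv m q
  have hr' : (r : ℤ) = m % q := by omega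
  have hm : (m : ℝ) / q = (r : ℝ) / q + ((m / q : ℤ) : ℝ) := by
    have : (m : ℝ) = r + q * ((m / q : ℤ) : ℝ) := by
      have : m = (r : ℤ) + q * (m / q) := by omega
      exact_mod_cast this
    field_simp
    linarith
  rw [hm, nn_add_int]
  unfold nn
  set k := round ((r : ℝ) / q)
  have hrq : (r : ℝ) < q := by
    have : (r : ℤ) < q := by omega
    exact_mod_cast this
  have hr0 : (0 : ℝ) ≤ r := by positivity
  rcases le_or_gt k 0 with hk | hk
  · have hk' : (k : ℝ) ≤ 0 := by exact_mod_cast hk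
    refine (min_le_left _ _).trans (le_trans ?_ (le_abs_self _)); linarith
  · have hk' : (1 : ℝ) ≤ k := by exact_mod_cast hk
    refine (min_le_right _ _).trans (le_trans ?_ (neg_le_abs _))
    rw [sub_div, div_self hqR.ne']; linarith

lemma inv_nn_le_ww (q : ℕ) (hq : 0 < q) (m : ℤ) (hm : (m % q).toNat ≠ 0) :
    1 / nn ((m : ℝ) / q) ≤ ww q ((m % q).toNat) := by
  have hq' : (0 : ℤ) < q := by exact_mod_cast hq
  have hqR : (0 : ℝ) < q := by exact_mod_cast hq
  have h := nn_res q hq m _ rfl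
  set r := (m % q).toNat with hr
  have h2 := Int.emod_lt_of_pos m hq'
  have hrq : (r : ℝ) < q := by
    have : (r : ℤ) < q := by omega
    exact_mod_cast this
  have hr0 : (0 : ℝ) < r := by exact_mod_cast Nat.pos_of_ne_zero hm
  have hqr : (0 : ℝ) < q - r := by linarith
  unfold ww
  rw [if_neg hm]
  rcases min_cases ((r : ℝ) / q) (((q : ℝ) - r) / q) with ⟨h1, _⟩ | ⟨h1, _⟩
  · rw [h1] at h
    have := one_div_le_one_div_of_le (by positivity) h
    rw [one_div_div] at this
    have : 0 ≤ (q : ℝ) / (q - r) := by positivity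
    linarith
  · rw [h1] at h
    have := one_div_le_one_div_of_le (by positivity) h
    rw [one_div_div] at this
    have : 0 ≤ (q : ℝ) / r := by positivity
    linarith

lemma sum_periodic_le (q : ℕ) (hq : 0 < q) (g : ℕ → ℝ) (hg : ∀ n, 0 ≤ g n) (hper : ∀ n, g (n + q) = g n) (D : ℕ) :
    ∑ d ∈ Ioc 0 D, g d ≤ ((D : ℝ) / q + 1) * ∑ r ∈ range q, g r := by
  have hqR : (0 : ℝ) < q := by exact_mod_cast hq
  have hS : 0 ≤ ∑ r ∈ range q, g r := Finset.sum_nonneg fun r _ => hg r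
  have h1 : ∀ k : ℕ, ∑ d ∈ range (q * k), g d = k * ∑ r ∈ range q, g r := by
    intro k
    induction k with
    | zero => simp
    | succ k ih =>
      have hper' : ∀ k n, g (n + q * k) = g n := by
        intro k; induction k with
        | zero => simp
        | succ k ih => intro n; rw [mul_add, mul_one, ← add_assoc, hper, ih]
      rw [mul_add, mul_one, Finset.sum_range_add, ih]
      have : ∑ x ∈ range q, g (q * k + x) = ∑ r ∈ range q, g r := by
        apply Finset.sum_congr rfl; intro x _; rw [add_comm, hper']
      rw [this]; push_cast; ring
  have h2 : ∑ d ∈ Ioc 0 D, g d ≤ ∑ d ∈ range (q * (D / q + 1)), g d := by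
    apply Finset.sum_le_sum_of_subset_of_nonneg
    · intro d hd
      rw [mem_Ioc] at hd
      rw [mem_range]
      have := Nat.lt_mul_div_succ D hq
      omega
    · intros; exact hg _
  rw [h1] at h2
  refine h2.trans ?_
  gcongr
  push_cast
  gcongr
  exact Nat.cast_div_le

/-- part (ii) -/
lemma sum_inv_nn (q : ℕ) (hq : 0 < q) (a : ℤ) (ha : IsCoprime a q) (D : ℕ) :
    ∑ d ∈ (Ioc 0 D).filter (fun d => ¬ q ∣ d), 1 / nn (d * (a / q : ℝ)) ≤ 2 * (D + q) * (1 + Real.log q) := by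
  have hqR : (0 : ℝ) < q := by exact_mod_cast hq
  have hq' : (0 : ℤ) < q := by exact_mod_cast hq
  have h1 : ∑ d ∈ (Ioc 0 D).filter (fun d => ¬ q ∣ d), 1 / nn (d * (a / q : ℝ)) ≤ ∑ d ∈ Ioc 0 D, ww q (((0 + a * d) % q).toNat) := by
    rw [Finset.sum_filter]
    apply Finset.sum_le_sum
    intro d hd
    split_ifs with h
    · apply ww_nonneg
      have h1 := Int.emod_nonneg (0 + a * d) hq'.ne'
      have h2 := Int.emod_lt_of_pos (0 + a * d) hq'
      omega
    · have e : (d : ℝ) * (a / q : ℝ) = ((0 + a * d : ℤ) : ℝ) / q := by push_cast; ring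
      rw [e]
      apply inv_nn_le_ww q hq
      intro h0
      apply h
      have h1 := Int.emod_nonneg (0 + a * d) hq'.ne'
      have h2 : (0 + a * d) % q = 0 := by omega
      rw [zero_add] at h2
      have h3 : (q : ℤ) ∣ a * d := Int.dvd_of_emod_eq_zero h2
      exact_mod_cast (ha.symm).dvd_of_dvd_mul_left h3
  refine h1.trans ((sum_periodic_le q hq (fun d => ww q (((0 + a * d) % q).toNat)) ?_ ?_ D).trans ?_)
  · intro d
    apply ww_nonneg
    have h1 := Int.emod_nonneg (0 + a * d) hq'.ne'
    have h2 := Int.emod_lt_of_pos (0 + a * d) hq'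
    omega
  · intro d
    have : (0 + a * ((d + q : ℕ) : ℤ)) % q = (0 + a * d) % q := by
      push_cast
      rw [mul_add, ← add_assoc, Int.add_mul_emod_self_right]
    simp only [this]
  · rw [perm_sum q hq a 0 ha]
    have h2 := sum_ww q hq
    calc ((D : ℝ) / q + 1) * ∑ r ∈ range q, ww q r ≤ ((D : ℝ) / q + 1) * (2 * q * (1 + Real.log q)) := by gcongr
      _ = _ := by field_simp
end FP


namespace FP
open Finset
open scoped ArithmeticFunction.Moebius ArithmeticFunction.vonMangoldt ArithmeticFunction.zeta

noncomputable def cc (N d : ℕ) : ℝ := (μ d : ℝ) * Real.log ((N : ℝ) / d) ^ 2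

noncomputable def EE (N : ℕ) (α : ℝ) (d : ℕ) : ℂ := ∑ m ∈ Ioc 0 (N / d), ee (((d * m : ℕ) : ℝ) * α)

lemma abs_moeb (d : ℕ) : |(μ d : ℝ)| ≤ 1 := by exact_mod_cast ArithmeticFunction.abs_moebius_le_one

lemma abs_cc (N d : ℕ) : |cc N d| ≤ Real.log ((N : ℝ) / d) ^ 2 := by
  unfold cc
  rw [abs_mul, abs_of_nonneg (sq_nonneg (Real.log ((N : ℝ) / d)))]
  have := abs_moeb d
  nlinarith [sq_nonneg (Real.log ((N : ℝ) / d))]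

lemma log_div_le {N d : ℕ} {H : ℝ} (hd : 0 < d) (hdN : d ≤ N) (h : (N : ℝ) ≤ H * d) :
    Real.log ((N : ℝ) / d) ^ 2 ≤ Real.log H ^ 2 := by
  have hd0 : (0 : ℝ) < d := by exact_mod_cast hd
  have h1 : (1 : ℝ) ≤ N / d := by rw [le_div_iff₀ hd0, one_mul]; exact_mod_cast hdN
  have h2 : (N : ℝ) / d ≤ H := by rwa [div_le_iff₀ hd0]
  have h3 := Real.log_nonneg h1
  have h4 := Real.log_le_log (by linarith) h2
  gcongr

lemma norm_EE (N : ℕ) (α : ℝ) (d : ℕ) : ‖EE N α d‖ ≤ (N : ℝ) / d := by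
  unfold EE
  refine (norm_sum_le _ _).trans ?_
  simp only [norm_ee, sum_const, Nat.card_Ioc, nsmul_eq_mul, mul_one, tsub_zero]
  exact Nat.cast_div_le

lemma norm_cc_EE (N : ℕ) (α : ℝ) (d : ℕ) (c b : ℝ) (hc : Real.log ((N : ℝ) / d) ^ 2 ≤ c) (hb : ‖EE N α d‖ ≤ b) :
    ‖(cc N d : ℂ) * EE N α d‖ ≤ c * b := by
  rw [norm_mul, Complex.norm_real, Real.norm_eq_abs]
  have := (abs_cc N d).trans hc
  have h2 := norm_nonneg (EE N α d)
  have h3 := abs_nonneg (cc N d)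
  exact mul_le_mul this hb h2 (h3.trans this)

lemma T1 (N D : ℕ) (α H : ℝ) (hD : D ≤ N) (hN : 0 < N) (hH : 1 ≤ H) (h : (N : ℝ) ≤ 2 * H * (D + 1)) :
    ‖∑ d ∈ Ioc D N, (cc N d : ℂ) * EE N α d‖ ≤ N * (1 + Real.log (2 * H)) ^ 3 := by
  have hl : 0 ≤ Real.log (2 * H) := Real.log_nonneg (by linarith)
  have hNR : (0 : ℝ) < N := by exact_mod_cast hN
  have h1 : ∀ d ∈ Ioc D N, ‖(cc N d : ℂ) * EE N α d‖ ≤ Real.log (2 * H) ^ 2 * N * (1 / d) := by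
    intro d hd
    rw [mem_Ioc] at hd
    have hdD : (D : ℝ) + 1 ≤ d := by exact_mod_cast hd.1
    have := norm_cc_EE N α d _ _ (log_div_le (N := N) (d := d) (H := 2 * H) (by omega) hd.2 (by nlinarith)) (norm_EE N α d)
    refine this.trans (le_of_eq ?_); ring
  refine (norm_sum_le_of_le _ h1).trans ?_
  rw [← Finset.mul_sum]
  have h2 := sum_Ioc_inv_le D N hD
  have h3 : Real.log N ≤ Real.log (2 * H) + Real.log (D + 1) := by
    rw [← Real.log_mul (by linarith) (by positivity)]
    exact Real.log_le_log hNR h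
  calc Real.log (2 * H) ^ 2 * N * ∑ i ∈ Ioc D N, 1 / (i : ℝ) ≤ (1 + Real.log (2 * H)) ^ 2 * N * (1 + Real.log (2 * H)) := by
        gcongr <;> linarith
    _ = _ := by ring

lemma T2 (N D q : ℕ) (hq : 0 < q) (a : ℤ) (ha : IsCoprime a q) (β H : ℝ) (hH : 1 ≤ H) (hN : 0 < N) (hDN : D ≤ N)
    (hD : 2 * H * D ≤ N) (hβ : |β| ≤ H / (q * N)) :
    ‖∑ d ∈ (Ioc 0 D).filter (fun d => ¬ q ∣ d), (cc N d : ℂ) * EE N (a / q + β) d‖ ≤ Real.log N ^ 2 * (2 * (D + q) * (1 + Real.log q)) := by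
  have hNR : (0 : ℝ) < N := by exact_mod_cast hN
  have hqR : (0 : ℝ) < q := by exact_mod_cast hq
  have h1 : ∀ d ∈ (Ioc 0 D).filter (fun d => ¬ q ∣ d), ‖(cc N d : ℂ) * EE N (a / q + β) d‖ ≤ Real.log N ^ 2 * (1 / nn (d * (a / q : ℝ))) := by
    intro d hd
    rw [mem_filter, mem_Ioc] at hd
    have hd1 : (1 : ℝ) ≤ d := by exact_mod_cast hd.1.1
    have hdD : (d : ℝ) ≤ D := by exact_mod_cast hd.1.2
    apply norm_cc_EE
    · apply log_div_le hd.1.1 (by omega); nlinarith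
    · have e : (d : ℝ) * (a / q : ℝ) = ((d * a : ℤ) : ℝ) / q := by push_cast; ring
      have h2 : 1 / (q : ℝ) ≤ nn (d * (a / q : ℝ)) := by
        rw [e]; apply nn_frac_ge hq
        intro h
        apply hd.2
        exact_mod_cast (ha.symm).dvd_of_dvd_mul_right h
      have h3 : |d * β| ≤ 1 / (2 * q) := by
        rw [abs_mul, abs_of_pos (by linarith : (0 : ℝ) < d)]
        calc (d : ℝ) * |β| ≤ D * (H / (q * N)) := by gcongr
          _ = (2 * H * D) / (2 * q * N) := by field_simp
          _ ≤ N / (2 * q * N) := by gcongr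
          _ = 1 / (2 * q) := by field_simp
      have h4 := nn_sub_le (d * (a / q : ℝ)) (d * β)
      have h5 : nn (d * (a / q : ℝ)) / 2 ≤ nn (d * (a / q + β)) := by
        rw [mul_add]
        have : 1 / (2 * (q : ℝ)) = (1 / q) / 2 := by field_simp
        linarith
      have h0 : 0 < nn (d * (a / q : ℝ)) := lt_of_lt_of_le (by positivity) h2
      have := geom_le (d * (a / q + β)) _ (by positivity) h5 0 (N / d)
      unfold EE
      refine le_trans (le_of_eq ?_) (this.trans (le_of_eq ?_))
      · congr 1
        apply Finset.sum_congr rfl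
        intro m _
        congr 1; push_cast; ring
      · field_simp
  refine (norm_sum_le_of_le _ h1).trans ?_
  rw [← Finset.mul_sum]
  gcongr
  exact sum_inv_nn q hq a ha D

lemma sum_filter_dvd {β : Type*} [AddCommMonoid β] (q D : ℕ) (hq : 0 < q) (g : ℕ → β) :
    ∑ d ∈ (Ioc 0 D).filter (fun d => q ∣ d), g d = ∑ k ∈ Ioc 0 (D / q), g (q * k) := by
  symm
  apply Finset.sum_bij (fun k _ => q * k)
  · intro k hk
    rw [mem_Ioc, Nat.le_div_iff_mul_le hq, mul_comm] at hk
    rw [mem_filter, mem_Ioc]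
    exact ⟨⟨Nat.mul_pos hq hk.1, hk.2⟩, dvd_mul_right _ _⟩
  · intro a _ b _ h; exact Nat.eq_of_mul_eq_mul_left hq h
  · intro d hd
    rw [mem_filter, mem_Ioc] at hd
    obtain ⟨⟨h1, h2⟩, k, rfl⟩ := hd
    refine ⟨k, ?_, rfl⟩
    rw [mem_Ioc, Nat.le_div_iff_mul_le hq, mul_comm]
    exact ⟨Nat.pos_of_mul_pos_left h1, h2⟩
  · intros; rfl

lemma EE_dvd (N q k : ℕ) (hq : 0 < q) (a : ℤ) (β : ℝ) :
    EE N (a / q + β) (q * k) = ∑ m ∈ Ioc 0 (N / (q * k)), ee (m * (((q * k : ℕ) : ℝ) * β)) := by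
  have hqR : (0 : ℝ) < q := by exact_mod_cast hq
  unfold EE
  apply Finset.sum_congr rfl
  intro m _
  have : ((q * k * m : ℕ) : ℝ) * (a / q + β) = m * (((q * k : ℕ) : ℝ) * β) + ((k * m * a : ℤ) : ℝ) := by
    push_cast; field_simp; ring
  rw [this, ee_add_int]

noncomputable def b1 (N : ℕ) (β : ℝ) : ℝ := max 1 (N * |β|)

lemma b1_ge (N : ℕ) (β : ℝ) : 1 ≤ b1 N β := le_max_left _ _

lemma norm_EE_dvd (N q k : ℕ) (hq : 0 < q) (hk : 0 < k) (a : ℤ) (β : ℝ) (hd : ((q * k : ℕ) : ℝ) * |β| ≤ 1 / 2) :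
    ‖EE N (a / q + β) (q * k)‖ ≤ N / (((q * k : ℕ) : ℝ) * b1 N β) := by
  have hd0 : (0 : ℝ) < ((q * k : ℕ) : ℝ) := by exact_mod_cast Nat.mul_pos hq hk
  unfold b1
  rcases max_cases 1 (N * |β|) with ⟨h, _⟩ | ⟨h, h'⟩
  · rw [h, mul_one]; exact norm_EE _ _ _
  · rw [h, EE_dvd N q k hq]
    have hβ : 0 < |β| := by
      rcases (abs_nonneg β).eq_or_lt with h0 | h0
      · rw [← h0] at h'; norm_num at h'
      · exact h0
    have hN : (0 : ℝ) < N := by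
      rcases (Nat.cast_nonneg N : (0 : ℝ) ≤ N).eq_or_lt with h0 | h0
      · rw [← h0] at h'; norm_num at h'
      · exact h0
    have hnn : ((q * k : ℕ) : ℝ) * |β| ≤ nn (((q * k : ℕ) : ℝ) * β) := by
      unfold nn
      set θ := ((q * k : ℕ) : ℝ) * β with hθ
      have hθa : |θ| = ((q * k : ℕ) : ℝ) * |β| := by rw [hθ, abs_mul, abs_of_pos hd0]
      rw [← hθa] at hd ⊢
      have := round_le θ 0
      by_cases hr : round θ = 0
      · rw [hr]; simp
      · have h1 : (1 : ℝ) ≤ |((round θ : ℤ) : ℝ)| := by exact_mod_cast Int.one_le_abs hr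
        have h2 := abs_sub_abs_le_abs_sub ((round θ : ℤ) : ℝ) θ
        rw [abs_sub_comm] at h2
        linarith
    refine (geom_le _ _ (by positivity) hnn 0 _).trans ?_
    rw [div_le_div_iff₀ (by positivity) (by positivity)]
    nlinarith [mul_pos hd0 (mul_pos hN hβ)]

lemma T3a (N D q : ℕ) (hq : 0 < q) (a : ℤ) (β H : ℝ) (hH : 1 ≤ H) (hN : 0 < N) (hDN : D ≤ N)
    (hD : 2 * H * D ≤ N) (hβ : |β| ≤ H / (q * N)) :
    ‖∑ d ∈ (Ioc 0 D).filter (fun d => q ∣ d), (cc N d : ℂ) * EE N (a / q + β) d‖ ≤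
      Real.log N ^ 2 * (1 + Real.log N) * (N / (q * b1 N β)) := by
  have hNR : (0 : ℝ) < N := by exact_mod_cast hN
  have hqR : (0 : ℝ) < q := by exact_mod_cast hq
  have hq1 : (1 : ℝ) ≤ q := by exact_mod_cast hq
  have hb := b1_ge N β
  rw [sum_filter_dvd q D hq]
  have h1 : ∀ k ∈ Ioc 0 (D / q), ‖(cc N (q * k) : ℂ) * EE N (a / q + β) (q * k)‖ ≤ Real.log N ^ 2 * (N / (q * b1 N β)) * (1 / k) := by
    intro k hk
    rw [mem_Ioc, Nat.le_div_iff_mul_le hq, mul_comm] at hk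
    have hk0 : (0 : ℝ) < k := by exact_mod_cast hk.1
    have hd1 : (1 : ℝ) ≤ (q * k : ℕ) := by exact_mod_cast Nat.mul_pos hq hk.1
    have hdD : ((q * k : ℕ) : ℝ) ≤ D := by exact_mod_cast hk.2
    have := norm_cc_EE N (a / q + β) (q * k) (Real.log N ^ 2) (N / (((q * k : ℕ) : ℝ) * b1 N β)) ?_ ?_
    · refine this.trans (le_of_eq ?_)
      push_cast; field_simp
    · apply log_div_le (Nat.mul_pos hq hk.1) (by omega); nlinarith
    · apply norm_EE_dvd N q k hq hk.1
      calc ((q * k : ℕ) : ℝ) * |β| ≤ D * (H / (q * N)) := by gcongr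
          _ = (2 * H * D) / (2 * q * N) := by field_simp
          _ ≤ N / (2 * q * N) := by gcongr
          _ = 1 / (2 * q) := by field_simp
          _ ≤ 1 / 2 := by apply one_div_le_one_div_of_le <;> linarith
  refine (norm_sum_le_of_le _ h1).trans ?_
  rw [← Finset.mul_sum, sum_Ioc_inv]
  have h2 := harm_le (D / q)
  have h3 : Real.log (D / q : ℕ) ≤ Real.log N := by
    rcases Nat.eq_zero_or_pos (D / q) with h | h
    · rw [h]; simp; apply Real.log_nonneg; exact_mod_cast hN
    · apply Real.log_le_log (by exact_mod_cast h)
      exact_mod_cast (Nat.div_le_self D q).trans hDN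
  calc _ ≤ Real.log N ^ 2 * (N / (q * b1 N β)) * (1 + Real.log N) := by gcongr; linarith
    _ = _ := by ring

lemma sum_int_approx (y θ : ℝ) (hy : 0 ≤ y) :
    ‖∑ m ∈ Ioc 0 ⌊y⌋₊, ee (m * θ) - ∫ t in (0 : ℝ)..y, ee (t * θ)‖ ≤ 2 * Real.pi * |θ| * y + 1 := by
  have hc : Continuous fun t : ℝ => ee (t * θ) := continuous_ee.comp (by fun_prop)
  set K := ⌊y⌋₊
  have hK : (K : ℝ) ≤ y := Nat.floor_le hy
  have h1 : ∫ t in (0 : ℝ)..y, ee (t * θ) = (∑ k ∈ range K, ∫ t in (k : ℝ)..(k + 1 : ℕ), ee (t * θ)) + ∫ t in (K : ℝ)..y, ee (t * θ) := by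
    rw [intervalIntegral.sum_integral_adjacent_intervals (a := fun k : ℕ => (k : ℝ)) (fun k _ => hc.intervalIntegrable _ _)]
    simp only [Nat.cast_zero]
    rw [intervalIntegral.integral_add_adjacent_intervals (hc.intervalIntegrable _ _) (hc.intervalIntegrable _ _)]
  have h2 : ∑ m ∈ Ioc 0 K, ee (m * θ) = ∑ k ∈ range K, ee ((k + 1 : ℕ) * θ) := by
    rw [Finset.range_eq_Ico, Finset.sum_Ico_add' (fun m : ℕ => ee (m * θ)) 0 K 1]
    rfl
  rw [h1, h2, ← sub_sub, ← Finset.sum_sub_distrib]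
  have h3 : ∀ k ∈ range K, ‖ee ((k + 1 : ℕ) * θ) - ∫ t in (k : ℝ)..(k + 1 : ℕ), ee (t * θ)‖ ≤ 2 * Real.pi * |θ| := by
    intro k _
    have : ee ((k + 1 : ℕ) * θ) = ∫ t in (k : ℝ)..(k + 1 : ℕ), ee ((k + 1 : ℕ) * θ) := by simp
    rw [this, ← intervalIntegral.integral_sub (by simp) (hc.intervalIntegrable _ _)]
    refine (intervalIntegral.norm_integral_le_of_norm_le_const (C := 2 * Real.pi * |θ|) ?_).trans ?_
    · intro t ht
      refine (norm_ee_sub_ee_le _ _).trans ?_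
      rw [← sub_mul, abs_mul]
      have : |((k + 1 : ℕ) : ℝ) - t| ≤ 1 := by
        rw [Set.uIoc_of_le (by push_cast; linarith)] at ht
        obtain ⟨h1, h2⟩ := ht
        rw [abs_le]; push_cast at *; constructor <;> linarith
      have h0 := Real.pi_pos
      calc 2 * Real.pi * (|((k + 1 : ℕ) : ℝ) - t| * |θ|) ≤ 2 * Real.pi * (1 * |θ|) := by gcongr
        _ = _ := by ring
    · push_cast; simp
  have h4 : ‖∫ t in (K : ℝ)..y, ee (t * θ)‖ ≤ 1 := by
    refine (intervalIntegral.norm_integral_le_of_norm_le_const (C := 1) ?_).trans ?_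
    · intro t _; rw [norm_ee]
    · rw [one_mul, abs_of_nonneg (by linarith)]
      have := Nat.lt_floor_add_one y
      linarith
  refine (norm_sub_le _ _).trans ?_
  have h5 := norm_sum_le_of_le _ h3
  rw [Finset.sum_const, Finset.card_range, nsmul_eq_mul] at h5
  have h6 : (K : ℝ) * (2 * Real.pi * |θ|) ≤ 2 * Real.pi * |θ| * y := by
    rw [mul_comm]; have := Real.pi_pos; gcongr
  linarith

noncomputable def JJ (N : ℕ) (β : ℝ) : ℂ := ∫ t in (0 : ℝ)..N, ee (t * β)

lemma norm_JJ (N : ℕ) (β : ℝ) : ‖JJ N β‖ ≤ N / b1 N β := by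
  unfold b1
  rcases max_cases 1 (N * |β|) with ⟨h, _⟩ | ⟨h, h'⟩
  · rw [h, div_one]
    refine (intervalIntegral.norm_integral_le_of_norm_le_const (C := 1) ?_).trans ?_
    · intro t _; rw [norm_ee]
    · simp
  · rw [h]
    have hβ : 0 < |β| := by
      rcases (abs_nonneg β).eq_or_lt with h0 | h0
      · rw [← h0] at h'; norm_num at h'
      · exact h0
    have hN : (0 : ℝ) < N := by
      rcases (Nat.cast_nonneg N : (0 : ℝ) ≤ N).eq_or_lt with h0 | h0
      · rw [← h0] at h'; norm_num at h'
      · exact h0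
    have hβ' : β ≠ 0 := abs_pos.1 hβ
    have hc : (2 * Real.pi * β : ℂ) * Complex.I ≠ 0 := by
      simp [hβ', Real.pi_ne_zero]
    have e : JJ N β = (ee (N * β) - 1) / ((2 * Real.pi * β : ℂ) * Complex.I) := by
      unfold JJ
      have : ∀ t : ℝ, ee (t * β) = Complex.exp ((2 * Real.pi * β : ℂ) * Complex.I * t) := by
        intro t; unfold ee; congr 1; push_cast; ring
      simp_rw [this]
      rw [integral_exp_mul_complex hc, ← this]
      have h0 := this 0
      rw [zero_mul, ee_zero] at h0
      rw [← h0]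
    rw [e, norm_div]
    have n1 : ‖ee (N * β) - 1‖ ≤ 2 := by
      refine (norm_sub_le _ _).trans ?_
      rw [norm_ee, norm_one]; norm_num
    have n2 : ‖(2 * Real.pi * β : ℂ) * Complex.I‖ = 2 * Real.pi * |β| := by
      simp [abs_of_pos Real.pi_pos]
    rw [n2, div_le_div_iff₀ (by have := Real.pi_pos; positivity) (by positivity)]
    have := Real.pi_gt_three
    calc ‖ee (N * β) - 1‖ * (N * |β|) ≤ 2 * (N * |β|) := by gcongr
      _ ≤ N * (2 * Real.pi * |β|) := by nlinarith [mul_pos hN hβ]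

lemma EE_approx (N q k : ℕ) (hq : 0 < q) (hk : 0 < k) (a : ℤ) (β : ℝ) :
    ‖EE N (a / q + β) (q * k) - JJ N β / (q * k : ℕ)‖ ≤ 8 * b1 N β := by
  have hd0 : (0 : ℝ) < ((q * k : ℕ) : ℝ) := by exact_mod_cast Nat.mul_pos hq hk
  have h := sum_int_approx ((N : ℝ) / (q * k : ℕ)) (((q * k : ℕ) : ℝ) * β) (by positivity)
  rw [Nat.floor_div_natCast, Nat.floor_natCast, ← EE_dvd N q k hq a β] at h
  have e : ∫ t in (0 : ℝ)..((N : ℝ) / (q * k : ℕ)), ee (t * (((q * k : ℕ) : ℝ) * β)) = JJ N β / (q * k : ℕ) := by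
    have := intervalIntegral.integral_comp_mul_right (fun s => ee (s * β)) (c := ((q * k : ℕ) : ℝ)) (a := 0) (b := (N : ℝ) / (q * k : ℕ)) hd0.ne'
    rw [zero_mul, div_mul_cancel₀ _ hd0.ne'] at this
    unfold JJ
    simp_rw [← mul_assoc]
    rw [this, Complex.real_smul, div_eq_inv_mul]
    push_cast; rfl
  rw [e] at h
  refine h.trans ?_
  have e2 : 2 * Real.pi * |((q * k : ℕ) : ℝ) * β| * ((N : ℝ) / (q * k : ℕ)) = 2 * Real.pi * (N * |β|) := by
    rw [abs_mul, abs_of_pos hd0]; field_simp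
  rw [e2]
  have h1 : (1 : ℝ) ≤ b1 N β := le_max_left _ _
  have h2 : N * |β| ≤ b1 N β := le_max_right _ _
  have h3 : 0 ≤ N * |β| := by positivity
  have := Real.pi_lt_d2
  nlinarith

lemma cc_sum_FF (N q : ℕ) (hq : 0 < q) :
    ∑ k ∈ Ioc 0 (N / q), cc N (q * k) / (q * k : ℕ) = (μ q : ℝ) / q * FF q.primeFactors ((N : ℝ) / q) := by
  have hqR : (0 : ℝ) < q := by exact_mod_cast hq
  unfold FF
  rw [Nat.floor_div_natCast, Nat.floor_natCast, Finset.mul_sum, Finset.sum_filter]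
  apply Finset.sum_congr rfl
  intro k hk
  rw [mem_Ioc] at hk
  have hk0 : (0 : ℝ) < k := by exact_mod_cast hk.1
  unfold cc
  split_ifs with h
  · have hc : Nat.Coprime q k := by
      apply Nat.coprime_of_dvd
      intro p hp h1 h2
      exact h p (Nat.mem_primeFactors.2 ⟨hp, h1, hq.ne'⟩) h2
    rw [ArithmeticFunction.isMultiplicative_moebius.map_mul_of_coprime hc]
    push_cast
    rw [div_div]
    field_simp
  · push Not at h
    obtain ⟨p, hp, hpk⟩ := h
    have hpq := Nat.dvd_of_mem_primeFactors hp
    have hpp := Nat.prime_of_mem_primeFactors hp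
    have : μ (q * k) = 0 := by
      apply ArithmeticFunction.moebius_eq_zero_of_not_squarefree
      intro hsq
      have := hsq p (mul_dvd_mul hpq hpk)
      exact hpp.one_lt.ne' (Nat.isUnit_iff.1 this)
    simp [this]

lemma T3b (N D q : ℕ) (hq : 0 < q) (hqN : q ≤ N) (a : ℤ) (β H : ℝ) (hH : 1 ≤ H) (hN : 0 < N) (hDN : D ≤ N)
    (hD : 2 * H * D ≤ N) (h : (N : ℝ) ≤ 2 * H * (D + 1)) :
    ‖∑ d ∈ (Ioc 0 D).filter (fun d => q ∣ d), (cc N d : ℂ) * EE N (a / q + β) d‖ ≤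
      (N / (q * b1 N β)) * (68 * VV q.primeFactors * (1 + Real.log N) + (1 + Real.log (2 * H)) ^ 3)
        + 8 * b1 N β * Real.log N ^ 2 * D := by
  have hNR : (0 : ℝ) < N := by exact_mod_cast hN
  have hqR : (0 : ℝ) < q := by exact_mod_cast hq
  have hq1 : (1 : ℝ) ≤ q := by exact_mod_cast hq
  have hb := b1_ge N β
  have hl : 0 ≤ Real.log (2 * H) := Real.log_nonneg (by linarith)
  have hDq : D / q ≤ N / q := Nat.div_le_div_right hDN
  rw [sum_filter_dvd q D hq]
  -- main term
  have hm1 : |∑ k ∈ Ioc 0 (N / q), cc N (q * k) / (q * k : ℕ)| ≤ 1 / q * (68 * VV q.primeFactors * (1 + Real.log N)) := by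
    rw [cc_sum_FF N q hq, abs_mul, abs_div, abs_of_pos hqR]
    have h1 : (1 : ℝ) ≤ N / q := by rw [le_div_iff₀ hqR, one_mul]; exact_mod_cast hqN
    have h2 := FF_bound q.primeFactors (fun r hr => Nat.prime_of_mem_primeFactors hr) _ h1
    have h3 : Real.log ((N : ℝ) / q) ≤ Real.log N := by
      apply Real.log_le_log (by linarith); rw [div_le_iff₀ hqR]; nlinarith
    have h4 := VV_pos q.primeFactors (fun r hr => Nat.prime_of_mem_primeFactors hr)
    have h5 := abs_moeb q
    have h6 : 0 ≤ Real.log ((N : ℝ) / q) := Real.log_nonneg h1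
    calc |(μ q : ℝ)| / q * |FF q.primeFactors ((N : ℝ) / q)| ≤ 1 / q * (68 * VV q.primeFactors * (1 + Real.log ((N : ℝ) / q))) := by
          gcongr
      _ ≤ _ := by gcongr
  have hm2 : |∑ k ∈ Ioc (D / q) (N / q), cc N (q * k) / (q * k : ℕ)| ≤ 1 / q * (1 + Real.log (2 * H)) ^ 3 := by
    have hDq1 : ((D : ℝ) + 1) ≤ q * ((D / q : ℕ) + 1) := by
      have := Nat.lt_mul_div_succ D hq
      exact_mod_cast this
    have h1 : ∀ k ∈ Ioc (D / q) (N / q), |cc N (q * k) / (q * k : ℕ)| ≤ 1 / q * Real.log (2 * H) ^ 2 * (1 / k) := by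
      intro k hk
      rw [mem_Ioc, Nat.le_div_iff_mul_le hq, mul_comm k] at hk
      have hk0 : (0 : ℝ) < k := by exact_mod_cast (Nat.zero_le _).trans_lt hk.1
      have hkD : ((D / q : ℕ) : ℝ) + 1 ≤ k := by exact_mod_cast hk.1
      have hD2 : (D : ℝ) + 1 ≤ q * k := hDq1.trans (by gcongr)
      rw [abs_div]
      have := (abs_cc N (q * k)).trans (log_div_le (H := 2 * H) (Nat.mul_pos hq ((Nat.zero_le _).trans_lt hk.1)) hk.2 (h.trans (by push_cast; gcongr)))
      rw [abs_of_nonneg (by positivity : (0 : ℝ) ≤ (q * k : ℕ))]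
      calc |cc N (q * k)| / (q * k : ℕ) ≤ Real.log (2 * H) ^ 2 / (q * k : ℕ) := by gcongr
        _ = _ := by push_cast; field_simp
    refine (Finset.abs_sum_le_sum_abs _ _).trans ((Finset.sum_le_sum h1).trans ?_)
    rw [← Finset.mul_sum]
    have h2 := sum_Ioc_inv_le (D / q) (N / q) hDq
    have h3 : Real.log (N / q : ℕ) ≤ Real.log (2 * H) + Real.log ((D / q : ℕ) + 1) := by
      rw [← Real.log_mul (by linarith) (by positivity)]
      apply Real.log_le_log
      · exact_mod_cast Nat.div_pos hqN hq
      · refine Nat.cast_div_le.trans ?_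
        rw [div_le_iff₀ hqR]
        calc (N : ℝ) ≤ 2 * H * (q * ((D / q : ℕ) + 1)) := h.trans (by gcongr)
          _ = _ := by ring
    calc 1 / q * Real.log (2 * H) ^ 2 * ∑ i ∈ Ioc (D / q) (N / q), 1 / (i : ℝ) ≤ 1 / q * (1 + Real.log (2 * H)) ^ 2 * (1 + Real.log (2 * H)) := by
          gcongr <;> linarith
      _ = _ := by ring
  have hm : |∑ k ∈ Ioc 0 (D / q), cc N (q * k) / (q * k : ℕ)| ≤ 1 / q * (68 * VV q.primeFactors * (1 + Real.log N) + (1 + Real.log (2 * H)) ^ 3) := by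
    have e := Finset.sum_Ioc_consecutive (fun k : ℕ => cc N (q * k) / (q * k : ℕ)) (Nat.zero_le (D / q)) hDq
    have e2 : ∑ k ∈ Ioc 0 (D / q), cc N (q * k) / (q * k : ℕ) = ∑ k ∈ Ioc 0 (N / q), cc N (q * k) / (q * k : ℕ) - ∑ k ∈ Ioc (D / q) (N / q), cc N (q * k) / (q * k : ℕ) := by
      rw [← e]; ring
    rw [e2]
    refine (abs_sub _ _).trans ?_
    rw [mul_add]
    exact add_le_add hm1 hm2
  have hsplit : ∑ k ∈ Ioc 0 (D / q), (cc N (q * k) : ℂ) * EE N (a / q + β) (q * k) =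
      JJ N β * ((∑ k ∈ Ioc 0 (D / q), cc N (q * k) / (q * k : ℕ) : ℝ) : ℂ) +
      ∑ k ∈ Ioc 0 (D / q), (cc N (q * k) : ℂ) * (EE N (a / q + β) (q * k) - JJ N β / (q * k : ℕ)) := by
    push_cast
    rw [Finset.mul_sum, ← Finset.sum_add_distrib]
    apply Finset.sum_congr rfl
    intro k _
    ring
  rw [hsplit]
  refine (norm_add_le _ _).trans (add_le_add ?_ ?_)
  · rw [norm_mul, Complex.norm_real, Real.norm_eq_abs]
    calc ‖JJ N β‖ * _ ≤ N / b1 N β * (1 / q * (68 * VV q.primeFactors * (1 + Real.log N) + (1 + Real.log (2 * H)) ^ 3)) := by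
          have := norm_JJ N β
          gcongr
      _ = _ := by field_simp
  · have h1 : ∀ k ∈ Ioc 0 (D / q), ‖(cc N (q * k) : ℂ) * (EE N (a / q + β) (q * k) - JJ N β / (q * k : ℕ))‖ ≤ Real.log N ^ 2 * (8 * b1 N β) := by
      intro k hk
      rw [mem_Ioc, Nat.le_div_iff_mul_le hq, mul_comm k] at hk
      rw [norm_mul, Complex.norm_real, Real.norm_eq_abs]
      have hd1 : (1 : ℝ) ≤ (q * k : ℕ) := by exact_mod_cast Nat.mul_pos hq hk.1
      have := (abs_cc N (q * k)).trans (log_div_le (H := N) (Nat.mul_pos hq hk.1) (by omega) (by nlinarith))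
      have h3 := EE_approx N q k hq hk.1 a β
      gcongr
    refine (norm_sum_le_of_le _ h1).trans ?_
    rw [Finset.sum_const, Nat.card_Ioc, nsmul_eq_mul]
    have : ((D / q - 0 : ℕ) : ℝ) ≤ D := by exact_mod_cast Nat.div_le_self D q
    calc ((D / q - 0 : ℕ) : ℝ) * (Real.log N ^ 2 * (8 * b1 N β)) ≤ D * (Real.log N ^ 2 * (8 * b1 N β)) := by gcongr
      _ = _ := by ring
end FP


namespace FP
open Finset

noncomputable def th (n : ℕ) : ℝ := if n.Prime then Real.log n else 0

lemma th_nonneg (n : ℕ) : 0 ≤ th n := by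
  unfold th; split_ifs
  · exact Real.log_natCast_nonneg n
  · rfl

lemma th_zero : th 0 = 0 := by simp [th]

lemma sum_th (K : ℕ) : ∑ u ∈ Ioc 0 K, th u ≤ 2 * K := by
  have := theta_pr_le K
  unfold pr at this
  rwa [Finset.sum_filter] at this

lemma sum_th_sub (K : ℕ) (s : Finset ℕ) (hs : s ⊆ Ioc 0 K) : ∑ u ∈ s, th u ≤ 2 * K :=
  (Finset.sum_le_sum_of_subset_of_nonneg hs fun _ _ _ => th_nonneg _).trans (sum_th K)

lemma bt2 (q A B c : ℕ) (hq : 0 < q) (hAB : A < B) (h : 4 * (q : ℝ) ^ 2 * (B : ℝ) ^ (1 / 4 : ℝ) ≤ (B : ℝ) - A) :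
    ∑ n ∈ (Ioc A B).filter (fun n => n ≡ c [MOD q]), th n ≤ 1026 * ((B : ℝ) - A) / q.totient := by
  have hB1 : (1 : ℝ) ≤ B := by exact_mod_cast (by omega : 1 ≤ B)
  set r : ℝ := (B : ℝ) ^ (1 / 8 : ℝ) with hr
  have hr1 : 1 ≤ r := Real.one_le_rpow hB1 (by norm_num)
  have hr8 : r ^ 8 = B := by
    rw [hr, ← Real.rpow_natCast, ← Real.rpow_mul (by positivity)]; norm_num
  have hr2 : r ^ 2 = (B : ℝ) ^ (1 / 4 : ℝ) := by
    rw [hr, ← Real.rpow_natCast, ← Real.rpow_mul (by positivity)]; norm_num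
  have hR1 := Nat.le_ceil r
  have hR2 : (⌈r⌉₊ : ℝ) ≤ 2 * r := by have := Nat.ceil_lt_add_one (by linarith : 0 ≤ r); linarith
  have := bt q ⌈r⌉₊ A B c hq hAB ?_ ?_
  · refine le_trans (le_of_eq ?_) this
    unfold prap th
    rw [Finset.sum_filter, Finset.sum_filter]
    apply Finset.sum_congr rfl
    intro n _
    by_cases h1 : n ≡ c [MOD q] <;> by_cases h2 : n.Prime <;> simp [h1, h2]
  · have : ((q ^ 2 * ⌈r⌉₊ ^ 2 : ℕ) : ℝ) ≤ ((B - A : ℕ) : ℝ) := by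
      rw [Nat.cast_sub hAB.le]
      push_cast
      refine le_trans ?_ h
      rw [← hr2]
      calc (q : ℝ) ^ 2 * (⌈r⌉₊ : ℝ) ^ 2 ≤ (q : ℝ) ^ 2 * (2 * r) ^ 2 := by gcongr
        _ = _ := by ring
    exact_mod_cast this
  · have : (B : ℝ) ≤ ((⌈r⌉₊ ^ 8 : ℕ) : ℝ) := by
      push_cast; rw [← hr8]; gcongr
    exact_mod_cast this

lemma bt3 (q A B c : ℕ) (hq : 0 < q) (P X : ℝ) (hP : 100 ≤ P) (hX : P ^ 16 ≤ X) (hqP : q ≤ P)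
    (hB : (B : ℝ) ≤ 8 * X) (hAB : X / P ^ 6 ≤ (B : ℝ) - A) :
    ∑ n ∈ (Ioc A B).filter (fun n => n ≡ c [MOD q]), th n ≤ 1026 * ((B : ℝ) - A) / q.totient := by
  have hP0 : 0 < P := by linarith
  have hX0 : 0 < X := lt_of_lt_of_le (by positivity) hX
  have h0 : 0 < X / P ^ 6 := by positivity
  apply bt2 q A B c hq
  · have : (A : ℝ) < B := by linarith
    exact_mod_cast this
  · refine le_trans ?_ hAB
    set s : ℝ := X ^ (1 / 4 : ℝ) with hs
    have hs4 : s ^ 4 = X := by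
      rw [hs, ← Real.rpow_natCast, ← Real.rpow_mul (by positivity)]; norm_num
    have hs0 : 0 < s := by positivity
    have hsP : P ^ 4 ≤ s := by
      have : (P ^ 4) ^ 4 ≤ s ^ 4 := by rw [hs4, ← pow_mul]; exact hX
      exact le_of_pow_le_pow_left₀ (by norm_num) hs0.le this
    have hB4 : (B : ℝ) ^ (1 / 4 : ℝ) ≤ 2 * s := by
      calc (B : ℝ) ^ (1 / 4 : ℝ) ≤ (16 * X) ^ (1 / 4 : ℝ) := by gcongr; linarith
        _ = 2 * s := by
          rw [Real.mul_rpow (by norm_num) hX0.le, show (16 : ℝ) = 2 ^ (4 : ℝ) by norm_num, ← Real.rpow_mul (by norm_num)]; norm_num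
          exact hs
    rw [le_div_iff₀ (by positivity)]
    calc 4 * (q : ℝ) ^ 2 * (B : ℝ) ^ (1 / 4 : ℝ) * P ^ 6 ≤ 4 * P ^ 2 * (2 * s) * P ^ 6 := by gcongr
      _ = 8 * (s * P ^ 8) := by ring
      _ ≤ P * (s * P ^ 8) := by gcongr; linarith
      _ = s * P ^ 9 := by ring
      _ ≤ s * P ^ 12 := by gcongr; linarith; norm_num
      _ = s * (P ^ 4) ^ 3 := by ring
      _ ≤ s * s ^ 3 := by gcongr
      _ = X := by rw [← hs4]; ring

noncomputable def ff (N M : ℕ) (α : ℝ) (v : ℕ) : ℂ :=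
  ∑ u ∈ (Ioc M (2 * M)).filter (fun u => u * v ≤ N), (th u : ℂ) * ee (((u * v : ℕ) : ℝ) * α)

lemma ff_zero (N M : ℕ) (α : ℝ) (v : ℕ) (hM : 0 < M) (hv : N / M < v) : ff N M α v = 0 := by
  unfold ff
  rw [Finset.filter_false_of_mem, Finset.sum_empty]
  intro u hu h
  rw [mem_Ioc] at hu
  have : v ≤ N / M := by
    rw [Nat.le_div_iff_mul_le hM]
    calc v * M ≤ v * u := by gcongr; omega
      _ = u * v := mul_comm _ _
      _ ≤ N := h
  omega

set_option maxHeartbeats 1000000 in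
lemma ff_shift (N M q j : ℕ) (hq : 0 < q) (hM : 0 < M) (a : ℤ) (β P ζ : ℝ) (hP : 100 ≤ P) (hMP : P ^ 16 ≤ M)
    (hζ1 : 1 ≤ ζ) (hζP : ζ ≤ P ^ 2) (hβ : N * |β| ≤ ζ) (hMN : M ≤ N)
    (hj : ((q * j : ℕ) : ℝ) ≤ (N / M : ℕ) / (4 * ζ ^ 2)) (v : ℕ) :
    ‖ff N M (a / q + β) v - ff N M (a / q + β) (v + q * j)‖ ≤ 7000 * (M / ζ) := by
  have hqR : (0 : ℝ) < q := by exact_mod_cast hq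
  have hMR : (0 : ℝ) < M := by exact_mod_cast hM
  set V := N / M with hV
  set h := q * j with hh
  have hV1 : 1 ≤ V := (Nat.one_le_div_iff hM).2 hMN
  have hV1R : (1 : ℝ) ≤ V := by exact_mod_cast hV1
  have hVN : (V : ℝ) * M ≤ N := by exact_mod_cast Nat.div_mul_le_self N M
  have hNV : (N : ℝ) ≤ 2 * M * V := by
    have : N < M * (V + 1) := Nat.lt_mul_div_succ N hM
    have : (N : ℝ) < M * (V + 1) := by exact_mod_cast this
    nlinarith
  have hζ0 : 0 < ζ := by linarith
  have hζ2 : 1 ≤ ζ ^ 2 := one_le_pow₀ hζ1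
  have hsub : (Ioc M (2 * M)).filter (fun u => u * (v + h) ≤ N) ⊆ (Ioc M (2 * M)).filter (fun u => u * v ≤ N) := by
    intro u hu
    rw [mem_filter] at hu ⊢
    refine ⟨hu.1, le_trans ?_ hu.2⟩
    gcongr; omega
  have e : ff N M (a / q + β) v - ff N M (a / q + β) (v + h) =
      ∑ u ∈ (Ioc M (2 * M)).filter (fun u => u * v ≤ N), (th u : ℂ) * (ee (((u * v : ℕ) : ℝ) * (a / q + β)) - ee (((u * (v + h) : ℕ) : ℝ) * (a / q + β)))
      + ∑ u ∈ (Ioc M (2 * M)).filter (fun u => u * v ≤ N) \ (Ioc M (2 * M)).filter (fun u => u * (v + h) ≤ N), (th u : ℂ) * ee (((u * (v + h) : ℕ) : ℝ) * (a / q + β)) := by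
    have := Finset.sum_sdiff hsub (f := fun u => (th u : ℂ) * ee (((u * (v + h) : ℕ) : ℝ) * (a / q + β)))
    unfold ff
    simp_rw [mul_sub]
    rw [Finset.sum_sub_distrib, ← this]
    ring
  rw [e]
  have hpi := Real.pi_lt_d2
  have hpi0 := Real.pi_pos
  have p1 : ‖∑ u ∈ (Ioc M (2 * M)).filter (fun u => u * v ≤ N), (th u : ℂ) * (ee (((u * v : ℕ) : ℝ) * (a / q + β)) - ee (((u * (v + h) : ℕ) : ℝ) * (a / q + β)))‖ ≤ 13 * (M / ζ) := by
    have h1 : ∀ u ∈ (Ioc M (2 * M)).filter (fun u => u * v ≤ N), ‖(th u : ℂ) * (ee (((u * v : ℕ) : ℝ) * (a / q + β)) - ee (((u * (v + h) : ℕ) : ℝ) * (a / q + β)))‖ ≤ th u * (Real.pi / ζ) := by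
      intro u hu
      rw [mem_filter, mem_Ioc] at hu
      have hu2 : (u : ℝ) ≤ 2 * M := by exact_mod_cast hu.1.2
      rw [norm_mul, Complex.norm_real, Real.norm_of_nonneg (th_nonneg u)]
      apply mul_le_mul_of_nonneg_left _ (th_nonneg u)
      have e1 : ((u * (v + h) : ℕ) : ℝ) * (a / q + β) = (((u * v : ℕ) : ℝ) * (a / q + β) + u * h * β) + ((u * j * a : ℤ) : ℝ) := by
        rw [hh]; push_cast; field_simp; ring
      rw [e1, ee_add_int]
      refine (norm_ee_sub_ee_le _ _).trans ?_
      rw [sub_add_cancel_left, abs_neg, abs_mul, abs_of_nonneg (by positivity : (0 : ℝ) ≤ u * h)]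
      calc 2 * Real.pi * ((u : ℝ) * h * |β|) ≤ 2 * Real.pi * ((2 * M) * (V / (4 * ζ ^ 2)) * |β|) := by gcongr
        _ = Real.pi / ζ ^ 2 * ((V * M) * |β|) := by field_simp; ring
        _ ≤ Real.pi / ζ ^ 2 * (N * |β|) := by gcongr
        _ ≤ Real.pi / ζ ^ 2 * ζ := by gcongr
        _ = Real.pi / ζ := by field_simp
    refine (norm_sum_le_of_le _ h1).trans ?_
    rw [← Finset.sum_mul]
    have h2 : ∑ u ∈ (Ioc M (2 * M)).filter (fun u => u * v ≤ N), th u ≤ 2 * (2 * M : ℕ) := by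
      apply sum_th_sub
      intro u hu
      rw [mem_filter, mem_Ioc] at hu
      rw [mem_Ioc]; omega
    push_cast at h2
    calc _ ≤ (2 * (2 * (M : ℝ))) * (Real.pi / ζ) := by gcongr
      _ = 4 * Real.pi * (M / ζ) := by ring
      _ ≤ 13 * (M / ζ) := by gcongr; linarith
  have p2 : ‖∑ u ∈ (Ioc M (2 * M)).filter (fun u => u * v ≤ N) \ (Ioc M (2 * M)).filter (fun u => u * (v + h) ≤ N), (th u : ℂ) * ee (((u * (v + h) : ℕ) : ℝ) * (a / q + β))‖ ≤ 6156 * (M / ζ) := by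
    have h1 : ‖∑ u ∈ (Ioc M (2 * M)).filter (fun u => u * v ≤ N) \ (Ioc M (2 * M)).filter (fun u => u * (v + h) ≤ N), (th u : ℂ) * ee (((u * (v + h) : ℕ) : ℝ) * (a / q + β))‖ ≤
        ∑ u ∈ (Ioc M (2 * M)).filter (fun u => u * v ≤ N) \ (Ioc M (2 * M)).filter (fun u => u * (v + h) ≤ N), th u := by
      apply norm_sum_le_of_le
      intro u _
      rw [norm_mul, norm_ee, mul_one, Complex.norm_real, Real.norm_of_nonneg (th_nonneg u)]
    refine h1.trans ?_
    clear h1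
    set A := N / (v + h) with hA
    set l := ⌈4 * M / ζ ^ 2⌉₊ + 1 with hl
    by_cases hex : ((Ioc M (2 * M)).filter (fun u => u * v ≤ N) \ (Ioc M (2 * M)).filter (fun u => u * (v + h) ≤ N)) = ∅
    · rw [hex]; simp; positivity
    have key : ∀ u ∈ (Ioc M (2 * M)).filter (fun u => u * v ≤ N) \ (Ioc M (2 * M)).filter (fun u => u * (v + h) ≤ N), A < u ∧ u ≤ A + l := by
      intro u hu
      simp only [mem_sdiff, mem_filter, mem_Ioc, not_and, not_le] at hu
      obtain ⟨⟨hu1, huv⟩, hu3⟩ := hu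
      have hu3 := hu3 hu1
      have hvh : 0 < v + h := by
        rcases Nat.eq_zero_or_pos (v + h) with h0 | h0
        · rw [h0] at hu3; simp at hu3
        · exact h0
      refine ⟨(Nat.div_lt_iff_lt_mul hvh).2 hu3, ?_⟩
      have hu2 : (u : ℝ) ≤ 2 * M := by exact_mod_cast hu1.2
      have hu3R : (N : ℝ) < u * (v + h) := by exact_mod_cast hu3
      have huvR : (u : ℝ) * v ≤ N := by exact_mod_cast huv
      have hvhR : (0 : ℝ) < (v : ℝ) + h := by exact_mod_cast hvh
      have hvh2 : (V : ℝ) / 2 ≤ v + h := by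
        by_contra hcon
        push Not at hcon
        have : (u : ℝ) * (v + h) ≤ 2 * M * (V / 2) := by gcongr
        nlinarith
      have hhV : (h : ℝ) ≤ V / 4 := hj.trans (by apply div_le_div_of_nonneg_left <;> nlinarith)
      have hv4 : (V : ℝ) / 4 ≤ v := by linarith
      have hv0 : (0 : ℝ) < v := by linarith
      have hAR : (N : ℝ) / (v + h) ≤ A + 1 := by
        have : N < (v + h) * (A + 1) := Nat.lt_mul_div_succ N hvh
        have : (N : ℝ) < (v + h) * (A + 1) := by exact_mod_cast this
        rw [div_le_iff₀ hvhR]; linarith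
      have hd : (N : ℝ) / v - N / (v + h) ≤ 4 * M / ζ ^ 2 := by
        have e : (N : ℝ) / v - N / (v + h) = N * h / (v * (v + h)) := by field_simp; ring
        rw [e]
        calc (N : ℝ) * h / (v * (v + h)) ≤ (2 * M * V) * (V / (4 * ζ ^ 2)) / ((V / 4) * (V / 2)) := by gcongr
          _ = 4 * M / ζ ^ 2 := by field_simp; ring
      have huN : (u : ℝ) ≤ N / v := by rw [le_div_iff₀ hv0]; exact huvR
      have : (u : ℝ) ≤ ((A + l : ℕ) : ℝ) := by
        have := Nat.le_ceil (4 * M / ζ ^ 2)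
        rw [hl]; push_cast; linarith
      exact_mod_cast this
    obtain ⟨u0, hu0⟩ := Finset.nonempty_iff_ne_empty.2 hex
    have hA2 : (A : ℝ) ≤ 2 * M := by
      have h1 := (key u0 hu0).1
      simp only [mem_sdiff, mem_filter, mem_Ioc] at hu0
      have : A ≤ 2 * M := by omega
      exact_mod_cast this
    have hM1 : 100 * ζ ^ 2 ≤ M := by
      calc 100 * ζ ^ 2 ≤ P * (P ^ 2) ^ 2 := by gcongr
        _ = P ^ 5 := by ring
        _ ≤ P ^ 16 := by gcongr; linarith; norm_num
        _ ≤ M := hMP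
    have hM2 : 100 ≤ M / ζ ^ 2 := by rw [le_div_iff₀ (by positivity)]; exact hM1
    have hl1 : (4 * M / ζ ^ 2 : ℝ) ≤ l := by
      have := Nat.le_ceil (4 * M / ζ ^ 2)
      rw [hl]; push_cast; linarith
    have hl2 : (l : ℝ) ≤ 6 * (M / ζ ^ 2) := by
      have := Nat.ceil_lt_add_one (show 0 ≤ 4 * M / ζ ^ 2 by positivity)
      have e : 4 * M / ζ ^ 2 = 4 * (M / ζ ^ 2) := by ring
      rw [hl]; push_cast; linarith
    have hMζ : (M : ℝ) / ζ ^ 2 ≤ M := div_le_self hMR.le hζ2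
    have hb := bt3 1 A (A + l) 0 one_pos P M hP hMP (by push_cast; linarith) (by push_cast; linarith) ?_
    · simp only [Nat.totient_one, Nat.cast_one, div_one, Nat.modEq_one, filter_true] at hb
      have : ∑ u ∈ (Ioc M (2 * M)).filter (fun u => u * v ≤ N) \ (Ioc M (2 * M)).filter (fun u => u * (v + h) ≤ N), th u ≤ ∑ n ∈ Ioc A (A + l), th n := by
        apply Finset.sum_le_sum_of_subset_of_nonneg
        · intro u hu; rw [mem_Ioc]; exact key u hu
        · intros; exact th_nonneg _
      refine this.trans (hb.trans ?_)
      push_cast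
      calc 1026 * ((A : ℝ) + l - A) = 1026 * l := by ring
        _ ≤ 1026 * (6 * (M / ζ ^ 2)) := by gcongr
        _ = 6156 * (M / ζ ^ 2) := by ring
        _ ≤ 6156 * (M / ζ) := by
          gcongr; nlinarith
    · push_cast
      have : (M : ℝ) / P ^ 6 ≤ 4 * M / ζ ^ 2 := by
        rw [div_le_div_iff₀ (by positivity) (by positivity)]
        have h4 : ζ ^ 2 ≤ P ^ 4 := by calc ζ ^ 2 ≤ (P ^ 2) ^ 2 := by gcongr
                                        _ = P ^ 4 := by ring
        have h6 : P ^ 4 ≤ P ^ 6 := by gcongr; linarith; norm_num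
        calc (M : ℝ) * ζ ^ 2 ≤ M * P ^ 6 := by gcongr; exact h4.trans h6
          _ ≤ 4 * M * P ^ 6 := by
            have : 0 ≤ M * P ^ 6 := by positivity
            linarith
      linarith
  refine (norm_add_le _ _).trans ?_
  have : 0 < M / ζ := by positivity
  linarith
end FP


namespace FP
open Finset

lemma inner_bt (q J w V : ℕ) (hq : 0 < q) (P : ℝ) (hP : 100 ≤ P) (hqP : (q : ℝ) ≤ P) (hV : P ^ 16 ≤ V) (hw : w ≤ V)
    (h1 : (V : ℝ) / P ^ 6 ≤ q * J) (h2 : (q : ℝ) * J ≤ V) (hJ : 0 < J) :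
    ∑ j ∈ Ioc 0 J, th (w - q * j) ≤ 2052 * (q * J) / q.totient := by
  have hV1 : (1 : ℝ) ≤ V := le_trans (one_le_pow₀ (by linarith)) hV
  have hqJ : 1 ≤ q * J := Nat.mul_pos hq hJ
  have hqJR : (1 : ℝ) ≤ q * J := by exact_mod_cast hqJ
  set A := w - (q * J + 1) with hA
  have hAw : A ≤ w := Nat.sub_le _ _
  have hAR : (A : ℝ) ≤ V := by exact_mod_cast hAw.trans hw
  have hb := bt3 q A (A + (q * J + 1)) w hq P V hP hV hqP (by push_cast; linarith) (by push_cast; linarith)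
  have e : (((A + (q * J + 1) : ℕ) : ℝ) - A) = q * J + 1 := by push_cast; ring
  rw [e] at hb
  have h3 : ∑ j ∈ Ioc 0 J, th (w - q * j) ≤ ∑ n ∈ (Ioc A (A + (q * J + 1))).filter (fun n => n ≡ w [MOD q]), th n := by
    have h4 : ∑ j ∈ Ioc 0 J, th (w - q * j) = ∑ j ∈ (Ioc 0 J).filter (fun j => q * j < w), th (w - q * j) := by
      rw [Finset.sum_filter]
      apply Finset.sum_congr rfl
      intro j _
      split_ifs with h
      · rfl
      · rw [Nat.sub_eq_zero_of_le (by omega), th_zero]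
    rw [h4]
    have hinj : Set.InjOn (fun j => w - q * j) ((Ioc 0 J).filter (fun j => q * j < w) : Finset ℕ) := by
      intro i hi j hj h
      simp only [coe_filter, mem_Ioc, Set.mem_ofPred_eq] at hi hj h
      have : q * i = q * j := by omega
      exact Nat.eq_of_mul_eq_mul_left hq this
    rw [← Finset.sum_image (f := th) hinj]
    apply Finset.sum_le_sum_of_subset_of_nonneg
    · intro n hn
      rw [mem_image] at hn
      obtain ⟨j, hj, rfl⟩ := hn
      rw [mem_filter, mem_Ioc] at hj
      have hj2 : q * j ≤ q * J := Nat.mul_le_mul_left q hj.1.2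
      have hj3 : 0 < q * j := Nat.mul_pos hq hj.1.1
      rw [mem_filter, mem_Ioc]
      refine ⟨by omega, ?_⟩
      have : (w - q * j) + q * j ≡ (w - q * j) [MOD q] := by
        simp [Nat.ModEq]
      rw [Nat.sub_add_cancel hj.2.le] at this
      exact this.symm
    · intros; exact th_nonneg _
  refine h3.trans (hb.trans ?_)
  have hφ : (0 : ℝ) < q.totient := by exact_mod_cast Nat.totient_pos.2 hq
  gcongr ?_ / _
  linarith

lemma avg_bound (N M q J : ℕ) (hq : 0 < q) (hM : 0 < M) (a : ℤ) (β P ζ : ℝ) (hP : 100 ≤ P) (hMP : P ^ 16 ≤ M) (hqP : (q : ℝ) ≤ P)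
    (hVP : P ^ 16 ≤ (N / M : ℕ))
    (hζ1 : 1 ≤ ζ) (hζP : ζ ≤ P ^ 2) (hβ : N * |β| ≤ ζ) (hMN : M ≤ N) (hJ : 0 < J)
    (hj : (q : ℝ) * J ≤ (N / M : ℕ) / (4 * ζ ^ 2)) (hj2 : ((N / M : ℕ) : ℝ) / P ^ 6 ≤ q * J) :
    ∑ v ∈ Ioc 0 (N / M), th v * ‖ff N M (a / q + β) v‖ ^ 2 ≤
      4 * (N / M : ℕ) * (7000 * (M / ζ)) ^ 2 + 4104 * (q / q.totient) * ∑ w ∈ Ioc 0 (N / M), ‖ff N M (a / q + β) w‖ ^ 2 := by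
  set V := N / M with hV
  set f := ff N M (a / q + β) with hf
  have hφ : (0 : ℝ) < q.totient := by exact_mod_cast Nat.totient_pos.2 hq
  have hJR : (0 : ℝ) < J := by exact_mod_cast hJ
  have hζ2 : 1 ≤ ζ ^ 2 := one_le_pow₀ hζ1
  have s1 : ∀ j ∈ Ioc 0 J, ∑ v ∈ Ioc 0 V, th v * ‖f v‖ ^ 2 ≤ 4 * V * (7000 * (M / ζ)) ^ 2 + 2 * ∑ w ∈ Ioc 0 V, th (w - q * j) * ‖f w‖ ^ 2 := by
    intro j hjJ
    rw [mem_Ioc] at hjJ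
    have hjR : ((q * j : ℕ) : ℝ) ≤ V / (4 * ζ ^ 2) := by
      refine le_trans ?_ hj
      push_cast
      have : (j : ℝ) ≤ J := by exact_mod_cast hjJ.2
      gcongr
    have h1 : ∀ v ∈ Ioc 0 V, th v * ‖f v‖ ^ 2 ≤ 2 * (7000 * (M / ζ)) ^ 2 * th v + 2 * (th v * ‖f (v + q * j)‖ ^ 2) := by
      intro v _
      have h2 := ff_shift N M q j hq hM a β P ζ hP hMP hζ1 hζP hβ hMN hjR v
      have h3 : ‖f v‖ ≤ 7000 * (M / ζ) + ‖f (v + q * j)‖ := by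
        have := norm_sub_norm_le (f v) (f (v + q * j))
        linarith
      have h4 : ‖f v‖ ^ 2 ≤ 2 * (7000 * (M / ζ)) ^ 2 + 2 * ‖f (v + q * j)‖ ^ 2 := by
        have h5 : ‖f v‖ ^ 2 ≤ (7000 * (M / ζ) + ‖f (v + q * j)‖) ^ 2 := by gcongr
        nlinarith [sq_nonneg (7000 * (M / ζ) - ‖f (v + q * j)‖)]
      have := mul_le_mul_of_nonneg_left h4 (th_nonneg v)
      linarith
    refine (Finset.sum_le_sum h1).trans ?_
    rw [Finset.sum_add_distrib, ← Finset.mul_sum, ← Finset.mul_sum]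
    have h5 := sum_th V
    have h6 : ∑ v ∈ Ioc 0 V, th v * ‖f (v + q * j)‖ ^ 2 ≤ ∑ w ∈ Ioc 0 V, th (w - q * j) * ‖f w‖ ^ 2 := by
      have e1 : ∑ v ∈ Ioc 0 V, th v * ‖f (v + q * j)‖ ^ 2 = ∑ v ∈ (Ioc 0 V).filter (fun v => v + q * j ≤ V), th v * ‖f (v + q * j)‖ ^ 2 := by
        rw [Finset.sum_filter]
        apply Finset.sum_congr rfl
        intro v _
        split_ifs with h
        · rfl
        · rw [hf, ff_zero N M _ _ hM (by omega)]; simp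
      have e2 : ∑ v ∈ (Ioc 0 V).filter (fun v => v + q * j ≤ V), th v * ‖f (v + q * j)‖ ^ 2 =
          ∑ w ∈ ((Ioc 0 V).filter (fun v => v + q * j ≤ V)).image (fun v => v + q * j), th (w - q * j) * ‖f w‖ ^ 2 := by
        rw [Finset.sum_image (by intro x _ y _ h; simpa using h)]
        apply Finset.sum_congr rfl
        intro v _
        rw [Nat.add_sub_cancel]
      rw [e1, e2]
      apply Finset.sum_le_sum_of_subset_of_nonneg
      · intro w hw
        rw [mem_image] at hw
        obtain ⟨v, hv, rfl⟩ := hw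
        rw [mem_filter, mem_Ioc] at hv
        rw [mem_Ioc]; omega
      · intro w _ _
        have := th_nonneg (w - q * j)
        positivity
    have h7 : 2 * (7000 * (M / ζ)) ^ 2 * ∑ v ∈ Ioc 0 V, th v ≤ 2 * (7000 * (M / ζ)) ^ 2 * (2 * V) := by gcongr
    linarith
  have s2 := Finset.sum_le_sum s1
  rw [Finset.sum_const, Nat.card_Ioc, nsmul_eq_mul, Finset.sum_add_distrib, Finset.sum_const, Nat.card_Ioc, nsmul_eq_mul, ← Finset.mul_sum,
    Finset.sum_comm, Nat.sub_zero] at s2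
  have s3 : ∑ w ∈ Ioc 0 V, ∑ j ∈ Ioc 0 J, th (w - q * j) * ‖f w‖ ^ 2 ≤ 2052 * (q * J) / q.totient * ∑ w ∈ Ioc 0 V, ‖f w‖ ^ 2 := by
    rw [Finset.mul_sum]
    apply Finset.sum_le_sum
    intro w hw
    rw [mem_Ioc] at hw
    rw [← Finset.sum_mul]
    gcongr
    apply inner_bt q J w V hq P hP hqP hVP hw.2 hj2 _ hJ
    refine hj.trans ?_
    apply div_le_self (by positivity)
    nlinarith
  have s4 : (J : ℝ) * ∑ v ∈ Ioc 0 V, th v * ‖f v‖ ^ 2 ≤ J * (4 * V * (7000 * (M / ζ)) ^ 2 + 4104 * (q / q.totient) * ∑ w ∈ Ioc 0 V, ‖f w‖ ^ 2) := by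
    calc _ ≤ _ := s2
      _ ≤ J * (4 * V * (7000 * (M / ζ)) ^ 2) + 2 * (2052 * (q * J) / q.totient * ∑ w ∈ Ioc 0 V, ‖f w‖ ^ 2) := by gcongr
      _ = _ := by ring
  exact le_of_mul_le_mul_left s4 hJR

/-- the kernel -/
noncomputable def Kr (N V : ℕ) (α : ℝ) (u u' : ℕ) : ℝ :=
  ‖∑ w ∈ Ioc 0 (min V (min (N / u) (N / u'))), ee (w * (((u : ℝ) - u') * α))‖

lemma Kr_le (N V : ℕ) (α : ℝ) (u u' : ℕ) : Kr N V α u u' ≤ V := by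
  unfold Kr
  refine (norm_sum_le _ _).trans ?_
  simp only [norm_ee, sum_const, Nat.card_Ioc, nsmul_eq_mul, mul_one, tsub_zero]
  exact_mod_cast min_le_left _ _

lemma Kr_le' (N V : ℕ) (α : ℝ) (u u' : ℕ) (δ : ℝ) (hδ : 0 < δ) (h : δ ≤ nn (((u : ℝ) - u') * α)) : Kr N V α u u' ≤ 1 / (2 * δ) :=
  geom_le _ δ hδ h 0 _

lemma energy (g : ℕ → ℝ) (hg : ∀ n, 0 ≤ g n) (N M V : ℕ) (α : ℝ) :
    ∑ w ∈ Ioc 0 V, ‖∑ u ∈ (Ioc M (2 * M)).filter (fun u => u * w ≤ N), (g u : ℂ) * ee (((u * w : ℕ) : ℝ) * α)‖ ^ 2 ≤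
      ∑ u ∈ Ioc M (2 * M), g u * ∑ u' ∈ Ioc M (2 * M), g u' * Kr N V α u u' := by
  have h1 : ∀ w : ℕ, ((‖∑ u ∈ (Ioc M (2 * M)).filter (fun u => u * w ≤ N), (g u : ℂ) * ee (((u * w : ℕ) : ℝ) * α)‖ ^ 2 : ℝ) : ℂ) =
      ∑ u ∈ Ioc M (2 * M), ∑ u' ∈ Ioc M (2 * M), (g u * g u' : ℂ) * (if u * w ≤ N ∧ u' * w ≤ N then ee (w * (((u : ℝ) - u') * α)) else 0) := by
    intro w
    push_cast
    rw [← Complex.mul_conj', map_sum, Finset.sum_mul_sum, Finset.sum_filter]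
    apply Finset.sum_congr rfl
    intro u _
    rw [Finset.sum_filter]
    by_cases h1 : u * w ≤ N
    · rw [if_pos h1]
      apply Finset.sum_congr rfl
      intro u' _
      by_cases h2 : u' * w ≤ N
      · rw [if_pos h2, if_pos ⟨h1, h2⟩, map_mul, Complex.conj_ofReal, ← ee_neg_conj]
        have : ee (w * (((u : ℝ) - u') * α)) = ee (((u * w : ℕ) : ℝ) * α) * ee (-(((u' * w : ℕ) : ℝ) * α)) := by
          rw [← ee_add]; congr 1; push_cast; ring
        rw [this]; push_cast; ring
      · rw [if_neg h2, if_neg (by tauto), mul_zero]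
    · rw [if_neg h1]
      symm
      apply Finset.sum_eq_zero
      intro u' _
      rw [if_neg (by tauto), mul_zero]
  have h2 : ((∑ w ∈ Ioc 0 V, ‖∑ u ∈ (Ioc M (2 * M)).filter (fun u => u * w ≤ N), (g u : ℂ) * ee (((u * w : ℕ) : ℝ) * α)‖ ^ 2 : ℝ) : ℂ) =
      ∑ u ∈ Ioc M (2 * M), ∑ u' ∈ Ioc M (2 * M), (g u * g u' : ℂ) * ∑ w ∈ Ioc 0 (min V (min (N / u) (N / u'))), ee (w * (((u : ℝ) - u') * α)) := by
    rw [Complex.ofReal_sum, Finset.sum_congr rfl (fun w _ => h1 w), Finset.sum_comm]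
    apply Finset.sum_congr rfl
    intro u hu
    rw [Finset.sum_comm]
    apply Finset.sum_congr rfl
    intro u' hu'
    rw [← Finset.mul_sum, ← Finset.sum_filter]
    congr 2
    rw [mem_Ioc] at hu hu'
    ext w
    simp only [mem_filter, mem_Ioc, le_min_iff, Nat.le_div_iff_mul_le (show 0 < u by omega), Nat.le_div_iff_mul_le (show 0 < u' by omega)]
    rw [mul_comm w u, mul_comm w u']
    tauto
  have h3 : ∑ w ∈ Ioc 0 V, ‖∑ u ∈ (Ioc M (2 * M)).filter (fun u => u * w ≤ N), (g u : ℂ) * ee (((u * w : ℕ) : ℝ) * α)‖ ^ 2 =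
      ‖((∑ w ∈ Ioc 0 V, ‖∑ u ∈ (Ioc M (2 * M)).filter (fun u => u * w ≤ N), (g u : ℂ) * ee (((u * w : ℕ) : ℝ) * α)‖ ^ 2 : ℝ) : ℂ)‖ := by
    rw [Complex.norm_real, Real.norm_of_nonneg (Finset.sum_nonneg fun _ _ => by positivity)]
  rw [h3, h2]
  apply norm_sum_le_of_le
  intro u _
  rw [Finset.mul_sum]
  apply norm_sum_le_of_le
  intro u' _
  rw [norm_mul, norm_mul, Complex.norm_real, Complex.norm_real, Real.norm_of_nonneg (hg u), Real.norm_of_nonneg (hg u'), mul_assoc]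
  rfl
end FP


namespace FP
open Finset

lemma nn_small (x : ℝ) (h : |x| < 1 / 2) : nn x = |x| := by
  unfold nn
  have : round x = 0 := by
    rw [round_eq_zero_iff]
    rw [abs_lt] at h
    constructor <;> linarith [h.1, h.2]
  rw [this]; simp

lemma int_part (q : ℕ) (a d : ℤ) (h : (q : ℤ) ∣ d) (hq : 0 < q) (β : ℝ) : nn ((d : ℝ) * (a / q + β)) = nn (d * β) := by
  obtain ⟨k, rfl⟩ := h
  have hqR : (q : ℝ) ≠ 0 := by positivity
  have : (((q : ℤ) * k : ℤ) : ℝ) * (a / q + β) = ((q : ℤ) * k : ℤ) * β + (k * a : ℤ) := by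
    push_cast; field_simp; ring
  rw [this, nn_add_int]

set_option maxHeartbeats 1000000 in
lemma kern (N M q u : ℕ) (hq : 0 < q) (hM : 0 < M) (a : ℤ) (ha : IsCoprime a (q : ℤ)) (β P : ℝ) (hP : 100 ≤ P) (hMP : P ^ 16 ≤ M) (hqP : (q : ℝ) ≤ P)
    (hVP : P ^ 16 ≤ (N / M : ℕ)) (hβ : N * |β| ≤ P) (hu : u ∈ Ioc M (2 * M)) :
    ∑ u' ∈ Ioc M (2 * M), th u' * Kr N (N / M) (a / q + β) u u' ≤
      4 * q * M + 4104 * (M * (N / M : ℕ) / (√(b1 N β) * q.totient)) := by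
  set V := N / M with hV
  have hqR : (0 : ℝ) < q := by exact_mod_cast hq
  have hMR : (0 : ℝ) < M := by exact_mod_cast hM
  have hP0 : 0 < P := by linarith
  have hVR : (0 : ℝ) < V := lt_of_lt_of_le (by positivity) hVP
  have hVN : (V : ℝ) * M ≤ N := by exact_mod_cast Nat.div_mul_le_self N M
  have hNR : (0 : ℝ) < N := lt_of_lt_of_le (by positivity) hVN
  have hφ : (0 : ℝ) < q.totient := by exact_mod_cast Nat.totient_pos.2 hq
  have hNV : (N : ℝ) ≤ 2 * M * V := by
    have h1 : N < M * (V + 1) := Nat.lt_mul_div_succ N hM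
    have h2 : (1 : ℝ) ≤ V := le_trans (one_le_pow₀ (by linarith)) hVP
    have h3 : (N : ℝ) < M * (V + 1) := by exact_mod_cast h1
    nlinarith
  set b := b1 N β with hb
  have hb1 : 1 ≤ b := le_max_left _ _
  have hbP : b ≤ P := max_le (by linarith) hβ
  set s := √b with hs
  have hs1 : 1 ≤ s := Real.one_le_sqrt.2 hb1
  have hss : s * s = b := Real.mul_self_sqrt (by linarith)
  have hsP : s ≤ P := by nlinarith
  rw [mem_Ioc] at hu
  -- M |β| small
  have hMβ : M * |β| ≤ 1 / (4 * q) := by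
    have h1 : (P ^ 16 * M) * |β| ≤ P := by
      refine le_trans ?_ hβ
      gcongr
      exact le_trans (by gcongr) hVN
    have h2 : M * |β| ≤ P / P ^ 16 := by
      rw [le_div_iff₀ (by positivity)]; linarith
    refine h2.trans ?_
    rw [div_le_div_iff₀ (by positivity) (by positivity)]
    have h3 : (4 : ℝ) * q ≤ P ^ 2 := by nlinarith
    have h4 : P ^ 3 ≤ P ^ 16 := pow_le_pow_right₀ (by linarith) (by norm_num)
    calc P * (4 * q) ≤ P * P ^ 2 := by gcongr
      _ = P ^ 3 := by ring
      _ ≤ _ := by linarith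
  have hMβ2 : M * |β| ≤ 1 / 4 := by
    refine hMβ.trans ?_
    have : (1 : ℝ) ≤ q := by exact_mod_cast hq
    apply div_le_div_of_nonneg_left <;> linarith
  have hd : ∀ u' ∈ Ioc M (2 * M), |(u : ℝ) - u'| ≤ M := by
    intro u' hu'
    rw [mem_Ioc] at hu'
    have h1 : (M : ℝ) < u := by exact_mod_cast hu.1
    have h2 : (u : ℝ) ≤ 2 * M := by exact_mod_cast hu.2
    have h3 : (M : ℝ) < u' := by exact_mod_cast hu'.1
    have h4 : (u' : ℝ) ≤ 2 * M := by exact_mod_cast hu'.2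
    rw [abs_le]; constructor <;> linarith
  have hd2 : ∀ u' ∈ Ioc M (2 * M), |((u : ℝ) - u') * β| ≤ M * |β| := by
    intro u' hu'
    rw [abs_mul]
    exact mul_le_mul_of_nonneg_right (hd u' hu') (abs_nonneg _)
  rw [← Finset.sum_filter_add_sum_filter_not (Ioc M (2 * M)) (fun u' => u' ≡ u [MOD q]), add_comm]
  apply add_le_add
  · -- not congruent
    have h1 : ∀ u' ∈ (Ioc M (2 * M)).filter (fun u' => ¬ u' ≡ u [MOD q]), th u' * Kr N V (a / q + β) u u' ≤ th u' * q := by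
      intro u' hu'
      rw [mem_filter] at hu'
      refine mul_le_mul_of_nonneg_left ?_ (th_nonneg _)
      have := Kr_le' N V (a / q + β) u u' (1 / (2 * q)) (by positivity) ?_
      · refine this.trans (le_of_eq ?_)
        field_simp
      · have e : ((u : ℝ) - u') * (a / q + β) = ((((u : ℤ) - u') * a : ℤ) : ℝ) / q + ((u : ℝ) - u') * β := by
          push_cast; ring
        rw [e]
        have h2 := nn_sub_le (((((u : ℤ) - u') * a : ℤ) : ℝ) / q) (((u : ℝ) - u') * β)
        have h3 : 1 / (q : ℝ) ≤ nn (((((u : ℤ) - u') * a : ℤ) : ℝ) / q) := by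
          apply nn_frac_ge hq
          intro h
          apply hu'.2
          have h4 : (q : ℤ) ∣ (u : ℤ) - u' := ha.symm.dvd_of_dvd_mul_right h
          exact (Nat.modEq_iff_dvd).2 h4
        have h5 := hd2 u' hu'.1
        have h6 : 1 / (2 * (q : ℝ)) = 1 / q - 1 / (2 * q) := by field_simp; norm_num
        have h7 : 1 / (4 * (q : ℝ)) ≤ 1 / (2 * q) := by
          apply div_le_div_of_nonneg_left <;> linarith
        linarith
    refine (Finset.sum_le_sum h1).trans ?_
    rw [← Finset.sum_mul]
    have := sum_th_sub (2 * M) ((Ioc M (2 * M)).filter (fun u' => ¬ u' ≡ u [MOD q])) (by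
      intro x hx; rw [mem_filter, mem_Ioc] at hx; rw [mem_Ioc]; omega)
    push_cast at this
    calc _ ≤ (2 * (2 * (M : ℝ))) * q := by gcongr
      _ = _ := by ring
  · set S := (Ioc M (2 * M)).filter (fun u' => u' ≡ u [MOD q]) with hS
    set Δ := ⌊(M : ℝ) / s⌋₊ with hΔ
    have hMs : 0 ≤ (M : ℝ) / s := by positivity
    have hΔ1 : (Δ : ℝ) ≤ M / s := Nat.floor_le hMs
    have hΔ2 : (M : ℝ) / s < Δ + 1 := Nat.lt_floor_add_one _
    have hΔM : Δ ≤ M := by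
      have : (Δ : ℝ) ≤ M := hΔ1.trans (div_le_self hMR.le hs1)
      exact_mod_cast this
    have h1 : ∀ u' ∈ S, th u' * Kr N V (a / q + β) u u' ≤ (if u - (Δ + 1) < u' ∧ u' ≤ u + Δ then th u' * V else 0) + th u' * (V / s) := by
      intro u' hu'
      rw [hS, mem_filter] at hu'
      by_cases hn : u - (Δ + 1) < u' ∧ u' ≤ u + Δ
      · rw [if_pos hn]
        have := mul_le_mul_of_nonneg_left (Kr_le N V (a / q + β) u u') (th_nonneg u')
        have h3 : 0 ≤ th u' * (V / s) := mul_nonneg (th_nonneg _) (by positivity)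
        linarith
      · rw [if_neg hn, zero_add]
        refine mul_le_mul_of_nonneg_left ?_ (th_nonneg _)
        have hfar : (M : ℝ) / s < |(u : ℝ) - u'| := by
          refine hΔ2.trans_le ?_
          rw [not_and_or] at hn
          rcases hn with h | h
          · have : u' + (Δ + 1) ≤ u := by omega
            have : (u' : ℝ) + (Δ + 1) ≤ u := by exact_mod_cast this
            exact le_trans (by linarith) (le_abs_self _)
          · have : u + (Δ + 1) ≤ u' := by omega
            have : (u : ℝ) + (Δ + 1) ≤ u' := by exact_mod_cast this
            exact le_trans (by linarith) (neg_le_abs _)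
        have hb2 : 1 < b := by
          by_contra hcon
          have hb' : b = 1 := le_antisymm (not_lt.1 hcon) hb1
          have : s = 1 := by rw [hs, hb', Real.sqrt_one]
          rw [this, div_one] at hfar
          have := hd u' hu'.1
          linarith
        have hbe : b = N * |β| := by
          rw [hb, b1] at hb2 ⊢
          exact max_eq_right (by
            rcases lt_max_iff.1 hb2 with h | h
            · linarith
            · exact h.le)
        have := Kr_le' N V (a / q + β) u u' (M * s / N) (by positivity) ?_
        · refine this.trans ?_
          rw [div_le_div_iff₀ (by positivity) (by positivity)]
          rw [one_mul]
          have : V * (2 * (M * s / N)) = (2 * M * V) * s / N := by ring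
          rw [this, le_div_iff₀ hNR]
          nlinarith
        · have hdvd : (q : ℤ) ∣ (u : ℤ) - u' := (Nat.modEq_iff_dvd).1 hu'.2
          have e := int_part q a ((u : ℤ) - u') hdvd hq β
          push_cast at e
          rw [e, nn_small _ (by have := hd2 u' hu'.1; linarith), abs_mul]
          have h5 : |β| = b / N := by rw [hbe]; field_simp
          rw [h5]
          calc M * s / N = M / s * (b / N) := by rw [← hss]; field_simp
            _ ≤ _ := by gcongr
    refine (Finset.sum_le_sum h1).trans ?_
    rw [Finset.sum_add_distrib, ← Finset.sum_filter, ← Finset.sum_mul, ← Finset.sum_mul]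
    have hbt1 := bt3 q M (2 * M) u hq P M hP hMP hqP (by push_cast; linarith) (by
      push_cast
      have : (M : ℝ) / P ^ 6 ≤ M := div_le_self hMR.le (one_le_pow₀ (by linarith))
      linarith)
    have hbt2 := bt3 q (u - (Δ + 1)) (u + Δ) u hq P M hP hMP hqP (by
      push_cast
      have h2 : (u : ℝ) ≤ 2 * M := by exact_mod_cast hu.2
      have h3 : (Δ : ℝ) ≤ M := by exact_mod_cast hΔM
      linarith) (by
      rw [Nat.cast_sub (by omega)]
      push_cast
      have : (M : ℝ) / P ^ 6 ≤ M / s := by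
        apply div_le_div_of_nonneg_left hMR.le (by linarith)
        exact hsP.trans (le_self_pow₀ (by linarith) (by norm_num))
      have : (0 : ℝ) ≤ Δ := by positivity
      linarith)
    have e1 : (((u + Δ : ℕ) : ℝ) - (u - (Δ + 1) : ℕ)) ≤ 3 * (M / s) := by
      rw [Nat.cast_sub (by omega)]
      push_cast
      have : 1 ≤ M / s := by
        rw [le_div_iff₀ (by linarith)]
        have : P ≤ P ^ 16 := le_self_pow₀ (by linarith) (by norm_num)
        linarith
      linarith
    have e2 : (((2 * M : ℕ) : ℝ) - M) = M := by push_cast; ring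
    rw [e2] at hbt1
    have h2 : ∑ i ∈ S with u - (Δ + 1) < i ∧ i ≤ u + Δ, th i ≤ 1026 * (3 * (M / s)) / q.totient := by
      refine le_trans (Finset.sum_le_sum_of_subset_of_nonneg ?_ fun _ _ _ => th_nonneg _) (hbt2.trans (by gcongr))
      intro x hx
      rw [mem_filter, hS, mem_filter] at hx
      rw [mem_filter, mem_Ioc]
      tauto
    calc _ ≤ 1026 * (3 * (M / s)) / q.totient * V + 1026 * M / q.totient * (V / s) := by gcongr
      _ = _ := by field_simp; ring

set_option maxHeartbeats 1000000 in
/-- Type II estimate for small denominators. -/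
lemma type2 : ∃ C > 0, ∀ (N M q : ℕ) (a : ℤ) (β P : ℝ) (s : Finset ℕ), 0 < q → 0 < M → IsCoprime a (q : ℤ) → 100 ≤ P → P ^ 16 ≤ M → (q : ℝ) ≤ P →
    P ^ 16 ≤ (N / M : ℕ) → N * |β| ≤ P → s ⊆ Ioc 0 (N / M) →
    ‖∑ v ∈ s, (th v : ℂ) * ff N M (a / q + β) v‖ ^ 2 ≤ C * N ^ 2 / √(q * b1 N β) := by
  obtain ⟨C, hC, hφC⟩ := phi_lower
  refine ⟨8 * 7000 ^ 2 + 32832 * 4 + 32832 * 4104 * C ^ 2, by positivity, ?_⟩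
  intro N M q a β P s hq hM ha hP hMP hqP hVP hβ hs
  set V := N / M with hV
  have hqR : (0 : ℝ) < q := by exact_mod_cast hq
  have hq1 : (1 : ℝ) ≤ q := by exact_mod_cast hq
  have hMR : (0 : ℝ) < M := by exact_mod_cast hM
  have hP0 : 0 < P := by linarith
  have hVR : (0 : ℝ) < V := lt_of_lt_of_le (by positivity) hVP
  have hVN : (V : ℝ) * M ≤ N := by exact_mod_cast Nat.div_mul_le_self N M
  have hNR : (0 : ℝ) < N := lt_of_lt_of_le (by positivity) hVN
  have hφ : (0 : ℝ) < q.totient := by exact_mod_cast Nat.totient_pos.2 hq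
  have hφ1 : (1 : ℝ) ≤ q.totient := by exact_mod_cast Nat.totient_pos.2 hq
  have hV1 : (1 : ℝ) ≤ V := le_trans (one_le_pow₀ (by linarith)) hVP
  have hMN : M ≤ N := by
    have : (M : ℝ) ≤ N := by nlinarith
    exact_mod_cast this
  set b := b1 N β with hb
  have hb1 : 1 ≤ b := le_max_left _ _
  have hbP : b ≤ P := max_le (by linarith) hβ
  set ζ := (q : ℝ) * b with hζ
  have hζ1 : 1 ≤ ζ := by nlinarith
  have hζP : ζ ≤ P ^ 2 := by
    calc ζ ≤ P * P := mul_le_mul hqP hbP (by linarith) hP0.le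
      _ = _ := by ring
  have hbζ : N * |β| ≤ ζ := by
    have : N * |β| ≤ b := le_max_right _ _
    nlinarith
  have hζ0 : 0 < ζ := by linarith
  have h4 : 4 * q * ζ ^ 2 ≤ V := by
    refine le_trans ?_ hVP
    calc 4 * q * ζ ^ 2 ≤ P * P * (P ^ 2) ^ 2 := by gcongr; linarith
      _ = P ^ 6 := by ring
      _ ≤ _ := pow_le_pow_right₀ (by linarith) (by norm_num)
  set J := ⌊(V : ℝ) / (4 * q * ζ ^ 2)⌋₊ with hJd
  have hJ0 : 1 ≤ (V : ℝ) / (4 * q * ζ ^ 2) := by rwa [le_div_iff₀ (by positivity), one_mul]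
  have hJ1 : (J : ℝ) ≤ V / (4 * q * ζ ^ 2) := Nat.floor_le (by linarith)
  have hJ2 : V / (4 * q * ζ ^ 2) < (J : ℝ) + 1 := Nat.lt_floor_add_one _
  have hJ : 0 < J := Nat.floor_pos.2 hJ0
  have hJR : (1 : ℝ) ≤ J := by exact_mod_cast hJ
  have hav := avg_bound N M q J hq hM a β P ζ hP hMP hqP hVP hζ1 hζP hbζ hMN hJ (by
    calc (q : ℝ) * J ≤ q * (V / (4 * q * ζ ^ 2)) := by gcongr
      _ = V / (4 * ζ ^ 2) := by field_simp) (by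
    calc ((V : ℕ) : ℝ) / P ^ 6 ≤ V / (8 * ζ ^ 2) := by
          apply div_le_div_of_nonneg_left hVR.le (by positivity)
          calc 8 * ζ ^ 2 ≤ P ^ 2 * (P ^ 2) ^ 2 := by gcongr; nlinarith
            _ = _ := by ring
      _ = q * (V / (4 * q * ζ ^ 2) / 2) := by field_simp; norm_num
      _ ≤ _ := by gcongr; linarith)
  have hen := energy th th_nonneg N M V (a / q + β)
  have hen2 : ∑ w ∈ Ioc 0 V, ‖ff N M (a / q + β) w‖ ^ 2 ≤ 4 * M * (4 * q * M + 4104 * (M * V / (√b * q.totient))) := by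
    refine hen.trans ?_
    calc _ ≤ ∑ u ∈ Ioc M (2 * M), th u * (4 * q * M + 4104 * (M * V / (√b * q.totient))) := by
          apply Finset.sum_le_sum
          intro u hu
          exact mul_le_mul_of_nonneg_left (kern N M q u hq hM a ha β P hP hMP hqP hVP hβ hu) (th_nonneg _)
      _ ≤ _ := by
          rw [← Finset.sum_mul]
          have := sum_th_sub (2 * M) (Ioc M (2 * M)) (by
            intro x hx; rw [mem_Ioc] at hx; rw [mem_Ioc]; omega)
          push_cast at this
          gcongr
          linarith
  have hcs : ‖∑ v ∈ s, (th v : ℂ) * ff N M (a / q + β) v‖ ^ 2 ≤ 2 * V * ∑ v ∈ Ioc 0 V, th v * ‖ff N M (a / q + β) v‖ ^ 2 := by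
    have h1 : ‖∑ v ∈ s, (th v : ℂ) * ff N M (a / q + β) v‖ ≤ ∑ v ∈ s, √(th v) * (√(th v) * ‖ff N M (a / q + β) v‖) := by
      apply norm_sum_le_of_le
      intro v _
      rw [norm_mul, Complex.norm_real, Real.norm_of_nonneg (th_nonneg v), ← mul_assoc, Real.mul_self_sqrt (th_nonneg v)]
    have h2 := Finset.sum_mul_sq_le_sq_mul_sq s (fun v => √(th v)) (fun v => √(th v) * ‖ff N M (a / q + β) v‖)
    refine le_trans (by gcongr) (h2.trans ?_)
    simp only [mul_pow, Real.sq_sqrt (th_nonneg _)]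
    apply mul_le_mul (sum_th_sub V s hs) _ (Finset.sum_nonneg fun v _ => mul_nonneg (th_nonneg _) (by positivity)) (by positivity)
    exact Finset.sum_le_sum_of_subset_of_nonneg hs fun v _ _ => mul_nonneg (th_nonneg _) (by positivity)
  have hsζ : √ζ = √q * √b := Real.sqrt_mul hqR.le _
  have hz1 : 1 ≤ √ζ := Real.one_le_sqrt.2 hζ1
  have hzP : √ζ ≤ P := by
    rw [Real.sqrt_le_left hP0.le]; exact hζP
  have hzζ : √ζ ≤ ζ := by
    have := Real.mul_self_sqrt hζ0.le
    nlinarith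
  have hMV : (M * V : ℝ) ^ 2 ≤ N ^ 2 := by gcongr; linarith
  have t1 : 8 * 7000 ^ 2 * ((M * V : ℝ) ^ 2 / ζ ^ 2) ≤ 8 * 7000 ^ 2 * N ^ 2 / √ζ := by
    rw [mul_div_assoc (8 * 7000 ^ 2)]
    gcongr
    nlinarith
  have t2 : (q : ℝ) / q.totient * (q * (M ^ 2 * V)) ≤ N ^ 2 / √ζ := by
    rw [le_div_iff₀ (by linarith)]
    have h1 : (q : ℝ) / q.totient ≤ P := (div_le_self hqR.le hφ1).trans hqP
    calc (q : ℝ) / q.totient * (q * (M ^ 2 * V)) * √ζ ≤ P * (P * (M ^ 2 * V)) * P := by gcongr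
      _ = P ^ 3 * (M ^ 2 * V) := by ring
      _ ≤ V * (M ^ 2 * V) := by
          gcongr
          refine le_trans ?_ hVP
          exact pow_le_pow_right₀ (by linarith) (by norm_num)
      _ = (M * V) ^ 2 := by ring
      _ ≤ _ := hMV
  have t3 : (q : ℝ) / q.totient * ((M * V) ^ 2 / (√b * q.totient)) ≤ C ^ 2 * (N ^ 2 / √ζ) := by
    have h1 := hφC q hq
    have h2 : (q : ℝ) * √q ≤ C ^ 2 * q.totient ^ 2 := by
      have h3 : ((q : ℝ) ^ (7 / 8 : ℝ)) ^ 2 = (q : ℝ) ^ (7 / 4 : ℝ) := by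
        rw [← Real.rpow_natCast, ← Real.rpow_mul hqR.le]; norm_num
      have h4 : (q : ℝ) * √q = (q : ℝ) ^ (3 / 2 : ℝ) := by
        rw [Real.sqrt_eq_rpow]
        nth_rewrite 1 [← Real.rpow_one (q : ℝ)]
        rw [← Real.rpow_add hqR]; norm_num
      have h5 : (q : ℝ) ^ (3 / 2 : ℝ) ≤ (q : ℝ) ^ (7 / 4 : ℝ) := Real.rpow_le_rpow_of_exponent_le hq1 (by norm_num)
      rw [h4]
      refine h5.trans ?_
      rw [← h3, ← mul_pow]
      gcongr
    have hsb : 0 < √b := Real.sqrt_pos.2 (by linarith)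
    have hsq : 0 < √(q : ℝ) := Real.sqrt_pos.2 hqR
    have e1 : (q : ℝ) / q.totient * ((M * V) ^ 2 / (√b * q.totient)) = ((q * √q) / q.totient ^ 2) * ((M * V) ^ 2 / √ζ) := by
      rw [hsζ]; field_simp
    rw [e1]
    apply mul_le_mul _ (by gcongr) (by positivity) (by positivity)
    rw [div_le_iff₀ (by positivity)]
    exact h2
  calc _ ≤ _ := hcs
    _ ≤ 2 * V * (4 * V * (7000 * (M / ζ)) ^ 2 + 4104 * (q / q.totient) * (4 * M * (4 * q * M + 4104 * (M * V / (√b * q.totient))))) := by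
        gcongr
        exact hav.trans (by gcongr)
    _ = 8 * 7000 ^ 2 * ((M * V : ℝ) ^ 2 / ζ ^ 2) + 32832 * 4 * ((q : ℝ) / q.totient * (q * (M ^ 2 * V)))
        + 32832 * 4104 * ((q : ℝ) / q.totient * ((M * V) ^ 2 / (√b * q.totient))) := by ring
    _ ≤ 8 * 7000 ^ 2 * N ^ 2 / √ζ + 32832 * 4 * (N ^ 2 / √ζ) + 32832 * 4104 * (C ^ 2 * (N ^ 2 / √ζ)) := by gcongr
    _ = _ := by ring
end FP


namespace FP
open Finset

lemma block_le (f : ℕ → ℝ) (hf : ∀ n, 0 ≤ f n) (q : ℕ) (hq : 0 < q) (W : ℝ) (hW : ∀ B : ℕ, ∑ j ∈ range q, f (B + j) ≤ W) (A M : ℕ) :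
    ∑ n ∈ Ioc A (A + M), f n ≤ ((M : ℝ) / q + 1) * W := by
  have hW0 : 0 ≤ W := (Finset.sum_nonneg fun _ _ => hf _).trans (hW 0)
  have h1 : ∀ K : ℕ, ∑ n ∈ Ioc A (A + K * q), f n ≤ K * W := by
    intro K
    induction K with
    | zero => simp
    | succ K ih =>
      have e : ∑ n ∈ Ioc A (A + (K + 1) * q), f n = ∑ n ∈ Ioc A (A + K * q), f n + ∑ n ∈ Ioc (A + K * q) (A + (K + 1) * q), f n := by
        rw [Finset.sum_Ioc_consecutive] <;> nlinarith
      have e2 : ∑ n ∈ Ioc (A + K * q) (A + (K + 1) * q), f n = ∑ j ∈ range q, f (A + K * q + 1 + j) := by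
        have : Ioc (A + K * q) (A + (K + 1) * q) = Ico (A + K * q + 1) (A + K * q + 1 + q) := by
          ext x; simp only [mem_Ioc, mem_Ico, Nat.add_mul]; omega
        rw [this, Finset.sum_Ico_eq_sum_range]
        congr 2
        omega
      rw [e, e2]
      push_cast
      have := hW (A + K * q + 1)
      linarith
  have h2 : M ≤ (M / q + 1) * q := by
    have := Nat.lt_div_mul_add (a := M) hq
    rw [Nat.add_mul]; omega
  calc ∑ n ∈ Ioc A (A + M), f n ≤ ∑ n ∈ Ioc A (A + (M / q + 1) * q), f n := by
        apply Finset.sum_le_sum_of_subset_of_nonneg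
        · apply Finset.Ioc_subset_Ioc_right; omega
        · intros; exact hf _
    _ ≤ ((M / q + 1 : ℕ) : ℝ) * W := h1 _
    _ ≤ _ := by
      push_cast
      gcongr
      exact Nat.cast_div_le

noncomputable def hh (V q r : ℕ) : ℝ := 2 * ww q r + (if r = 0 then (V : ℝ) else 0) + (if r = 1 then (V : ℝ) else 0) + (if r = q - 1 then (V : ℝ) else 0)

lemma sum_hh (V q : ℕ) (hq : 0 < q) : ∑ r ∈ range q, hh V q r ≤ 4 * q * (1 + Real.log q) + 3 * V := by
  unfold hh
  rw [Finset.sum_add_distrib, Finset.sum_add_distrib, Finset.sum_add_distrib, ← Finset.mul_sum]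
  have h1 := sum_ww q hq
  have h2 : ∀ c : ℕ, ∑ r ∈ range q, (if r = c then (V : ℝ) else 0) ≤ V := by
    intro c
    rw [Finset.sum_ite_eq']
    split_ifs <;> simp
  have := h2 0
  have := h2 1
  have := h2 (q - 1)
  linarith

lemma Kr_nonneg (N V : ℕ) (α : ℝ) (u u' : ℕ) : 0 ≤ Kr N V α u u' := norm_nonneg _

lemma Kr_hh (N V q : ℕ) (hq : 0 < q) (α : ℝ) (u u' : ℕ) (m : ℤ) (r : ℕ) (hr : (m % q).toNat = r) (h : |((u : ℝ) - u') * α - m / q| ≤ 3 / (2 * q)) :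
    Kr N V α u u' ≤ hh V q r := by
  have hqR : (0 : ℝ) < q := by exact_mod_cast hq
  have hrq : r < q := by
    have h1 := Int.emod_lt_of_pos m (show (0 : ℤ) < q by exact_mod_cast hq)
    have h2 := Int.emod_nonneg m (show (q : ℤ) ≠ 0 by positivity)
    omega
  have hw := ww_nonneg q r hrq
  have hV := Kr_le N V α u u'
  have hV0 : (0 : ℝ) ≤ V := by positivity
  unfold hh
  by_cases h0 : r = 0
  · rw [if_pos h0]; split_ifs <;> linarith
  by_cases h1 : r = 1
  · rw [if_pos h1]; split_ifs <;> linarith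
  by_cases h2 : r = q - 1
  · rw [if_pos h2]; split_ifs <;> linarith
  rw [if_neg h0, if_neg h1, if_neg h2]
  have hr2 : (2 : ℝ) ≤ r := by exact_mod_cast (by omega : 2 ≤ r)
  have hr3 : (2 : ℝ) ≤ (q : ℝ) - r := by
    have : 2 + r ≤ q := by omega
    have : (2 : ℝ) + r ≤ q := by exact_mod_cast this
    linarith
  have h3 := nn_res q hq m r hr
  have h4 := nn_sub_le ((m : ℝ) / q) (((u : ℝ) - u') * α - m / q)
  rw [add_sub_cancel] at h4
  have h5 : 1 / (4 * (q : ℝ)) * min (r : ℝ) (q - r) ≤ nn (((u : ℝ) - u') * α) := by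
    have e : min ((r : ℝ) / q) ((q - r) / q) = min (r : ℝ) (q - r) / q := (min_div_div_right hqR.le _ _)
    rw [e] at h3
    have h6 : 2 ≤ min (r : ℝ) (q - r) := le_min hr2 hr3
    set t := min (r : ℝ) (q - r)
    have h7 : 1 / (4 * (q : ℝ)) * t ≤ t / q - 3 / (2 * q) := by
      rw [div_sub_div _ _ (by positivity) (by positivity), one_div_mul_eq_div, div_le_div_iff₀ (by positivity) (by positivity)]
      have : 0 < (q : ℝ) ^ 2 := by positivity
      nlinarith
    linarith
  have h6 : 0 < min (r : ℝ) (q - r) := lt_min (by linarith) (by linarith)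
  have h7 := Kr_le' N V α u u' _ (by positivity) h5
  refine h7.trans ?_
  unfold ww
  rw [if_neg h0]
  have e2 : 1 / (2 * (1 / (4 * (q : ℝ)) * min (r : ℝ) (q - r))) = 2 * (q / min (r : ℝ) (q - r)) := by
    field_simp; norm_num
  rw [e2]
  have p1 : 0 < (q : ℝ) / r := by positivity
  have p2 : 0 < (q : ℝ) / (q - r) := div_pos hqR (by linarith)
  rcases min_choice (r : ℝ) (q - r) with h | h <;> rw [h] <;> linarith

lemma window (N V q : ℕ) (hq : 0 < q) (a : ℤ) (ha : IsCoprime a (q : ℤ)) (β : ℝ) (hβ : |β| ≤ 1 / (q : ℝ) ^ 2) (u B : ℕ) :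
    ∑ j ∈ range q, Kr N V (a / q + β) u (B + j) ≤ 4 * q * (1 + Real.log q) + 3 * V := by
  have hqR : (0 : ℝ) < q := by exact_mod_cast hq
  set γ : ℝ := ((u : ℝ) - B) * (a / q + β) with hγ
  set c : ℤ := round (q * γ) with hc
  have hcγ : |γ - c / q| ≤ 1 / (2 * q) := by
    have h1 := abs_sub_round (q * γ)
    rw [← hc] at h1
    have : γ - c / q = (q * γ - c) / q := by field_simp
    rw [this, abs_div, abs_of_pos hqR, div_le_div_iff₀ hqR (by positivity)]
    nlinarith
  have h1 : ∀ j ∈ range q, Kr N V (a / q + β) u (B + j) ≤ hh V q (((c + (-a) * (j : ℤ)) % q).toNat) := by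
    intro j hj
    rw [mem_range] at hj
    apply Kr_hh N V q hq _ _ _ (c + (-a) * (j : ℤ)) _ rfl
    have e : ((u : ℝ) - (B + j : ℕ)) * (a / q + β) - ((c + (-a) * (j : ℤ) : ℤ) : ℝ) / q = (γ - c / q) + (-(j * β)) := by
      rw [hγ]; push_cast; field_simp; ring
    rw [e]
    refine (abs_add_le _ _).trans ?_
    rw [abs_neg, abs_mul, Nat.abs_cast]
    have h2 : (j : ℝ) * |β| ≤ 1 / q := by
      have hjq : (j : ℝ) ≤ q := by exact_mod_cast hj.le
      calc (j : ℝ) * |β| ≤ q * (1 / (q : ℝ) ^ 2) := by gcongr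
        _ = _ := by field_simp
    have : 3 / (2 * (q : ℝ)) = 1 / (2 * q) + 1 / q := by field_simp; norm_num
    linarith
  refine (Finset.sum_le_sum h1).trans ?_
  rw [perm_sum q hq (-a) c ha.neg_left (fun r => hh V q r)]
  exact sum_hh V q hq

lemma th_le (N n : ℕ) (h : n ≤ N) : th n ≤ Real.log N := by
  unfold th
  split_ifs with hp
  · exact Real.log_le_log (by exact_mod_cast hp.pos) (by exact_mod_cast h)
  · exact Real.log_natCast_nonneg N

set_option maxHeartbeats 1000000 in
/-- Crude Type II estimate. -/
lemma type2c (N M q : ℕ) (a : ℤ) (β K : ℝ) (s : Finset ℕ) (hq : 0 < q) (hM : 0 < M) (ha : IsCoprime a (q : ℤ)) (hK : 2 ≤ K) (hKM : K ≤ M)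
    (hKV : K ≤ (N / M : ℕ)) (hKq : K ≤ q) (hqK : q * K ≤ N) (hβ : |β| ≤ 1 / (q : ℝ) ^ 2) (hL : 1 ≤ Real.log N) (hs : s ⊆ Ioc 0 (N / M)) :
    ‖∑ v ∈ s, (th v : ℂ) * ff N M (a / q + β) v‖ ^ 2 ≤ 256 * Real.log N ^ 3 * N ^ 2 / K := by
  set V := N / M with hV
  set L := Real.log N with hLd
  have hqR : (0 : ℝ) < q := by exact_mod_cast hq
  have hMR : (0 : ℝ) < M := by exact_mod_cast hM
  have hVR : (0 : ℝ) < V := by linarith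
  have hVN : (V : ℝ) * M ≤ N := by exact_mod_cast Nat.div_mul_le_self N M
  have hNR : (0 : ℝ) < N := lt_of_lt_of_le (by positivity) hVN
  have hqN : (q : ℝ) ≤ N := by nlinarith
  have hMN : 2 * M ≤ N := by
    have : (2 : ℝ) * M ≤ N := by nlinarith
    exact_mod_cast this
  have hlogq : Real.log q ≤ L := Real.log_le_log hqR hqN
  set W : ℝ := 4 * q * (1 + Real.log q) + 3 * V with hW
  have hlq : 0 ≤ Real.log q := Real.log_natCast_nonneg q
  have hW0 : 0 ≤ W := by positivity
  have hW1 : W ≤ 8 * L * (q + V) := by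
    have : 4 * (q : ℝ) * (1 + Real.log q) ≤ 4 * q * (2 * L) := by gcongr; linarith
    nlinarith
  have hen := energy th th_nonneg N M V (a / q + β)
  have hen2 : ∑ w ∈ Ioc 0 V, ‖ff N M (a / q + β) w‖ ^ 2 ≤ 4 * M * (L * ((M / q + 1) * W)) := by
    refine hen.trans ?_
    calc _ ≤ ∑ u ∈ Ioc M (2 * M), th u * (L * ((M / q + 1) * W)) := by
          apply Finset.sum_le_sum
          intro u hu
          refine mul_le_mul_of_nonneg_left ?_ (th_nonneg _)
          have h1 := block_le (fun u' => Kr N V (a / q + β) u u') (fun _ => Kr_nonneg _ _ _ _ _) q hq W (fun B => window N V q hq a ha β hβ u B) M M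
          calc _ ≤ ∑ u' ∈ Ioc M (2 * M), L * Kr N V (a / q + β) u u' := by
                apply Finset.sum_le_sum
                intro u' hu'
                rw [mem_Ioc] at hu'
                exact mul_le_mul_of_nonneg_right (th_le N u' (by omega)) (Kr_nonneg _ _ _ _ _)
            _ ≤ _ := by
                rw [← Finset.mul_sum]
                have e : 2 * M = M + M := by ring
                rw [e]
                gcongr
      _ ≤ _ := by
          rw [← Finset.sum_mul]
          have := sum_th_sub (2 * M) (Ioc M (2 * M)) (by
            intro x hx; rw [mem_Ioc] at hx; rw [mem_Ioc]; omega)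
          push_cast at this
          gcongr
          linarith
  have hcs : ‖∑ v ∈ s, (th v : ℂ) * ff N M (a / q + β) v‖ ^ 2 ≤ 2 * V * L * ∑ v ∈ Ioc 0 V, ‖ff N M (a / q + β) v‖ ^ 2 := by
    have h1 : ‖∑ v ∈ s, (th v : ℂ) * ff N M (a / q + β) v‖ ≤ ∑ v ∈ s, th v * ‖ff N M (a / q + β) v‖ := by
      apply norm_sum_le_of_le
      intro v _
      rw [norm_mul, Complex.norm_real, Real.norm_of_nonneg (th_nonneg v)]
    have h2 := Finset.sum_mul_sq_le_sq_mul_sq s (fun v => th v) (fun v => ‖ff N M (a / q + β) v‖)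
    refine le_trans (by gcongr) (h2.trans ?_)
    apply mul_le_mul _ _ (Finset.sum_nonneg fun v _ => by positivity) (by positivity)
    · calc ∑ v ∈ s, th v ^ 2 ≤ ∑ v ∈ s, th v * L := by
            apply Finset.sum_le_sum
            intro v hv
            have := hs hv
            rw [mem_Ioc] at this
            rw [sq]
            exact mul_le_mul_of_nonneg_left (th_le N v (this.2.trans (Nat.div_le_self _ _))) (th_nonneg _)
        _ ≤ _ := by
            rw [← Finset.sum_mul]
            have := sum_th_sub V s hs
            gcongr
    · exact Finset.sum_le_sum_of_subset_of_nonneg hs fun v _ _ => by positivity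
  have hK0 : 0 < K := by linarith
  have k1 : (M : ℝ) ≤ N / K := by
    rw [le_div_iff₀ hK0]; nlinarith
  have k2 : (V : ℝ) ≤ N / K := by
    rw [le_div_iff₀ hK0]; nlinarith
  have k3 : (q : ℝ) ≤ N / K := by rwa [le_div_iff₀ hK0]
  have k4 : (V : ℝ) * M / q ≤ N / K := by gcongr
  calc _ ≤ _ := hcs
    _ ≤ 2 * V * L * (4 * M * (L * ((M / q + 1) * (8 * L * (q + V))))) := by gcongr; exact hen2.trans (by gcongr)
    _ = 64 * L ^ 3 * (V * M) * (M + V * M / q + q + V) := by field_simp; ring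
    _ ≤ 64 * L ^ 3 * N * (N / K + N / K + N / K + N / K) := by gcongr
    _ = _ := by ring
end FP


namespace FP
open Finset
open scoped ArithmeticFunction.Moebius ArithmeticFunction.vonMangoldt ArithmeticFunction.zeta

noncomputable def kap (n : ℕ) : ℝ := if n.Prime then 0 else Λ n

lemma kap_nonneg (n : ℕ) : 0 ≤ kap n := by
  unfold kap; split_ifs
  · rfl
  · exact ArithmeticFunction.vonMangoldt_nonneg

lemma th_add_kap (n : ℕ) : Λ n = th n + kap n := by
  unfold th kap
  split_ifs with h
  · rw [ArithmeticFunction.vonMangoldt_apply_prime h]; simp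
  · simp

lemma th_le_L (n : ℕ) : th n ≤ Λ n := by
  have := kap_nonneg n
  rw [th_add_kap]; linarith

lemma kap_le_L (n : ℕ) : kap n ≤ Λ n := by
  have := th_nonneg n
  rw [th_add_kap]; linarith

lemma sum_kap : ∃ C > 0, ∀ N : ℕ, ∑ n ∈ Ioc 0 N, kap n / n ≤ C := by
  have h := ArithmeticFunction.vonMangoldt.summable_residueClass_non_primes_div (q := 1) (a := 0)
  have e : ∀ n : ℕ, (if n.Prime then 0 else ArithmeticFunction.vonMangoldt.residueClass (0 : ZMod 1) n) / (n : ℝ) = kap n / n := by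
    intro n
    unfold kap
    congr 2
    unfold ArithmeticFunction.vonMangoldt.residueClass
    rw [Set.indicator_of_mem]
    exact Subsingleton.elim _ _
  simp_rw [e] at h
  refine ⟨∑' n : ℕ, kap n / n + 1, ?_, ?_⟩
  · have : 0 ≤ ∑' n : ℕ, kap n / n := tsum_nonneg fun n => div_nonneg (kap_nonneg n) (by positivity)
    linarith
  · intro N
    have := h.sum_le_tsum (Ioc 0 N) (fun n _ => div_nonneg (kap_nonneg n) (by positivity))
    linarith

lemma hyp_swap {β : Type*} [AddCommMonoid β] (F : ℕ → ℕ → β) (N : ℕ) :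
    ∑ d ∈ Ioc 0 N, ∑ m ∈ Ioc 0 (N / d), F d m = ∑ m ∈ Ioc 0 N, ∑ d ∈ Ioc 0 (N / m), F d m := by
  apply Finset.sum_comm'
  intro x y
  simp only [mem_Ioc]
  constructor
  · rintro ⟨⟨h1, h2⟩, h3, h4⟩
    have h5 := (Nat.le_div_iff_mul_le h1).1 h4
    refine ⟨⟨h1, (Nat.le_div_iff_mul_le h3).2 (by linarith)⟩, h3, ?_⟩
    nlinarith
  · rintro ⟨⟨h1, h2⟩, h3, h4⟩
    have h5 := (Nat.le_div_iff_mul_le h3).1 h2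
    refine ⟨⟨h1, by nlinarith⟩, h3, (Nat.le_div_iff_mul_le h1).2 (by linarith)⟩

lemma hyp_bound (f g : ℕ → ℝ) (hf : ∀ n, 0 ≤ f n) (hg : ∀ n, 0 ≤ g n) (hgL : ∀ n, g n ≤ Λ n) (N U : ℕ) :
    ∑ d ∈ Ioc 0 U, ∑ m ∈ Ioc 0 (N / d), f d * g m ≤ 6 * N * ∑ d ∈ Ioc 0 U, f d / d := by
  rw [Finset.mul_sum]
  apply Finset.sum_le_sum
  intro d hd
  rw [← Finset.mul_sum]
  have h1 : ∑ m ∈ Ioc 0 (N / d), g m ≤ 6 * (N / d) :=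
    calc _ ≤ ∑ m ∈ Ioc 0 (N / d), Λ m := Finset.sum_le_sum fun m _ => hgL m
      _ ≤ 6 * (N / d : ℕ) := psi_nat_le _
      _ ≤ _ := by gcongr; exact Nat.cast_div_le
  calc f d * ∑ m ∈ Ioc 0 (N / d), g m ≤ f d * (6 * (N / d)) := mul_le_mul_of_nonneg_left h1 (hf d)
    _ = _ := by ring

lemma dyad (f : ℕ → ℂ) (U I : ℕ) : ∑ d ∈ Ioc U (U * 2 ^ I), f d = ∑ i ∈ range I, ∑ d ∈ Ioc (U * 2 ^ i) (2 * (U * 2 ^ i)), f d := by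
  induction I with
  | zero => simp
  | succ I ih =>
    rw [Finset.sum_range_succ, ← ih]
    have e : 2 * (U * 2 ^ I) = U * 2 ^ (I + 1) := by ring
    rw [e, Finset.sum_Ioc_consecutive]
    · exact Nat.le_mul_of_pos_right U (by positivity)
    · rw [pow_succ]; nlinarith [Nat.zero_le (U * 2 ^ I)]

lemma block_eq (N M U : ℕ) (hM : 0 < M) (α : ℝ) :
    ∑ d ∈ Ioc M (2 * M), ∑ m ∈ Ioc U (N / d), ((th d * th m : ℝ) : ℂ) * ee (((d * m : ℕ) : ℝ) * α) =
      ∑ v ∈ Ioc U (N / M), (th v : ℂ) * ff N M α v := by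
  unfold ff
  simp_rw [Finset.mul_sum]
  rw [Finset.sum_comm' (t' := Ioc U (N / M)) (s' := fun v => (Ioc M (2 * M)).filter (fun u => u * v ≤ N))]
  · apply Finset.sum_congr rfl
    intro v _
    apply Finset.sum_congr rfl
    intro u _
    push_cast; ring
  · intro x y
    simp only [mem_Ioc, mem_filter]
    constructor
    · rintro ⟨h1, h2, h3⟩
      have h5 := (Nat.le_div_iff_mul_le (by omega : 0 < x)).1 h3
      refine ⟨⟨h1, by linarith⟩, h2, (Nat.le_div_iff_mul_le hM).2 ?_⟩
      nlinarith
    · rintro ⟨⟨h1, h2⟩, h3, h4⟩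
      exact ⟨h1, h3, (Nat.le_div_iff_mul_le (by omega)).2 (by linarith)⟩

set_option maxHeartbeats 1000000 in
lemma LL_bound : ∃ C > 0, ∀ (N U : ℕ) (α Bd : ℝ), 1 ≤ U → 0 ≤ Bd →
    (∀ M : ℕ, U ≤ M → U < N / M → ‖∑ v ∈ Ioc U (N / M), (th v : ℂ) * ff N M α v‖ ≤ Bd) →
    ‖∑ n ∈ Ioc 0 N, (((Λ * Λ) n : ℝ) : ℂ) * ee ((n : ℝ) * α)‖ ≤ C * N * (1 + Real.log U) + (Nat.log 2 N + 1 : ℕ) * Bd := by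
  obtain ⟨C, hC, hκ⟩ := sum_kap
  refine ⟨12 * C + 72, by positivity, ?_⟩
  intro N U α Bd hU hBd hM
  have hlU : 0 ≤ Real.log U := Real.log_natCast_nonneg U
  have hL0 : ∀ n, 0 ≤ Λ n := fun n => ArithmeticFunction.vonMangoldt_nonneg
  set e : ℕ → ℂ := fun n => ee ((n : ℝ) * α) with he
  have he1 : ∀ n, ‖e n‖ = 1 := fun n => norm_ee _
  have h0 : ∑ n ∈ Ioc 0 N, (((Λ * Λ) n : ℝ) : ℂ) * e n = ∑ d ∈ Ioc 0 N, ∑ m ∈ Ioc 0 (N / d), ((Λ d * Λ m : ℝ) : ℂ) * e (d * m) := by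
    rw [← sum_anti (fun d m => ((Λ d * Λ m : ℝ) : ℂ) * e (d * m))]
    apply Finset.sum_congr rfl
    intro n _
    rw [ArithmeticFunction.mul_apply, Complex.ofReal_sum, Finset.sum_mul]
    apply Finset.sum_congr rfl
    intro x hx
    rw [(Nat.mem_divisorsAntidiagonal.1 hx).1]
  -- decomposition
  have h1 : ∀ d m : ℕ, ((Λ d * Λ m : ℝ) : ℂ) * e (d * m) = ((kap d * Λ m : ℝ) : ℂ) * e (d * m) + ((th d * kap m : ℝ) : ℂ) * e (d * m)
      + ((th d * th m : ℝ) : ℂ) * e (d * m) := by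
    intro d m
    rw [← add_mul, ← add_mul, ← Complex.ofReal_add, ← Complex.ofReal_add]
    congr 2
    rw [th_add_kap d, th_add_kap m]; ring
  have nb : ∀ (f g : ℕ → ℝ) (s : Finset ℕ) (t : ℕ → Finset ℕ), (∀ n, 0 ≤ f n) → (∀ n, 0 ≤ g n) →
      ‖∑ d ∈ s, ∑ m ∈ t d, ((f d * g m : ℝ) : ℂ) * e (d * m)‖ ≤ ∑ d ∈ s, ∑ m ∈ t d, f d * g m := by
    intro f g s t hf hg
    apply norm_sum_le_of_le
    intro d _
    apply norm_sum_le_of_le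
    intro m _
    rw [norm_mul, he1, mul_one, Complex.norm_real, Real.norm_of_nonneg (mul_nonneg (hf d) (hg m))]
  have b1 : ‖∑ d ∈ Ioc 0 N, ∑ m ∈ Ioc 0 (N / d), ((kap d * Λ m : ℝ) : ℂ) * e (d * m)‖ ≤ 6 * N * C := by
    refine (nb _ _ _ _ kap_nonneg hL0).trans ((hyp_bound kap _ kap_nonneg hL0 (fun _ => le_rfl) N N).trans ?_)
    gcongr; exact hκ N
  have b2 : ‖∑ d ∈ Ioc 0 N, ∑ m ∈ Ioc 0 (N / d), ((th d * kap m : ℝ) : ℂ) * e (d * m)‖ ≤ 6 * N * C := by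
    refine (nb _ _ _ _ th_nonneg kap_nonneg).trans ?_
    rw [hyp_swap]
    have := hyp_bound kap th kap_nonneg th_nonneg th_le_L N N
    simp_rw [mul_comm (th _) (kap _)]
    refine this.trans ?_
    gcongr; exact hκ N
  -- main part
  have mert : ∑ d ∈ Ioc 0 U, th d / d ≤ Real.log U + 6 :=
    le_trans (Finset.sum_le_sum fun d _ => by have := th_le_L d; gcongr) (mertens U hU)
  set G : ℕ → ℂ := fun d => ∑ m ∈ Ioc U (N / d), ((th d * th m : ℝ) : ℂ) * e (d * m) with hG
  have hsplit : ∀ d, ∑ m ∈ Ioc 0 (N / d), ((th d * th m : ℝ) : ℂ) * e (d * m) =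
      ∑ m ∈ Ioc 0 (min U (N / d)), ((th d * th m : ℝ) : ℂ) * e (d * m) + G d := by
    intro d
    rw [hG]
    rw [← Finset.sum_filter_add_sum_filter_not (Ioc 0 (N / d)) (fun m => m ≤ U)]
    congr 1 <;> apply Finset.sum_congr _ (fun _ _ => rfl) <;> ext x <;> simp only [mem_filter, mem_Ioc] <;> omega
  have b3 : ‖∑ d ∈ Ioc 0 N, ∑ m ∈ Ioc 0 (min U (N / d)), ((th d * th m : ℝ) : ℂ) * e (d * m)‖ ≤ 6 * N * (Real.log U + 6) := by
    refine (nb _ _ _ _ th_nonneg th_nonneg).trans ?_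
    have hle : ∑ d ∈ Ioc 0 N, ∑ m ∈ Ioc 0 (min U (N / d)), th d * th m = ∑ m ∈ Ioc 0 U, ∑ d ∈ Ioc 0 (N / m), th m * th d := by
      rw [Finset.sum_comm' (t' := Ioc 0 U) (s' := fun m => Ioc 0 (N / m))]
      · apply Finset.sum_congr rfl
        intro _ _
        apply Finset.sum_congr rfl
        intro _ _
        ring
      · intro x y
        simp only [mem_Ioc, le_min_iff]
        constructor
        · rintro ⟨⟨h1, h2⟩, h3, h4, h5⟩
          have h5 := (Nat.le_div_iff_mul_le h1).1 h5
          exact ⟨⟨h1, (Nat.le_div_iff_mul_le h3).2 (by linarith)⟩, h3, h4⟩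
        · rintro ⟨⟨h1, h2⟩, h3, h4⟩
          have h5 := (Nat.le_div_iff_mul_le h3).1 h2
          refine ⟨⟨h1, by nlinarith⟩, h3, h4, (Nat.le_div_iff_mul_le h1).2 (by linarith)⟩
    rw [hle]
    refine (hyp_bound th th th_nonneg th_nonneg th_le_L N U).trans ?_
    gcongr
  set I := Nat.log 2 N + 1 with hI
  have hNI : N < U * 2 ^ I := by
    have : N < 2 ^ I := Nat.lt_pow_succ_log_self (by norm_num) N
    nlinarith
  have hG0 : ∀ d, N < d → G d = 0 := by
    intro d hd
    rw [hG]
    simp only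
    rw [Nat.div_eq_of_lt hd]
    simp
  have hGN : ∑ d ∈ Ioc 0 N, G d = ∑ d ∈ Ioc 0 U, G d + ∑ d ∈ Ioc U (U * 2 ^ I), G d := by
    rw [Finset.sum_Ioc_consecutive _ (Nat.zero_le _) (Nat.le_mul_of_pos_right U (by positivity))]
    apply Finset.sum_subset
    · exact Finset.Ioc_subset_Ioc_right hNI.le
    · intro x hx hx2
      rw [mem_Ioc] at hx hx2
      exact hG0 x (by omega)
  have b4 : ‖∑ d ∈ Ioc 0 U, G d‖ ≤ 6 * N * (Real.log U + 6) := by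
    rw [hG]
    refine (nb _ _ _ (fun d => Ioc U (N / d)) th_nonneg th_nonneg).trans ?_
    refine le_trans (Finset.sum_le_sum fun d _ => ?_) ((hyp_bound th th th_nonneg th_nonneg th_le_L N U).trans ?_)
    · apply Finset.sum_le_sum_of_subset_of_nonneg
      · exact Finset.Ioc_subset_Ioc_left (Nat.zero_le _)
      · intro m _ _; exact mul_nonneg (th_nonneg _) (th_nonneg _)
    · gcongr
  have b5 : ‖∑ d ∈ Ioc U (U * 2 ^ I), G d‖ ≤ I * Bd := by
    rw [dyad]
    have : ∀ i ∈ range I, ‖∑ d ∈ Ioc (U * 2 ^ i) (2 * (U * 2 ^ i)), G d‖ ≤ Bd := by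
      intro i _
      have hUM : U ≤ U * 2 ^ i := Nat.le_mul_of_pos_right U (by positivity)
      have := block_eq N (U * 2 ^ i) U (by omega) α
      rw [hG, this]
      by_cases hlt : U < N / (U * 2 ^ i)
      · exact hM _ hUM hlt
      · rw [Finset.Ioc_eq_empty hlt]; simpa using hBd
    refine (norm_sum_le_of_le _ this).trans ?_
    simp
  rw [h0]
  simp_rw [h1]
  simp_rw [Finset.sum_add_distrib]
  simp_rw [hsplit]
  rw [Finset.sum_add_distrib, hGN]
  have hfin : ∀ x y z w t : ℂ, ‖x + y + (z + (w + t))‖ ≤ ‖x‖ + ‖y‖ + ‖z‖ + ‖w‖ + ‖t‖ := by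
    intro x y z w t
    have h1 := norm_add_le (x + y) (z + (w + t))
    have h2 := norm_add_le x y
    have h3 := norm_add_le z (w + t)
    have h4 := norm_add_le w t
    linarith
  refine (hfin _ _ _ _ _).trans ?_
  have hN0 : (0 : ℝ) ≤ N := by positivity
  have h2 : (12 * C + 72) * N * (1 + Real.log U) = 12 * N * C + 72 * N + (12 * C + 72) * (N * Real.log U) := by ring
  have h3 : 12 * (N * Real.log U) ≤ (12 * C + 72) * (N * Real.log U) := by gcongr; linarith
  rw [h2]
  linarith

lemma log_sum (N : ℕ) : ∑ n ∈ Ioc 0 N, Λ n * Real.log ((N : ℝ) / n) ≤ 6 * N := by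
  have h1 : ∀ n ∈ Ioc 0 N, Λ n * Real.log ((N : ℝ) / n) ≤ ∑ k ∈ Ico n N, Λ n * (1 / k : ℝ) := by
    intro n hn
    rw [mem_Ioc] at hn
    rw [← Finset.mul_sum]
    apply mul_le_mul_of_nonneg_left _ ArithmeticFunction.vonMangoldt_nonneg
    obtain ⟨k, rfl⟩ := Nat.exists_eq_add_of_le hn.2
    have hn0 : 0 < n := hn.1
    clear hn
    induction k with
    | zero => simp
    | succ k ih =>
      rw [← add_assoc, Finset.sum_Ico_succ_top (by omega)]
      have hx : (0 : ℝ) < ((n + k : ℕ) : ℝ) := by exact_mod_cast (by omega)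
      have hn1 : (0 : ℝ) < n := by exact_mod_cast hn0
      have e : Real.log (((n + k + 1 : ℕ) : ℝ) / n) = Real.log (((n + k : ℕ) : ℝ) / n) + Real.log (1 + 1 / ((n + k : ℕ) : ℝ)) := by
        rw [← Real.log_mul (by positivity) (by positivity)]
        congr 1
        push_cast
        field_simp
      rw [e]
      have h3 : Real.log (1 + 1 / ((n + k : ℕ) : ℝ)) ≤ 1 / ((n + k : ℕ) : ℝ) := by
        have := Real.log_le_sub_one_of_pos (x := 1 + 1 / ((n + k : ℕ) : ℝ)) (by positivity)
        linarith
      linarith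
  refine (Finset.sum_le_sum h1).trans ?_
  rw [Finset.sum_comm' (t' := Ioc 0 N) (s' := fun k => (Ioc 0 k).filter (fun _ => k < N))]
  · calc _ ≤ ∑ k ∈ Ioc 0 N, (6 : ℝ) := by
          apply Finset.sum_le_sum
          intro k hk
          rw [mem_Ioc] at hk
          have hk0 : (0 : ℝ) < k := by exact_mod_cast hk.1
          rw [← Finset.sum_mul]
          calc _ ≤ (6 * (k : ℝ)) * (1 / k) := by
                gcongr
                refine le_trans (Finset.sum_le_sum_of_subset_of_nonneg (Finset.filter_subset _ _) fun _ _ _ => ArithmeticFunction.vonMangoldt_nonneg) (psi_nat_le k)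
            _ = 6 := by field_simp
      _ = _ := by simp; ring
  · intro x y
    simp only [mem_Ioc, mem_Ico, mem_filter]
    omega
end FP


namespace FP
open Finset
open scoped ArithmeticFunction.Moebius ArithmeticFunction.vonMangoldt ArithmeticFunction.zeta

lemma log_pow_bound (L : ℝ) (hL : 2 ≤ L) : (1 + Real.log (2 * L ^ 17)) ^ 3 ≤ 206 ^ 3 * L ^ (1 / 4 : ℝ) := by
  set r := L ^ (1 / 12 : ℝ) with hr
  have hL0 : 0 < L := by linarith
  have hr1 : 1 ≤ r := Real.one_le_rpow (by linarith) (by norm_num)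
  have hr3 : r ^ 3 = L ^ (1 / 4 : ℝ) := by
    rw [hr, ← Real.rpow_natCast, ← Real.rpow_mul hL0.le]; norm_num
  have h1 : Real.log L ≤ 12 * r := by
    have := Real.log_le_rpow_div hL0.le (show (0 : ℝ) < 1 / 12 by norm_num)
    rw [← hr] at this; linarith
  have h2 : Real.log (2 * L ^ 17) = Real.log 2 + 17 * Real.log L := by
    rw [Real.log_mul (by norm_num) (by positivity), Real.log_pow]; norm_num
  have h3 := Real.log_two_lt_d9
  have h4 : 0 ≤ Real.log (2 * L ^ 17) := Real.log_nonneg (by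
    have : 1 ≤ L ^ 17 := one_le_pow₀ (by linarith)
    linarith)
  rw [← hr3, ← mul_pow]
  gcongr
  linarith

set_option maxHeartbeats 1000000 in
lemma TT_bound : ∃ C > 0, ∀ (N q : ℕ) (a : ℤ) (β : ℝ), 2 ≤ Real.log N → 0 < q → IsCoprime a (q : ℤ) →
    q * Real.log N ^ 15 ≤ N → |β| ≤ Real.log N ^ 17 / (q * N) →
    ‖∑ d ∈ Ioc 0 N, (cc N d : ℂ) * EE N (a / q + β) d‖ ≤
      C * N * (Real.log N * (q * b1 N β) ^ (-(1 / 4) : ℝ) + Real.log N ^ (1 / 4 : ℝ)) := by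
  obtain ⟨C, hC, hφC⟩ := phi_lower
  refine ⟨206 ^ 3 + 206 ^ 3 + 136 * C + 18, by positivity, ?_⟩
  intro N q a β hL hq ha hqN hβ
  set L := Real.log N with hLd
  have hN : 0 < N := by
    by_contra h
    have : N = 0 := by omega
    rw [hLd, this] at hL; simp at hL; linarith
  have hNR : (0 : ℝ) < N := by exact_mod_cast hN
  have hqR : (0 : ℝ) < q := by exact_mod_cast hq
  have hq1 : (1 : ℝ) ≤ q := by exact_mod_cast hq
  have hL0 : 0 < L := by linarith
  have hL1 : 1 ≤ L := by linarith
  set H := L ^ 17 with hH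
  have hH1 : 1 ≤ H := one_le_pow₀ hL1
  have hH0 : 0 < H := by linarith
  set D := ⌊(N : ℝ) / (2 * H)⌋₊ with hDd
  have hD1 : (D : ℝ) ≤ N / (2 * H) := Nat.floor_le (by positivity)
  have hD2 : (N : ℝ) / (2 * H) < D + 1 := Nat.lt_floor_add_one _
  have hD3 : 2 * H * D ≤ N := by
    rw [le_div_iff₀ (by positivity)] at hD1; linarith
  have hD4 : (N : ℝ) ≤ 2 * H * (D + 1) := by
    rw [div_lt_iff₀ (by positivity)] at hD2; linarith
  have hDN : D ≤ N := by
    have : (D : ℝ) ≤ N := hD1.trans (div_le_self hNR.le (by linarith))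
    exact_mod_cast this
  have hqN' : (q : ℝ) ≤ N := by
    refine le_trans ?_ hqN
    exact le_mul_of_one_le_right hqR.le (one_le_pow₀ hL1)
  have hlq : Real.log q ≤ L := Real.log_le_log hqR hqN'
  have hlq0 : 0 ≤ Real.log q := Real.log_natCast_nonneg q
  have hlam := log_pow_bound L hL
  rw [← hH] at hlam
  set r := L ^ (1 / 4 : ℝ) with hr
  have hr1 : 1 ≤ r := Real.one_le_rpow hL1 (by norm_num)
  set b := b1 N β with hb
  have hb1 : 1 ≤ b := b1_ge N β
  set Z := (q : ℝ) * b with hZ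
  have hZ1 : 1 ≤ Z := by nlinarith
  have hZ0 : 0 < Z := by linarith
  set w := Z ^ (-(1 / 4) : ℝ) with hw
  have hw0 : 0 < w := Real.rpow_pos_of_pos hZ0 _
  have t1 := T1 N D (a / q + β) H hDN hN hH1 hD4
  have t2 := T2 N D q hq a ha β H hH1 hN hDN hD3 hβ
  have t1' : ‖∑ d ∈ Ioc D N, (cc N d : ℂ) * EE N (a / q + β) d‖ ≤ 206 ^ 3 * (N * r) := by
    refine t1.trans ?_
    calc N * (1 + Real.log (2 * H)) ^ 3 ≤ N * (206 ^ 3 * r) := by gcongr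
      _ = _ := by ring
  have hDL : (D : ℝ) ≤ N / L ^ 15 := by
    refine hD1.trans ?_
    apply div_le_div_of_nonneg_left hNR.le (by positivity)
    have : L ^ 15 ≤ L ^ 17 := pow_le_pow_right₀ hL1 (by norm_num)
    linarith
  have hqL : (q : ℝ) ≤ N / L ^ 15 := by rwa [le_div_iff₀ (by positivity)]
  have t2' : L ^ 2 * (2 * (D + q) * (1 + Real.log q)) ≤ 8 * N := by
    calc L ^ 2 * (2 * (D + q) * (1 + Real.log q)) ≤ L ^ 2 * (2 * (N / L ^ 15 + N / L ^ 15) * (2 * L)) := by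
          gcongr; linarith
      _ = 8 * N / L ^ 12 := by field_simp; ring
      _ ≤ _ := div_le_self (by positivity) (one_le_pow₀ hL1)
  have t3' : ‖∑ d ∈ (Ioc 0 D).filter (fun d => q ∣ d), (cc N d : ℂ) * EE N (a / q + β) d‖ ≤ (136 * C + 2) * (N * (L * w)) + 206 ^ 3 * (N * r) + 8 * N := by
    by_cases hZL : L ^ 4 ≤ Z
    · have t3 := T3a N D q hq a β H hH1 hN hDN hD3 hβ
      rw [← hb, ← hZ, ← hLd] at t3
      have h1 : L ^ 2 / Z ≤ w := by
        have h2 : L ^ 2 ≤ Z ^ (1 / 2 : ℝ) := by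
          rw [← Real.sqrt_eq_rpow]
          apply Real.le_sqrt_of_sq_le
          calc (L ^ 2) ^ 2 = L ^ 4 := by ring
            _ ≤ Z := hZL
        rw [div_le_iff₀ hZ0]
        refine h2.trans ?_
        rw [hw]
        nth_rewrite 3 [← Real.rpow_one Z]
        rw [← Real.rpow_add hZ0]
        exact Real.rpow_le_rpow_of_exponent_le hZ1 (by norm_num)
      calc _ ≤ L ^ 2 * (1 + L) * (N / Z) := t3
        _ ≤ L ^ 2 * (2 * L) * (N / Z) := by gcongr; linarith
        _ = 2 * (N * (L * (L ^ 2 / Z))) := by ring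
        _ ≤ 2 * (N * (L * w)) := by gcongr
        _ ≤ _ := by
          have : 0 ≤ 136 * C * (N * (L * w)) := by positivity
          have : 0 ≤ 206 ^ 3 * (N * r) := by positivity
          linarith
    · push Not at hZL
      have t3 := T3b N D q hq (by exact_mod_cast hqN') a β H hH1 hN hDN hD3 hD4
      rw [← hb, ← hZ, ← hLd] at t3
      have hVV : VV q.primeFactors ≤ C * Z ^ (1 / 8 : ℝ) := by
        have hφ : (0 : ℝ) < q.totient := by exact_mod_cast Nat.totient_pos.2 hq
        have h1 : VV q.primeFactors = q / q.totient := by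
          have := totient_VV hq
          rw [eq_div_iff hφ.ne']; linarith
        rw [h1, div_le_iff₀ hφ]
        have h2 := hφC q hq
        have h3 : (q : ℝ) = (q : ℝ) ^ (7 / 8 : ℝ) * (q : ℝ) ^ (1 / 8 : ℝ) := by
          rw [← Real.rpow_add hqR]; norm_num
        have h4 : (q : ℝ) ^ (1 / 8 : ℝ) ≤ Z ^ (1 / 8 : ℝ) := by
          apply Real.rpow_le_rpow hqR.le _ (by norm_num)
          rw [hZ]; nlinarith
        calc (q : ℝ) = (q : ℝ) ^ (7 / 8 : ℝ) * (q : ℝ) ^ (1 / 8 : ℝ) := h3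
          _ ≤ (C * q.totient) * Z ^ (1 / 8 : ℝ) := by gcongr
          _ = _ := by ring
      have h5 : Z ^ (1 / 8 : ℝ) / Z ≤ w := by
        rw [div_le_iff₀ hZ0, hw]
        nth_rewrite 3 [← Real.rpow_one Z]
        rw [← Real.rpow_add hZ0]
        exact Real.rpow_le_rpow_of_exponent_le hZ1 (by norm_num)
      have hbZ : b ≤ Z := by rw [hZ]; nlinarith
      calc _ ≤ _ := t3
        _ ≤ N / Z * (68 * (C * Z ^ (1 / 8 : ℝ)) * (2 * L) + 206 ^ 3 * r) + 8 * L ^ 4 * L ^ 2 * (N / (2 * L ^ 17)) := by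
            gcongr
            · linarith
            · exact hbZ.trans hZL.le
        _ = 136 * C * (N * (L * (Z ^ (1 / 8 : ℝ) / Z))) + 206 ^ 3 * (N * r) / Z + 4 * N / L ^ 11 := by
            field_simp; ring
        _ ≤ 136 * C * (N * (L * w)) + 206 ^ 3 * (N * r) + 4 * N := by
            gcongr
            · exact div_le_self (by positivity) hZ1
            · exact div_le_self (by positivity) (one_le_pow₀ hL1)
        _ ≤ _ := by
          have : 0 ≤ 2 * (N * (L * w)) := by positivity
          linarith
  have hs : ∑ d ∈ Ioc 0 N, (cc N d : ℂ) * EE N (a / q + β) d = ∑ d ∈ (Ioc 0 D).filter (fun d => q ∣ d), (cc N d : ℂ) * EE N (a / q + β) d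
      + ∑ d ∈ (Ioc 0 D).filter (fun d => ¬ q ∣ d), (cc N d : ℂ) * EE N (a / q + β) d + ∑ d ∈ Ioc D N, (cc N d : ℂ) * EE N (a / q + β) d := by
    rw [Finset.sum_filter_add_sum_filter_not, Finset.sum_Ioc_consecutive _ (Nat.zero_le _) hDN]
  rw [hs]
  refine (norm_add₃_le).trans ?_
  have h1 : (N : ℝ) ≤ N * r := le_mul_of_one_le_right hNR.le hr1
  have h2 : 0 ≤ N * (L * w) := by positivity
  have h3 : 0 ≤ C * (N * r) := by positivity
  have e : (206 ^ 3 + 206 ^ 3 + 136 * C + 18) * N * (L * w + r) = (206 ^ 3 + 206 ^ 3 + 136 * C + 18) * (N * (L * w)) + (206 ^ 3 + 206 ^ 3 + 18) * (N * r) + 136 * (C * (N * r)) := by ring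
  rw [e]
  have e2 : (136 * C + 2) * (N * (L * w)) ≤ (206 ^ 3 + 206 ^ 3 + 136 * C + 18) * (N * (L * w)) := by apply mul_le_mul_of_nonneg_right _ h2; linarith
  linarith

set_option maxHeartbeats 1000000 in
/-- The main exponential sum estimate. -/
theorem expsum : ∃ C > 0, ∀ (N q : ℕ) (a : ℤ) (β : ℝ), 2 ≤ Real.log N → 0 < q → IsCoprime a (q : ℤ) →
    q * Real.log N ^ 15 ≤ N → |β| ≤ Real.log N ^ 17 / (q * N) → |β| ≤ 1 / (q : ℝ) ^ 2 →
    ‖∑ n ∈ Ioc 0 N, (Λ n : ℂ) * ee ((n : ℝ) * (a / q + β))‖ ≤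
      C * N * ((q * b1 N β) ^ (-(1 / 4) : ℝ) + Real.log N ^ (-(3 / 4) : ℝ)) := by
  obtain ⟨C1, hC1, hT⟩ := TT_bound
  obtain ⟨C2, hC2, hLL⟩ := LL_bound
  obtain ⟨C3, hC3, ht2⟩ := type2
  refine ⟨C1 + 1100 * C2 + 4 * √C3 + 100, by positivity, ?_⟩
  intro N q a β hL hq ha hqN hβ hβ2
  have hT := hT N q a β hL hq ha hqN hβ
  set L := Real.log N with hLd
  have hN : 0 < N := by
    by_contra h
    have : N = 0 := by omega
    rw [hLd, this] at hL; simp at hL; linarith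
  have hNR : (0 : ℝ) < N := by exact_mod_cast hN
  have hqR : (0 : ℝ) < q := by exact_mod_cast hq
  have hq1 : (1 : ℝ) ≤ q := by exact_mod_cast hq
  have hL0 : 0 < L := by linarith
  have hL1 : 1 ≤ L := by linarith
  set b := b1 N β with hb
  have hb1 : 1 ≤ b := b1_ge N β
  set Z := (q : ℝ) * b with hZ
  have hZ1 : 1 ≤ Z := by nlinarith
  have hZ0 : 0 < Z := by linarith
  set w := Z ^ (-(1 / 4) : ℝ) with hw
  have hw0 : 0 < w := Real.rpow_pos_of_pos hZ0 _
  set r := L ^ (1 / 4 : ℝ) with hr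
  have hr1 : 1 ≤ r := Real.one_le_rpow hL1 (by norm_num)
  set α : ℝ := a / q + β with hα
  set U := ⌈L ^ 272⌉₊ with hU
  have hUL : L ^ 272 ≤ U := Nat.le_ceil _
  have hL272 : 1 ≤ L ^ 272 := one_le_pow₀ hL1
  have hU1 : 1 ≤ U := by
    have : (1 : ℝ) ≤ U := hL272.trans hUL
    exact_mod_cast this
  have hU2 : (U : ℝ) ≤ 2 * L ^ 272 := by
    have := Nat.ceil_lt_add_one (by linarith : 0 ≤ L ^ 272)
    linarith
  have hlogU : Real.log U ≤ 1089 * r := by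
    have h1 : Real.log U ≤ Real.log (2 * L ^ 272) := Real.log_le_log (by exact_mod_cast hU1) hU2
    have h2 : Real.log (2 * L ^ 272) = Real.log 2 + 272 * Real.log L := by
      rw [Real.log_mul (by norm_num) (by positivity), Real.log_pow]; norm_num
    have h3 := Real.log_two_lt_d9
    have h4 : Real.log L ≤ 4 * r := by
      have := Real.log_le_rpow_div hL0.le (show (0 : ℝ) < 1 / 4 by norm_num)
      rw [← hr] at this; linarith
    linarith
  set Bd : ℝ := √C3 * N * w + 16 * N / L with hBd
  have hBd0 : 0 ≤ Bd := by positivity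
  have hLLb := hLL N U α Bd hU1 hBd0 (by
    intro M hUM hUN
    have hMR : (U : ℝ) ≤ M := by exact_mod_cast hUM
    have hVR : (U : ℝ) ≤ (N / M : ℕ) := by exact_mod_cast hUN.le
    have hM0 : 0 < M := by omega
    by_cases hqL : (q : ℝ) ≤ L ^ 17
    · have hP16 : (L ^ 17) ^ 16 ≤ (U : ℝ) := by
        refine le_trans (le_of_eq ?_) hUL
        rw [← pow_mul]
      have := ht2 N M q a β (L ^ 17) (Ioc U (N / M)) hq hM0 ha (by
        calc (100 : ℝ) ≤ 2 ^ 17 := by norm_num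
          _ ≤ L ^ 17 := by gcongr) (hP16.trans hMR) hqL (hP16.trans hVR) (by
        have h1 : N * |β| ≤ N * (L ^ 17 / (q * N)) := by gcongr
        refine h1.trans ?_
        have : N * (L ^ 17 / (q * N)) = L ^ 17 / q := by field_simp
        rw [this]
        exact div_le_self (by positivity) hq1) (Finset.Ioc_subset_Ioc_left (Nat.zero_le _))
      rw [← hb, ← hZ] at this
      have h2 : ‖∑ v ∈ Ioc U (N / M), (th v : ℂ) * ff N M (a / q + β) v‖ ≤ √C3 * N * w := by
        apply le_of_sq_le_sq _ (by positivity)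
        refine this.trans (le_of_eq ?_)
        have e1 : w ^ 2 = (√Z)⁻¹ := by
          rw [hw, ← Real.rpow_natCast, ← Real.rpow_mul hZ0.le, Real.sqrt_eq_rpow, ← Real.rpow_neg hZ0.le]
          norm_num
        rw [mul_pow, mul_pow, e1, Real.sq_sqrt hC3.le]
        ring
      refine h2.trans ?_
      rw [hBd]
      have : 0 ≤ 16 * N / L := by positivity
      linarith
    · push Not at hqL
      have h15 : L ^ 15 ≤ (U : ℝ) := (pow_le_pow_right₀ hL1 (by norm_num)).trans hUL
      have := type2c N M q a β (L ^ 15) (Ioc U (N / M)) hq hM0 ha (by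
        calc (2 : ℝ) ≤ 2 ^ 15 := by norm_num
          _ ≤ L ^ 15 := by gcongr) (h15.trans hMR) (h15.trans hVR)
          ((pow_le_pow_right₀ hL1 (by norm_num)).trans hqL.le) hqN hβ2 (by linarith) (Finset.Ioc_subset_Ioc_left (Nat.zero_le _))
      have h2 : ‖∑ v ∈ Ioc U (N / M), (th v : ℂ) * ff N M (a / q + β) v‖ ≤ 16 * N / L := by
        apply le_of_sq_le_sq _ (by positivity)
        refine this.trans ?_
        rw [div_pow, div_le_div_iff₀ (by positivity) (by positivity)]
        calc 256 * L ^ 3 * N ^ 2 * L ^ 2 = 256 * N ^ 2 * L ^ 5 := by ring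
          _ ≤ 256 * N ^ 2 * L ^ 15 := by
              have : L ^ 5 ≤ L ^ 15 := pow_le_pow_right₀ hL1 (by norm_num)
              gcongr
          _ = _ := by ring
      refine h2.trans ?_
      rw [hBd]
      have : 0 ≤ √C3 * N * w := by positivity
      linarith)
  have hI : ((Nat.log 2 N + 1 : ℕ) : ℝ) ≤ 3 * L := by
    have h1 : (2 : ℝ) ^ (Nat.log 2 N) ≤ N := by exact_mod_cast Nat.pow_log_le_self 2 hN.ne'
    have h2 := Real.log_le_log (by positivity) h1
    rw [Real.log_pow] at h2
    have h3 := Real.log_two_gt_d9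
    have h4 : (Nat.log 2 N : ℝ) * (1 / 2) ≤ Nat.log 2 N * Real.log 2 := by gcongr; linarith
    push_cast
    linarith
  -- the Selberg identity
  have hsel := selberg_sum N hNR N (fun n => ee ((n : ℝ) * α))
  have hL2 : ‖∑ n ∈ Ioc 0 N, ((Λ n * Real.log ((N : ℝ) / n) : ℝ) : ℂ) * ee ((n : ℝ) * α)‖ ≤ 6 * N := by
    refine le_trans (norm_sum_le_of_le _ fun n hn => ?_) (log_sum N)
    rw [mem_Ioc] at hn
    rw [norm_mul, norm_ee, mul_one, Complex.norm_real, Real.norm_of_nonneg]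
    apply mul_nonneg ArithmeticFunction.vonMangoldt_nonneg
    apply Real.log_nonneg
    rw [le_div_iff₀ (by exact_mod_cast hn.1), one_mul]
    exact_mod_cast hn.2
  have h1s : ∑ n ∈ Ioc 0 N, (((if n = 1 then L ^ 2 else 0 : ℝ)) : ℂ) * ee ((n : ℝ) * α) = (L ^ 2 : ℝ) * ee ((1 : ℕ) * α) := by
    rw [Finset.sum_eq_single 1]
    · simp
    · intro n _ hn; simp [hn]
    · intro h; rw [mem_Ioc] at h; omega
  have hdec : (L : ℂ) * ∑ n ∈ Ioc 0 N, (Λ n : ℂ) * ee ((n : ℝ) * α) = ∑ d ∈ Ioc 0 N, (cc N d : ℂ) * EE N α d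
      - (L ^ 2 : ℝ) * ee ((1 : ℕ) * α) - ∑ n ∈ Ioc 0 N, ((Λ n * Real.log ((N : ℝ) / n) : ℝ) : ℂ) * ee ((n : ℝ) * α)
      - ∑ n ∈ Ioc 0 N, (((Λ * Λ) n : ℝ) : ℂ) * ee ((n : ℝ) * α) := by
    have e1 : ∑ d ∈ Ioc 0 N, (cc N d : ℂ) * EE N α d = ∑ n ∈ Ioc 0 N, (sg N n : ℂ) * ee ((n : ℝ) * α) := by
      rw [← hsel]; rfl
    rw [e1, ← h1s, ← Finset.sum_sub_distrib, ← Finset.sum_sub_distrib, ← Finset.sum_sub_distrib, Finset.mul_sum]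
    apply Finset.sum_congr rfl
    intro n hn
    rw [mem_Ioc] at hn
    have hn0 : (n : ℝ) ≠ 0 := by have := hn.1; positivity
    rw [← sub_mul, ← sub_mul, ← sub_mul, ← mul_assoc]
    congr 1
    rw [← Complex.ofReal_sub, ← Complex.ofReal_sub, ← Complex.ofReal_sub, ← Complex.ofReal_mul]
    congr 1
    unfold sg
    rw [Real.log_div hNR.ne' hn0, ← hLd]
    ring
  have hLS : L * ‖∑ n ∈ Ioc 0 N, (Λ n : ℂ) * ee ((n : ℝ) * α)‖ ≤
      C1 * N * (L * w + r) + L ^ 2 + 6 * N + (C2 * N * (1 + Real.log U) + (Nat.log 2 N + 1 : ℕ) * Bd) := by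
    have e : L * ‖∑ n ∈ Ioc 0 N, (Λ n : ℂ) * ee ((n : ℝ) * α)‖ = ‖(L : ℂ) * ∑ n ∈ Ioc 0 N, (Λ n : ℂ) * ee ((n : ℝ) * α)‖ := by
      rw [norm_mul, Complex.norm_real, Real.norm_of_nonneg hL0.le]
    rw [e, hdec]
    refine (norm_sub_le _ _).trans (add_le_add ((norm_sub_le _ _).trans (add_le_add ((norm_sub_le _ _).trans (add_le_add hT ?_)) hL2)) hLLb)
    rw [norm_mul, norm_ee, mul_one, Complex.norm_real, Real.norm_of_nonneg (by positivity)]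
  have hL2N : L ^ 2 ≤ 4 * N := by
    have h1 := Real.log_le_rpow_div hNR.le (show (0 : ℝ) < 1 / 2 by norm_num)
    rw [← Real.sqrt_eq_rpow, ← hLd] at h1
    have h2 : L ≤ 2 * √N := by linarith
    calc L ^ 2 ≤ (2 * √(N : ℝ)) ^ 2 := by gcongr
      _ = 4 * (N : ℝ) := by rw [mul_pow, Real.sq_sqrt hNR.le]; norm_num
  have hNr : (N : ℝ) ≤ N * r := le_mul_of_one_le_right hNR.le hr1
  have hC2N : C2 * N * (1 + Real.log U) ≤ 1100 * C2 * (N * r) := by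
    calc C2 * N * (1 + Real.log U) ≤ C2 * N * (r + 1089 * r) := by gcongr
      _ = 1090 * (C2 * (N * r)) := by ring
      _ ≤ 1100 * (C2 * (N * r)) := by gcongr; norm_num
      _ = _ := by ring
  have hIB : (Nat.log 2 N + 1 : ℕ) * Bd ≤ 3 * √C3 * (N * (L * w)) + 48 * N := by
    calc (Nat.log 2 N + 1 : ℕ) * Bd ≤ 3 * L * Bd := by gcongr
      _ = 3 * √C3 * (N * (L * w)) + 48 * N := by rw [hBd]; field_simp; ring
  have hr2 : r = L * L ^ (-(3 / 4) : ℝ) := by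
    have h := Real.rpow_add hL0 1 (-(3 / 4))
    rw [Real.rpow_one] at h
    rw [← h, hr]; norm_num
  have hfin : L * ‖∑ n ∈ Ioc 0 N, (Λ n : ℂ) * ee ((n : ℝ) * α)‖ ≤ L * ((C1 + 1100 * C2 + 4 * √C3 + 100) * N * (w + L ^ (-(3 / 4) : ℝ))) := by
    have e : L * ((C1 + 1100 * C2 + 4 * √C3 + 100) * N * (w + L ^ (-(3 / 4) : ℝ))) =
        (C1 + 1100 * C2 + 4 * √C3 + 100) * (N * (L * w)) + (C1 + 1100 * C2 + 4 * √C3 + 100) * (N * r) := by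
      rw [hr2]; ring
    rw [e]
    have p1 : 0 ≤ N * (L * w) := by positivity
    have p2 : 0 ≤ N * r := by positivity
    have p3 : 0 ≤ √C3 * (N * (L * w)) := by positivity
    have p4 : 0 ≤ √C3 * (N * r) := by positivity
    have p5 : 0 ≤ C2 * (N * (L * w)) := by positivity
    calc _ ≤ _ := hLS
      _ ≤ C1 * (N * (L * w)) + C1 * (N * r) + 4 * N + 6 * N + (1100 * C2 * (N * r) + (3 * √C3 * (N * (L * w)) + 48 * N)) := by
          linarith
      _ ≤ _ := by linarith
  exact le_of_mul_le_mul_left hfin hL0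
end FP


namespace FP
open Finset Filter
open scoped ArithmeticFunction.vonMangoldt

lemma sum_kap_le (N : ℕ) (hN : 1 ≤ N) : ∑ n ∈ Ioc 0 N, kap n ≤ 2 * √(N : ℝ) * Real.log N := by
  have h := Chebyshev.psi_sub_theta_le (x := (N : ℝ)) (by exact_mod_cast hN)
  have e1 : Chebyshev.psi N = ∑ n ∈ Ioc 0 N, Λ n := by unfold Chebyshev.psi; simp
  have e2 : Chebyshev.theta N = ∑ n ∈ Ioc 0 N, th n := by
    rw [theta_pr]; unfold pr; rw [Finset.sum_filter]; rfl
  rw [e1, e2, ← Finset.sum_sub_distrib] at h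
  refine le_trans (le_of_eq ?_) h
  apply Finset.sum_congr rfl
  intro n _
  rw [th_add_kap]; ring

noncomputable def thc (n : ℕ) : ℂ := (th n : ℂ)

lemma norm_thc (n : ℕ) : ‖thc n‖ = th n := by
  unfold thc; rw [Complex.norm_real, Real.norm_of_nonneg (th_nonneg n)]

lemma sum_thc_sq (m N1 N2 : ℕ) (h : N2 ≤ m) : ∑ n ∈ Ioc N1 N2, ‖thc n‖ ^ 2 ≤ 2 * m * Real.log m := by
  have h1 : ∑ n ∈ Ioc N1 N2, th n ≤ 2 * m := by
    apply sum_th_sub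
    intro n hn; rw [mem_Ioc] at hn ⊢; omega
  calc ∑ n ∈ Ioc N1 N2, ‖thc n‖ ^ 2 ≤ ∑ n ∈ Ioc N1 N2, th n * Real.log m := by
        apply Finset.sum_le_sum
        intro n hn
        rw [mem_Ioc] at hn
        rw [norm_thc, sq]
        have := th_nonneg n
        gcongr
        exact th_le m n (by omega)
    _ = (∑ n ∈ Ioc N1 N2, th n) * Real.log m := by rw [Finset.sum_mul]
    _ ≤ _ := by
        have := Real.log_natCast_nonneg m
        gcongr

/-- eventual comparison of logs and powers -/
lemma ev_log (r s c : ℝ) (hs : 0 < s) (hc : 0 < c) : ∀ᶠ m : ℕ in atTop, Real.log m ^ r ≤ c * (m : ℝ) ^ s := by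
  have h := (isLittleO_log_rpow_rpow_atTop r hs).bound hc
  have h2 := tendsto_natCast_atTop_atTop (R := ℝ) |>.eventually h
  filter_upwards [h2] with m hm
  rw [Real.norm_eq_abs, Real.norm_of_nonneg (by positivity)] at hm
  exact (le_abs_self _).trans hm

lemma ev_loglarge (B : ℝ) : ∀ᶠ m : ℕ in atTop, B ≤ Real.log m :=
  (Real.tendsto_log_atTop.comp tendsto_natCast_atTop_atTop).eventually_ge_atTop B

lemma ev_rpow_large (s B : ℝ) (hs : 0 < s) : ∀ᶠ m : ℕ in atTop, B ≤ (m : ℝ) ^ s :=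
  ((tendsto_rpow_atTop hs).comp tendsto_natCast_atTop_atTop).eventually_ge_atTop B

set_option maxHeartbeats 1000000 in
lemma theta_int : ∃ C > 0, ∀ᶠ m : ℕ in atTop, ∀ N1 N2 X : ℕ, (m : ℝ) / 8 ≤ N1 → N2 ≤ m → 1 ≤ X →
    (X : ℝ) ≤ 2 * Real.log m ^ 3 →
    ∫ α in (0 : ℝ)..1, (arcs (Ioc 0 X) (X / m)).indicator (fun _ => (1 : ℝ)) α * ‖SS thc (Ioc N1 N2) α‖ ^ 2 ≤
      C * m * (X : ℝ) ^ (1 / 8 : ℝ) := by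
  obtain ⟨C, hC, hV⟩ := VV_bound
  refine ⟨32 * C, by positivity, ?_⟩
  filter_upwards [ev_log 9 (1 / 2) (1 / 32) (by norm_num) (by norm_num), ev_rpow_large (1 / 8) 2 (by norm_num),
    ev_rpow_large (3 / 4) 10 (by norm_num), ev_loglarge 1, eventually_ge_atTop 1] with m h9 h8 h34 hL1 hm1
  intro N1 N2 X hN1 hN2 hX1 hXL
  have hm : (0 : ℝ) < m := by exact_mod_cast hm1
  set L := Real.log m with hL
  have hL0 : 0 < L := by linarith
  set t : ℝ := (m : ℝ) ^ (1 / 8 : ℝ) with ht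
  have ht0 : 0 < t := by positivity
  have ht2 : (m : ℝ) ^ (1 / 4 : ℝ) = t ^ 2 := by
    rw [ht, ← Real.rpow_natCast, ← Real.rpow_mul hm.le]; norm_num
  have ht4 : (m : ℝ) ^ (1 / 2 : ℝ) = t ^ 4 := by
    rw [ht, ← Real.rpow_natCast, ← Real.rpow_mul hm.le]; norm_num
  have ht6 : (m : ℝ) ^ (3 / 4 : ℝ) = t ^ 6 := by
    rw [ht, ← Real.rpow_natCast, ← Real.rpow_mul hm.le]; norm_num
  have ht8 : (m : ℝ) = t ^ 8 := by
    rw [ht, ← Real.rpow_natCast, ← Real.rpow_mul hm.le]; norm_num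
  rw [ht4] at h9
  rw [ht6] at h34
  set R := ⌊t ^ 2⌋₊ with hR
  have hRle : (R : ℝ) ≤ t ^ 2 := Nat.floor_le (by positivity)
  have hRge : t ≤ R := by
    have := Nat.lt_floor_add_one (t ^ 2)
    rw [← hR] at this
    nlinarith
  have hR1 : 1 ≤ R := by
    have : (1 : ℝ) ≤ R := by linarith
    exact_mod_cast this
  have hRN : (R : ℝ) < N1 := by
    have : t ^ 2 * 10 ≤ t ^ 2 * t ^ 6 := by gcongr
    have e : t ^ 2 * t ^ 6 = m := by rw [ht8]; ring
    rw [e] at this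
    have : 0 < t ^ 2 := by positivity
    linarith
  have hRN' : R < N1 := by exact_mod_cast hRN
  have hlogR : L / 8 ≤ Real.log R := by
    have : L / 8 = Real.log t := by rw [ht, Real.log_rpow hm, hL]; ring
    rw [this]
    exact Real.log_le_log ht0 hRge
  have hXL' : (X : ℝ) ≤ 2 * L ^ 3 := hXL
  have hX0 : (0 : ℝ) < X := by exact_mod_cast hX1
  have hst := star thc (Ioc N1 N2) (sqf (pr X) R) (fun r hr => (mem_sqf.1 hr).2.1) (by
      intro n hn ha r hr
      rw [mem_Ioc] at hn
      obtain ⟨⟨hr0, hrR⟩, -, -⟩ := mem_sqf.1 hr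
      have hp : n.Prime := by
        by_contra hnp
        apply ha; unfold thc th; simp [hnp]
      apply Nat.Coprime.symm
      rw [Nat.Prime.coprime_iff_not_dvd hp]
      intro hd
      have := Nat.le_of_dvd hr0 hd
      omega) (Ioc 0 X) (X / m) (fun q hq => (mem_Ioc.1 hq).1) (by
      intro q hq r hr
      rw [mem_Ioc] at hq
      obtain ⟨⟨hr0, hrR⟩, -, hrp⟩ := mem_sqf.1 hr
      apply Nat.coprime_of_dvd
      intro p hp hpr hpq
      have := Nat.le_of_dvd hq.1 hpq
      exact hrp p (mem_pr.2 ⟨by omega, hp⟩) hpr) X (t ^ 2) (fun q hq => by exact_mod_cast (mem_Ioc.1 hq).2)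
      (fun r hr => le_trans (by exact_mod_cast (mem_sqf.1 hr).1.2) hRle) (by
      have e9 : L ^ (9 : ℝ) = L ^ 9 := by rw [← Real.rpow_natCast]; norm_num
      rw [e9] at h9
      have : (X : ℝ) ^ 3 ≤ 8 * L ^ 9 := by
        calc (X : ℝ) ^ 3 ≤ (2 * L ^ 3) ^ 3 := by gcongr
          _ = _ := by ring
      have h4 : 0 < t ^ 4 := by positivity
      have e : 2 * (X / m) * (X : ℝ) ^ 2 * (t ^ 2) ^ 2 = 2 * X ^ 3 / t ^ 4 := by
        rw [ht8]; field_simp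
      rw [e, div_lt_one h4]
      linarith)
  have hG := GG_lower (pr X) (fun p hp => (mem_pr.1 hp).2) R hR1
  have hVX := hV X (pr X) hX1 (Finset.Subset.refl _)
  have hsum := sum_thc_sq m N1 N2 hN2
  set Int := ∫ α in (0 : ℝ)..1, (arcs (Ioc 0 X) (X / m)).indicator (fun _ => (1 : ℝ)) α * ‖SS thc (Ioc N1 N2) α‖ ^ 2 with hInt
  have hI0 : 0 ≤ Int := by
    apply intervalIntegral.integral_nonneg (by norm_num)
    intro α _
    exact mul_nonneg (Set.indicator_nonneg (fun _ _ => by norm_num) _) (by positivity)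
  have hVp := VV_pos (pr X) (fun p hp => (mem_pr.1 hp).2)
  have hst' : GG (pr X) R * Int ≤ 2 * m * L := hst.trans hsum
  have h1 : L / 16 * Int ≤ VV (pr X) * (2 * m * L) := by
    calc L / 16 * Int ≤ (VV (pr X) * GG (pr X) R) * Int := by gcongr; linarith
      _ = VV (pr X) * (GG (pr X) R * Int) := by ring
      _ ≤ _ := by gcongr
  have h2 : L / 16 * Int ≤ L / 16 * (32 * m * VV (pr X)) := by
    refine h1.trans (le_of_eq ?_); ring
  have h3 := le_of_mul_le_mul_left h2 (by positivity)
  calc Int ≤ _ := h3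
    _ ≤ 32 * m * (C * (X : ℝ) ^ (1 / 8 : ℝ)) := by gcongr
    _ = _ := by ring
end FP


namespace FP
open Finset Filter
open scoped ArithmeticFunction.vonMangoldt

lemma thc_le_expsum (N : ℕ) (hN : 1 ≤ N) (α : ℝ) : ‖∑ n ∈ Ioc 0 N, thc n * ee ((n : ℝ) * α)‖ ≤
    ‖∑ n ∈ Ioc 0 N, (Λ n : ℂ) * ee ((n : ℝ) * α)‖ + 2 * √(N : ℝ) * Real.log N := by
  have e : ∑ n ∈ Ioc 0 N, thc n * ee ((n : ℝ) * α) = ∑ n ∈ Ioc 0 N, (Λ n : ℂ) * ee ((n : ℝ) * α)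
      - ∑ n ∈ Ioc 0 N, (kap n : ℂ) * ee ((n : ℝ) * α) := by
    rw [← Finset.sum_sub_distrib]
    apply Finset.sum_congr rfl
    intro n _
    rw [th_add_kap, thc]; push_cast; ring
  rw [e]
  refine (norm_sub_le _ _).trans ?_
  gcongr
  refine le_trans (norm_sum_le_of_le _ fun n _ => ?_) (sum_kap_le N hN)
  rw [norm_mul, norm_ee, mul_one, Complex.norm_real, Real.norm_of_nonneg (kap_nonneg n)]

set_option maxHeartbeats 1000000 in
lemma pt_single : ∃ C > 0, ∀ᶠ m : ℕ in atTop, ∀ (N q : ℕ) (a : ℤ) (β : ℝ), (m : ℝ) / 8 ≤ N → N ≤ m → 0 < q →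
    IsCoprime a (q : ℤ) → q * Real.log m ^ 16 ≤ m → |β| ≤ Real.log m ^ 16 / (q * m) → |β| ≤ 1 / (q : ℝ) ^ 2 →
    ‖∑ n ∈ Ioc 0 N, thc n * ee ((n : ℝ) * (a / q + β))‖ ≤
      C * m * ((max (q : ℝ) (m * |β|)) ^ (-(1 / 4) : ℝ) + Real.log m ^ (-(3 / 4) : ℝ)) := by
  obtain ⟨C, hC, hE⟩ := expsum
  refine ⟨2 * C + 1, by positivity, ?_⟩
  filter_upwards [ev_log (7 / 4) (1 / 2) (1 / 2) (by norm_num) (by norm_num), ev_loglarge (2 ^ 17), eventually_ge_atTop 1]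
    with m h7 hL17 hm1
  intro N q a β hN8 hNm hq ha hqm hβ1 hβ2
  have hm : (0 : ℝ) < m := by exact_mod_cast hm1
  set L := Real.log m with hL
  have hL0 : 0 < L := by linarith
  have hNR : (0 : ℝ) < N := by linarith
  have hN1 : 1 ≤ N := by exact_mod_cast hNR
  have hNmR : (N : ℝ) ≤ m := by exact_mod_cast hNm
  have hqR : (0 : ℝ) < q := by exact_mod_cast hq
  have hlN : Real.log N ≤ L := Real.log_le_log hNR hNmR
  have hlN2 : L / 2 ≤ Real.log N := by
    have h1 := Real.log_le_log (by positivity) hN8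
    rw [Real.log_div hm.ne' (by norm_num), ← hL] at h1
    have h2 : Real.log 8 ≤ 7 := by
      have := Real.log_le_sub_one_of_pos (show (0 : ℝ) < 8 by norm_num); linarith
    linarith
  have hlN0 : 0 < Real.log N := by linarith
  have hes := hE N q a β (by linarith) hq ha (by
      calc (q : ℝ) * Real.log N ^ 15 ≤ q * L ^ 15 := by gcongr
        _ = q * L ^ 16 / L := by field_simp
        _ ≤ m / L := by gcongr
        _ ≤ m / 8 := by gcongr; linarith
        _ ≤ N := hN8) (by
      refine hβ1.trans ?_
      have h17 : L ^ 16 ≤ Real.log N ^ 17 := by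
        calc L ^ 16 ≤ L ^ 16 * (L / 2 ^ 17) := by
              apply le_mul_of_one_le_right (by positivity)
              rw [le_div_iff₀ (by positivity), one_mul]; exact hL17
          _ = (L / 2) ^ 17 := by ring
          _ ≤ _ := by gcongr
      gcongr) hβ2
  have hth := thc_le_expsum N hN1 (a / q + β)
  set Z := max (q : ℝ) (m * |β|) with hZ
  have hZ0 : 0 < Z := lt_of_lt_of_le hqR (le_max_left _ _)
  have hq1 : (1 : ℝ) ≤ q := by exact_mod_cast hq
  have hZb : Z / 8 ≤ q * b1 N β := by
    have hb := b1_ge N β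
    have hb2 : N * |β| ≤ b1 N β := le_max_right _ _
    rw [div_le_iff₀ (by norm_num), hZ, max_le_iff]
    constructor
    · nlinarith
    · have h1 : m / 8 * |β| ≤ N * |β| := by gcongr
      have h2 : b1 N β ≤ q * b1 N β := le_mul_of_one_le_left (by linarith) hq1
      linarith
  have hw1 : (q * b1 N β) ^ (-(1 / 4) : ℝ) ≤ 2 * Z ^ (-(1 / 4) : ℝ) := by
    calc (q * b1 N β) ^ (-(1 / 4) : ℝ) ≤ (Z / 8) ^ (-(1 / 4) : ℝ) :=
          Real.rpow_le_rpow_of_nonpos (by positivity) hZb (by norm_num)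
      _ ≤ (Z / 16) ^ (-(1 / 4) : ℝ) := Real.rpow_le_rpow_of_nonpos (by positivity) (by linarith) (by norm_num)
      _ = 2 * Z ^ (-(1 / 4) : ℝ) := by
          rw [Real.div_rpow hZ0.le (by norm_num), show (16 : ℝ) = 2 ^ (4 : ℝ) by norm_num, ← Real.rpow_mul (by norm_num)]
          norm_num; ring
  have hw2 : Real.log N ^ (-(3 / 4) : ℝ) ≤ 2 * L ^ (-(3 / 4) : ℝ) := by
    calc Real.log N ^ (-(3 / 4) : ℝ) ≤ (L / 2) ^ (-(3 / 4) : ℝ) :=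
          Real.rpow_le_rpow_of_nonpos (by positivity) hlN2 (by norm_num)
      _ = (2 : ℝ) ^ (3 / 4 : ℝ) * L ^ (-(3 / 4) : ℝ) := by
          rw [Real.div_rpow hL0.le (by norm_num), Real.rpow_neg (by norm_num : (0 : ℝ) ≤ 2)]; field_simp
      _ ≤ (2 : ℝ) ^ (1 : ℝ) * L ^ (-(3 / 4) : ℝ) := by
          gcongr
          · norm_num
          · norm_num
      _ = _ := by norm_num
  have hk : 2 * √(N : ℝ) * Real.log N ≤ m * L ^ (-(3 / 4) : ℝ) := by
    rw [← Real.sqrt_eq_rpow] at h7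
    have e : L ^ (7 / 4 : ℝ) * L ^ (-(3 / 4) : ℝ) = L := by
      rw [← Real.rpow_add hL0]; norm_num
    calc 2 * √(N : ℝ) * Real.log N ≤ 2 * √(m : ℝ) * L := by gcongr
      _ = 2 * √(m : ℝ) * (L ^ (7 / 4 : ℝ) * L ^ (-(3 / 4) : ℝ)) := by rw [e]
      _ ≤ 2 * √(m : ℝ) * ((1 / 2 * √(m : ℝ)) * L ^ (-(3 / 4) : ℝ)) := by gcongr
      _ = (√(m : ℝ) * √(m : ℝ)) * L ^ (-(3 / 4) : ℝ) := by ring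
      _ = _ := by rw [Real.mul_self_sqrt hm.le]
  have hZn : 0 ≤ Z ^ (-(1 / 4) : ℝ) := by positivity
  have hLn : 0 ≤ L ^ (-(3 / 4) : ℝ) := by positivity
  have hb0 : 0 ≤ b1 N β := by linarith [b1_ge N β]
  calc _ ≤ _ := hth
    _ ≤ C * N * ((q * b1 N β) ^ (-(1 / 4) : ℝ) + Real.log N ^ (-(3 / 4) : ℝ)) + m * L ^ (-(3 / 4) : ℝ) := add_le_add hes hk
    _ ≤ C * m * (2 * Z ^ (-(1 / 4) : ℝ) + 2 * L ^ (-(3 / 4) : ℝ)) + m * L ^ (-(3 / 4) : ℝ) := by gcongr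
    _ ≤ C * m * (2 * Z ^ (-(1 / 4) : ℝ) + 2 * L ^ (-(3 / 4) : ℝ)) + m * (Z ^ (-(1 / 4) : ℝ) + L ^ (-(3 / 4) : ℝ)) := by
        gcongr; linarith
    _ = _ := by ring

lemma SS_split (N1 N2 : ℕ) (h : N1 ≤ N2) (α : ℝ) : SS thc (Ioc N1 N2) α =
    ∑ n ∈ Ioc 0 N2, thc n * ee ((n : ℝ) * α) - ∑ n ∈ Ioc 0 N1, thc n * ee ((n : ℝ) * α) := by
  unfold SS
  rw [← Finset.sum_Ioc_consecutive _ (Nat.zero_le N1) h]; ring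

set_option maxHeartbeats 1000000 in
lemma pointwise : ∃ C > 0, ∀ᶠ m : ℕ in atTop, ∀ (N1 N2 : ℕ) (α : ℝ), (m : ℝ) / 8 ≤ N1 → N1 ≤ N2 → N2 ≤ m →
    ∃ (q : ℕ) (a : ℤ), 0 < q ∧ ‖SS thc (Ioc N1 N2) α‖ ≤
      C * m * ((max (q : ℝ) (m * |α - a / q|)) ^ (-(1 / 4) : ℝ) + Real.log m ^ (-(3 / 4) : ℝ)) := by
  obtain ⟨C, hC, hE⟩ := pt_single
  refine ⟨2 * C, by positivity, ?_⟩
  filter_upwards [hE, ev_log 16 1 1 (by norm_num) (by norm_num), ev_loglarge 1, eventually_ge_atTop 1]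
    with m hEm h16 hL1 hm1
  intro N1 N2 α hN1 hN12 hN2
  have hm : (0 : ℝ) < m := by exact_mod_cast hm1
  set L := Real.log m with hL
  have hL0 : 0 < L := by linarith
  have e16 : L ^ (16 : ℝ) = L ^ 16 := by rw [← Real.rpow_natCast]; norm_num
  rw [e16, Real.rpow_one, one_mul] at h16
  set Q := ⌊(m : ℝ) / L ^ 16⌋₊ with hQ
  have hQ1 : 0 < Q := by
    rw [hQ, Nat.floor_pos, le_div_iff₀ (by positivity), one_mul]; exact h16
  have hQle : (Q : ℝ) ≤ m / L ^ 16 := Nat.floor_le (by positivity)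
  have hQlt : (m : ℝ) / L ^ 16 < Q + 1 := Nat.lt_floor_add_one _
  obtain ⟨r, hr1, hr2⟩ := Real.exists_rat_abs_sub_le_and_den_le α hQ1
  have hd0 : 0 < r.den := r.den_pos
  have hdR : (0 : ℝ) < r.den := by exact_mod_cast hd0
  have hrc : (r : ℝ) = (r.num : ℝ) / r.den := Rat.cast_def r
  rw [hrc] at hr1
  have hr2R : (r.den : ℝ) ≤ Q := by exact_mod_cast hr2
  set β := α - (r.num : ℝ) / r.den with hβ
  have hα : (r.num : ℝ) / r.den + β = α := by rw [hβ]; ring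
  have hcop : IsCoprime r.num (r.den : ℤ) := by
    rw [Int.isCoprime_iff_nat_coprime]; simpa using r.reduced
  have c1 : (r.den : ℝ) * L ^ 16 ≤ m := by
    rw [← le_div_iff₀ (by positivity)]; linarith
  have c2 : |β| ≤ L ^ 16 / (r.den * m) := by
    refine hr1.trans ?_
    rw [div_le_div_iff₀ (by positivity) (by positivity)]
    rw [div_lt_iff₀ (by positivity)] at hQlt
    calc 1 * ((r.den : ℝ) * m) = r.den * m := by ring
      _ ≤ r.den * ((Q + 1) * L ^ 16) := by gcongr
      _ = _ := by ring
  have c3 : |β| ≤ 1 / (r.den : ℝ) ^ 2 := by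
    refine hr1.trans ?_
    rw [sq]; gcongr; linarith
  have hN12R : (N1 : ℝ) ≤ N2 := by exact_mod_cast hN12
  have b1 := hEm N2 r.den r.num β (by linarith) hN2 hd0 hcop c1 c2 c3
  have b2 := hEm N1 r.den r.num β hN1 (by omega) hd0 hcop c1 c2 c3
  rw [hα] at b1 b2
  refine ⟨r.den, r.num, hd0, ?_⟩
  rw [SS_split _ _ hN12]
  refine (norm_sub_le _ _).trans ?_
  linarith
end FP


namespace FP
open Finset Filter

lemma ii_mul (g F : ℝ → ℝ) (hg : Measurable g) (hg1 : ∀ x, |g x| ≤ 1) (hF : Continuous F) :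
    IntervalIntegrable (fun α => g α * F α) MeasureTheory.volume 0 1 := by
  have h1 : IntervalIntegrable (fun α => |F α|) MeasureTheory.volume 0 1 := by
    apply Continuous.intervalIntegrable; fun_prop
  refine h1.mono_fun' ?_ ?_
  · exact (hg.mul hF.measurable).aestronglyMeasurable
  · refine Filter.Eventually.of_forall fun x => ?_
    simp only [Real.norm_eq_abs, abs_mul]
    exact mul_le_of_le_one_left (abs_nonneg _) (hg1 x)

lemma ind_meas (Q : Finset ℕ) (η : ℝ) : Measurable ((arcs Q η).indicator (fun _ => (1 : ℝ))) :=
  measurable_const.indicator (measurableSet_arcs Q η)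

lemma ind_abs (A : Set ℝ) (x : ℝ) : |A.indicator (fun _ => (1 : ℝ)) x| ≤ 1 := by
  by_cases h : x ∈ A
  · rw [Set.indicator_of_mem h]; norm_num
  · rw [Set.indicator_of_notMem h]; norm_num

lemma ind_nonneg (A : Set ℝ) (x : ℝ) : 0 ≤ A.indicator (fun _ => (1 : ℝ)) x :=
  Set.indicator_nonneg (fun _ _ => by norm_num) _

set_option maxHeartbeats 1000000 in
lemma minor_pt (C : ℝ) (hC : 0 < C) (m j0 J q : ℕ) (a : ℤ) (α L s : ℝ) (hm : 0 < m) (hL : 1 ≤ L) (hq : 0 < q) (hs : 0 ≤ s)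
    (hJ : L ^ 3 ≤ 2 ^ J) (hα : α ∉ arcs (Ioc 0 (2 ^ j0)) ((2 : ℝ) ^ j0 / m))
    (h : s ≤ C * m * ((max (q : ℝ) (m * |α - a / q|)) ^ (-(1 / 4) : ℝ) + L ^ (-(3 / 4) : ℝ))) :
    s ^ 2 ≤ 2 * C ^ 2 * m ^ 2 * (2 * L ^ (-(3 / 2) : ℝ) + ∑ j ∈ Ico j0 J, ((2 : ℝ) ^ (-(1 / 2) : ℝ)) ^ j *
      (arcs (Ioc 0 (2 ^ (j + 1))) (((2 ^ (j + 1) : ℕ) : ℝ) / m)).indicator (fun _ => (1 : ℝ)) α) := by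
  have hmR : (0 : ℝ) < m := by exact_mod_cast hm
  set β := α - a / q with hβ
  set Z := max (q : ℝ) (m * |β|) with hZ
  have hq1 : (1 : ℝ) ≤ q := by exact_mod_cast hq
  have hZ1 : 1 ≤ Z := hq1.trans (le_max_left _ _)
  have hZ0 : 0 < Z := by linarith
  have hL0 : 0 < L := by linarith
  have hmem : ∀ j : ℕ, Z ≤ 2 ^ j → α ∈ arcs (Ioc 0 (2 ^ j)) ((2 : ℝ) ^ j / m) := by
    intro j hj
    refine ⟨q, ?_, a, ?_⟩
    · rw [mem_Ioc]
      refine ⟨hq, ?_⟩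
      have : (q : ℝ) ≤ 2 ^ j := (le_max_left _ _).trans hj
      exact_mod_cast this
    · rw [← hβ, le_div_iff₀ hmR, mul_comm]
      exact (le_max_right _ _).trans hj
  have hZj : (2 : ℝ) ^ j0 < Z := by
    by_contra hcon
    push Not at hcon
    exact hα (hmem j0 hcon)
  set x := Z ^ (-(1 / 4) : ℝ) with hx
  set y := L ^ (-(3 / 4) : ℝ) with hy
  have hx2 : x ^ 2 = Z ^ (-(1 / 2) : ℝ) := by
    rw [hx, ← Real.rpow_natCast, ← Real.rpow_mul hZ0.le]; norm_num
  have hy2 : y ^ 2 = L ^ (-(3 / 2) : ℝ) := by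
    rw [hy, ← Real.rpow_natCast, ← Real.rpow_mul hL0.le]; norm_num
  set T := ∑ j ∈ Ico j0 J, ((2 : ℝ) ^ (-(1 / 2) : ℝ)) ^ j *
      (arcs (Ioc 0 (2 ^ (j + 1))) (((2 ^ (j + 1) : ℕ) : ℝ) / m)).indicator (fun _ => (1 : ℝ)) α with hT
  have hterm : ∀ j ∈ Ico j0 J, 0 ≤ ((2 : ℝ) ^ (-(1 / 2) : ℝ)) ^ j *
      (arcs (Ioc 0 (2 ^ (j + 1))) (((2 ^ (j + 1) : ℕ) : ℝ) / m)).indicator (fun _ => (1 : ℝ)) α :=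
    fun j _ => mul_nonneg (by positivity) (ind_nonneg _ _)
  have hT0 : 0 ≤ T := Finset.sum_nonneg hterm
  have key : x ^ 2 ≤ y ^ 2 + T := by
    by_cases hZL : L ^ 3 ≤ Z
    · have : x ^ 2 ≤ y ^ 2 := by
        rw [hx2, hy2]
        calc Z ^ (-(1 / 2) : ℝ) ≤ (L ^ 3) ^ (-(1 / 2) : ℝ) :=
              Real.rpow_le_rpow_of_nonpos (by positivity) hZL (by norm_num)
          _ = _ := by rw [← Real.rpow_natCast, ← Real.rpow_mul hL0.le]; norm_num
      linarith
    · push Not at hZL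
      obtain ⟨j, hj1, hj2⟩ := exists_nat_pow_near hZ1 (by norm_num : (1 : ℝ) < 2)
      have hjj0 : j0 < j + 1 := by
        have : (2 : ℝ) ^ j0 < 2 ^ (j + 1) := hZj.trans hj2
        exact (pow_lt_pow_iff_right₀ (by norm_num)).1 this
      have hjJ : j < J := by
        have : (2 : ℝ) ^ j < 2 ^ J := by linarith
        exact (pow_lt_pow_iff_right₀ (by norm_num)).1 this
      have h1 := Finset.single_le_sum hterm (mem_Ico.2 ⟨by omega, hjJ⟩ : j ∈ Ico j0 J)
      have h2 : α ∈ arcs (Ioc 0 (2 ^ (j + 1))) (((2 ^ (j + 1) : ℕ) : ℝ) / m) := by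
        have := hmem (j + 1) hj2.le
        push_cast; exact this
      simp only [Set.indicator_of_mem h2, mul_one] at h1
      have h3 : x ^ 2 ≤ ((2 : ℝ) ^ (-(1 / 2) : ℝ)) ^ j := by
        rw [hx2]
        calc Z ^ (-(1 / 2) : ℝ) ≤ ((2 : ℝ) ^ j) ^ (-(1 / 2) : ℝ) :=
              Real.rpow_le_rpow_of_nonpos (by positivity) hj1 (by norm_num)
          _ = _ := by
              rw [← Real.rpow_natCast, ← Real.rpow_natCast, ← Real.rpow_mul (by norm_num), ← Real.rpow_mul (by norm_num), mul_comm]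
      have := sq_nonneg y
      linarith
  calc s ^ 2 ≤ (C * m * (x + y)) ^ 2 := by gcongr
    _ = C ^ 2 * m ^ 2 * (x + y) ^ 2 := by ring
    _ ≤ C ^ 2 * m ^ 2 * (2 * (2 * y ^ 2 + T)) := by
        gcongr
        nlinarith [sq_nonneg (x - y)]
    _ = _ := by rw [hy2]; ring
end FP


namespace FP
open Finset Filter

lemma geo_tail (j0 J : ℕ) (τ : ℝ) (h0 : 0 < τ) (h1 : τ < 1) : ∑ j ∈ Ico j0 J, τ ^ j ≤ τ ^ j0 / (1 - τ) := by
  by_cases h : j0 ≤ J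
  · rw [geom_sum_Ico' h1.ne h]
    have : 0 < 1 - τ := by linarith
    gcongr
    have : 0 ≤ τ ^ J := by positivity
    linarith
  · rw [Finset.Ico_eq_empty (by omega), Finset.sum_empty]
    have : 0 < 1 - τ := by linarith
    positivity

set_option maxHeartbeats 1000000 in
lemma minor_int (δ : ℝ) (hδ : 0 < δ) : ∃ j0 : ℕ, ∀ᶠ m : ℕ in atTop, ∀ (N1 N2 : ℕ) (g : ℝ → ℝ), (m : ℝ) / 8 ≤ N1 →
    N1 ≤ N2 → N2 ≤ m → Measurable g → (∀ x, 0 ≤ g x) → (∀ x, g x ≤ 1) →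
    (∀ α, g α ≠ 0 → α ∉ arcs (Ioc 0 (2 ^ j0)) ((2 : ℝ) ^ j0 / m)) →
    ∫ α in (0 : ℝ)..1, g α * ‖SS thc (Ioc N1 N2) α‖ ^ 4 ≤ δ * m ^ 3 := by
  obtain ⟨C, hC, hP⟩ := pointwise
  obtain ⟨C2, hC2, hT⟩ := theta_int
  set ρ : ℝ := (2 : ℝ) ^ (-(1 / 2) : ℝ) with hρ
  set σ : ℝ := (2 : ℝ) ^ (1 / 8 : ℝ) with hσ
  have hρ0 : 0 < ρ := by positivity
  have hσ0 : 0 < σ := by positivity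
  set τ := ρ * σ with hτ
  have hτ0 : 0 < τ := by positivity
  have hτ1 : τ < 1 := by
    rw [hτ, hρ, hσ, ← Real.rpow_add (by norm_num)]
    apply Real.rpow_lt_one_of_one_lt_of_neg <;> norm_num
  have hD : 0 < 1 - τ := by linarith
  set K := 2 * C ^ 2 * C2 * σ / (1 - τ) with hK
  have hK0 : 0 < K := by positivity
  obtain ⟨j0, hj0⟩ := exists_pow_lt_of_lt_one (show 0 < δ / (2 * K) by positivity) hτ1
  refine ⟨j0, ?_⟩
  have hLev : ∀ᶠ m : ℕ in atTop, (8 * C ^ 2) * Real.log m ^ (-(1 / 2) : ℝ) ≤ δ / 2 := by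
    have h1 := (tendsto_rpow_neg_atTop (show (0 : ℝ) < 1 / 2 by norm_num)).comp
      (Real.tendsto_log_atTop.comp tendsto_natCast_atTop_atTop)
    have h2 := h1.const_mul (8 * C ^ 2)
    rw [mul_zero] at h2
    exact h2.eventually_le_const (by positivity)
  filter_upwards [hP, hT, hLev, ev_loglarge 1, eventually_ge_atTop 1] with m hPm hTm hLm hL1 hm1
  intro N1 N2 g hN1 hN12 hN2 hgm hg0 hg1 hgs
  have hm : (0 : ℝ) < m := by exact_mod_cast hm1
  set L := Real.log m with hL
  have hL0 : 0 < L := by linarith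
  set S := SS thc (Ioc N1 N2) with hS
  have hSc : Continuous S := continuous_SS _ _
  obtain ⟨J', hJ1, hJ2⟩ := exists_nat_pow_near (one_le_pow₀ hL1 : 1 ≤ L ^ 3) (by norm_num : (1 : ℝ) < 2)
  set J := J' + 1 with hJ
  have hJle : (2 : ℝ) ^ J ≤ 2 * L ^ 3 := by rw [hJ, pow_succ]; linarith
  set ind : ℕ → ℝ → ℝ := fun j => (arcs (Ioc 0 (2 ^ (j + 1))) (((2 ^ (j + 1) : ℕ) : ℝ) / m)).indicator (fun _ => (1 : ℝ)) with hind
  have hpt : ∀ α, g α * ‖S α‖ ^ 4 ≤ 2 * C ^ 2 * m ^ 2 * (2 * L ^ (-(3 / 2) : ℝ) * ‖S α‖ ^ 2 +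
      ∑ j ∈ Ico j0 J, ρ ^ j * (ind j α * ‖S α‖ ^ 2)) := by
    intro α
    have hnn : 0 ≤ 2 * C ^ 2 * m ^ 2 * (2 * L ^ (-(3 / 2) : ℝ) * ‖S α‖ ^ 2 +
      ∑ j ∈ Ico j0 J, ρ ^ j * (ind j α * ‖S α‖ ^ 2)) := by
      have : 0 ≤ ∑ j ∈ Ico j0 J, ρ ^ j * (ind j α * ‖S α‖ ^ 2) :=
        Finset.sum_nonneg fun j _ => mul_nonneg (by positivity) (mul_nonneg (ind_nonneg _ _) (by positivity))
      positivity
    by_cases hgα : g α = 0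
    · rw [hgα, zero_mul]; exact hnn
    · obtain ⟨q, a, hq, hb⟩ := hPm N1 N2 α hN1 hN12 hN2
      have := minor_pt C hC m j0 J q a α L ‖S α‖ hm1 hL1 hq (norm_nonneg _) hJ2.le (hgs α hgα) hb
      calc g α * ‖S α‖ ^ 4 ≤ 1 * ‖S α‖ ^ 4 := by gcongr; exact hg1 α
        _ = ‖S α‖ ^ 2 * ‖S α‖ ^ 2 := by ring
        _ ≤ _ := mul_le_mul_of_nonneg_right this (by positivity)
        _ = _ := by
            rw [mul_assoc, add_mul, Finset.sum_mul]
            congr 2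
            apply Finset.sum_congr rfl
            intro j _
            rw [mul_assoc]
  have hi1 : IntervalIntegrable (fun α => ‖S α‖ ^ 2) MeasureTheory.volume 0 1 := by
    apply Continuous.intervalIntegrable; fun_prop
  have hi2 : ∀ j ∈ Ico j0 J, IntervalIntegrable (fun α => ρ ^ j * (ind j α * ‖S α‖ ^ 2)) MeasureTheory.volume 0 1 := by
    intro j _
    apply IntervalIntegrable.const_mul
    exact ii_mul _ _ (ind_meas _ _) (ind_abs _) (by fun_prop)
  have hi3 : IntervalIntegrable (fun α => ∑ j ∈ Ico j0 J, ρ ^ j * (ind j α * ‖S α‖ ^ 2)) MeasureTheory.volume 0 1 :=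
    ii_sum _ _ _ _ hi2
  have hi4 : IntervalIntegrable (fun α => 2 * L ^ (-(3 / 2) : ℝ) * ‖S α‖ ^ 2) MeasureTheory.volume 0 1 := hi1.const_mul _
  have hpars : ∫ α in (0 : ℝ)..1, ‖S α‖ ^ 2 ≤ 2 * m * L := by
    rw [hS, parseval]; exact sum_thc_sq m N1 N2 hN2
  have hΘ : ∀ j ∈ Ico j0 J, ∫ α in (0 : ℝ)..1, ind j α * ‖S α‖ ^ 2 ≤ C2 * m * σ ^ (j + 1) := by
    intro j hj
    rw [mem_Ico] at hj
    have hp : (2 : ℝ) ^ (j + 1) ≤ 2 ^ J := pow_le_pow_right₀ (by norm_num) (by omega)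
    have := hTm N1 N2 (2 ^ (j + 1)) hN1 hN2 Nat.one_le_two_pow (by push_cast; linarith)
    refine this.trans (le_of_eq ?_)
    rw [hσ]; push_cast
    rw [← Real.rpow_natCast, ← Real.rpow_natCast, ← Real.rpow_mul (by norm_num), ← Real.rpow_mul (by norm_num), mul_comm (1 / 8 : ℝ)]
  calc ∫ α in (0 : ℝ)..1, g α * ‖S α‖ ^ 4
      ≤ ∫ α in (0 : ℝ)..1, 2 * C ^ 2 * m ^ 2 * (2 * L ^ (-(3 / 2) : ℝ) * ‖S α‖ ^ 2 +
        ∑ j ∈ Ico j0 J, ρ ^ j * (ind j α * ‖S α‖ ^ 2)) := by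
        apply intervalIntegral.integral_mono_on (by norm_num)
        · apply ii_mul g _ hgm _ (by fun_prop)
          intro x; rw [abs_of_nonneg (hg0 x)]; exact hg1 x
        · exact (hi4.add hi3).const_mul _
        · intro α _; exact hpt α
    _ = 2 * C ^ 2 * m ^ 2 * (2 * L ^ (-(3 / 2) : ℝ) * (∫ α in (0 : ℝ)..1, ‖S α‖ ^ 2) +
        ∑ j ∈ Ico j0 J, ρ ^ j * ∫ α in (0 : ℝ)..1, ind j α * ‖S α‖ ^ 2) := by
        rw [intervalIntegral.integral_const_mul, intervalIntegral.integral_add hi4 hi3,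
          intervalIntegral.integral_const_mul, intervalIntegral.integral_finsetSum hi2]
        simp only [intervalIntegral.integral_const_mul]
    _ ≤ 2 * C ^ 2 * m ^ 2 * (2 * L ^ (-(3 / 2) : ℝ) * (2 * m * L) + ∑ j ∈ Ico j0 J, ρ ^ j * (C2 * m * σ ^ (j + 1))) := by
        gcongr with j hj
        exact hΘ j hj
    _ = (8 * C ^ 2) * (L ^ (-(3 / 2) : ℝ) * L) * m ^ 3 + 2 * C ^ 2 * C2 * σ * (∑ j ∈ Ico j0 J, τ ^ j) * m ^ 3 := by
        have : ∑ j ∈ Ico j0 J, ρ ^ j * (C2 * m * σ ^ (j + 1)) = (∑ j ∈ Ico j0 J, τ ^ j) * (C2 * m * σ) := by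
          rw [Finset.sum_mul]
          apply Finset.sum_congr rfl
          intro j _
          rw [hτ, mul_pow]; ring
        rw [this]; ring
    _ ≤ δ / 2 * m ^ 3 + 2 * C ^ 2 * C2 * σ * (τ ^ j0 / (1 - τ)) * m ^ 3 := by
        have e : L ^ (-(3 / 2) : ℝ) * L = L ^ (-(1 / 2) : ℝ) := by
          have h := Real.rpow_add hL0 (-(3 / 2)) 1
          rw [Real.rpow_one] at h
          rw [← h]; norm_num
        rw [e]
        gcongr
        exact geo_tail _ _ _ hτ0 hτ1
    _ = δ / 2 * m ^ 3 + K * τ ^ j0 * m ^ 3 := by rw [hK]; ring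
    _ ≤ δ / 2 * m ^ 3 + K * (δ / (2 * K)) * m ^ 3 := by gcongr
    _ = _ := by field_simp; norm_num
end FP


namespace FP
open Finset Filter Topology
open scoped ArithmeticFunction.vonMangoldt

lemma abel_id (d : ℕ → ℂ) (β : ℝ) (N : ℕ) : ∑ n ∈ Ioc 0 N, d n * ee ((n : ℝ) * β) =
    (∑ n ∈ Ioc 0 N, d n) * ee ((N : ℝ) * β) -
      ∑ k ∈ range N, (∑ n ∈ Ioc 0 k, d n) * (ee (((k + 1 : ℕ) : ℝ) * β) - ee ((k : ℝ) * β)) := by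
  induction N with
  | zero => simp
  | succ N ih =>
    rw [Finset.sum_range_succ, ← Finset.insert_Ioc_right_eq_Ioc_add_one (Nat.zero_le N),
      Finset.sum_insert (by simp), Finset.sum_insert (by simp), ih]
    ring

lemma abel_le (d : ℕ → ℂ) (β M : ℝ) (N : ℕ) (hM : ∀ k ≤ N, ‖∑ n ∈ Ioc 0 k, d n‖ ≤ M) :
    ‖∑ n ∈ Ioc 0 N, d n * ee ((n : ℝ) * β)‖ ≤ M * (1 + N * (2 * Real.pi * |β|)) := by
  have hM0 : 0 ≤ M := (norm_nonneg _).trans (hM 0 (Nat.zero_le _))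
  rw [abel_id]
  refine (norm_sub_le _ _).trans ?_
  rw [mul_add, mul_one]
  apply add_le_add
  · rw [norm_mul, norm_ee, mul_one]; exact hM N le_rfl
  · refine (norm_sum_le_of_le _ (fun k hk => ?_ : ∀ k ∈ range N, _ ≤ M * (2 * Real.pi * |β|))).trans ?_
    · rw [norm_mul]
      rw [mem_range] at hk
      apply mul_le_mul (hM k (by omega)) _ (norm_nonneg _) hM0
      have := norm_ee_sub_ee_le (((k + 1 : ℕ) : ℝ) * β) ((k : ℝ) * β)
      refine this.trans (le_of_eq ?_)
      congr 2
      push_cast; ring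
    · rw [Finset.sum_const, card_range, nsmul_eq_mul]
      apply le_of_eq; ring

set_option maxHeartbeats 1000000 in
lemma th_class (q b : ℕ) (hq : 0 < q) (hb : b ∈ cop q) (δ : ℝ) (hδ : 0 < δ) : ∃ K : ℝ, 0 ≤ K ∧ ∀ k : ℕ,
    |∑ n ∈ (Ioc 0 k).filter (fun n => n % q = b), th n - k / q.totient| ≤ δ * k + K := by
  have : NeZero q := ⟨hq.ne'⟩
  obtain ⟨hbq, hbc⟩ := mem_cop.1 hb
  have hu : IsUnit (b : ZMod q) := (ZMod.isUnit_iff_coprime b q).2 hbc.symm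
  have h1 := (pnt_ap q (b : ZMod q) hu).comp (tendsto_natCast_atTop_atTop (R := ℝ))
  have h2 := (Metric.tendsto_nhds.1 h1) (δ / 2) (by positivity)
  have h3 := ev_log 1 (1 / 2) (δ / 4) (by norm_num) (by positivity)
  obtain ⟨k0, hk0⟩ := Filter.eventually_atTop.1 (h2.and (h3.and (eventually_ge_atTop 1)))
  have hφ : (1 : ℝ) ≤ q.totient := by exact_mod_cast Nat.totient_pos.2 hq
  have hle : ∀ k : ℕ, ∑ n ∈ (Ioc 0 k).filter (fun n => n % q = b), th n ≤ 2 * k := fun k =>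
    sum_th_sub k _ (Finset.filter_subset _ _)
  have hge : ∀ k : ℕ, 0 ≤ ∑ n ∈ (Ioc 0 k).filter (fun n => n % q = b), th n := fun k =>
    Finset.sum_nonneg fun n _ => th_nonneg n
  refine ⟨2 * k0, by positivity, ?_⟩
  intro k
  by_cases hk : k ≤ k0
  · have hkR : (k : ℝ) ≤ k0 := by exact_mod_cast hk
    have h4 : (k : ℝ) / q.totient ≤ k := div_le_self (by positivity) hφ
    have h5 : 0 ≤ (k : ℝ) / q.totient := by positivity
    have h6 : 0 ≤ δ * k := by positivity
    have := hle k
    have := hge k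
    have : (0 : ℝ) ≤ k := by positivity
    rw [abs_le]
    constructor <;> linarith
  · obtain ⟨e1, e2, e3⟩ := hk0 k (by omega)
    have hkR : (0 : ℝ) < k := by exact_mod_cast e3
    simp only [Function.comp, Nat.floor_natCast] at e1
    rw [Real.dist_eq] at e1
    have e4 : ∑ n ∈ Icc 1 k, ArithmeticFunction.vonMangoldt.residueClass (b : ZMod q) n =
        ∑ n ∈ (Ioc 0 k).filter (fun n => n % q = b), th n + ∑ n ∈ (Ioc 0 k).filter (fun n => n % q = b), kap n := by
      rw [← Finset.sum_add_distrib, Finset.sum_filter]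
      apply Finset.sum_congr
      · ext n; simp [Nat.succ_le_iff]
      · intro n _
        rw [← th_add_kap]
        unfold ArithmeticFunction.vonMangoldt.residueClass
        rw [Set.indicator_apply]
        congr 1
        rw [Set.mem_ofPred_eq, ZMod.natCast_eq_natCast_iff', Nat.mod_eq_of_lt hbq]
    have e5 : ∑ n ∈ (Ioc 0 k).filter (fun n => n % q = b), kap n ≤ 2 * √(k : ℝ) * Real.log k :=
      le_trans (Finset.sum_le_sum_of_subset_of_nonneg (Finset.filter_subset _ _) fun n _ _ => kap_nonneg n) (sum_kap_le k e3)
    have e6 : 0 ≤ ∑ n ∈ (Ioc 0 k).filter (fun n => n % q = b), kap n := Finset.sum_nonneg fun n _ => kap_nonneg n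
    have e7 : 2 * √(k : ℝ) * Real.log k ≤ δ / 2 * k := by
      rw [Real.rpow_one, ← Real.sqrt_eq_rpow] at e2
      calc 2 * √(k : ℝ) * Real.log k ≤ 2 * √(k : ℝ) * (δ / 4 * √(k : ℝ)) := by gcongr
        _ = δ / 2 * (√(k : ℝ) * √(k : ℝ)) := by ring
        _ = _ := by rw [Real.mul_self_sqrt hkR.le]
    rw [e4] at e1
    set A := ∑ n ∈ (Ioc 0 k).filter (fun n => n % q = b), th n
    set B := ∑ n ∈ (Ioc 0 k).filter (fun n => n % q = b), kap n
    have e8 : |A + B - k / q.totient| ≤ δ / 2 * k := by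
      have : A + B - k / q.totient = ((A + B) / k - (q.totient : ℝ)⁻¹) * k := by field_simp
      rw [this, abs_mul, abs_of_pos hkR]
      gcongr
    have hk00 : (0 : ℝ) ≤ 2 * k0 := by positivity
    rw [abs_le] at e8 ⊢
    constructor <;> linarith [e8.1, e8.2]

lemma th_noncop (q b k : ℕ) (hq : 0 < q) (hbq : b < q) (hb : b ∉ cop q) :
    ∑ n ∈ (Ioc 0 k).filter (fun n => n % q = b), th n ≤ 2 * q := by
  have hnc : ¬ q.Coprime b := fun h => hb (mem_cop.2 ⟨hbq, h⟩)
  calc ∑ n ∈ (Ioc 0 k).filter (fun n => n % q = b), th n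
      = ∑ n ∈ ((Ioc 0 k).filter (fun n => n % q = b)).filter Nat.Prime, th n := by
        symm
        apply Finset.sum_filter_of_ne
        intro n _ hn
        by_contra hp
        apply hn; unfold th; simp [hp]
    _ ≤ 2 * q := by
        apply sum_th_sub
        intro n hn
        rw [mem_filter, mem_filter, mem_Ioc] at hn
        obtain ⟨⟨⟨hn0, -⟩, hnb⟩, hp⟩ := hn
        rw [mem_Ioc]
        refine ⟨hn0, ?_⟩
        by_contra hlt
        apply hnc
        have h1 : Nat.Coprime n q := by
          rw [Nat.Prime.coprime_iff_not_dvd hp]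
          intro hd
          have := Nat.le_of_dvd hq hd
          omega
        rw [← hnb]
        unfold Nat.Coprime at *
        rw [Nat.gcd_comm, ← Nat.gcd_rec, Nat.gcd_comm]
        exact h1

set_option maxHeartbeats 1000000 in
lemma D_bound (q a : ℕ) (hq : 0 < q) (ha : a ∈ cop q) (δ : ℝ) (hδ : 0 < δ) : ∃ K : ℝ, 0 ≤ K ∧ ∀ k : ℕ,
    ‖∑ n ∈ Ioc 0 k, (thc n * ee ((n : ℝ) * ((a : ℝ) / q)) - ((ArithmeticFunction.moebius q : ℤ) : ℂ) / q.totient)‖ ≤ δ * k + K := by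
  have hqR : (0 : ℝ) < q := by exact_mod_cast hq
  have hδ' : 0 < δ / q := by positivity
  choose! K hK0 hK using fun b (hb : b ∈ cop q) => th_class q b hq hb (δ / q) hδ'
  have hcs : cop q ⊆ range q := Finset.filter_subset _ _
  set K1 := ∑ b ∈ cop q, K b with hK1
  have hK10 : 0 ≤ K1 := Finset.sum_nonneg fun b hb => hK0 b hb
  refine ⟨K1 + q * (2 * q), by positivity, ?_⟩
  intro k
  set Θ : ℕ → ℝ := fun b => ∑ n ∈ (Ioc 0 k).filter (fun n => n % q = b), th n with hΘ
  have e1 : ∑ n ∈ Ioc 0 k, thc n * ee ((n : ℝ) * ((a : ℝ) / q)) =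
      ∑ b ∈ range q, (Θ b : ℂ) * ee (((b : ℝ) / q) * (a : ℤ)) := by
    rw [← Finset.sum_fiberwise_of_maps_to (s := Ioc 0 k) (t := range q) (g := fun n => n % q)
      (fun n _ => mem_range.2 (Nat.mod_lt _ hq))]
    apply Finset.sum_congr rfl
    intro b _
    simp only [hΘ]
    push_cast
    rw [Finset.sum_mul]
    apply Finset.sum_congr rfl
    intro n hn
    rw [mem_filter] at hn
    unfold thc
    congr 1
    have h2 : (n : ℝ) = q * (n / q : ℕ) + b := by
      rw [← hn.2]; exact_mod_cast (Nat.div_add_mod n q).symm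
    have h3 : (n : ℝ) * ((a : ℝ) / q) = ((b : ℝ) / q) * (a : ℝ) + (((n / q : ℕ) * a : ℕ) : ℤ) := by
      have h4 : (((((n / q : ℕ) * a : ℕ) : ℤ)) : ℝ) = ((n / q : ℕ) : ℝ) * a := by
        rw [Int.cast_natCast, Nat.cast_mul]
      rw [h4, h2]; field_simp; ring
    rw [h3, ee_add_int]
  have hram := ramanujan (a : ℤ) q hq (by exact_mod_cast (Nat.isCoprime_iff_coprime.2 (mem_cop.1 ha).2))
  have e2 : ∑ n ∈ Ioc 0 k, (thc n * ee ((n : ℝ) * ((a : ℝ) / q)) - ((ArithmeticFunction.moebius q : ℤ) : ℂ) / q.totient) =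
      ∑ b ∈ cop q, ((Θ b - k / q.totient : ℝ) : ℂ) * ee (((b : ℝ) / q) * (a : ℤ)) +
      ∑ b ∈ range q \ cop q, (Θ b : ℂ) * ee (((b : ℝ) / q) * (a : ℤ)) := by
    rw [Finset.sum_sub_distrib, e1, ← hram, Finset.sum_const, Nat.card_Ioc, ← Finset.sum_sdiff hcs]
    have : ∑ b ∈ cop q, ((Θ b - k / q.totient : ℝ) : ℂ) * ee (((b : ℝ) / q) * (a : ℤ)) =
        ∑ b ∈ cop q, (Θ b : ℂ) * ee (((b : ℝ) / q) * (a : ℤ)) - (k / q.totient) * ∑ b ∈ cop q, ee (((b : ℝ) / q) * (a : ℤ)) := by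
      rw [Finset.mul_sum, ← Finset.sum_sub_distrib]
      apply Finset.sum_congr rfl
      intro b _
      push_cast; ring
    rw [this, nsmul_eq_mul, Nat.sub_zero]
    ring
  rw [e2]
  refine (norm_add_le _ _).trans ?_
  have b1 : ‖∑ b ∈ cop q, ((Θ b - k / q.totient : ℝ) : ℂ) * ee (((b : ℝ) / q) * (a : ℤ))‖ ≤ δ * k + K1 := by
    refine (norm_sum_le_of_le _ (fun b hb => ?_ : ∀ b ∈ cop q, _ ≤ δ / q * k + K b)).trans ?_
    · rw [norm_mul, norm_ee, mul_one, Complex.norm_real, Real.norm_eq_abs]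
      exact hK b hb k
    · rw [Finset.sum_add_distrib, ← hK1, Finset.sum_const, nsmul_eq_mul]
      refine add_le_add ?_ le_rfl
      have : ((cop q).card : ℝ) ≤ q := by
        have := Finset.card_le_card hcs
        rw [card_range] at this
        exact_mod_cast this
      calc ((cop q).card : ℝ) * (δ / q * k) ≤ q * (δ / q * k) := by gcongr
        _ = δ * k := by field_simp
  have b2 : ‖∑ b ∈ range q \ cop q, (Θ b : ℂ) * ee (((b : ℝ) / q) * (a : ℤ))‖ ≤ q * (2 * q) := by
    refine (norm_sum_le_of_le _ (fun b hb => ?_ : ∀ b ∈ range q \ cop q, _ ≤ (2 * q : ℝ))).trans ?_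
    · rw [Finset.mem_sdiff, mem_range] at hb
      rw [norm_mul, norm_ee, mul_one, Complex.norm_real, Real.norm_of_nonneg (Finset.sum_nonneg fun n _ => th_nonneg n)]
      exact th_noncop q b k hq hb.1 hb.2
    · rw [Finset.sum_const, nsmul_eq_mul]
      gcongr
      have := Finset.card_le_card (Finset.sdiff_subset : range q \ cop q ⊆ range q)
      rwa [card_range] at this
  linarith
end FP


namespace FP
open Finset Filter Topology

noncomputable def muphi (q : ℕ) : ℂ := ((ArithmeticFunction.moebius q : ℤ) : ℂ) / q.totient

noncomputable def TT (N1 N2 : ℕ) : ℝ → ℂ := SS (fun _ => 1) (Ioc N1 N2)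

set_option maxHeartbeats 1000000 in
lemma approx_one (q a : ℕ) (hq : 0 < q) (ha : a ∈ cop q) (B δ : ℝ) (hB : 0 < B) (hδ : 0 < δ) :
    ∀ᶠ m : ℕ in atTop, ∀ N ≤ m, ∀ β : ℝ, |β| ≤ B / m →
    ‖∑ n ∈ Ioc 0 N, thc n * ee ((n : ℝ) * ((a : ℝ) / q + β)) - muphi q * ∑ n ∈ Ioc 0 N, ee ((n : ℝ) * β)‖ ≤ δ * m := by
  set P := 1 + 2 * Real.pi * B with hP
  have hP0 : 0 < P := by positivity
  obtain ⟨K, hK0, hK⟩ := D_bound q a hq ha (δ / (2 * P)) (by positivity)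
  filter_upwards [eventually_ge_atTop ⌈K * P * 2 / δ⌉₊, eventually_ge_atTop 1] with m hm1 hm2
  intro N hN β hβ
  have hm : (0 : ℝ) < m := by exact_mod_cast hm2
  have hmK : K * P * 2 / δ ≤ m := (Nat.le_ceil _).trans (by exact_mod_cast hm1)
  rw [div_le_iff₀ hδ] at hmK
  have hNm : (N : ℝ) ≤ m := by exact_mod_cast hN
  have e : ∑ n ∈ Ioc 0 N, thc n * ee ((n : ℝ) * ((a : ℝ) / q + β)) - muphi q * ∑ n ∈ Ioc 0 N, ee ((n : ℝ) * β) =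
      ∑ n ∈ Ioc 0 N, (thc n * ee ((n : ℝ) * ((a : ℝ) / q)) - muphi q) * ee ((n : ℝ) * β) := by
    rw [Finset.mul_sum, ← Finset.sum_sub_distrib]
    apply Finset.sum_congr rfl
    intro n _
    rw [mul_add, ee_add]; ring
  rw [e]
  have h := abel_le (fun n => thc n * ee ((n : ℝ) * ((a : ℝ) / q)) - muphi q) β (δ / (2 * P) * m + K) N (by
    intro k hk
    refine (hK k).trans ?_
    have : (k : ℝ) ≤ m := by exact_mod_cast hk.trans hN
    gcongr)
  refine h.trans ?_
  have h2 : 1 + N * (2 * Real.pi * |β|) ≤ P := by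
    rw [hP]
    have : N * (2 * Real.pi * |β|) ≤ m * (2 * Real.pi * (B / m)) := by gcongr
    have e2 : m * (2 * Real.pi * (B / m)) = 2 * Real.pi * B := by field_simp
    linarith
  calc (δ / (2 * P) * m + K) * (1 + N * (2 * Real.pi * |β|)) ≤ (δ / (2 * P) * m + K) * P := by gcongr
    _ = δ / 2 * m + K * P := by field_simp
    _ ≤ _ := by linarith

lemma TT_split (N1 N2 : ℕ) (h : N1 ≤ N2) (β : ℝ) : TT N1 N2 β =
    ∑ n ∈ Ioc 0 N2, ee ((n : ℝ) * β) - ∑ n ∈ Ioc 0 N1, ee ((n : ℝ) * β) := by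
  unfold TT SS
  simp only [one_mul]
  rw [← Finset.sum_Ioc_consecutive _ (Nat.zero_le N1) h]; ring

/-- the neighbourhood of the integers -/
def UU (η : ℝ) : Set ℝ := arcs {1} η

lemma mem_UU (η x : ℝ) : x ∈ UU η ↔ ∃ k : ℤ, |x - k| ≤ η := by
  unfold UU arcs
  simp

lemma approx_SS (q a : ℕ) (hq : 0 < q) (ha : a ∈ cop q) (B δ : ℝ) (hB : 0 < B) (hδ : 0 < δ) :
    ∀ᶠ m : ℕ in atTop, ∀ N1 N2, N1 ≤ N2 → N2 ≤ m → ∀ β ∈ UU (B / m),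
    ‖SS thc (Ioc N1 N2) (β + (a : ℝ) / q) - muphi q * TT N1 N2 β‖ ≤ δ * m := by
  filter_upwards [approx_one q a hq ha B (δ / 2) hB (by positivity)] with m hm
  intro N1 N2 h12 h2 β hβ
  obtain ⟨k, hk⟩ := (mem_UU _ _).1 hβ
  have e1 : SS thc (Ioc N1 N2) (β + (a : ℝ) / q) = SS thc (Ioc N1 N2) ((a : ℝ) / q + (β - k)) := by
    rw [← SS_add_int _ _ ((a : ℝ) / q + (β - k)) k]; congr 1; ring
  have e2 : TT N1 N2 β = TT N1 N2 (β - k) := by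
    unfold TT
    rw [← SS_add_int _ _ (β - k) k]; congr 1; ring
  rw [e1, e2, SS_split _ _ h12, TT_split _ _ h12]
  have h3 := hm N2 h2 (β - k) hk
  have h4 := hm N1 (h12.trans h2) (β - k) hk
  have e3 : ∀ A B C D : ℂ, A - B - muphi q * (C - D) = (A - muphi q * C) - (B - muphi q * D) := by
    intros; ring
  rw [e3]
  refine (norm_sub_le _ _).trans ?_
  linarith

set_option maxHeartbeats 1000000 in
lemma UU_int (η : ℝ) (hη : 0 ≤ η) (hη2 : η < 1 / 2) :
    ∫ α in (0 : ℝ)..1, (UU η).indicator (fun _ => (1 : ℝ)) α ≤ 2 * η := by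
  have hmU : MeasurableSet (UU η) := measurableSet_arcs _ _
  rw [intervalIntegral.integral_of_le (by norm_num), MeasureTheory.integral_indicator hmU,
    MeasureTheory.Measure.restrict_restrict hmU, MeasureTheory.integral_const]
  simp only [smul_eq_mul, mul_one, MeasureTheory.measureReal_restrict_apply_univ]
  have hsub : UU η ∩ Set.Ioc 0 1 ⊆ Set.Icc 0 η ∪ Set.Icc (1 - η) 1 := by
    rintro x ⟨hx, hx0, hx1⟩
    obtain ⟨k, hk⟩ := (mem_UU _ _).1 hx
    rw [abs_le] at hk
    have h1 : (k : ℝ) < 2 := by linarith [hk.1]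
    have h2 : (-1 : ℝ) < k := by linarith [hk.2]
    have h1' : k < 2 := by exact_mod_cast h1
    have h2' : -1 < k := by exact_mod_cast h2
    have : k = 0 ∨ k = 1 := by omega
    rcases this with rfl | rfl
    · left; simp at hk; exact ⟨hx0.le, hk.2⟩
    · right; simp at hk; exact ⟨by linarith [hk.1], hx1⟩
  calc MeasureTheory.volume.real (UU η ∩ Set.Ioc 0 1) ≤ MeasureTheory.volume.real (Set.Icc 0 η ∪ Set.Icc (1 - η) 1) := by
        refine MeasureTheory.measureReal_mono hsub ?_
        apply ne_of_lt
        refine (MeasureTheory.measure_union_le _ _).trans_lt ?_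
        simp [Real.volume_Icc]
    _ ≤ _ := MeasureTheory.measureReal_union_le _ _
    _ = 2 * η := by
        rw [Real.volume_real_Icc_of_le hη, Real.volume_real_Icc_of_le (by linarith)]; ring

lemma TT_sym (N1 N2 m : ℕ) (hm : N1 + N2 + 1 = m) (β : ℝ) :
    TT N1 N2 β ^ 4 * ee (-((2 * m : ℕ) : ℝ) * β) = ((‖TT N1 N2 β‖ ^ 4 : ℝ) : ℂ) := by
  have h1 : (starRingEnd ℂ) (TT N1 N2 β) = TT N1 N2 β * ee (-(m : ℝ) * β) := by
    unfold TT SS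
    simp only [one_mul]
    rw [map_sum, Finset.sum_mul]
    apply Finset.sum_bij' (fun n _ => m - n) (fun n _ => m - n)
    · intro n hn; rw [mem_Ioc] at hn ⊢; omega
    · intro n hn; rw [mem_Ioc] at hn ⊢; omega
    · intro n hn; rw [mem_Ioc] at hn; omega
    · intro n hn; rw [mem_Ioc] at hn; omega
    · intro n hn
      rw [mem_Ioc] at hn
      rw [← ee_neg_conj, ← ee_add]
      congr 1
      rw [Nat.cast_sub (by omega)]; ring
  have h2 : ee (-((2 * m : ℕ) : ℝ) * β) = ee (-(m : ℝ) * β) * ee (-(m : ℝ) * β) := by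
    rw [← ee_add]; congr 1; push_cast; ring
  have h3 : ((‖TT N1 N2 β‖ ^ 4 : ℝ) : ℂ) = (TT N1 N2 β * (starRingEnd ℂ) (TT N1 N2 β)) ^ 2 := by
    rw [Complex.mul_conj, Complex.normSq_eq_norm_sq]; push_cast; ring
  rw [h3, h2, h1]; ring

lemma TT_lower (N1 N2 m : ℕ) (hm : 0 < m) (h12 : N1 ≤ N2) (h2 : N2 ≤ m) (β : ℝ) (hβ : |β| ≤ 1 / (16 * m)) :
    ((N2 : ℝ) - N1) / 2 ≤ ‖TT N1 N2 β‖ := by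
  have hmR : (0 : ℝ) < m := by exact_mod_cast hm
  have h12R : (N1 : ℝ) ≤ N2 := by exact_mod_cast h12
  have e : TT N1 N2 β = ((N2 - N1 : ℝ) : ℂ) - ∑ n ∈ Ioc N1 N2, (1 - ee ((n : ℝ) * β)) := by
    unfold TT SS
    rw [Finset.sum_sub_distrib]
    simp only [one_mul, Finset.sum_const, Nat.card_Ioc, nsmul_eq_mul, mul_one]
    push_cast [h12]; ring
  have h3 : ‖∑ n ∈ Ioc N1 N2, (1 - ee ((n : ℝ) * β))‖ ≤ ((N2 : ℝ) - N1) / 2 := by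
    refine (norm_sum_le_of_le _ (fun n hn => ?_ : ∀ n ∈ Ioc N1 N2, _ ≤ (1 / 2 : ℝ))).trans ?_
    · rw [mem_Ioc] at hn
      rw [norm_sub_rev]
      refine (norm_ee_sub_one_le _).trans ?_
      have hn2 : (n : ℝ) ≤ m := by exact_mod_cast hn.2.trans h2
      rw [abs_mul, abs_of_nonneg (by positivity : (0 : ℝ) ≤ n)]
      calc 2 * Real.pi * (n * |β|) ≤ 2 * Real.pi * (m * (1 / (16 * m))) := by gcongr
        _ = Real.pi / 8 := by field_simp; norm_num
        _ ≤ 1 / 2 := by linarith [Real.pi_lt_four]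
    · rw [Finset.sum_const, Nat.card_Ioc, nsmul_eq_mul]
      push_cast [h12]; linarith
  rw [e]
  have h4 := norm_sub_norm_le (((N2 - N1 : ℝ)) : ℂ) (∑ n ∈ Ioc N1 N2, (1 - ee ((n : ℝ) * β)))
  rw [Complex.norm_real, Real.norm_of_nonneg (by linarith)] at h4
  linarith
end FP


namespace FP
open Finset Filter

lemma UU_uniq (C q q' a a' : ℕ) (η α : ℝ) (hC : 2 * η * C ^ 2 < 1) (hq : q ∈ Ioc 0 C) (hq' : q' ∈ Ioc 0 C)
    (ha : a ∈ cop q) (ha' : a' ∈ cop q') (h : α - (a : ℝ) / q ∈ UU η) (h' : α - (a' : ℝ) / q' ∈ UU η) :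
    q = q' ∧ a = a' := by
  obtain ⟨k, hk⟩ := (mem_UU _ _).1 h
  obtain ⟨k', hk'⟩ := (mem_UU _ _).1 h'
  rw [mem_Ioc] at hq hq'
  obtain ⟨ha1, ha2⟩ := mem_cop.1 ha
  obtain ⟨ha1', ha2'⟩ := mem_cop.1 ha'
  have hqR : (0 : ℝ) < q := by exact_mod_cast hq.1
  have hqR' : (0 : ℝ) < q' := by exact_mod_cast hq'.1
  have hqC : (q : ℝ) ≤ C := by exact_mod_cast hq.2
  have hqC' : (q' : ℝ) ≤ C := by exact_mod_cast hq'.2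
  have hη : 0 ≤ η := (abs_nonneg _).trans hk
  set D : ℤ := (a + k * q) * q' - (a' + k' * q') * q with hD
  have e1 : (D : ℝ) = ((α - (a' : ℝ) / q' - k') - (α - (a : ℝ) / q - k)) * (q * q') := by
    rw [hD]; push_cast; field_simp; ring
  have h1 : |(D : ℝ)| < 1 := by
    rw [e1, abs_mul, abs_of_pos (by positivity : (0 : ℝ) < q * q')]
    have h2 := abs_sub (α - (a' : ℝ) / q' - k') (α - (a : ℝ) / q - k)
    have h3 : (q : ℝ) * q' ≤ C ^ 2 := by
      rw [sq]; exact mul_le_mul hqC hqC' hqR'.le (by linarith)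
    calc _ ≤ (2 * η) * (C : ℝ) ^ 2 := mul_le_mul (by linarith) h3 (by positivity) (by positivity)
      _ < 1 := hC
  have hD0 : D = 0 := by
    have : |D| < 1 := by exact_mod_cast h1
    exact Int.abs_lt_one_iff.1 this
  have e2 : ((a : ℤ) + k * q) * q' = (a' + k' * q') * q := by rw [hD] at hD0; linarith
  have c1 : IsCoprime (q : ℤ) (a + k * q) := by
    have : IsCoprime (q : ℤ) a := by exact_mod_cast Nat.isCoprime_iff_coprime.2 ha2
    exact (IsCoprime.add_mul_right_right_iff).2 this
  have c2 : IsCoprime (q' : ℤ) (a' + k' * q') := by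
    have : IsCoprime (q' : ℤ) a' := by exact_mod_cast Nat.isCoprime_iff_coprime.2 ha2'
    exact (IsCoprime.add_mul_right_right_iff).2 this
  have d1 : (q : ℤ) ∣ q' := c1.dvd_of_dvd_mul_left (by rw [e2]; exact dvd_mul_left _ _)
  have d2 : (q' : ℤ) ∣ q := c2.dvd_of_dvd_mul_left (by rw [← e2]; exact dvd_mul_left _ _)
  have hqq : q = q' := Nat.dvd_antisymm (by exact_mod_cast d1) (by exact_mod_cast d2)
  refine ⟨hqq, ?_⟩
  subst hqq
  have e3 : (a : ℤ) + k * q = a' + k' * q := mul_right_cancel₀ (by exact_mod_cast hq.1.ne') e2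
  have e4 : ((a : ℤ) + k * q) % q = (a' + k' * q) % q := by rw [e3]
  rw [Int.add_mul_emod_self_right, Int.add_mul_emod_self_right] at e4
  have e5 : a % q = a' % q := by exact_mod_cast e4
  rwa [Nat.mod_eq_of_lt ha1, Nat.mod_eq_of_lt ha1'] at e5

/-- indicator of the major arcs, as a sum -/
noncomputable def gg (C : ℕ) (η α : ℝ) : ℝ :=
  ∑ q ∈ Ioc 0 C, ∑ a ∈ cop q, (UU η).indicator (fun _ => (1 : ℝ)) (α - (a : ℝ) / q)

lemma gg_nonneg (C : ℕ) (η α : ℝ) : 0 ≤ gg C η α :=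
  Finset.sum_nonneg fun _ _ => Finset.sum_nonneg fun _ _ => ind_nonneg _ _

lemma gg_meas (C : ℕ) (η : ℝ) : Measurable (gg C η) := by
  unfold gg
  refine Finset.measurable_sum _ fun q _ => Finset.measurable_sum _ fun a _ => ?_
  exact (ind_meas _ _).comp (measurable_id.sub_const _)

lemma gg_le_one (C : ℕ) (η α : ℝ) (hC : 2 * η * C ^ 2 < 1) : gg C η α ≤ 1 := by
  by_cases h : ∃ q ∈ Ioc 0 C, ∃ a ∈ cop q, α - (a : ℝ) / q ∈ UU η
  · obtain ⟨q, hq, a, ha, h⟩ := h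
    unfold gg
    rw [Finset.sum_eq_single q, Finset.sum_eq_single a]
    · exact (le_abs_self _).trans (ind_abs _ _)
    · intro b hb hba
      apply Set.indicator_of_notMem
      intro hh
      exact hba (UU_uniq C q q a b η α hC hq hq ha hb h hh).2.symm
    · intro hh; exact absurd ha hh
    · intro q' hq' hne
      apply Finset.sum_eq_zero
      intro b hb
      apply Set.indicator_of_notMem
      intro hh
      exact hne (UU_uniq C q q' a b η α hC hq hq' ha hb h hh).1.symm
    · intro hh; exact absurd hq hh
  · push Not at h
    unfold gg
    rw [Finset.sum_eq_zero]
    · norm_num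
    · intro q hq
      apply Finset.sum_eq_zero
      intro a ha
      exact Set.indicator_of_notMem (h q hq a ha) _

lemma gg_ge_one (C : ℕ) (η α : ℝ) (h : α ∈ arcs (Ioc 0 C) η) : 1 ≤ gg C η α := by
  obtain ⟨q, hq, k, hk⟩ := h
  rw [mem_Ioc] at hq
  set r : ℚ := (k : ℚ) / q with hr
  have hd : r.den ∣ q := by
    have := Rat.den_dvd k (q : ℤ)
    rw [hr]; exact_mod_cast this
  have hden : 0 < r.den := r.den_pos
  have hdC : r.den ∈ Ioc 0 C := mem_Ioc.2 ⟨hden, (Nat.le_of_dvd hq.1 hd).trans hq.2⟩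
  set a : ℕ := (r.num % r.den).toNat with ha
  have hdz : (r.den : ℤ) ≠ 0 := by exact_mod_cast hden.ne'
  have ha0 : (a : ℤ) = r.num % r.den := Int.toNat_of_nonneg (Int.emod_nonneg _ hdz)
  have hacop : a ∈ cop r.den := by
    rw [mem_cop]
    constructor
    · have : (a : ℤ) < r.den := by rw [ha0]; exact Int.emod_lt_of_pos _ (by exact_mod_cast hden)
      exact_mod_cast this
    · rw [← Nat.isCoprime_iff_coprime, ha0]
      have h1 : IsCoprime (r.den : ℤ) r.num := by
        rw [Int.isCoprime_iff_gcd_eq_one]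
        have := r.reduced
        rw [Int.gcd_comm]; exact this
      have h2 : r.num % r.den = r.num + (-(r.num / r.den)) * r.den := by
        have := Int.emod_add_mul_ediv r.num r.den
        linarith
      rw [h2]
      exact (IsCoprime.add_mul_right_right_iff).2 h1
  have hmem : α - (a : ℝ) / r.den ∈ UU η := by
    rw [mem_UU]
    refine ⟨r.num / r.den, ?_⟩
    have h3 : ((k : ℝ) / q) = (r.num : ℝ) / r.den := by
      have h4 : ((r : ℚ) : ℝ) = (r.num : ℝ) / r.den := Rat.cast_def r
      rw [← h4, hr]; push_cast; rfl
    have h5 : (r.num : ℝ) = a + r.den * ((r.num / r.den : ℤ) : ℝ) := by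
      have := Int.emod_add_mul_ediv r.num r.den
      rw [← ha0] at this
      have h6 : (((a : ℤ) + r.den * (r.num / r.den) : ℤ) : ℝ) = ((r.num : ℤ) : ℝ) := by rw [this]
      push_cast at h6
      exact h6.symm
    have hdR : (0 : ℝ) < r.den := by exact_mod_cast hden
    have h7 : α - (a : ℝ) / r.den - ((r.num / r.den : ℤ) : ℝ) = α - k / q := by
      rw [h3, h5]; field_simp; ring
    rw [h7]; exact hk
  have : (UU η).indicator (fun _ => (1 : ℝ)) (α - (a : ℝ) / r.den) = 1 := Set.indicator_of_mem hmem _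
  rw [← this]
  unfold gg
  refine le_trans ?_ (Finset.single_le_sum (f := fun q : ℕ => ∑ a ∈ cop q, (UU η).indicator (fun _ => (1 : ℝ)) (α - (a : ℝ) / q))
    (fun _ _ => Finset.sum_nonneg fun _ _ => ind_nonneg _ _) hdC)
  exact Finset.single_le_sum (f := fun a : ℕ => (UU η).indicator (fun _ => (1 : ℝ)) (α - (a : ℝ) / r.den)) (fun _ _ => ind_nonneg _ _) hacop

end FP


namespace FP
open Finset Filter

lemma le_tot_sq (q : ℕ) (hq : 0 < q) : (Odd q → q ≤ q.totient ^ 2) ∧ q ≤ 2 * q.totient ^ 2 := by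
  induction q using Nat.recOnPosPrimePosCoprime with
  | zero => omega
  | one => simp
  | prime_pow p k hp hk =>
    obtain ⟨j, rfl⟩ : ∃ j, k = j + 1 := ⟨k - 1, by omega⟩
    rw [Nat.totient_prime_pow_succ hp]
    have hpj : 1 ≤ p ^ j := Nat.one_le_pow _ _ hp.pos
    have h1 : p ^ (j + 1) = p ^ j * p := pow_succ _ _
    obtain ⟨t, rfl⟩ : ∃ t, p = t + 2 := ⟨p - 2, by have := hp.two_le; omega⟩
    have h2 : t + 2 - 1 = t + 1 := by omega
    rw [h1, h2]
    set x := (t + 2) ^ j with hx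
    have key : ∀ c : ℕ, t + 2 ≤ c * (t + 1) ^ 2 → x * (t + 2) ≤ c * (x * (t + 1)) ^ 2 := by
      intro c hc
      calc x * (t + 2) ≤ x * (c * (t + 1) ^ 2) := Nat.mul_le_mul_left _ hc
        _ ≤ (x * x) * (c * (t + 1) ^ 2) := Nat.mul_le_mul_right _ (Nat.le_mul_of_pos_left _ hpj)
        _ = _ := by ring
    constructor
    · intro ho
      have ht : 1 ≤ t := by
        rcases Nat.eq_zero_or_pos t with rfl | h
        · exfalso
          rw [Nat.odd_mul] at ho
          exact absurd ho.2 (by decide)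
        · exact h
      have := key 1 (by nlinarith)
      rwa [one_mul] at this
    · exact key 2 (by nlinarith)
  | coprime a b ha hb hab iha ihb =>
    rw [Nat.totient_mul hab]
    have ha' := iha (by omega)
    have hb' := ihb (by omega)
    constructor
    · intro ho
      rw [Nat.odd_mul] at ho
      rw [mul_pow]; exact Nat.mul_le_mul (ha'.1 ho.1) (hb'.1 ho.2)
    · rcases Nat.even_or_odd a with h | h
      · have hbo : Odd b := by
          rw [← Nat.not_even_iff_odd]
          intro h2
          have := Nat.dvd_gcd h.two_dvd h2.two_dvd
          rw [hab] at this; omega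
        calc a * b ≤ (2 * a.totient ^ 2) * b.totient ^ 2 := Nat.mul_le_mul ha'.2 (hb'.1 hbo)
          _ = _ := by ring
      · calc a * b ≤ a.totient ^ 2 * (2 * b.totient ^ 2) := Nat.mul_le_mul (ha'.1 h) hb'.2
          _ = _ := by ring

lemma tot_term (n : ℕ) (hn : 1 ≤ n) :
    1 / ((n + 1).totient : ℝ) ^ 3 ≤ 5.66 * (1 / √(n : ℝ) - 1 / √((n : ℝ) + 1)) := by
  have hn0 : (1 : ℝ) ≤ n := by exact_mod_cast hn
  set t := √(n : ℝ) with ht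
  set s := √((n : ℝ) + 1) with hs
  have ht0 : 0 < t := Real.sqrt_pos.2 (by linarith)
  have hs0 : 0 < s := Real.sqrt_pos.2 (by linarith)
  have ht2 : t ^ 2 = n := Real.sq_sqrt (by linarith)
  have hs2 : s ^ 2 = n + 1 := Real.sq_sqrt (by linarith)
  have hts : t ≤ s := Real.sqrt_le_sqrt (by linarith)
  have hφ := (le_tot_sq (n + 1) (by omega)).2
  set f : ℝ := ((n + 1).totient : ℝ) with hf
  have hf0 : 0 < f := by rw [hf]; exact_mod_cast Nat.totient_pos.2 (by omega)
  have hφ' : s ^ 2 ≤ 2 * f ^ 2 := by rw [hs2, hf]; exact_mod_cast hφ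
  have h1 : s ≤ 1.415 * f := by
    apply le_of_sq_le_sq _ (by positivity)
    nlinarith
  have h2 : s ^ 3 ≤ 2.83 * f ^ 3 := by
    calc s ^ 3 = s ^ 2 * s := by ring
      _ ≤ (2 * f ^ 2) * (1.415 * f) := mul_le_mul hφ' h1 hs0.le (by positivity)
      _ = _ := by ring
  have h3 : 1 / f ^ 3 ≤ 2.83 / s ^ 3 := by
    rw [div_le_div_iff₀ (by positivity) (by positivity)]; linarith
  have h4 : 1 / t - 1 / s = 1 / (s * t * (s + t)) := by
    have : (s - t) * (s + t) = 1 := by nlinarith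
    have h5 : s - t = 1 / (s + t) := by rw [eq_div_iff (by positivity)]; exact this
    have : 1 / t - 1 / s = (s - t) / (s * t) := by field_simp
    rw [this, h5]; field_simp
  have h5 : s * t * (s + t) ≤ 2 * s ^ 3 := by
    calc s * t * (s + t) ≤ s * s * (s + s) := by gcongr
      _ = _ := by ring
  rw [h4]
  have h6 : 1 / (2 * s ^ 3) ≤ 1 / (s * t * (s + t)) := one_div_le_one_div_of_le (by positivity) h5
  calc _ ≤ _ := h3
    _ = 5.66 * (1 / (2 * s ^ 3)) := by field_simp; norm_num
    _ ≤ _ := by linarith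

lemma tot_sum30 : ∑ q ∈ Ioc 2 30, 1 / (q.totient : ℝ) ^ 3 ≤ 1 / 2 := by
  have e : ∀ q ∈ Ioc 2 30, (1 / (q.totient : ℝ) ^ 3) = (((1 / (q.totient : ℚ) ^ 3 : ℚ)) : ℝ) := by
    intro q _; push_cast; rfl
  rw [Finset.sum_congr rfl e, ← Rat.cast_sum]
  have : ∑ q ∈ Ioc 2 30, (1 / (q.totient : ℚ) ^ 3) ≤ 1 / 2 := by decide +kernel
  have h2 : ((∑ q ∈ Ioc 2 30, (1 / (q.totient : ℚ) ^ 3) : ℚ) : ℝ) ≤ ((1 / 2 : ℚ) : ℝ) := by exact_mod_cast this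
  refine h2.trans (by norm_num)

lemma tot_sum (C : ℕ) : ∑ q ∈ Ioc 2 C, 1 / (q.totient : ℝ) ^ 3 ≤ 7 / 4 := by
  have key : ∀ n : ℕ, 30 ≤ n → ∑ q ∈ Ioc 2 n, 1 / (q.totient : ℝ) ^ 3 ≤ 1 / 2 + 5.66 * (1 / √(30 : ℝ) - 1 / √(n : ℝ)) := by
    intro n hn
    induction n, hn using Nat.le_induction with
    | base => have := tot_sum30; push_cast; linarith
    | succ n hn ih =>
      rw [Finset.sum_Ioc_succ_top (by omega)]
      have := tot_term n (by omega)
      push_cast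
      linarith
  have h1 := key (max C 30) (le_max_right _ _)
  have h2 : 0 ≤ 1 / √((max C 30 : ℕ) : ℝ) := by positivity
  have h3 : 1 / √(30 : ℝ) ≤ 1 / 5.4 := by
    apply one_div_le_one_div_of_le (by norm_num)
    apply Real.le_sqrt_of_sq_le; norm_num
  calc _ ≤ ∑ q ∈ Ioc 2 (max C 30), 1 / (q.totient : ℝ) ^ 3 := by
        apply Finset.sum_le_sum_of_subset_of_nonneg
        · exact Finset.Ioc_subset_Ioc_right (le_max_left _ _)
        · intros; positivity
    _ ≤ _ := h1
    _ ≤ 1 / 2 + 5.66 * (1 / 5.4 - 0) := by linarith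
    _ ≤ 7 / 4 := by norm_num

/-- lower bound weights -/
noncomputable def kpw (q : ℕ) : ℝ := if q ≤ 2 then 1 else -(1 / (q.totient : ℝ) ^ 4)

lemma kpw_sum (C : ℕ) (hC : 1 ≤ C) : 1 / 4 ≤ ∑ q ∈ Ioc 0 C, (q.totient : ℝ) * kpw q := by
  rcases Nat.lt_or_ge C 2 with h | h
  · have : C = 1 := by omega
    subst this
    simp [kpw]; norm_num
  · rw [← Finset.sum_Ioc_consecutive _ (Nat.zero_le 2) h]
    have h1 : ∑ q ∈ Ioc 0 2, (q.totient : ℝ) * kpw q = 2 := by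
      rw [show Ioc 0 2 = {1, 2} by decide, Finset.sum_pair (by norm_num)]
      simp [kpw]; norm_num
    have h2 : ∑ q ∈ Ioc 2 C, (q.totient : ℝ) * kpw q = - ∑ q ∈ Ioc 2 C, 1 / (q.totient : ℝ) ^ 3 := by
      rw [← Finset.sum_neg_distrib]
      apply Finset.sum_congr rfl
      intro q hq
      rw [mem_Ioc] at hq
      have : (0 : ℝ) < q.totient := by exact_mod_cast Nat.totient_pos.2 (by omega)
      rw [kpw, if_neg (by omega)]
      field_simp
    rw [h1, h2]
    linarith [tot_sum C]
end FP


namespace FP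
open Finset Filter

lemma thc_nonprime (n : ℕ) (h : ¬ n.Prime) : thc n = 0 := by
  unfold thc th; simp [h]

lemma SS4 (s : Finset ℕ) (n : ℕ) (α : ℝ) : SS thc s α ^ 4 * ee (-(n : ℝ) * α) =
    ∑ a ∈ s, ∑ b ∈ s, ∑ c ∈ s, ∑ d ∈ s, thc a * thc b * thc c * thc d *
      ee ((((a : ℤ) + b + c + d - n : ℤ) : ℝ) * α) := by
  have e : SS thc s α ^ 4 * ee (-(n : ℝ) * α) =
      SS thc s α * (SS thc s α * (SS thc s α * (SS thc s α * ee (-(n : ℝ) * α)))) := by ring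
  rw [e]
  unfold SS
  simp only [Finset.sum_mul, Finset.mul_sum]
  refine Finset.sum_congr rfl fun a _ => Finset.sum_congr rfl fun b _ => Finset.sum_congr rfl fun c _ =>
    Finset.sum_congr rfl fun d _ => ?_
  have : ee ((((a : ℤ) + b + c + d - n : ℤ) : ℝ) * α) =
      ee (a * α) * ee (b * α) * ee (c * α) * ee (d * α) * ee (-(n : ℝ) * α) := by
    rw [← ee_add, ← ee_add, ← ee_add, ← ee_add]; congr 1; push_cast; ring
  rw [this]; ring

lemma norep_int (s : Finset ℕ) (n : ℕ)
    (h : ∀ a ∈ s, ∀ b ∈ s, ∀ c ∈ s, ∀ d ∈ s, a.Prime → b.Prime → c.Prime → d.Prime → n ≠ a + b + c + d) :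
    ∫ α in (0 : ℝ)..1, SS thc s α ^ 4 * ee (-(n : ℝ) * α) = 0 := by
  have hc : ∀ k : ℤ, Continuous fun α : ℝ => ee ((k : ℝ) * α) := fun k => continuous_ee.comp (by fun_prop)
  simp only [SS4]
  rw [intervalIntegral.integral_finsetSum]
  swap
  · intro a _
    apply Continuous.intervalIntegrable
    refine continuous_finsetSum _ fun b _ => continuous_finsetSum _ fun c _ => continuous_finsetSum _ fun d _ => ?_
    exact continuous_const.mul (hc _)
  refine Finset.sum_eq_zero fun a ha => ?_
  rw [intervalIntegral.integral_finsetSum]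
  swap
  · intro b _
    apply Continuous.intervalIntegrable
    refine continuous_finsetSum _ fun c _ => continuous_finsetSum _ fun d _ => ?_
    exact continuous_const.mul (hc _)
  refine Finset.sum_eq_zero fun b hb => ?_
  rw [intervalIntegral.integral_finsetSum]
  swap
  · intro c _
    apply Continuous.intervalIntegrable
    refine continuous_finsetSum _ fun d _ => ?_
    exact continuous_const.mul (hc _)
  refine Finset.sum_eq_zero fun c hcc => ?_
  rw [intervalIntegral.integral_finsetSum]
  swap
  · intro d _
    apply Continuous.intervalIntegrable
    exact continuous_const.mul (hc _)
  refine Finset.sum_eq_zero fun d hd => ?_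
  rw [intervalIntegral.integral_const_mul, integral_ee]
  by_cases hap : a.Prime
  swap
  · rw [thc_nonprime a hap]; simp
  by_cases hbp : b.Prime
  swap
  · rw [thc_nonprime b hbp]; simp
  by_cases hcp : c.Prime
  swap
  · rw [thc_nonprime c hcp]; simp
  by_cases hdp : d.Prime
  swap
  · rw [thc_nonprime d hdp]; simp
  rw [if_neg, mul_zero]
  have := h a ha b hb c hcc d hd hap hbp hcp hdp
  omega

/-- the real part of the integrand -/
noncomputable def fr (N1 N2 n : ℕ) (α : ℝ) : ℝ := (SS thc (Ioc N1 N2) α ^ 4 * ee (-(n : ℝ) * α)).re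

lemma cont_fr0 (N1 N2 n : ℕ) : Continuous fun α => SS thc (Ioc N1 N2) α ^ 4 * ee (-(n : ℝ) * α) :=
  ((continuous_SS _ _).pow 4).mul (continuous_ee.comp (by fun_prop))

lemma cont_fr (N1 N2 n : ℕ) : Continuous (fr N1 N2 n) := Complex.continuous_re.comp (cont_fr0 N1 N2 n)

lemma fr_abs (N1 N2 n : ℕ) (α : ℝ) : |fr N1 N2 n α| ≤ ‖SS thc (Ioc N1 N2) α‖ ^ 4 := by
  unfold fr
  refine (Complex.abs_re_le_norm _).trans ?_
  rw [norm_mul, norm_ee, norm_pow, mul_one]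

lemma fr_per (N1 N2 n : ℕ) : Function.Periodic (fr N1 N2 n) 1 := by
  intro x
  unfold fr
  have h1 : SS thc (Ioc N1 N2) (x + 1) = SS thc (Ioc N1 N2) x := SS_periodic _ _ x
  have h2 : ee (-(n : ℝ) * (x + 1)) = ee (-(n : ℝ) * x) := by
    rw [← ee_sub_int (-(n : ℝ) * x) n]; congr 1; push_cast; ring
  rw [h1, h2]

lemma fr_int (N1 N2 n : ℕ)
    (h : ∀ a ∈ Ioc N1 N2, ∀ b ∈ Ioc N1 N2, ∀ c ∈ Ioc N1 N2, ∀ d ∈ Ioc N1 N2,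
      a.Prime → b.Prime → c.Prime → d.Prime → n ≠ a + b + c + d) :
    ∫ α in (0 : ℝ)..1, fr N1 N2 n α = 0 := by
  have h1 := norep_int (Ioc N1 N2) n h
  have h2 := Complex.reCLM.intervalIntegral_comp_comm ((cont_fr0 N1 N2 n).intervalIntegrable (μ := MeasureTheory.volume) 0 1)
  rw [h1] at h2
  simpa [fr] using h2

lemma shift_int (N1 N2 n : ℕ) (η c : ℝ) :
    ∫ α in (0 : ℝ)..1, (UU η).indicator (fun _ => (1 : ℝ)) (α - c) * fr N1 N2 n α =
    ∫ β in (0 : ℝ)..1, (UU η).indicator (fun _ => (1 : ℝ)) β * fr N1 N2 n (β + c) := by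
  set F : ℝ → ℝ := fun β => (UU η).indicator (fun _ => (1 : ℝ)) β * fr N1 N2 n (β + c) with hF
  have hper : Function.Periodic F 1 := by
    intro x
    simp only [hF]
    have h1 : fr N1 N2 n (x + 1 + c) = fr N1 N2 n (x + c) := by
      rw [← fr_per N1 N2 n (x + c)]; congr 1; ring
    have h2 : (x + 1 ∈ UU η) = (x ∈ UU η) := propext (arcs_add_one _ _ (by simp) x)
    rw [h1]
    by_cases hx : x ∈ UU η
    · rw [Set.indicator_of_mem hx, Set.indicator_of_mem (h2 ▸ hx)]
    · rw [Set.indicator_of_notMem hx, Set.indicator_of_notMem (h2 ▸ hx)]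
  have h3 : ∀ α, (UU η).indicator (fun _ => (1 : ℝ)) (α - c) * fr N1 N2 n α = F (α - c) := by
    intro α; simp [hF]
  simp only [h3]
  rw [intervalIntegral.integral_comp_sub_right (fun x => F x) c]
  have := hper.intervalIntegral_add_eq (0 - c) 0
  rw [show (1 : ℝ) - c = 0 - c + 1 by ring, this]; simp
end FP


namespace FP
open Finset Filter

lemma pow4_diff (A B : ℂ) (x d : ℝ) (hx : 0 ≤ x) (hA : ‖A‖ ≤ x) (hB : ‖B‖ ≤ x) (hd : ‖A - B‖ ≤ d) :
    ‖A ^ 4 - B ^ 4‖ ≤ d * (4 * x ^ 3) := by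
  have e : A ^ 4 - B ^ 4 = (A - B) * (A ^ 3 + A ^ 2 * B + A * B ^ 2 + B ^ 3) := by ring
  rw [e, norm_mul]
  refine mul_le_mul hd ?_ (norm_nonneg _) ((norm_nonneg _).trans hd)
  have h1 : ‖A ^ 3‖ ≤ x ^ 3 := by rw [norm_pow]; gcongr
  have h2 : ‖A ^ 2 * B‖ ≤ x ^ 3 := by
    rw [norm_mul, norm_pow, pow_succ x 2]; gcongr
  have h3 : ‖A * B ^ 2‖ ≤ x ^ 3 := by
    rw [norm_mul, norm_pow, show x ^ 3 = x * x ^ 2 by ring]; gcongr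
  have h4 : ‖B ^ 3‖ ≤ x ^ 3 := by rw [norm_pow]; gcongr
  have h5 := norm_add_le (A ^ 3 + A ^ 2 * B + A * B ^ 2) (B ^ 3)
  have h6 := norm_add_le (A ^ 3 + A ^ 2 * B) (A * B ^ 2)
  have h7 := norm_add_le (A ^ 3) (A ^ 2 * B)
  linarith

lemma norm_SS_le (m N1 N2 : ℕ) (h2 : N2 ≤ m) (α : ℝ) : ‖SS thc (Ioc N1 N2) α‖ ≤ 2 * m := by
  unfold SS
  refine (norm_sum_le_of_le _ (fun n _ => ?_ : ∀ n ∈ Ioc N1 N2, _ ≤ th n)).trans ?_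
  · rw [norm_mul, norm_ee, mul_one, norm_thc]
  · exact sum_th_sub m _ (Finset.Ioc_subset_Ioc (Nat.zero_le _) h2)

lemma norm_TT_le (m N1 N2 : ℕ) (h2 : N2 ≤ m) (α : ℝ) : ‖TT N1 N2 α‖ ≤ m := by
  unfold TT SS
  refine (norm_sum_le_of_le _ (fun n _ => ?_ : ∀ n ∈ Ioc N1 N2, _ ≤ (1 : ℝ))).trans ?_
  · rw [norm_mul, norm_ee, mul_one, norm_one]
  · rw [Finset.sum_const, Nat.card_Ioc, nsmul_eq_mul, mul_one]
    exact_mod_cast (Nat.sub_le _ _).trans h2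

lemma norm_muphi (q : ℕ) (hq : 0 < q) : ‖muphi q‖ ≤ 1 / q.totient := by
  unfold muphi
  rw [norm_div, Complex.norm_natCast]
  apply div_le_div_of_nonneg_right _ (by positivity)
  rw [Complex.norm_intCast]
  exact_mod_cast ArithmeticFunction.abs_moebius_le_one

lemma norm_muphi_le_one (q : ℕ) (hq : 0 < q) : ‖muphi q‖ ≤ 1 := by
  refine (norm_muphi q hq).trans ?_
  have : (1 : ℝ) ≤ q.totient := by exact_mod_cast Nat.totient_pos.2 hq
  rw [div_le_one (by linarith)]; exact this

lemma main_re (q a m : ℕ) (hq : 0 < q) (ha : a ∈ cop q) (t : ℝ) (ht : 0 ≤ t) :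
    kpw q * t ≤ (muphi q ^ 4 * (t : ℂ) * ee (-((2 * m : ℕ) : ℝ) * ((a : ℝ) / q))).re := by
  obtain ⟨ha1, ha2⟩ := mem_cop.1 ha
  by_cases h : q ≤ 2
  · rw [kpw, if_pos h, one_mul]
    have h12 : q = 1 ∨ q = 2 := by omega
    have h1 : muphi q ^ 4 = 1 := by
      rcases h12 with rfl | rfl
      · simp [muphi]
      · unfold muphi; rw [ArithmeticFunction.moebius_apply_prime Nat.prime_two]; simp; norm_num
    have h2 : ee (-((2 * m : ℕ) : ℝ) * ((a : ℝ) / q)) = 1 := by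
      rcases h12 with rfl | rfl
      · have : a = 0 := by omega
        subst this; simp [ee_zero]
      · rw [← ee_int (-(m * a : ℤ))]; congr 1; push_cast; ring
    rw [h1, h2]; simp
  · rw [kpw, if_neg h]
    set z := muphi q ^ 4 * (t : ℂ) * ee (-((2 * m : ℕ) : ℝ) * ((a : ℝ) / q)) with hz
    have h1 : ‖z‖ ≤ 1 / (q.totient : ℝ) ^ 4 * t := by
      rw [hz, norm_mul, norm_mul, norm_ee, mul_one, norm_pow, Complex.norm_real, Real.norm_of_nonneg ht]
      apply mul_le_mul_of_nonneg_right _ ht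
      calc ‖muphi q‖ ^ 4 ≤ (1 / (q.totient : ℝ)) ^ 4 := pow_le_pow_left₀ (norm_nonneg _) (norm_muphi q hq) 4
        _ = _ := by rw [div_pow, one_pow]
    have h2 := (abs_le.1 (Complex.abs_re_le_norm z)).1
    linarith

lemma fr_lower (q a m N1 N2 : ℕ) (hq : 0 < q) (ha : a ∈ cop q) (hm : N1 + N2 + 1 = m) (β δ : ℝ)
    (h : ‖SS thc (Ioc N1 N2) (β + (a : ℝ) / q) - muphi q * TT N1 N2 β‖ ≤ δ * m) :
    kpw q * ‖TT N1 N2 β‖ ^ 4 - 32 * δ * m ^ 4 ≤ fr N1 N2 (2 * m) (β + (a : ℝ) / q) := by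
  have h2 : N2 ≤ m := by omega
  unfold fr
  set A := SS thc (Ioc N1 N2) (β + (a : ℝ) / q) with hA
  set E := ee (-((2 * m : ℕ) : ℝ) * (β + (a : ℝ) / q)) with hE
  have hBn : ‖muphi q * TT N1 N2 β‖ ≤ 2 * m := by
    rw [norm_mul]
    have := mul_le_mul (norm_muphi_le_one q hq) (norm_TT_le m N1 N2 h2 β) (norm_nonneg _) zero_le_one
    have h0 : (0 : ℝ) ≤ m := by positivity
    linarith
  have h3 := pow4_diff A _ (2 * m) (δ * m) (by positivity) (norm_SS_le m N1 N2 h2 _) hBn h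
  have e1 : (muphi q * TT N1 N2 β) ^ 4 * E =
      muphi q ^ 4 * ((‖TT N1 N2 β‖ ^ 4 : ℝ) : ℂ) * ee (-((2 * m : ℕ) : ℝ) * ((a : ℝ) / q)) := by
    rw [← TT_sym N1 N2 m hm β, hE, mul_add, ee_add]; ring
  have h4 := main_re q a m hq ha (‖TT N1 N2 β‖ ^ 4) (by positivity)
  rw [← e1] at h4
  have h5 : A ^ 4 * E = (muphi q * TT N1 N2 β) ^ 4 * E + (A ^ 4 - (muphi q * TT N1 N2 β) ^ 4) * E := by ring
  rw [h5, Complex.add_re]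
  have h6 := (abs_le.1 (Complex.abs_re_le_norm ((A ^ 4 - (muphi q * TT N1 N2 β) ^ 4) * E))).1
  rw [norm_mul, hE, norm_ee, mul_one, ← hE] at h6
  have e2 : δ * m * (4 * (2 * (m : ℝ)) ^ 3) = 32 * δ * m ^ 4 := by ring
  linarith

lemma ind_int_mono (η : ℝ) (F G : ℝ → ℝ) (hF : Continuous F) (hG : Continuous G) (h : ∀ β ∈ UU η, F β ≤ G β) :
    ∫ β in (0 : ℝ)..1, (UU η).indicator (fun _ => (1 : ℝ)) β * F β ≤
    ∫ β in (0 : ℝ)..1, (UU η).indicator (fun _ => (1 : ℝ)) β * G β := by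
  apply intervalIntegral.integral_mono_on zero_le_one
  · exact ii_mul _ _ (ind_meas _ _) (ind_abs _) hF
  · exact ii_mul _ _ (ind_meas _ _) (ind_abs _) hG
  · intro x _
    by_cases hx : x ∈ UU η
    · rw [Set.indicator_of_mem hx, one_mul, one_mul]; exact h x hx
    · rw [Set.indicator_of_notMem hx, zero_mul, zero_mul]

lemma cont_TT (N1 N2 : ℕ) : Continuous (TT N1 N2) := continuous_SS _ _

lemma major_one (q a m N1 N2 : ℕ) (hq : 0 < q) (ha : a ∈ cop q) (hm : N1 + N2 + 1 = m) (η δ : ℝ) (hδ : 0 ≤ δ)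
    (hη : 0 ≤ η) (hη2 : η < 1 / 2)
    (h : ∀ β ∈ UU η, ‖SS thc (Ioc N1 N2) (β + (a : ℝ) / q) - muphi q * TT N1 N2 β‖ ≤ δ * m) :
    kpw q * (∫ β in (0 : ℝ)..1, (UU η).indicator (fun _ => (1 : ℝ)) β * ‖TT N1 N2 β‖ ^ 4) - 64 * δ * m ^ 4 * η ≤
    ∫ α in (0 : ℝ)..1, (UU η).indicator (fun _ => (1 : ℝ)) (α - (a : ℝ) / q) * fr N1 N2 (2 * m) α := by
  rw [shift_int]
  have hTc : Continuous fun β => ‖TT N1 N2 β‖ ^ 4 := (cont_TT N1 N2).norm.pow 4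
  have h1 := ind_int_mono η (fun β => kpw q * ‖TT N1 N2 β‖ ^ 4 - 32 * δ * m ^ 4) (fun β => fr N1 N2 (2 * m) (β + (a : ℝ) / q))
    ((continuous_const.mul hTc).sub continuous_const) ((cont_fr _ _ _).comp (by fun_prop))
    (fun β hβ => fr_lower q a m N1 N2 hq ha hm β δ (h β hβ))
  refine le_trans ?_ h1
  have e : ∀ β : ℝ, (UU η).indicator (fun _ => (1 : ℝ)) β * (kpw q * ‖TT N1 N2 β‖ ^ 4 - 32 * δ * m ^ 4) =
      kpw q * ((UU η).indicator (fun _ => (1 : ℝ)) β * ‖TT N1 N2 β‖ ^ 4) -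
      32 * δ * m ^ 4 * ((UU η).indicator (fun _ => (1 : ℝ)) β * 1) := by intro β; ring
  simp only [e]
  rw [intervalIntegral.integral_sub, intervalIntegral.integral_const_mul, intervalIntegral.integral_const_mul]
  · simp only [mul_one]
    have h2 := mul_le_mul_of_nonneg_left (UU_int η hη hη2) (by positivity : 0 ≤ 32 * δ * (m : ℝ) ^ 4)
    linarith
  · exact (ii_mul _ _ (ind_meas _ _) (ind_abs _) hTc).const_mul _
  · exact (ii_mul _ _ (ind_meas _ _) (ind_abs _) continuous_const).const_mul _

lemma K_lower (m N1 N2 : ℕ) (hm : 0 < m) (h12 : N1 ≤ N2) (h2 : N2 ≤ m) (η d : ℝ) (hη : 1 / m ≤ η) (hd : 0 ≤ d)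
    (hN : d * m ≤ ((N2 : ℝ) - N1) / 2) :
    d ^ 4 * m ^ 3 / 16 ≤ ∫ β in (0 : ℝ)..1, (UU η).indicator (fun _ => (1 : ℝ)) β * ‖TT N1 N2 β‖ ^ 4 := by
  have hmR : (1 : ℝ) ≤ m := by exact_mod_cast hm
  set F : ℝ → ℝ := fun β => (UU η).indicator (fun _ => (1 : ℝ)) β * ‖TT N1 N2 β‖ ^ 4 with hF
  have hF0 : ∀ x, 0 ≤ F x := fun x => mul_nonneg (ind_nonneg _ _) (by positivity)
  have hTc : Continuous fun β => ‖TT N1 N2 β‖ ^ 4 := (cont_TT N1 N2).norm.pow 4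
  have hI : IntervalIntegrable F MeasureTheory.volume 0 1 := ii_mul _ _ (ind_meas _ _) (ind_abs _) hTc
  set w : ℝ := 1 / (16 * m) with hw
  have hw0 : 0 ≤ w := by positivity
  have hw1 : w ≤ 1 := by
    rw [hw, div_le_one (by positivity)]; linarith
  have h3 : ∫ β in (0 : ℝ)..w, F β ≤ ∫ β in (0 : ℝ)..1, F β := by
    apply intervalIntegral.integral_mono_interval le_rfl hw0 hw1 _ hI
    exact Filter.Eventually.of_forall hF0
  have h4 : ∫ β in (0 : ℝ)..w, (d * m) ^ 4 ≤ ∫ β in (0 : ℝ)..w, F β := by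
    apply intervalIntegral.integral_mono_on hw0
    · exact intervalIntegrable_const
    · apply hI.mono_set
      rw [Set.uIcc_of_le hw0, Set.uIcc_of_le zero_le_one]
      exact Set.Icc_subset_Icc_right hw1
    · intro x hx
      have hxw : |x| ≤ w := by rw [abs_of_nonneg hx.1]; exact hx.2
      have hxU : x ∈ UU η := by
        rw [mem_UU]
        refine ⟨0, ?_⟩
        rw [Int.cast_zero, sub_zero]
        refine hxw.trans (le_trans ?_ hη)
        rw [hw]
        apply one_div_le_one_div_of_le (by positivity); linarith
      simp only [hF]
      rw [Set.indicator_of_mem hxU, one_mul]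
      exact pow_le_pow_left₀ (by positivity) (hN.trans (TT_lower N1 N2 m hm h12 h2 x hxw)) 4
  rw [intervalIntegral.integral_const, smul_eq_mul] at h4
  have e : (w - 0) * (d * m) ^ 4 = d ^ 4 * m ^ 3 / 16 := by
    rw [hw]; field_simp; ring
  linarith
end FP


namespace FP
open Finset Filter

lemma major_sum (C m N1 N2 : ℕ) (hC : 1 ≤ C) (hm : N1 + N2 + 1 = m) (η δ : ℝ) (hδ : 0 ≤ δ)
    (hη : 0 ≤ η) (hη2 : η < 1 / 2)
    (h : ∀ q ∈ Ioc 0 C, ∀ a ∈ cop q, ∀ β ∈ UU η,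
      ‖SS thc (Ioc N1 N2) (β + (a : ℝ) / q) - muphi q * TT N1 N2 β‖ ≤ δ * m) :
    1 / 4 * (∫ β in (0 : ℝ)..1, (UU η).indicator (fun _ => (1 : ℝ)) β * ‖TT N1 N2 β‖ ^ 4) - C ^ 2 * (64 * δ * m ^ 4 * η) ≤
    ∫ α in (0 : ℝ)..1, gg C η α * fr N1 N2 (2 * m) α := by
  have hind : ∀ c : ℝ, IntervalIntegrable (fun α => (UU η).indicator (fun _ => (1 : ℝ)) (α - c) * fr N1 N2 (2 * m) α)
      MeasureTheory.volume 0 1 := by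
    intro c
    exact ii_mul (fun α => (UU η).indicator (fun _ => (1 : ℝ)) (α - c)) _
      ((ind_meas _ _).comp (measurable_id.sub_const _)) (fun x => ind_abs _ _) (cont_fr _ _ _)
  set K := ∫ β in (0 : ℝ)..1, (UU η).indicator (fun _ => (1 : ℝ)) β * ‖TT N1 N2 β‖ ^ 4 with hK
  have hK0 : 0 ≤ K := intervalIntegral.integral_nonneg zero_le_one
    (fun x _ => mul_nonneg (ind_nonneg _ _) (by positivity))
  set W := 64 * δ * (m : ℝ) ^ 4 * η with hW
  have hW0 : 0 ≤ W := by positivity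
  have e : ∫ α in (0 : ℝ)..1, gg C η α * fr N1 N2 (2 * m) α = ∑ q ∈ Ioc 0 C, ∑ a ∈ cop q,
      ∫ α in (0 : ℝ)..1, (UU η).indicator (fun _ => (1 : ℝ)) (α - (a : ℝ) / q) * fr N1 N2 (2 * m) α := by
    unfold gg
    simp only [Finset.sum_mul]
    rw [intervalIntegral.integral_finsetSum]
    · refine Finset.sum_congr rfl fun q _ => ?_
      rw [intervalIntegral.integral_finsetSum]
      intro a _; exact hind _
    · intro q _
      exact ii_sum _ _ _ _ fun a _ => hind _
  rw [e]
  have h1 : ∑ q ∈ Ioc 0 C, ∑ a ∈ cop q, (kpw q * K - W) ≤ ∑ q ∈ Ioc 0 C, ∑ a ∈ cop q,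
      ∫ α in (0 : ℝ)..1, (UU η).indicator (fun _ => (1 : ℝ)) (α - (a : ℝ) / q) * fr N1 N2 (2 * m) α := by
    refine Finset.sum_le_sum fun q hq => Finset.sum_le_sum fun a ha => ?_
    exact major_one q a m N1 N2 (mem_Ioc.1 hq).1 ha hm η δ hδ hη hη2 (h q hq a ha)
  refine le_trans ?_ h1
  have e2 : ∑ q ∈ Ioc 0 C, ∑ a ∈ cop q, (kpw q * K - W) =
      (∑ q ∈ Ioc 0 C, (q.totient : ℝ) * kpw q) * K - ∑ q ∈ Ioc 0 C, (q.totient : ℝ) * W := by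
    rw [Finset.sum_mul, ← Finset.sum_sub_distrib]
    refine Finset.sum_congr rfl fun q _ => ?_
    rw [Finset.sum_const, card_cop, nsmul_eq_mul]; ring
  rw [e2]
  have h2 := mul_le_mul_of_nonneg_right (kpw_sum C hC) hK0
  have h3 : ∑ q ∈ Ioc 0 C, (q.totient : ℝ) * W ≤ C ^ 2 * W := by
    refine (Finset.sum_le_sum (g := fun _ => (C : ℝ) * W) fun q hq => ?_).trans ?_
    · apply mul_le_mul_of_nonneg_right _ hW0
      exact_mod_cast (Nat.totient_le q).trans (mem_Ioc.1 hq).2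
    · rw [Finset.sum_const, Nat.card_Ioc, nsmul_eq_mul]
      simp only [Nat.sub_zero]
      exact le_of_eq (by ring)
  linarith

set_option maxHeartbeats 1000000 in
lemma final (δ0 : ℝ) (h0 : 0 < δ0) (h1 : δ0 ≤ 1 / 2) : ∀ᶠ m : ℕ in atTop,
    ∀ N1 N2 : ℕ, N1 = ⌊(1 - δ0) * m / 2⌋₊ → N1 + N2 + 1 = m →
    ∃ a ∈ Ioc N1 N2, ∃ b ∈ Ioc N1 N2, ∃ c ∈ Ioc N1 N2, ∃ d ∈ Ioc N1 N2,
      a.Prime ∧ b.Prime ∧ c.Prime ∧ d.Prime ∧ 2 * m = a + b + c + d := by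
  set κ : ℝ := (δ0 / 4) ^ 4 / 16 with hκ
  have hκ0 : 0 < κ := by positivity
  obtain ⟨j0, hmin⟩ := minor_int (κ / 16) (by positivity)
  set C : ℕ := 2 ^ j0 with hC
  have hC1 : 1 ≤ C := Nat.one_le_two_pow
  have hCR : (1 : ℝ) ≤ C := by exact_mod_cast hC1
  have hCc : (2 : ℝ) ^ j0 = C := by rw [hC]; push_cast; rfl
  rw [hCc] at hmin
  set δ : ℝ := κ / (1024 * C ^ 3) with hδ
  have hδ0 : 0 < δ := by positivity
  have happ : ∀ᶠ m : ℕ in atTop, ∀ q ∈ Ioc 0 C, ∀ a ∈ cop q, ∀ N1 N2, N1 ≤ N2 → N2 ≤ m → ∀ β ∈ UU ((C : ℝ) / m),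
      ‖SS thc (Ioc N1 N2) (β + (a : ℝ) / q) - muphi q * TT N1 N2 β‖ ≤ δ * m := by
    rw [Filter.eventually_all_finset]
    intro q hq
    rw [Filter.eventually_all_finset]
    intro a ha
    exact approx_SS q a (mem_Ioc.1 hq).1 ha C δ (by linarith) hδ0
  have hbig : ∀ᶠ m : ℕ in atTop, max (2 * (C : ℝ) ^ 3 + 1) (max (2 / δ0) 8) ≤ m :=
    (tendsto_natCast_atTop_atTop (R := ℝ)).eventually (eventually_ge_atTop _)
  filter_upwards [hmin, happ, hbig] with m hmin happ hbig
  intro N1 N2 hN1 hm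
  have hb1 := (le_max_left _ _).trans hbig
  have hb2 := (le_max_left _ _).trans ((le_max_right _ _).trans hbig)
  have hb3 := (le_max_right _ _).trans ((le_max_right _ _).trans hbig)
  have hmR : (0 : ℝ) < m := by linarith
  have hm0 : 0 < m := by exact_mod_cast hmR
  have hfl : (N1 : ℝ) ≤ (1 - δ0) * m / 2 := by
    rw [hN1]; apply Nat.floor_le
    have : 0 ≤ 1 - δ0 := by linarith
    positivity
  have hfl2 : (1 - δ0) * m / 2 < N1 + 1 := by rw [hN1]; exact Nat.lt_floor_add_one _
  have hmc : (N1 : ℝ) + N2 + 1 = m := by exact_mod_cast hm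
  have hd0m : 2 ≤ δ0 * m := by
    rw [div_le_iff₀ h0] at hb2; linarith
  have hgap : δ0 / 4 * m ≤ ((N2 : ℝ) - N1) / 2 := by linarith
  have h12 : N1 ≤ N2 := by
    have : (N1 : ℝ) ≤ N2 := by nlinarith
    exact_mod_cast this
  have h2 : N2 ≤ m := by omega
  have hN18 : (m : ℝ) / 8 ≤ N1 := by
    have : 1 / 2 * (m : ℝ) ≤ (1 - δ0) * m := mul_le_mul_of_nonneg_right (by linarith) hmR.le
    linarith
  set η : ℝ := (C : ℝ) / m with hη
  have hη0 : 0 ≤ η := by positivity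
  have hηm : η * m = C := by rw [hη]; field_simp
  have hsmall : 2 * η * C ^ 2 < 1 := by
    rw [hη]
    have : 2 * ((C : ℝ) / m) * C ^ 2 = 2 * C ^ 3 / m := by ring
    rw [this, div_lt_one hmR]; linarith
  have hη2 : η < 1 / 2 := by
    have : η * 1 ≤ η * (C : ℝ) ^ 2 := mul_le_mul_of_nonneg_left (by nlinarith) hη0
    linarith
  by_contra hcon
  push Not at hcon
  have hz := fr_int N1 N2 (2 * m) (fun a ha b hb c hc d hd hap hbp hcp hdp =>
    hcon a ha b hb c hc d hd hap hbp hcp hdp)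
  have hg1 : ∀ x, gg C η x ≤ 1 := fun x => gg_le_one C η x hsmall
  have hmeas : Measurable (fun x => 1 - gg C η x) := measurable_const.sub (gg_meas C η)
  have hmi := hmin N1 N2 (fun x => 1 - gg C η x) hN18 h12 h2 hmeas
    (fun x => by linarith [hg1 x]) (fun x => by linarith [gg_nonneg C η x])
    (fun x hx hx2 => hx (by
      have := gg_ge_one C η x hx2
      linarith [hg1 x]))
  have hmaj := major_sum C m N1 N2 hC1 hm η δ hδ0.le hη0 hη2
    (fun q hq a ha β hβ => happ q hq a ha N1 N2 h12 h2 β hβ)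
  have hK := K_lower m N1 N2 hm0 h12 h2 η (δ0 / 4) (by
    rw [hη]; exact div_le_div_of_nonneg_right hCR hmR.le) (by positivity) hgap
  have hi1 : IntervalIntegrable (fun α => gg C η α * fr N1 N2 (2 * m) α) MeasureTheory.volume 0 1 :=
    ii_mul _ _ (gg_meas C η) (fun x => by rw [abs_of_nonneg (gg_nonneg _ _ _)]; exact hg1 x) (cont_fr _ _ _)
  have habs : ∀ x, |1 - gg C η x| ≤ 1 := fun x => by
    rw [abs_of_nonneg (by linarith [hg1 x])]; linarith [gg_nonneg C η x]
  have hi2 : IntervalIntegrable (fun α => (1 - gg C η α) * fr N1 N2 (2 * m) α) MeasureTheory.volume 0 1 :=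
    ii_mul _ _ hmeas habs (cont_fr _ _ _)
  have hi3 : IntervalIntegrable (fun α => (1 - gg C η α) * ‖SS thc (Ioc N1 N2) α‖ ^ 4) MeasureTheory.volume 0 1 :=
    ii_mul _ _ hmeas habs ((continuous_SS _ _).norm.pow 4)
  have hsplit : ∫ α in (0 : ℝ)..1, fr N1 N2 (2 * m) α = (∫ α in (0 : ℝ)..1, gg C η α * fr N1 N2 (2 * m) α) +
      ∫ α in (0 : ℝ)..1, (1 - gg C η α) * fr N1 N2 (2 * m) α := by
    rw [← intervalIntegral.integral_add hi1 hi2]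
    congr 1; funext α; ring
  have hlow : -(∫ α in (0 : ℝ)..1, (1 - gg C η α) * ‖SS thc (Ioc N1 N2) α‖ ^ 4) ≤
      ∫ α in (0 : ℝ)..1, (1 - gg C η α) * fr N1 N2 (2 * m) α := by
    rw [← intervalIntegral.integral_neg]
    apply intervalIntegral.integral_mono_on zero_le_one hi3.neg hi2
    intro x _
    have ha := (abs_le.1 (fr_abs N1 N2 (2 * m) x)).1
    have hb := mul_le_mul_of_nonneg_left ha (by linarith [hg1 x] : 0 ≤ 1 - gg C η x)
    simp only [Pi.neg_apply]
    linarith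
  have herr : (C : ℝ) ^ 2 * (64 * δ * m ^ 4 * η) = κ / 16 * m ^ 3 := by
    rw [hδ, hη]; field_simp; norm_num
  rw [herr] at hmaj
  have hK' : κ * m ^ 3 ≤ ∫ β in (0 : ℝ)..1, (UU η).indicator (fun _ => (1 : ℝ)) β * ‖TT N1 N2 β‖ ^ 4 := by
    refine le_trans (le_of_eq ?_) hK
    rw [hκ]; ring
  have hpos : 0 < κ * (m : ℝ) ^ 3 := by positivity
  linarith

end FP

theorem even_number_as_sum_of_four_balanced_primes {ε : ℝ} (hε : 0 < ε) :
    ∃ N : ℕ, ∀ n : ℕ, n > N → Even n →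
      ∃ q₁ q₂ q₃ q₄ : ℕ, q₁.Prime ∧ q₂.Prime ∧ q₃.Prime ∧ q₄.Prime ∧
        n = q₁ + q₂ + q₃ + q₄ ∧
        ∀ q ∈ ({q₁, q₂, q₃, q₄} : Set ℕ),
          (1 - ε) * n / 4 ≤ (q : ℝ) ∧ (q : ℝ) ≤ (1 + ε) * n / 4 := by
  set δ0 : ℝ := min ε (1 / 2) with hδ0
  have h0 : 0 < δ0 := lt_min hε (by norm_num)
  have h1 : δ0 ≤ 1 / 2 := min_le_right _ _
  have h2 : δ0 ≤ ε := min_le_left _ _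
  obtain ⟨M, hM⟩ := Filter.eventually_atTop.1 (FP.final δ0 h0 h1)
  refine ⟨2 * M + 2, fun n hn he => ?_⟩
  obtain ⟨m, rfl⟩ := he
  have hmR : (0 : ℝ) ≤ m := by positivity
  have hm1 : (1 : ℝ) ≤ m := by exact_mod_cast (by omega : 1 ≤ m)
  set N1 := ⌊(1 - δ0) * m / 2⌋₊ with hN1
  have hfl : (N1 : ℝ) ≤ (1 - δ0) * m / 2 := by
    apply Nat.floor_le
    have : 0 ≤ 1 - δ0 := by linarith
    positivity
  have hfl2 : (1 - δ0) * m / 2 < N1 + 1 := Nat.lt_floor_add_one _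
  have hlt : N1 < m := by
    have : (N1 : ℝ) < m := by nlinarith
    exact_mod_cast this
  obtain ⟨N2, hN2⟩ : ∃ N2, N1 + N2 + 1 = m := ⟨m - 1 - N1, by omega⟩
  have hmc : (N1 : ℝ) + N2 + 1 = m := by exact_mod_cast hN2
  have hδm : δ0 * m ≤ ε * m := mul_le_mul_of_nonneg_right h2 hmR
  obtain ⟨a, ha, b, hb, c, hc, d, hd, hap, hbp, hcp, hdp, hs⟩ := hM m (by omega) N1 N2 hN1 hN2
  refine ⟨a, b, c, d, hap, hbp, hcp, hdp, by omega, ?_⟩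
  have key : ∀ x ∈ Finset.Ioc N1 N2,
      (1 - ε) * ((m + m : ℕ) : ℝ) / 4 ≤ (x : ℝ) ∧ (x : ℝ) ≤ (1 + ε) * ((m + m : ℕ) : ℝ) / 4 := by
    intro x hx
    rw [Finset.mem_Ioc] at hx
    have hx1 : (N1 : ℝ) + 1 ≤ x := by exact_mod_cast hx.1
    have hx2 : (x : ℝ) ≤ N2 := by exact_mod_cast hx.2
    push_cast
    constructor <;> nlinarith
  intro q hq
  simp only [Set.mem_insert_iff, Set.mem_singleton_iff] at hq
  rcases hq with rfl | rfl | rfl | rfl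
  · exact key _ ha
  · exact key _ hb
  · exact key _ hc
  · exact key _ hd
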